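/- There exists an absolute constant C > 0 such that for every fixed integer k ≥ 3 there exist arbitrarily large finite sets A ⊆ ℝ with max(|kA|, |A^{(k)}|) ≤ |A|^{C·(log k)/(log log k)}; that is, for every N there is a finite A ⊆ ℝ with |A| ≥ N satisfying this bound. -/

import Mathlib

open Pointwise

/-- The `k`-fold sum set `kA = {a₁ + ⋯ + a_k : aᵢ ∈ A}`. -/
def kfoldSumSet {R : Type*} [AddCommMonoid R] (k : ℕ) (A : Set R) : Set R :=
  {x | ∃ f : Fin k → R, (∀ i, f i ∈ A) ∧ ∑ i, f i = x}

/-- The `k`-fold product set `A^{(k)} = {a₁ ⋯ a_k : aᵢ ∈ A}`. -/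
def kfoldProdSet {R : Type*} [CommMonoid R] (k : ℕ) (A : Set R) : Set R :=
  {x | ∃ f : Fin k → R, (∀ i, f i ∈ A) ∧ ∏ i, f i = x}

namespace SumProd

open Filter Topology NumberField nonZeroDivisors

section zeta

variable (K : Type*) [Field K] [NumberField K]

/-- The Dedekind zeta function as a sum over nonzero ideals, for a real argument. -/
noncomputable def idealZeta (s : ℝ) : ℝ :=
  ∑' I : (Ideal (𝓞 K))⁰, (Ideal.absNorm (I : Ideal (𝓞 K)) : ℝ) ^ (-s)

lemma absNorm_pos (I : (Ideal (𝓞 K))⁰) : 0 < Ideal.absNorm (I : Ideal (𝓞 K)) := by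
  have := nonZeroDivisors.coe_ne_zero I
  exact Nat.pos_of_ne_zero (by simpa [Ideal.absNorm_eq_zero_iff] using this)

lemma lseries_coeff_summable {s : ℝ} (hs : 1 < s) :
    LSeriesSummable (fun n ↦ ((Nat.card {I : Ideal (𝓞 K) // Ideal.absNorm I = n} : ℝ) : ℂ)) s := by
  refine LSeriesSummable_of_sum_norm_bigO_and_nonneg (r := 1) ?_ (fun _ ↦ Nat.cast_nonneg _)
    zero_le_one (by simpa using hs)
  refine Asymptotics.isBigO_atTop_natCast_rpow_of_tendsto_div_rpow
    (a := dedekindZeta_residue K) ?_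
  simp only [Real.rpow_one]
  refine ((Ideal.tendsto_norm_le_div_atTop₀ K).comp tendsto_natCast_atTop_atTop).congr fun n ↦ ?_
  simp only [Function.comp_apply, Nat.cast_le, ← Nat.cast_sum]
  congr
  rw [← add_left_inj 1, ← Ideal.card_norm_le_eq_card_norm_le_add_one,
    show Finset.Icc 1 n = Finset.Ioc 0 n from Finset.Icc_succ_left_eq_Ioc _ _,
    show 1 = Nat.card {I : Ideal (𝓞 K) // Ideal.absNorm I = 0} by
      simp [Ideal.absNorm_eq_zero_iff],
    Finset.sum_Ioc_add_eq_sum_Icc (n.zero_le),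
    ← Finset.card_preimage_eq_sum_card_image_eq
      (fun k _ ↦ Ideal.finite_setOfPred_absNorm_eq k)]
  simp [Set.coe_eq_subtype]

lemma hasSum_term_sigma {s : ℝ} (n : ℕ) :
    HasSum (fun I : {I : (Ideal (𝓞 K))⁰ // Ideal.absNorm (I : Ideal (𝓞 K)) = n} ↦
      (Ideal.absNorm (I.1 : Ideal (𝓞 K)) : ℝ) ^ (-s))
      (‖LSeries.term (fun n ↦ ((Nat.card {I : Ideal (𝓞 K) // Ideal.absNorm I = n} : ℝ) : ℂ)) s n‖) := by
  rcases Nat.eq_zero_or_pos n with rfl | hn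
  · have : IsEmpty {I : (Ideal (𝓞 K))⁰ // Ideal.absNorm (I : Ideal (𝓞 K)) = 0} :=
      ⟨fun I ↦ (absNorm_pos K I.1).ne' I.2⟩
    simp [hasSum_empty]
  · have hfin : Finite {I : Ideal (𝓞 K) // Ideal.absNorm I = n} :=
      (Ideal.finite_setOfPred_absNorm_eq n).to_subtype
    let e : {I : (Ideal (𝓞 K))⁰ // Ideal.absNorm (I : Ideal (𝓞 K)) = n} ≃
        {I : Ideal (𝓞 K) // Ideal.absNorm I = n} :=
      { toFun := fun I ↦ ⟨I.1, I.2⟩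
        invFun := fun I ↦ ⟨⟨I.1, mem_nonZeroDivisors_of_ne_zero (by
          rintro h; rw [← I.2, h] at hn; simp at hn)⟩, I.2⟩
        left_inv := fun _ ↦ rfl
        right_inv := fun _ ↦ rfl }
    have := Finite.of_equiv _ e.symm
    have := Fintype.ofFinite {I : (Ideal (𝓞 K))⁰ // Ideal.absNorm (I : Ideal (𝓞 K)) = n}
    have h := hasSum_fintype (fun I : {I : (Ideal (𝓞 K))⁰ // Ideal.absNorm (I : Ideal (𝓞 K)) = n} ↦
      (Ideal.absNorm (I.1 : Ideal (𝓞 K)) : ℝ) ^ (-s))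
    convert h using 1
    rw [LSeries.term_of_ne_zero hn.ne', norm_div, Complex.norm_natCast_cpow_of_pos hn,
      Finset.sum_congr rfl (fun I _ ↦ by rw [I.2])]
    rw [Finset.sum_const, ← Nat.card_congr e, Nat.card_eq_fintype_card, Finset.card_univ]
    simp [Real.rpow_neg, div_eq_mul_inv]

lemma summable_absNorm {s : ℝ} (hs : 1 < s) :
    Summable (fun I : (Ideal (𝓞 K))⁰ ↦ (Ideal.absNorm (I : Ideal (𝓞 K)) : ℝ) ^ (-s)) := by
  let e := Equiv.sigmaFiberEquiv (fun I : (Ideal (𝓞 K))⁰ ↦ Ideal.absNorm (I : Ideal (𝓞 K)))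
  rw [← e.summable_iff, summable_sigma_of_nonneg (fun _ ↦ by simp only [Function.comp]; positivity)]
  refine ⟨fun n ↦ (hasSum_term_sigma K n).summable, ?_⟩
  refine (lseries_coeff_summable K hs).norm.congr fun n ↦ ?_
  exact ((hasSum_term_sigma K n).tsum_eq).symm

lemma idealZeta_eq {s : ℝ} (hs : 1 < s) : (idealZeta K s : ℂ) = dedekindZeta K s := by
  let e := Equiv.sigmaFiberEquiv (fun I : (Ideal (𝓞 K))⁰ ↦ Ideal.absNorm (I : Ideal (𝓞 K)))
  have h1 := (e.summable_iff.mpr (summable_absNorm K hs)).tsum_sigma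
  rw [idealZeta, ← e.tsum_eq]
  erw [h1]
  rw [Complex.ofReal_tsum, dedekindZeta, LSeries]
  refine tsum_congr fun n ↦ ?_
  have := (hasSum_term_sigma K (s := s) n).tsum_eq
  erw [this]
  rcases Nat.eq_zero_or_pos n with rfl | hn
  · simp
  · rw [LSeries.term_of_ne_zero hn.ne', LSeries.term_of_ne_zero hn.ne', norm_div,
      Complex.norm_natCast_cpow_of_pos hn]
    simp only [Complex.ofReal_re, Complex.ofReal_div]
    rw [Complex.ofReal_cpow (by positivity)]
    simp

/-- The simple pole of the zeta function at `1`. -/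
lemma tendsto_idealZeta :
    Tendsto (fun s : ℝ ↦ (s - 1) * idealZeta K s) (𝓝[>] 1) (𝓝 (dedekindZeta_residue K)) := by
  have h := tendsto_sub_one_mul_dedekindZeta_nhdsGT K
  have h2 : Tendsto (fun s : ℝ ↦ (((s - 1) * idealZeta K s : ℝ) : ℂ)) (𝓝[>] 1)
      (𝓝 ((dedekindZeta_residue K : ℝ) : ℂ)) := by
    refine h.congr' ?_
    filter_upwards [self_mem_nhdsWithin] with s hs
    rw [Complex.ofReal_mul, idealZeta_eq K hs]
    simp
  exact (Complex.continuous_re.tendsto _).comp h2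

end zeta

end SumProd

namespace SumProd

open Filter Topology NumberField nonZeroDivisors IsDedekindDomain

section euler

variable {R : Type*} [CommRing R] [IsDedekindDomain R]

/-- A prime of a Dedekind domain as a nonzero ideal. -/
def primeIdeal (P : HeightOneSpectrum R) : (Ideal R)⁰ :=
  ⟨P.asIdeal, mem_nonZeroDivisors_of_ne_zero P.ne_bot⟩

/-- The nonzero ideals prime to a given set of primes. -/
def primeTo (S : Finset (HeightOneSpectrum R)) : Set ((Ideal R)⁰) :=
  {I | ∀ P ∈ S, ¬ P.asIdeal ∣ (I : Ideal R)}

lemma mul_mem_primeTo {S : Finset (HeightOneSpectrum R)} {P : HeightOneSpectrum R} (hP : P ∉ S)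
    (I : (Ideal R)⁰) : primeIdeal P * I ∈ primeTo S ↔ I ∈ primeTo S := by
  constructor
  · intro h Q hQ hd
    exact h Q hQ (hd.trans (Dvd.intro_left _ rfl))
  · intro h Q hQ hd
    rcases Q.prime.dvd_or_dvd (a := P.asIdeal) (b := (I : Ideal R)) hd with h1 | h1
    · have h2 : Q.asIdeal = P.asIdeal :=
        (P.isMaximal.eq_of_le Q.isPrime.ne_top (Ideal.le_of_dvd h1)).symm
      exact hP (HeightOneSpectrum.ext h2 ▸ hQ)
    · exact h Q hQ h1

lemma primeIdeal_mul_injective (P : HeightOneSpectrum R) :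
    Function.Injective (fun I : (Ideal R)⁰ ↦ primeIdeal P * I) := by
  intro I J h
  have h' := congrArg (Subtype.val) h
  exact Subtype.ext (mul_left_cancel₀ P.ne_bot h')

lemma tsum_primeTo (f : (Ideal R)⁰ →* ℝ) (hf : Summable f) (S : Finset (HeightOneSpectrum R)) :
    ∑' I, (primeTo S).indicator f I = (∏ P ∈ S, (1 - f (primeIdeal P))) * ∑' I, f I := by
  classical
  induction S using Finset.induction_on with
  | empty => simp [primeTo]
  | insert P S hP ih =>
    rw [Finset.prod_insert hP, mul_assoc, ← ih, one_sub_mul, ← tsum_mul_left]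
    have hinj := primeIdeal_mul_injective P
    set D : Set ((Ideal R)⁰) := {I | P.asIdeal ∣ (I : Ideal R)} with hD
    have h1 : ∀ I, (primeTo (insert P S)).indicator f I =
        (primeTo S).indicator f I - (D ∩ primeTo S).indicator f I := by
      intro I
      by_cases h1 : I ∈ primeTo S <;> by_cases h2 : I ∈ D
      · have : I ∉ primeTo (insert P S) := fun h ↦ h P (Finset.mem_insert_self _ _) h2
        simp [h1, h2, this]
      · have : I ∈ primeTo (insert P S) := by
          intro Q hQ
          rcases Finset.mem_insert.mp hQ with rfl | hQ
          · exact h2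
          · exact h1 Q hQ
        simp [h1, h2, this]
      all_goals
        have : I ∉ primeTo (insert P S) := fun h ↦ h1 fun Q hQ ↦ h Q (Finset.mem_insert_of_mem hQ)
        simp [h1, this]
    simp_rw [h1]
    rw [(hf.indicator (primeTo S)).tsum_sub (hf.indicator (D ∩ primeTo S))]
    congr 1
    have hsupp : Function.support ((D ∩ primeTo S).indicator f) ⊆
        Set.range (fun I : (Ideal R)⁰ ↦ primeIdeal P * I) := by
      intro I hI
      obtain ⟨J, hJ⟩ : P.asIdeal ∣ (I : Ideal R) := (Set.indicator_apply_ne_zero.mp hI).1.1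
      refine ⟨(⟨J, mem_nonZeroDivisors_of_ne_zero ?_⟩ : (Ideal R)⁰), Subtype.ext hJ.symm⟩
      rintro rfl
      exact nonZeroDivisors.coe_ne_zero I (by simpa using hJ)
    rw [← hinj.tsum_eq hsupp]
    refine tsum_congr fun I ↦ ?_
    have hd : primeIdeal P * I ∈ D := Dvd.intro (I : Ideal R) rfl
    by_cases h : I ∈ primeTo S
    · have h2 : primeIdeal P * I ∈ D ∩ primeTo S := ⟨hd, (mul_mem_primeTo hP I).mpr h⟩
      rw [Set.indicator_of_mem h2, Set.indicator_of_mem h, map_mul]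
    · rw [Set.indicator_of_notMem (fun h' ↦ h ((mul_mem_primeTo hP I).mp h'.2)),
        Set.indicator_of_notMem h, mul_zero]

lemma tendsto_euler (f : (Ideal R)⁰ →* ℝ) (hf : Summable f) :
    Tendsto (fun S : Finset (HeightOneSpectrum R) ↦
      (∏ P ∈ S, (1 - f (primeIdeal P))) * ∑' I, f I) atTop (𝓝 1) := by
  classical
  simp_rw [← tsum_primeTo f hf]
  have h1 : ∑' I : (Ideal R)⁰, (if I = 1 then (1 : ℝ) else 0) = 1 := tsum_ite_eq 1 _
  rw [← h1]
  refine tendsto_tsum_of_dominated_convergence (bound := fun I ↦ ‖f I‖) hf.norm ?_ ?_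
  · intro I
    split_ifs with hI
    · subst hI
      refine tendsto_const_nhds.congr fun S ↦ ?_
      rw [Set.indicator_of_mem, map_one]
      intro P _ hd
      exact P.isPrime.ne_top (Ideal.isUnit_iff.mp (isUnit_of_dvd_one hd))
    · obtain ⟨M, hM, hle⟩ := Ideal.exists_le_maximal (I : Ideal R) (by
        intro h
        exact hI (Subtype.ext (by simpa using h)))
      have hM0 : M ≠ ⊥ := by
        rintro rfl
        exact nonZeroDivisors.coe_ne_zero I (le_bot_iff.mp hle)
      refine tendsto_const_nhds.congr' ?_
      filter_upwards [eventually_ge_atTop {(⟨M, hM.isPrime, hM0⟩ : HeightOneSpectrum R)}] with S hS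
      rw [Set.indicator_of_notMem]
      exact fun h ↦ h _ (hS (Finset.mem_singleton_self _)) (Ideal.dvd_iff_le.mpr hle)
  · exact Eventually.of_forall fun S I ↦ norm_indicator_le_norm_self _ _

/-- Comparison of Euler products. -/
lemma le_of_euler_le {ι : Type*} {l : Filter ι} [l.NeBot] {a b : ι → ℝ} {X Y : ℝ}
    (ha : Tendsto (fun i ↦ a i * X) l (𝓝 1)) (hb : Tendsto (fun i ↦ b i * Y) l (𝓝 1))
    (ha0 : ∀ i, 0 ≤ a i) (hab : ∀ i, a i ≤ b i) (hY : 0 < Y) : Y ≤ X := by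
  have hX : 0 < X := by
    by_contra h
    have : ∀ i, a i * X ≤ 0 := fun i ↦ mul_nonpos_of_nonneg_of_nonpos (ha0 i) (not_lt.mp h)
    have := le_of_tendsto ha (Eventually.of_forall this)
    linarith
  have h1 : Tendsto (fun i ↦ b i * Y * (X / Y)) l (𝓝 (1 * (X / Y))) := hb.mul_const _
  have h2 := le_of_tendsto_of_tendsto ha h1 (Eventually.of_forall fun i ↦ by
    have : b i * Y * (X / Y) = b i * X := by field_simp
    change a i * X ≤ b i * Y * (X / Y)
    rw [this]
    exact mul_le_mul_of_nonneg_right (hab i) hX.le)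
  rwa [one_mul, one_le_div hY] at h2

end euler

section compare

variable {K M : Type*} [Field K] [NumberField K] [Field M] [NumberField M] [Algebra K M]

/-- The prime below. -/
noncomputable def primeBelow (K : Type*) [Field K] [NumberField K] {M : Type*} [Field M]
    [NumberField M] [Algebra K M] (𝔓 : HeightOneSpectrum (𝓞 M)) : HeightOneSpectrum (𝓞 K) :=
  ⟨𝔓.asIdeal.under (𝓞 K), inferInstance, Ideal.IsIntegral.comap_ne_bot _ 𝔓.ne_bot⟩

lemma exists_relNorm_eq (𝔓 : HeightOneSpectrum (𝓞 M)) :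
    ∃ f : ℕ, 0 < f ∧ Ideal.relNorm (𝓞 K) 𝔓.asIdeal = (primeBelow K 𝔓).asIdeal ^ f := by
  have : 𝔓.asIdeal.LiesOver (primeBelow K 𝔓).asIdeal := ⟨rfl⟩
  have := (primeBelow K 𝔓).isPrime
  obtain ⟨f, hf⟩ := Ideal.exists_relNorm_eq_pow_of_isPrime (R := 𝓞 K) 𝔓.asIdeal
    (primeBelow K 𝔓).asIdeal
  refine ⟨f, Nat.pos_of_ne_zero ?_, hf⟩
  rintro rfl
  rw [pow_zero] at hf
  have h1 : Ideal.absNorm 𝔓.asIdeal = 1 := by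
    rw [← Ideal.absNorm_relNorm (R := 𝓞 K), hf, map_one]
  exact 𝔓.isPrime.ne_top (Ideal.absNorm_eq_one_iff.mp h1)

/-- The inertia degree of a prime over the prime below. -/
noncomputable def inertia (K : Type*) [Field K] [NumberField K] {M : Type*} [Field M]
    [NumberField M] [Algebra K M] (𝔓 : HeightOneSpectrum (𝓞 M)) : ℕ :=
  (exists_relNorm_eq (K := K) 𝔓).choose

lemma inertia_pos (𝔓 : HeightOneSpectrum (𝓞 M)) : 0 < inertia K 𝔓 :=
  (exists_relNorm_eq (K := K) 𝔓).choose_spec.1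

lemma relNorm_prime (𝔓 : HeightOneSpectrum (𝓞 M)) :
    Ideal.relNorm (𝓞 K) 𝔓.asIdeal = (primeBelow K 𝔓).asIdeal ^ inertia K 𝔓 :=
  (exists_relNorm_eq (K := K) 𝔓).choose_spec.2

lemma prod_dvd_map (P : HeightOneSpectrum (𝓞 K)) (T : Finset (HeightOneSpectrum (𝓞 M)))
    (hT : ∀ 𝔓 ∈ T, primeBelow K 𝔓 = P) :
    ∏ 𝔓 ∈ T, 𝔓.asIdeal ∣ P.asIdeal.map (algebraMap (𝓞 K) (𝓞 M)) := by
  classical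
  rw [← Finset.prod_image (f := fun I : Ideal (𝓞 M) ↦ I)
    (fun _ _ _ _ h ↦ HeightOneSpectrum.ext h)]
  refine Finset.prod_primes_dvd _ ?_ ?_
  · intro I hI
    obtain ⟨𝔓, -, rfl⟩ := Finset.mem_image.mp hI
    exact 𝔓.prime
  · intro I hI
    obtain ⟨𝔓, h, rfl⟩ := Finset.mem_image.mp hI
    rw [← hT 𝔓 h, Ideal.dvd_iff_le]
    exact Ideal.map_comap_le

lemma sum_inertia_le (P : HeightOneSpectrum (𝓞 K)) (T : Finset (HeightOneSpectrum (𝓞 M)))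
    (hT : ∀ 𝔓 ∈ T, primeBelow K 𝔓 = P) :
    ∑ 𝔓 ∈ T, inertia K 𝔓 ≤ Module.finrank K M := by
  have h1 := map_dvd (Ideal.relNorm (𝓞 K)) (prod_dvd_map P T hT)
  rw [Ideal.relNorm_algebraMap, map_prod, Finset.prod_congr rfl (fun 𝔓 h ↦ by
    rw [relNorm_prime 𝔓, hT 𝔓 h]), Finset.prod_pow_eq_pow_sum] at h1
  have h2 := (pow_dvd_pow_iff P.ne_bot P.prime.not_isUnit).mp h1
  rwa [← IsFractionRing.finrank_eq (𝓞 K) K (𝓞 M) M] at h2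

lemma finite_primeBelow (P : HeightOneSpectrum (𝓞 K)) :
    {𝔓 : HeightOneSpectrum (𝓞 M) | primeBelow K 𝔓 = P}.Finite := by
  by_contra h
  obtain ⟨T, hT, hc⟩ := Set.Infinite.exists_subset_card_eq h (Module.finrank K M + 1)
  have h1 := sum_inertia_le P T fun 𝔓 h ↦ hT h
  have h2 : T.card ≤ ∑ 𝔓 ∈ T, inertia K 𝔓 := by
    rw [Finset.card_eq_sum_ones]
    exact Finset.sum_le_sum fun 𝔓 _ ↦ inertia_pos 𝔓
  omega

lemma local_le {x e₁ e₂ : ℝ} (hx : 0 < x) (hx1 : x < 1) (h₁ : e₁ = 1 ∨ e₁ = -1)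
    (h₂ : e₂ = 1 ∨ e₂ = -1) {ι : Type*} (T : Finset ι) (f : ι → ℕ) (hf : ∀ i, 0 < f i)
    (hsum : ∑ i ∈ T, f i ≤ 2) (he : ∀ i ∈ T, e₁ ^ f i = 1 ∧ e₂ ^ f i = 1) :
    (1 - x) * (1 - e₁ * x) * (1 - e₂ * x) * (1 - e₁ * e₂ * x) ≤
      (∏ i ∈ T, (1 - x ^ f i)) ^ 2 := by
  have hc : T.card ≤ ∑ i ∈ T, f i := by
    rw [Finset.card_eq_sum_ones]
    exact Finset.sum_le_sum fun i _ ↦ hf i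
  by_cases h : ∃ i ∈ T, f i = 1
  · obtain ⟨i, hi, h1⟩ := h
    have h3 := he i hi
    rw [h1, pow_one, pow_one] at h3
    rw [h3.1, h3.2]
    have h4 : (1 - x) ^ 2 ≤ ∏ i ∈ T, (1 - x ^ f i) := by
      calc (1 - x) ^ 2 ≤ (1 - x) ^ T.card :=
            pow_le_pow_of_le_one (by linarith) (by linarith) (hc.trans hsum)
        _ = ∏ i ∈ T, (1 - x) := by rw [Finset.prod_const]
        _ ≤ _ := Finset.prod_le_prod (fun _ _ ↦ by linarith) fun i _ ↦
            sub_le_sub_left (pow_le_of_le_one hx.le hx1.le (hf i).ne') _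
    calc _ = ((1 - x) ^ 2) ^ 2 := by ring
      _ ≤ _ := by gcongr
  · push Not at h
    have h2 : ∀ i ∈ T, 2 ≤ f i := fun i hi ↦ by have := hf i; have := h i hi; omega
    have h5 : T.card * 2 ≤ ∑ i ∈ T, f i := by
      simpa using Finset.card_nsmul_le_sum T f 2 h2
    have h4 : 1 - x ^ 2 ≤ ∏ i ∈ T, (1 - x ^ f i) := by
      calc 1 - x ^ 2 ≤ (1 - x ^ 2) ^ T.card := by
            conv_lhs => rw [← pow_one (1 - x ^ 2)]
            exact pow_le_pow_of_le_one (by nlinarith) (by nlinarith) (by omega)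
        _ = ∏ i ∈ T, (1 - x ^ 2) := by rw [Finset.prod_const]
        _ ≤ _ := Finset.prod_le_prod (fun _ _ ↦ by nlinarith) fun i hi ↦
            sub_le_sub_left (pow_le_pow_of_le_one hx.le hx1.le (h2 i hi)) _
    have h6 : (1 - x) * (1 - e₁ * x) * (1 - e₂ * x) * (1 - e₁ * e₂ * x) ≤ (1 - x ^ 2) ^ 2 := by
      rcases h₁ with rfl | rfl <;> rcases h₂ with rfl | rfl
      · nlinarith [mul_pos hx (pow_pos (sub_pos.mpr hx1) 2)]
      all_goals apply le_of_eq; ring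
    exact h6.trans (pow_le_pow_left₀ (by nlinarith) h4 2)

/-- The Dirichlet series weight attached to a multiplicative function on ideals. -/
noncomputable def weight (ψ : (Ideal (𝓞 K))⁰ →* ℝ) (s : ℝ) : (Ideal (𝓞 K))⁰ →* ℝ where
  toFun I := ψ I * (Ideal.absNorm (I : Ideal (𝓞 K)) : ℝ) ^ (-s)
  map_one' := by simp
  map_mul' I J := by
    rw [map_mul, Submonoid.coe_mul, map_mul, Nat.cast_mul,
      Real.mul_rpow (Nat.cast_nonneg _) (Nat.cast_nonneg _)]
    ring

lemma summable_weight (ψ : (Ideal (𝓞 K))⁰ →* ℝ) (hψ : ∀ I, ψ I = 1 ∨ ψ I = -1) {s : ℝ}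
    (hs : 1 < s) : Summable (weight ψ s) := by
  refine (summable_absNorm K hs).of_norm_bounded fun I ↦ ?_
  have h1 : ‖ψ I‖ = 1 := by rcases hψ I with h | h <;> simp [h]
  change ‖ψ I * _‖ ≤ _
  rw [norm_mul, h1, one_mul, Real.norm_of_nonneg (by positivity)]

theorem idealZeta_sq_le (hrank : Module.finrank K M = 2) (ψ₁ ψ₂ : (Ideal (𝓞 K))⁰ →* ℝ)
    (h₁ : ∀ I, ψ₁ I = 1 ∨ ψ₁ I = -1) (h₂ : ∀ I, ψ₂ I = 1 ∨ ψ₂ I = -1)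
    (hn : ∀ 𝔓 : HeightOneSpectrum (𝓞 M), ∀ f : ℕ, 
      Ideal.relNorm (𝓞 K) 𝔓.asIdeal = (primeBelow K 𝔓).asIdeal ^ f →
      ψ₁ (primeIdeal (primeBelow K 𝔓)) ^ f = 1 ∧ ψ₂ (primeIdeal (primeBelow K 𝔓)) ^ f = 1)
    {s : ℝ} (hs : 1 < s) :
    idealZeta M s ^ 2 ≤ idealZeta K s * (∑' I, weight ψ₁ s I) * (∑' I, weight ψ₂ s I) *
      ∑' I, weight (ψ₁ * ψ₂) s I := by
  classical
  have h₃ : ∀ I, (ψ₁ * ψ₂) I = 1 ∨ (ψ₁ * ψ₂) I = -1 := by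
    intro I
    rcases h₁ I with h | h <;> rcases h₂ I with h' | h' <;> simp [h, h']
  have hK : idealZeta K s = ∑' I, weight (1 : (Ideal (𝓞 K))⁰ →* ℝ) s I :=
    tsum_congr fun I ↦ (one_mul _).symm
  have hM : idealZeta M s = ∑' I, weight (1 : (Ideal (𝓞 M))⁰ →* ℝ) s I :=
    tsum_congr fun I ↦ (one_mul _).symm
  have t0 := tendsto_euler _ (summable_weight (1 : (Ideal (𝓞 K))⁰ →* ℝ) (fun _ ↦ .inl rfl) hs)
  have t1 := tendsto_euler _ (summable_weight ψ₁ h₁ hs)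
  have t2 := tendsto_euler _ (summable_weight ψ₂ h₂ hs)
  have t3 := tendsto_euler _ (summable_weight (ψ₁ * ψ₂) h₃ hs)
  have tM := tendsto_euler _ (summable_weight (1 : (Ideal (𝓞 M))⁰ →* ℝ) (fun _ ↦ .inl rfl) hs)
  have tX := ((t0.mul t1).mul t2).mul t3
  let B : Finset (HeightOneSpectrum (𝓞 K)) → Finset (HeightOneSpectrum (𝓞 M)) := fun S ↦
    S.biUnion fun P ↦ (finite_primeBelow (M := M) P).toFinset
  have hB : Tendsto B atTop atTop := by
    refine tendsto_atTop.mpr fun W ↦ ?_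
    filter_upwards [eventually_ge_atTop (W.image (primeBelow K))] with S hS
    intro 𝔓 h𝔓
    exact Finset.mem_biUnion.mpr ⟨primeBelow K 𝔓, hS (Finset.mem_image_of_mem _ h𝔓), by simp⟩
  have tY := (tM.comp hB).pow 2
  simp only [mul_one, one_pow] at tX tY
  have hpos : ∀ P : HeightOneSpectrum (𝓞 K),
      0 < (Ideal.absNorm P.asIdeal : ℝ) ^ (-s) ∧ (Ideal.absNorm P.asIdeal : ℝ) ^ (-s) < 1 := by
    intro P
    have h0 := absNorm_pos K (primeIdeal P)
    have h1 : Ideal.absNorm P.asIdeal ≠ 1 := fun h ↦ P.isPrime.ne_top (Ideal.absNorm_eq_one_iff.mp h)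
    have h2 : (1 : ℝ) < Ideal.absNorm P.asIdeal := by
      have : 0 < Ideal.absNorm P.asIdeal := by exact_mod_cast h0
      exact_mod_cast (show 1 < Ideal.absNorm P.asIdeal by omega)
    exact ⟨by positivity, Real.rpow_lt_one_of_one_lt_of_neg h2 (by linarith)⟩
  have hMpos : 0 < idealZeta M s ^ 2 := by
    have h0 : 0 < idealZeta M s := by
      refine (summable_absNorm M hs).tsum_pos (fun I ↦ by positivity) 1 (by simp)
    positivity
  have hnonneg (P : HeightOneSpectrum (𝓞 K)) :
      0 ≤ (1 - weight (1 : (Ideal (𝓞 K))⁰ →* ℝ) s (primeIdeal P)) *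
        (1 - weight ψ₁ s (primeIdeal P)) * (1 - weight ψ₂ s (primeIdeal P)) *
        (1 - weight (ψ₁ * ψ₂) s (primeIdeal P)) := by
    obtain ⟨hx, hx1⟩ := hpos P
    have key : ∀ ψ : (Ideal (𝓞 K))⁰ →* ℝ, (∀ I, ψ I = 1 ∨ ψ I = -1) →
        0 ≤ 1 - weight ψ s (primeIdeal P) := by
      intro ψ hψ
      change 0 ≤ 1 - ψ (primeIdeal P) * (Ideal.absNorm P.asIdeal : ℝ) ^ (-s)
      rcases hψ (primeIdeal P) with h | h <;> rw [h] <;> linarith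
    exact mul_nonneg (mul_nonneg (mul_nonneg (key 1 fun _ ↦ .inl rfl) (key _ h₁)) (key _ h₂))
      (key _ h₃)
  refine le_of_euler_le (l := atTop)
    (a := fun S : Finset (HeightOneSpectrum (𝓞 K)) ↦ ∏ P ∈ S,
      ((1 - weight (1 : (Ideal (𝓞 K))⁰ →* ℝ) s (primeIdeal P)) *
        (1 - weight ψ₁ s (primeIdeal P)) * (1 - weight ψ₂ s (primeIdeal P)) *
        (1 - weight (ψ₁ * ψ₂) s (primeIdeal P))))
    (b := fun S ↦ (∏ 𝔓 ∈ B S, (1 - weight (1 : (Ideal (𝓞 M))⁰ →* ℝ) s (primeIdeal 𝔓))) ^ 2)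
    ?_ ?_ ?_ ?_ hMpos
  · refine tX.congr fun S ↦ ?_
    rw [hK]
    simp only [Finset.prod_mul_distrib]
    ring
  · refine tY.congr fun S ↦ ?_
    rw [hM, ← mul_pow]
    rfl
  · exact fun S ↦ Finset.prod_nonneg fun P _ ↦ hnonneg P
  · intro S
    rw [Finset.prod_biUnion, ← Finset.prod_pow]
    · refine Finset.prod_le_prod (fun P _ ↦ hnonneg P) ?_
      intro P hP
      obtain ⟨hx, hx1⟩ := hpos P
      have hmem : ∀ 𝔓 ∈ (finite_primeBelow (M := M) P).toFinset, primeBelow K 𝔓 = P := by simp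
      have := local_le hx hx1 (h₁ (primeIdeal P)) (h₂ (primeIdeal P))
        (finite_primeBelow (M := M) P).toFinset (inertia K) inertia_pos
        ((sum_inertia_le P _ hmem).trans hrank.le) (fun 𝔓 h ↦ by
          have := hn 𝔓 _ (relNorm_prime 𝔓)
          rwa [hmem 𝔓 h] at this)
      refine le_trans (le_of_eq ?_) (this.trans (le_of_eq ?_))
      · simp only [weight, MonoidHom.coe_mk, OneHom.coe_mk, MonoidHom.one_apply, one_mul, 
          MonoidHom.mul_apply, primeIdeal]
      · congr 1
        refine Finset.prod_congr rfl fun 𝔓 h ↦ ?_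
        simp only [weight, MonoidHom.coe_mk, OneHom.coe_mk, MonoidHom.one_apply, one_mul,
          primeIdeal]
        rw [← Ideal.absNorm_relNorm (R := 𝓞 K) (I := 𝔓.asIdeal), relNorm_prime, hmem 𝔓 h, map_pow,
          Nat.cast_pow, ← Real.rpow_natCast, ← Real.rpow_natCast,
          ← Real.rpow_mul (Nat.cast_nonneg _), ← Real.rpow_mul (Nat.cast_nonneg _), mul_comm]
    · intro P _ Q _ hPQ
      refine Finset.disjoint_left.mpr fun 𝔓 h h' ↦ hPQ ?_
      simp only [Set.Finite.mem_toFinset, Set.mem_ofPred_eq] at h h'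
      exact h.symm.trans h'

end compare

end SumProd

namespace SumProd

open Filter Topology NumberField nonZeroDivisors

/-- The tent function. -/
noncomputable def tent (t : ℝ) : ℝ := max 0 (1 - |t|)

lemma tent_nonneg (t : ℝ) : 0 ≤ tent t := le_max_left _ _

lemma tent_le_one (t : ℝ) : tent t ≤ 1 := max_le zero_le_one (by linarith [abs_nonneg t])

lemma tent_eq_zero {t : ℝ} (h : 1 ≤ |t|) : tent t = 0 := max_eq_left (by linarith)

lemma tent_lipschitz (x y : ℝ) : |tent x - tent y| ≤ |x - y| := by
  have h1 := abs_max_sub_max_le_max 0 (1 - |x|) 0 (1 - |y|)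
  have h2 : |(1 - |x|) - (1 - |y|)| ≤ |x - y| := by
    rw [show (1 - |x|) - (1 - |y|) = |y| - |x| by ring, abs_sub_comm x y]
    exact abs_abs_sub_abs_le y x
  refine h1.trans (max_le (by simp) h2)

lemma abs_prod_sub_prod_le {ι : Type*} (T : Finset ι) (f g : ι → ℝ)
    (hf : ∀ i, 0 ≤ f i ∧ f i ≤ 1) (hg : ∀ i, 0 ≤ g i ∧ g i ≤ 1) :
    |∏ i ∈ T, f i - ∏ i ∈ T, g i| ≤ ∑ i ∈ T, |f i - g i| := by
  classical
  induction T using Finset.induction_on with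
  | empty => simp
  | insert i T hi ih =>
    rw [Finset.prod_insert hi, Finset.prod_insert hi, Finset.sum_insert hi]
    have h1 : |∏ i ∈ T, f i| ≤ 1 := by
      rw [abs_of_nonneg (Finset.prod_nonneg fun i _ ↦ (hf i).1)]
      exact Finset.prod_le_one (fun i _ ↦ (hf i).1) fun i _ ↦ (hf i).2
    have h2 : |g i| ≤ 1 := by rw [abs_of_nonneg (hg i).1]; exact (hg i).2
    calc |f i * ∏ i ∈ T, f i - g i * ∏ i ∈ T, g i|
        = |(f i - g i) * ∏ i ∈ T, f i + g i * (∏ i ∈ T, f i - ∏ i ∈ T, g i)| := by ring_nf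
      _ ≤ |f i - g i| * |∏ i ∈ T, f i| + |g i| * |∏ i ∈ T, f i - ∏ i ∈ T, g i| := by
        rw [← abs_mul, ← abs_mul]; exact abs_add_le _ _
      _ ≤ |f i - g i| * 1 + 1 * ∑ i ∈ T, |f i - g i| := by gcongr
      _ = _ := by ring

lemma exists_norm_eq {ι : Type*} [Fintype ι] [Nonempty ι] (a : ι → ℝ) : ∃ j, ‖a‖ = ‖a j‖ := by
  obtain ⟨j, hj⟩ := Finite.exists_max fun i ↦ ‖a i‖
  exact ⟨j, le_antisymm ((pi_norm_le_iff_of_nonneg (norm_nonneg _)).mpr hj) (norm_le_pi_norm a j)⟩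

lemma abs_exp_neg_sub_le {p q P : ℝ} (hp : P ≤ p) (hq : P ≤ q) :
    |Real.exp (-p) - Real.exp (-q)| ≤ Real.exp (-P) * |p - q| := by
  wlog h : p ≤ q generalizing p q
  · rw [abs_sub_comm, abs_sub_comm p]
    exact this hq hp (le_of_not_ge h)
  have h1 : Real.exp (-q) ≤ Real.exp (-p) := Real.exp_le_exp.mpr (by linarith)
  rw [abs_of_nonneg (by linarith), abs_sub_comm, abs_of_nonneg (by linarith)]
  have h2 : Real.exp (-q) = Real.exp (-p) * Real.exp (-(q - p)) := by
    rw [← Real.exp_add]; ring_nf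
  have h3 := Real.add_one_le_exp (-(q - p))
  have h4 : Real.exp (-p) ≤ Real.exp (-P) := Real.exp_le_exp.mpr (by linarith)
  calc _ = Real.exp (-p) * (1 - Real.exp (-(q - p))) := by rw [h2]; ring
    _ ≤ Real.exp (-p) * (q - p) := mul_le_mul_of_nonneg_left (by linarith) (Real.exp_nonneg _)
    _ ≤ _ := mul_le_mul_of_nonneg_right h4 (by linarith)

section

variable {ι κ : Type*} [Fintype ι] [Fintype κ] (m : ι → ℕ) (Y : (ι → ℝ) →ₗ[ℝ] (κ → ℝ))

/-- A compactly supported (modulo scaling) smoothing of the norm power, in terms of the absolute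
values at all places. -/
noncomputable def smooth (s : ℝ) (a : ι → ℝ) : ℝ :=
  (∏ j, tent (Y (fun i ↦ Real.log (a i)) j)) * Real.exp (-(s * ∑ i, m i * Real.log (a i)))

lemma smooth_nonneg (s : ℝ) (a : ι → ℝ) : 0 ≤ smooth m Y s a :=
  mul_nonneg (Finset.prod_nonneg fun _ _ ↦ tent_nonneg _) (Real.exp_nonneg _)

lemma smooth_le_exp (s : ℝ) (a : ι → ℝ) :
    smooth m Y s a ≤ Real.exp (-(s * ∑ i, m i * Real.log (a i))) :=
  mul_le_of_le_one_left (Real.exp_nonneg _)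
    (Finset.prod_le_one (fun _ _ ↦ tent_nonneg _) fun _ _ ↦ tent_le_one _)

lemma smooth_le_one {s : ℝ} (hs : 0 ≤ s) {a : ι → ℝ} (ha : 0 ≤ ∑ i, m i * Real.log (a i)) :
    smooth m Y s a ≤ 1 :=
  (smooth_le_exp m Y s a).trans (Real.exp_le_one_iff.mpr (by
    have := mul_nonneg hs ha
    linarith))

variable {Y}

lemma comparable_of_smooth_ne_zero {C : ℝ} (hC0 : 0 ≤ C)
    (hC : ∀ l : ι → ℝ, ∀ i j, |l i - l j| ≤ C * ‖Y l‖) {s : ℝ} {a : ι → ℝ} (ha : ∀ i, 0 < a i)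
    (h : smooth m Y s a ≠ 0) (i j : ι) : Real.exp (-C) * a j ≤ a i := by
  have h1 : ‖Y (fun i ↦ Real.log (a i))‖ ≤ 1 := by
    refine (pi_norm_le_iff_of_nonneg zero_le_one).mpr fun k ↦ ?_
    by_contra hk
    exact h (mul_eq_zero_of_left (Finset.prod_eq_zero (Finset.mem_univ k)
      (tent_eq_zero (not_le.mp hk).le)) _)
  have h2 := (hC (fun i ↦ Real.log (a i)) i j).trans (mul_le_of_le_one_right hC0 h1)
  have h3 : -C + Real.log (a j) ≤ Real.log (a i) := by
    have := (abs_le.mp h2).1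
    linarith
  calc _ = Real.exp (-C + Real.log (a j)) := by rw [Real.exp_add, Real.exp_log (ha j)]
    _ ≤ Real.exp (Real.log (a i)) := Real.exp_le_exp.mpr h3
    _ = a i := Real.exp_log (ha i)

lemma exp_sum_log_le {a : ι → ℝ} {s q : ℝ} (hs : 0 ≤ s) (hq : 0 < q) (ha : ∀ i, q ≤ a i) :
    s * (∑ i, m i : ℕ) * Real.log q ≤ s * ∑ i, m i * Real.log (a i) := by
  rw [mul_assoc, Nat.cast_sum, Finset.sum_mul]
  gcongr with i
  exact ha i

lemma abs_log_sub_log_le {x y q ρ : ℝ} (hq : 0 < q) (hx : q ≤ x) (hy : q ≤ y) (h : |x - y| ≤ ρ) :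
    |Real.log x - Real.log y| ≤ ρ / q := by
  wlog hxy : x ≤ y generalizing x y
  · rw [abs_sub_comm] at h ⊢
    exact this hy hx h (le_of_not_ge hxy)
  have hx0 : 0 < x := hq.trans_le hx
  have hy0 : 0 < y := hq.trans_le hy
  have h1 : Real.log x ≤ Real.log y := Real.log_le_log hx0 hxy
  rw [abs_sub_comm, abs_of_nonneg (by linarith), ← Real.log_div hy0.ne' hx0.ne']
  have h2 := Real.log_le_sub_one_of_pos (div_pos hy0 hx0)
  have h3 : y - x ≤ ρ := by rw [abs_sub_comm] at h; exact (le_abs_self _).trans h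
  calc _ ≤ y / x - 1 := h2
    _ = (y - x) / x := by field_simp
    _ ≤ ρ / q := div_le_div₀ ((abs_nonneg _).trans h) h3 hq hx

theorem abs_smooth_sub_smooth_le [Nonempty ι] {C : ℝ} (hC0 : 0 ≤ C)
    (hC : ∀ l : ι → ℝ, ∀ i j, |l i - l j| ≤ C * ‖Y l‖) {ρ : ℝ} (hρ : 0 ≤ ρ) :
    ∃ B : ℝ, 0 ≤ B ∧ ∀ s : ℝ, 1 ≤ s → s ≤ 2 → ∀ a b : ι → ℝ, (∀ i, 0 < a i) → (∀ i, 0 < b i) →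
      0 ≤ ∑ i, m i * Real.log (a i) → 0 ≤ ∑ i, m i * Real.log (b i) → (∀ i, |a i - b i| ≤ ρ) →
      |smooth m Y s a - smooth m Y s b| ≤ B * ‖a‖ ^ (-((∑ i, m i : ℕ) + 1 : ℝ)) := by
  classical
  set n := ∑ i, m i with hn
  set c := Real.exp (-C) with hc
  have hc0 : 0 < c := Real.exp_pos _
  have hc1 : c ≤ 1 := Real.exp_le_one_iff.mpr (by linarith)
  set M₀ := (4 * ρ + 4) / c with hM₀
  have hM₀0 : 0 < M₀ := by positivity
  obtain ⟨D, hD0, hD⟩ : ∃ D : ℝ, 0 ≤ D ∧ ∀ l, ‖Y l‖ ≤ D * ‖l‖ :=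
    ⟨‖LinearMap.toContinuousLinearMap Y‖, norm_nonneg _,
      (LinearMap.toContinuousLinearMap Y).le_opNorm⟩
  set q := c / 4 with hq
  have hq0 : 0 < q := by positivity
  set E := (Fintype.card κ * D + 2 * n) * ρ with hE
  have hE0 : 0 ≤ E := by positivity
  refine ⟨M₀ ^ ((n : ℝ) + 1) + E * q ^ (-((n : ℝ) + 1)), by positivity, ?_⟩
  intro s hs hs2 a b ha hb hNa hNb hab
  obtain ⟨j₀, hj₀⟩ : ∃ j, ‖a‖ = a j := by
    obtain ⟨j, hj⟩ := exists_norm_eq a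
    exact ⟨j, by rw [hj, Real.norm_of_nonneg (ha j).le]⟩
  set M := ‖a‖ with hM
  have hM0 : 0 < M := hj₀ ▸ ha j₀
  have h1 : M ^ (-((n : ℝ) + 1)) > 0 := by positivity
  rw [add_mul]
  rcases le_or_gt M M₀ with hle | hgt
  · have ha1 := smooth_le_one m Y (by linarith : 0 ≤ s) hNa
    have hb1 := smooth_le_one m Y (by linarith : 0 ≤ s) hNb
    have ha0 := smooth_nonneg m Y s a
    have hb0 := smooth_nonneg m Y s b
    have h2 : 1 ≤ M₀ ^ ((n : ℝ) + 1) * M ^ (-((n : ℝ) + 1)) := by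
      rw [Real.rpow_neg hM0.le, ← div_eq_mul_inv, one_le_div (by positivity)]
      exact Real.rpow_le_rpow hM0.le hle (by positivity)
    have h3 : 0 ≤ E * q ^ (-((n : ℝ) + 1)) * M ^ (-((n : ℝ) + 1)) := by positivity
    have : |smooth m Y s a - smooth m Y s b| ≤ 1 := abs_le.mpr ⟨by linarith, by linarith⟩
    linarith
  · have h3 : 0 ≤ M₀ ^ ((n : ℝ) + 1) * M ^ (-((n : ℝ) + 1)) := by positivity
    suffices h : |smooth m Y s a - smooth m Y s b| ≤
        E * q ^ (-((n : ℝ) + 1)) * M ^ (-((n : ℝ) + 1)) by linarith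
    by_cases h0 : smooth m Y s a = 0 ∧ smooth m Y s b = 0
    · rw [h0.1, h0.2, sub_zero, abs_zero]; positivity
    have hcM : 4 * ρ + 4 < c * M := by
      rw [hM₀, div_lt_iff₀ hc0] at hgt; linarith
    have hbM : M - ρ ≤ b j₀ := by
      have := (abs_le.mp (hab j₀)).2; linarith
    have hcM' : c * M ≤ M := mul_le_of_le_one_left hM0.le hc1
    have hqc : q * M = c * M / 4 := by rw [hq]; ring
    have hboth : (∀ i, q * M ≤ a i) ∧ ∀ i, q * M ≤ b i := by
      by_cases h0a : smooth m Y s a = 0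
      · have h4 := fun i ↦ comparable_of_smooth_ne_zero m hC0 hC hb (fun h ↦ h0 ⟨h0a, h⟩) i j₀
        have h5 : ∀ i, c * M - ρ ≤ b i := fun i ↦ by
          have := mul_le_mul_of_nonneg_left hbM hc0.le
          nlinarith [h4 i]
        refine ⟨fun i ↦ ?_, fun i ↦ ?_⟩
        · have := h5 i; have := (abs_le.mp (hab i)).1; linarith
        · have := h5 i; linarith
      · have h4 := fun i ↦ comparable_of_smooth_ne_zero m hC0 hC ha h0a i j₀
        rw [← hj₀] at h4
        refine ⟨fun i ↦ ?_, fun i ↦ ?_⟩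
        · have := h4 i; have : 0 < c * M := by positivity
          linarith
        · have := h4 i; have := (abs_le.mp (hab i)).2; linarith
    obtain ⟨hqa, hqb⟩ := hboth
    have hqM : 1 ≤ q * M := by rw [hqc]; linarith
    have hqM0 : 0 < q * M := by positivity
    set δ := ρ / (q * M) with hδ
    have hlog : ∀ i, |Real.log (a i) - Real.log (b i)| ≤ δ := fun i ↦
      abs_log_sub_log_le hqM0 (hqa i) (hqb i) (hab i)
    have hδ0 : 0 ≤ δ := by positivity
    set P := s * n * Real.log (q * M) with hP
    have hPa := exp_sum_log_le m (by linarith : 0 ≤ s) hqM0 hqa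
    have hPb := exp_sum_log_le m (by linarith : 0 ≤ s) hqM0 hqb
    rw [← hn, ← hP] at hPa hPb
    have hPle : Real.exp (-P) ≤ (q * M) ^ (-(n : ℝ)) := by
      rw [Real.rpow_def_of_pos hqM0, Real.exp_le_exp, hP]
      have := Real.log_nonneg hqM
      have h6 : 0 ≤ (n : ℝ) * Real.log (q * M) := by positivity
      nlinarith
    have hexp : |Real.exp (-(s * ∑ i, m i * Real.log (a i))) -
        Real.exp (-(s * ∑ i, m i * Real.log (b i)))| ≤ (q * M) ^ (-(n : ℝ)) * (2 * n * δ) := by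
      refine (abs_exp_neg_sub_le hPa hPb).trans ?_
      have : |s * ∑ i, m i * Real.log (a i) - s * ∑ i, m i * Real.log (b i)| ≤ 2 * n * δ := by
        rw [← mul_sub, ← Finset.sum_sub_distrib, abs_mul, abs_of_nonneg (by linarith : 0 ≤ s),
          mul_assoc]
        have h7 : |∑ i, (m i * Real.log (a i) - m i * Real.log (b i))| ≤ n * δ := by
          refine (Finset.abs_sum_le_sum_abs _ _).trans ?_
          rw [hn, Nat.cast_sum, Finset.sum_mul]
          refine Finset.sum_le_sum fun i _ ↦ ?_
          rw [← mul_sub, abs_mul, Nat.abs_cast]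
          exact mul_le_mul_of_nonneg_left (hlog i) (Nat.cast_nonneg _)
        exact mul_le_mul hs2 h7 (abs_nonneg _) (by norm_num)
      exact mul_le_mul hPle this (abs_nonneg _) (by positivity)
    have hW : |∏ j, tent (Y (fun i ↦ Real.log (a i)) j) -
        ∏ j, tent (Y (fun i ↦ Real.log (b i)) j)| ≤ Fintype.card κ * D * δ := by
      refine (abs_prod_sub_prod_le _ _ _ (fun _ ↦ ⟨tent_nonneg _, tent_le_one _⟩)
        fun _ ↦ ⟨tent_nonneg _, tent_le_one _⟩).trans ?_
      have h8 : ∀ j, |tent (Y (fun i ↦ Real.log (a i)) j) - tent (Y (fun i ↦ Real.log (b i)) j)| ≤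
          D * δ := by
        intro j
        refine (tent_lipschitz _ _).trans ?_
        rw [← Pi.sub_apply, ← map_sub, ← Real.norm_eq_abs]
        refine (norm_le_pi_norm _ j).trans ((hD _).trans ?_)
        gcongr
        exact (pi_norm_le_iff_of_nonneg hδ0).mpr fun i ↦ hlog i
      refine (Finset.sum_le_sum fun j _ ↦ h8 j).trans (le_of_eq ?_)
      rw [Finset.sum_const, Finset.card_univ, nsmul_eq_mul]
      ring
    have hEa : Real.exp (-(s * ∑ i, m i * Real.log (a i))) ≤ (q * M) ^ (-(n : ℝ)) :=
      (Real.exp_le_exp.mpr (neg_le_neg hPa)).trans hPle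
    have hWb : ∏ j, tent (Y (fun i ↦ Real.log (b i)) j) ≤ 1 :=
      Finset.prod_le_one (fun _ _ ↦ tent_nonneg _) fun _ _ ↦ tent_le_one _
    have hWb0 : 0 ≤ ∏ j, tent (Y (fun i ↦ Real.log (b i)) j) :=
      Finset.prod_nonneg (fun _ _ ↦ tent_nonneg _)
    unfold smooth
    set Wa := ∏ j, tent (Y (fun i ↦ Real.log (a i)) j)
    set Wb := ∏ j, tent (Y (fun i ↦ Real.log (b i)) j)
    set Ea := Real.exp (-(s * ∑ i, m i * Real.log (a i)))
    set Eb := Real.exp (-(s * ∑ i, m i * Real.log (b i)))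
    have hEa0 : 0 ≤ Ea := Real.exp_nonneg _
    calc |Wa * Ea - Wb * Eb| = |(Wa - Wb) * Ea + Wb * (Ea - Eb)| := by ring_nf
      _ ≤ |Wa - Wb| * Ea + Wb * |Ea - Eb| := by
        refine (abs_add_le _ _).trans ?_
        rw [abs_mul, abs_mul, abs_of_nonneg hEa0, abs_of_nonneg hWb0]
      _ ≤ (Fintype.card κ * D * δ) * (q * M) ^ (-(n : ℝ)) +
          1 * ((q * M) ^ (-(n : ℝ)) * (2 * n * δ)) := by gcongr
      _ = E * ((q * M) ^ (-(n : ℝ)) * (q * M)⁻¹) := by rw [hE, hδ]; ring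
      _ = E * (q * M) ^ (-((n : ℝ) + 1)) := by
        rw [neg_add, Real.rpow_add hqM0, Real.rpow_neg_one]
      _ = _ := by rw [Real.mul_rpow hq0.le hM0.le]; ring

lemma smooth_le_norm_rpow [Nonempty ι] {C : ℝ} (hC0 : 0 ≤ C)
    (hC : ∀ l : ι → ℝ, ∀ i j, |l i - l j| ≤ C * ‖Y l‖) {s : ℝ} (hs : 0 ≤ s) :
    ∃ B : ℝ, 0 ≤ B ∧ ∀ a : ι → ℝ, (∀ i, 0 < a i) →
      smooth m Y s a ≤ B * ‖a‖ ^ (-(s * (∑ i, m i : ℕ))) := by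
  set n := ∑ i, m i with hn
  refine ⟨Real.exp (-C) ^ (-(s * n)), by positivity, fun a ha ↦ ?_⟩
  by_cases h0 : smooth m Y s a = 0
  · rw [h0]; positivity
  obtain ⟨j₀, hj₀⟩ : ∃ j, ‖a‖ = a j := by
    obtain ⟨j, hj⟩ := exists_norm_eq a
    exact ⟨j, by rw [hj, Real.norm_of_nonneg (ha j).le]⟩
  have hM0 : 0 < ‖a‖ := hj₀ ▸ ha j₀
  have h1 := fun i ↦ comparable_of_smooth_ne_zero m hC0 hC ha h0 i j₀
  rw [← hj₀] at h1
  have h2 : 0 < Real.exp (-C) * ‖a‖ := by positivity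
  have h3 := exp_sum_log_le m hs h2 h1
  refine (smooth_le_exp m Y s a).trans ?_
  rw [← Real.mul_rpow (Real.exp_nonneg _) hM0.le, Real.rpow_def_of_pos h2, Real.exp_le_exp]
  rw [← hn] at h3
  linarith

end

end SumProd

namespace SumProd

open Filter Topology NumberField nonZeroDivisors NumberField.InfinitePlace
open NumberField.Units NumberField.Units.dirichletUnitTheorem

open scoped Classical

variable (K : Type*) [Field K] [NumberField K]

/-- Projection of a vector of logarithms to the log space. -/
noncomputable def logProj : (InfinitePlace K → ℝ) →ₗ[ℝ] logSpace K where
  toFun l w := mult w.1 * (l w.1 - (∑ v, mult v * l v) / Module.finrank ℚ K)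
  map_add' l l' := by
    funext w
    simp only [Pi.add_apply, mul_add, Finset.sum_add_distrib, add_div]
    ring
  map_smul' c l := by
    funext w
    simp only [Pi.smul_apply, smul_eq_mul, RingHom.id_apply]
    have : ∑ v, (mult v : ℝ) * (c * l v) = c * ∑ v, mult v * l v := by
      rw [Finset.mul_sum]; exact Finset.sum_congr rfl fun _ _ ↦ by ring
    rw [this]
    ring

/-- Coordinates of a vector of logarithms with respect to the fundamental units. -/
noncomputable def logCoord : (InfinitePlace K → ℝ) →ₗ[ℝ] (Fin (rank K) → ℝ) :=
  ((basisUnitLattice K).ofZLatticeBasis ℝ (unitLattice K)).equivFun.toLinearMap ∘ₗ logProj K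

/-- The absolute values of `x` at the infinite places. -/
def absVec (x : K) : InfinitePlace K → ℝ := fun w ↦ w x

variable {K}

lemma abs_sub_le_logProj (l : InfinitePlace K → ℝ) (i j : InfinitePlace K) :
    |l i - l j| ≤ 2 * Fintype.card (InfinitePlace K) * ‖logProj K l‖ := by
  set A := (∑ v, mult v * l v) / (Module.finrank ℚ K : ℝ) with hA
  have hn : (Module.finrank ℚ K : ℝ) ≠ 0 := by exact_mod_cast Module.finrank_pos.ne'
  have h0 : ∑ v, (mult v : ℝ) * (l v - A) = 0 := by
    simp only [mul_sub, Finset.sum_sub_distrib]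
    rw [← Finset.sum_mul, ← Nat.cast_sum, sum_mult_eq, hA]
    field_simp
    ring
  have h1 : ∀ w : {w : InfinitePlace K // w ≠ w₀}, |(mult w.1 : ℝ) * (l w.1 - A)| ≤ ‖logProj K l‖ :=
    fun w ↦ norm_le_pi_norm (logProj K l) w
  have hm : ∀ w : InfinitePlace K, (1 : ℝ) ≤ mult w := fun w ↦ by
    exact_mod_cast (mult_pos : 0 < mult w)
  have hcard : (1 : ℝ) ≤ Fintype.card (InfinitePlace K) := by exact_mod_cast Fintype.card_pos
  have h2 : ∀ w : InfinitePlace K, |(mult w : ℝ) * (l w - A)| ≤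
      Fintype.card (InfinitePlace K) * ‖logProj K l‖ := by
    intro w
    by_cases hw : w = w₀
    · subst hw
      rw [Fintype.sum_eq_add_sum_subtype_ne _ w₀] at h0
      rw [eq_neg_of_add_eq_zero_left h0, abs_neg]
      refine (Finset.abs_sum_le_sum_abs _ _).trans ((Finset.sum_le_sum fun w _ ↦ h1 w).trans ?_)
      rw [Finset.sum_const, nsmul_eq_mul]
      gcongr
      rw [Finset.card_univ]
      exact Fintype.card_subtype_le _
    · exact (h1 ⟨w, hw⟩).trans (le_mul_of_one_le_left (norm_nonneg _) hcard)
  have h3 : ∀ w : InfinitePlace K, |l w - A| ≤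
      Fintype.card (InfinitePlace K) * ‖logProj K l‖ := by
    intro w
    refine le_trans ?_ (h2 w)
    rw [abs_mul, Nat.abs_cast]
    exact le_mul_of_one_le_left (abs_nonneg _) (hm w)
  calc |l i - l j| = |(l i - A) - (l j - A)| := by ring_nf
    _ ≤ |l i - A| + |l j - A| := abs_sub _ _
    _ ≤ _ := by linarith [h3 i, h3 j]

variable (K) in
lemma exists_abs_sub_le_logCoord : ∃ C : ℝ, 0 ≤ C ∧ ∀ l : InfinitePlace K → ℝ, ∀ i j,
    |l i - l j| ≤ C * ‖logCoord K l‖ := by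
  set e := ((basisUnitLattice K).ofZLatticeBasis ℝ (unitLattice K)).equivFun
  set f := LinearMap.toContinuousLinearMap e.symm.toLinearMap
  refine ⟨2 * Fintype.card (InfinitePlace K) * ‖f‖, by positivity, fun l i j ↦ ?_⟩
  refine (abs_sub_le_logProj l i j).trans ?_
  have : logProj K l = f (logCoord K l) := (e.symm_apply_apply _).symm
  rw [mul_assoc (2 * _ : ℝ)]
  refine mul_le_mul_of_nonneg_left ?_ (by positivity : (0 : ℝ) ≤ 2 * Fintype.card (InfinitePlace K))
  rw [this]
  exact f.le_opNorm _

lemma logProj_unit (u : (𝓞 K)ˣ) :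
    logProj K (fun w ↦ Real.log (w (u : K))) = logEmbedding K (Additive.ofMul u) := by
  funext w
  change (mult w.1 : ℝ) * (_ - _) = _
  rw [sum_mult_mul_log]
  simp [logEmbedding_component]

lemma logCoord_fundSystem (i : Fin (rank K)) :
    logCoord K (fun w ↦ Real.log (w (fundSystem K i : K))) = Pi.single i 1 := by
  rw [logCoord, LinearMap.comp_apply, logProj_unit, logEmbedding_fundSystem]
  funext j
  change ((basisUnitLattice K).ofZLatticeBasis ℝ (unitLattice K)).repr _ j = _
  rw [Module.Basis.ofZLatticeBasis_repr_apply, Module.Basis.repr_self, Finsupp.single_apply,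
    Pi.single_apply]
  simp [eq_comm]

/-- The logarithmic coordinates of a unit. -/
lemma logCoord_unit (ζ : torsion K) (e : Fin (rank K) → ℤ) :
    logCoord K (fun w ↦ Real.log (w ((ζ * ∏ i, fundSystem K i ^ e i : (𝓞 K)ˣ) : K))) =
      fun i ↦ (e i : ℝ) := by
  have h1 : logProj K (fun w ↦ Real.log (w ((ζ * ∏ i, fundSystem K i ^ e i : (𝓞 K)ˣ) : K))) =
      ∑ i, (e i : ℝ) • logProj K (fun w ↦ Real.log (w (fundSystem K i : K))) := by
    simp_rw [logProj_unit]
    have h0 : logEmbedding K (Additive.ofMul (ζ : (𝓞 K)ˣ)) = 0 := by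
      rw [← AddMonoidHom.mem_ker, logEmbedding_ker]
      exact ζ.2
    rw [ofMul_mul, map_add, h0, zero_add, ofMul_prod, map_sum]
    refine Finset.sum_congr rfl fun i _ ↦ ?_
    rw [ofMul_zpow, map_zsmul, Int.cast_smul_eq_zsmul]
  rw [logCoord, LinearMap.comp_apply, h1, map_sum]
  have h2 := fun i ↦ logCoord_fundSystem (K := K) i
  simp only [logCoord, LinearMap.comp_apply] at h2
  simp_rw [map_smul, h2]
  funext j
  simp [Finset.sum_apply, Pi.single_apply]

lemma tsum_tent (y : ℝ) : ∃ N : ℕ, ∀ m : ℤ, m ∉ Finset.Icc (-(N : ℤ)) N → tent (y + m) = 0 := by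
  refine ⟨⌈|y| + 1⌉₊, fun m hm ↦ tent_eq_zero ?_⟩
  have h1 := Nat.le_ceil (|y| + 1)
  have h2 : (⌈|y| + 1⌉₊ : ℝ) ≤ |(m : ℝ)| := by
    have : ((⌈|y| + 1⌉₊ : ℕ) : ℤ) ≤ |m| := by
      rw [Finset.mem_Icc, not_and_or] at hm
      rcases hm with hm | hm
      · exact le_abs.mpr (.inr (by omega))
      · exact le_abs.mpr (.inl (by omega))
    exact_mod_cast this
  have h3 := abs_sub_abs_le_abs_sub (m : ℝ) (-y)
  rw [abs_neg, sub_neg_eq_add, add_comm] at h3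
  linarith [add_comm y (m : ℝ) ▸ h3]

lemma sum_tent_eq_one (y : ℝ) (s : Finset ℤ) (hs : ∀ m : ℤ, m ∉ s → tent (y + m) = 0) :
    ∑ m ∈ s, tent (y + m) = 1 := by
  have h1 : ∀ m : ℤ, m ∉ ({-⌊y⌋, -⌊y⌋ - 1} : Finset ℤ) → tent (y + m) = 0 := by
    intro m hm
    simp only [Finset.mem_insert, Finset.mem_singleton, not_or] at hm
    refine tent_eq_zero ?_
    have ha := Int.floor_le y
    have hb := Int.lt_floor_add_one y
    rcases lt_or_ge m (-⌊y⌋ - 1) with h | h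
    · have : (m : ℝ) ≤ -⌊y⌋ - 2 := by exact_mod_cast (show m ≤ -⌊y⌋ - 2 by omega)
      exact le_abs.mpr (.inr (by linarith))
    · have : (-⌊y⌋ + 1 : ℝ) ≤ m := by exact_mod_cast (show -⌊y⌋ + 1 ≤ m by omega)
      exact le_abs.mpr (.inl (by linarith))
  have h2 : ∀ t : Finset ℤ, (∀ m : ℤ, m ∉ t → tent (y + m) = 0) →
      ∑' m : ℤ, tent (y + m) = ∑ m ∈ t, tent (y + m) := fun t ht ↦ tsum_eq_sum ht
  rw [← h2 s hs, h2 _ h1, Finset.sum_pair (by omega)]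
  have ha := Int.floor_le y
  have hb := Int.lt_floor_add_one y
  unfold tent
  push_cast
  rw [abs_of_nonneg (by linarith), abs_of_nonpos (by linarith), max_eq_right (by linarith),
    max_eq_right (by linarith)]
  ring

lemma hasSum_prod_tent {r : ℕ} (y : Fin r → ℝ) :
    HasSum (fun e : Fin r → ℤ ↦ ∏ j, tent (y j + e j)) 1 := by
  choose N hN using fun j ↦ tsum_tent (y j)
  have h1 : ∑ e ∈ Fintype.piFinset (fun j ↦ Finset.Icc (-(N j : ℤ)) (N j)),
      ∏ j, tent (y j + e j) = 1 := by
    rw [← Finset.prod_univ_sum (fun j ↦ Finset.Icc (-(N j : ℤ)) (N j))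
      (fun j m ↦ tent (y j + m))]
    exact Finset.prod_eq_one fun j _ ↦ sum_tent_eq_one (y j) _ (hN j)
  rw [← h1]
  refine hasSum_sum_of_ne_finset_zero fun e he ↦ ?_
  obtain ⟨j, hj⟩ : ∃ j, e j ∉ Finset.Icc (-(N j : ℤ)) (N j) := by
    by_contra! h
    exact he (Fintype.mem_piFinset.mpr h)
  exact Finset.prod_eq_zero (Finset.mem_univ j) (hN j _ hj)

/-- The smoothed norm power of an algebraic integer. -/
noncomputable def smoothAt (s : ℝ) (x : 𝓞 K) : ℝ :=
  if x = 0 then 0 else smooth (mult (K := K)) (logCoord K) s (absVec K x)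

lemma sum_log_absVec {x : K} (hx : x ≠ 0) :
    ∑ w, mult w * Real.log (absVec K x w) = Real.log |(Algebra.norm ℚ x : ℝ)| := by
  rw [← Rat.cast_abs, ← prod_eq_abs_norm, Real.log_prod]
  · simp [Real.log_pow, absVec]
  · intro w _
    exact pow_ne_zero _ ((map_ne_zero w).mpr hx)

lemma exp_sum_log_absVec (s : ℝ) {x : 𝓞 K} (hx : x ≠ 0) :
    Real.exp (-(s * ∑ w, mult w * Real.log (absVec K x w))) =
      (Ideal.absNorm (Ideal.span {x}) : ℝ) ^ (-s) := by
  have hx' : (x : K) ≠ 0 := by exact_mod_cast hx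
  have h1 : |(Algebra.norm ℚ (x : K) : ℝ)| = Ideal.absNorm (Ideal.span {x}) := by
    rw [Ideal.absNorm_span_singleton, ← Algebra.coe_norm_int, Nat.cast_natAbs, Int.cast_abs]
    simp
  have h2 : 0 < (Ideal.absNorm (Ideal.span {x}) : ℝ) := by
    rw [← h1]
    exact abs_pos.mpr (by exact_mod_cast Algebra.norm_ne_zero_iff.mpr hx')
  rw [sum_log_absVec hx', h1, Real.rpow_def_of_pos h2]
  ring_nf

variable (K) in
/-- Units as torsion units times integral vectors of exponents. -/
noncomputable def unitsEquiv : torsion K × (Fin (rank K) → ℤ) ≃ (𝓞 K)ˣ :=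
  Equiv.ofBijective (fun p ↦ p.1 * ∏ i, fundSystem K i ^ p.2 i)
    ⟨fun _ _ h ↦ (exist_unique_eq_mul_prod K _).unique rfl h,
      fun x ↦ (exist_unique_eq_mul_prod K x).exists.imp fun _ h ↦ h.symm⟩

lemma hasSum_comp_snd {ι β : Type*} [Finite ι] {f : β → ℝ} {a : ℝ} (hf : HasSum f a)
    (hf0 : ∀ b, 0 ≤ f b) : HasSum (fun p : ι × β ↦ f p.2) (Nat.card ι * a) := by
  have := Fintype.ofFinite ι
  have h := hasSum_fintype (fun _ : ι ↦ (1 : ℝ))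
  simpa [Nat.card_eq_fintype_card] using
    h.mul hf (h.summable.mul_of_nonneg hf.summable (fun _ ↦ zero_le_one) hf0)

lemma smoothAt_units_mul (s : ℝ) {x : 𝓞 K} (hx : x ≠ 0) (p : torsion K × (Fin (rank K) → ℤ)) :
    smoothAt s ((unitsEquiv K p : 𝓞 K) * x) = (Ideal.absNorm (Ideal.span {x}) : ℝ) ^ (-s) *
      ∏ j, tent (logCoord K (fun w ↦ Real.log (absVec K x w)) j + p.2 j) := by
  have hx' : (x : K) ≠ 0 := by exact_mod_cast hx
  have hu : ((unitsEquiv K p : 𝓞 K) : K) ≠ 0 := by exact_mod_cast (unitsEquiv K p).ne_zero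
  have hux : (unitsEquiv K p : 𝓞 K) * x ≠ 0 := mul_ne_zero (unitsEquiv K p).ne_zero hx
  have h2 : (fun w : InfinitePlace K ↦
      Real.log (absVec K ((unitsEquiv K p : 𝓞 K) * x : 𝓞 K) w)) =
      (fun w ↦ Real.log (absVec K x w)) +
        fun w ↦ Real.log (w ((p.1 * ∏ i, fundSystem K i ^ p.2 i : (𝓞 K)ˣ) : K)) := by
    funext w
    have hwu := (map_ne_zero w).mpr hu
    have hwx := (map_ne_zero w).mpr hx'
    simp only [absVec, Pi.add_apply, map_mul]
    rw [mul_comm, Real.log_mul hwx hwu]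
    rfl
  rw [smoothAt, if_neg hux, smooth, exp_sum_log_absVec s hux, mul_comm,
    Ideal.span_singleton_mul_left_unit (unitsEquiv K p).isUnit, h2, map_add, logCoord_unit]
  rfl

/-- Summing the smoothed norm power over a class of associates. -/
lemma hasSum_smoothAt_units (s : ℝ) {x : 𝓞 K} (hx : x ≠ 0) :
    HasSum (fun u : (𝓞 K)ˣ ↦ smoothAt s ((u : 𝓞 K) * x))
      (torsionOrder K * (Ideal.absNorm (Ideal.span {x}) : ℝ) ^ (-s)) := by
  rw [← (unitsEquiv K).hasSum_iff]
  have h1 := hasSum_comp_snd (ι := torsion K)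
    (hasSum_prod_tent (logCoord K (fun w ↦ Real.log (absVec K x w))))
    fun e ↦ Finset.prod_nonneg fun _ _ ↦ tent_nonneg _
  have h2 := h1.mul_left ((Ideal.absNorm (Ideal.span {x}) : ℝ) ^ (-s))
  rw [mul_one, mul_comm] at h2
  have h3 : (fun u : (𝓞 K)ˣ ↦ smoothAt s ((u : 𝓞 K) * x)) ∘ unitsEquiv K = _ :=
    funext (smoothAt_units_mul s hx)
  rw [h3]
  exact h2

end SumProd

namespace SumProd

open Filter Topology NumberField nonZeroDivisors NumberField.InfinitePlace

open scoped Classical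

variable {K : Type*} [Field K] [NumberField K]

lemma norm_absVec (x : K) : ‖absVec K x‖ = ‖mixedEmbedding K x‖ := by
  rw [mixedEmbedding.norm_eq_sup'_normAtPlace]
  refine le_antisymm ?_ ?_
  · refine (pi_norm_le_iff_of_nonempty _).mpr fun w ↦ ?_
    rw [absVec, Real.norm_of_nonneg (apply_nonneg w x), ← mixedEmbedding.normAtPlace_apply]
    exact Finset.le_sup' (fun w ↦ mixedEmbedding.normAtPlace w (mixedEmbedding K x))
      (Finset.mem_univ w)
  · refine Finset.sup'_le _ _ fun w _ ↦ ?_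
    rw [mixedEmbedding.normAtPlace_apply]
    exact (Real.le_norm_self _).trans (norm_le_pi_norm (absVec K x) w)

lemma summable_absVec {r : ℝ} (hr : r < -Module.finrank ℚ K) :
    Summable fun x : 𝓞 K ↦ ‖absVec K x‖ ^ r := by
  have h1 := ZLattice.summable_norm_rpow (mixedEmbedding.integerLattice K) r (by
    rwa [ZLattice.rank ℝ, mixedEmbedding.finrank])
  let f : 𝓞 K → mixedEmbedding.integerLattice K := fun x ↦
    ⟨mixedEmbedding K x, ⟨x, rfl⟩⟩
  have hf : Function.Injective f := fun x y h ↦ by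
    have := (NumberField.mixedEmbedding_injective K) (congrArg Subtype.val h)
    exact_mod_cast this
  refine (h1.comp_injective hf).congr fun x ↦ ?_
  rw [norm_absVec]
  rfl

lemma absVec_pos {x : 𝓞 K} (hx : x ≠ 0) (w : InfinitePlace K) : 0 < absVec K x w :=
  w.pos_iff.mpr (by exact_mod_cast hx)

lemma sum_log_absVec_nonneg {x : 𝓞 K} (hx : x ≠ 0) :
    0 ≤ ∑ w, mult w * Real.log (absVec K x w) := by
  have hx' : (x : K) ≠ 0 := by exact_mod_cast hx
  rw [sum_log_absVec hx', ← Algebra.coe_norm_int, Rat.cast_intCast]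
  refine Real.log_nonneg ?_
  have : Algebra.norm ℤ x ≠ 0 := Algebra.norm_ne_zero_iff.mpr hx
  exact_mod_cast Int.one_le_abs this

lemma smoothAt_nonneg (s : ℝ) (x : 𝓞 K) : 0 ≤ smoothAt s x := by
  unfold smoothAt
  split_ifs
  · exact le_rfl
  · exact smooth_nonneg _ _ _ _

lemma smoothAt_le_one {s : ℝ} (hs : 0 ≤ s) (x : 𝓞 K) : smoothAt s x ≤ 1 := by
  unfold smoothAt
  split_ifs with h
  · exact zero_le_one
  · exact smooth_le_one _ _ hs (sum_log_absVec_nonneg h)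

lemma summable_smoothAt {s : ℝ} (hs : 1 < s) : Summable fun x : 𝓞 K ↦ smoothAt s x := by
  obtain ⟨C, hC0, hC⟩ := exists_abs_sub_le_logCoord K
  obtain ⟨B, hB0, hB⟩ := smooth_le_norm_rpow (mult (K := K)) hC0 hC (zero_le_one.trans hs.le)
  rw [sum_mult_eq] at hB
  have hn : (0 : ℝ) < Module.finrank ℚ K := by exact_mod_cast Module.finrank_pos
  refine .of_nonneg_of_le (smoothAt_nonneg s) (fun x ↦ ?_)
    ((summable_absVec (K := K) (r := -(s * Module.finrank ℚ K)) (by nlinarith)).mul_left B)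
  unfold smoothAt
  split_ifs with h
  · positivity
  · exact hB _ (absVec_pos h)

/-- Translating by `r` changes the smoothed norm power by a summable amount. -/
lemma exists_smoothAt_sub_le (r : 𝓞 K) : ∃ h : 𝓞 K → ℝ, Summable h ∧
    ∀ s : ℝ, 1 ≤ s → s ≤ 2 → ∀ x, |smoothAt s x - smoothAt s (r + x)| ≤ h x := by
  obtain ⟨C, hC0, hC⟩ := exists_abs_sub_le_logCoord K
  obtain ⟨B, hB0, hB⟩ := abs_smooth_sub_smooth_le (mult (K := K)) hC0 hC
    (norm_nonneg (absVec K r))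
  rw [sum_mult_eq] at hB
  refine ⟨fun x ↦ B * ‖absVec K x‖ ^ (-(Module.finrank ℚ K + 1 : ℝ)) +
    ((if x = 0 then 1 else 0) + if x = -r then 1 else 0), ?_, fun s hs hs2 x ↦ ?_⟩
  · exact ((summable_absVec (by linarith)).mul_left B).add
      ((hasSum_ite_eq (0 : 𝓞 K) (1 : ℝ)).summable.add (hasSum_ite_eq (-r) (1 : ℝ)).summable)
  beta_reduce
  have h01 : |smoothAt s x - smoothAt s (r + x)| ≤ 1 := by
    have h1 := smoothAt_nonneg s x
    have h2 := smoothAt_nonneg s (r + x)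
    have h3 := smoothAt_le_one (zero_le_one.trans hs) x
    have h4 := smoothAt_le_one (zero_le_one.trans hs) (r + x)
    rw [abs_le]
    constructor <;> linarith
  have hpos : 0 ≤ B * ‖absVec K x‖ ^ (-(Module.finrank ℚ K + 1 : ℝ)) := by positivity
  by_cases hx : x = 0
  · rw [if_pos hx]
    have : (0 : ℝ) ≤ if x = -r then 1 else 0 := by split_ifs <;> norm_num
    linarith
  by_cases hrx : x = -r
  · rw [if_neg hx, if_pos hrx]
    linarith
  have hrx' : r + x ≠ 0 := fun h ↦ hrx (eq_neg_of_add_eq_zero_right h)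
  rw [if_neg hx, if_neg hrx, add_zero, add_zero, smoothAt, smoothAt, if_neg hx, if_neg hrx']
  refine hB s hs hs2 _ _ (absVec_pos hx) (absVec_pos hrx') (sum_log_absVec_nonneg hx)
    (sum_log_absVec_nonneg hrx') fun w ↦ ?_
  refine le_trans ?_ (norm_le_pi_norm (absVec K r) w)
  rw [abs_sub_comm, absVec, absVec, absVec, Real.norm_of_nonneg (apply_nonneg w _)]
  have := w.1.abs_abv_sub_le_abv_sub ((r + x : 𝓞 K) : K) x
  rwa [show ((r + x : 𝓞 K) : K) - x = r by push_cast; ring] at this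

/-- Coset decomposition modulo an ideal. -/
noncomputable def cosetEquiv {R : Type*} [CommRing R] (J : Ideal R) : (R ⧸ J) × J ≃ R :=
  Equiv.ofBijective (fun p ↦ p.1.out + p.2) ⟨by
    rintro ⟨q, x⟩ ⟨q', x'⟩ h
    simp only at h
    have hq : q = q' := by
      rw [← Ideal.Quotient.mk_out q, ← Ideal.Quotient.mk_out q', Ideal.Quotient.eq]
      rw [show q.out - q'.out = (x' : R) - x by linear_combination h]
      exact J.sub_mem x'.2 x.2
    subst hq
    rw [add_right_inj] at h
    exact Prod.ext rfl (Subtype.ext h), fun y ↦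
    ⟨⟨Ideal.Quotient.mk J y, y - (Ideal.Quotient.mk J y).out,
      by rw [← Ideal.Quotient.eq, Ideal.Quotient.mk_out]⟩, by simp⟩⟩

lemma abs_tsum_sub_card_mul_le {R : Type*} [CommRing R] (J : Ideal R) [Finite (R ⧸ J)] {f : R → ℝ}
    (hf : Summable f) {h : R ⧸ J → R → ℝ} (hh : ∀ q, Summable (h q))
    (hle : ∀ q x, |f x - f (q.out + x)| ≤ h q x) :
    |∑' x, f x - Nat.card (R ⧸ J) * ∑' x : J, f x| ≤ ∑' q, ∑' x : J, h q x := by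
  have := Fintype.ofFinite (R ⧸ J)
  have hS' : Summable fun p ↦ f (cosetEquiv J p) := (cosetEquiv J).summable_iff.mpr hf
  have h1 : ∑' x, f x = ∑ q : R ⧸ J, ∑' x : J, f (q.out + x) := by
    rw [← (cosetEquiv J).tsum_eq, hS'.tsum_prod, tsum_fintype]
    rfl
  have h2 : (Nat.card (R ⧸ J) : ℝ) * ∑' x : J, f x = ∑ q : R ⧸ J, ∑' x : J, f x := by
    rw [Finset.sum_const, nsmul_eq_mul, Finset.card_univ, Nat.card_eq_fintype_card]
  rw [h1, h2, ← Finset.sum_sub_distrib, tsum_fintype fun q ↦ ∑' x : J, h q x]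
  refine (Finset.abs_sum_le_sum_abs _ _).trans (Finset.sum_le_sum fun q _ ↦ ?_)
  have hJS : Summable fun x : J ↦ f x := hf.subtype (J : Set R)
  have hqS : Summable fun x : J ↦ f (q.out + x) :=
    hf.comp_injective ((add_right_injective q.out).comp Subtype.val_injective)
  rw [← hqS.tsum_sub hJS, ← Real.norm_eq_abs]
  refine tsum_of_norm_bounded ((hh q).subtype (J : Set R)).hasSum fun x ↦ ?_
  rw [Real.norm_eq_abs, abs_sub_comm]
  exact hle q x

/-- The smoothed sum over a nonzero ideal is proportional to its density, up to a bounded error. -/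
lemma exists_abs_tsum_smoothAt_sub_le {J : Ideal (𝓞 K)} (hJ : J ≠ ⊥) : ∃ C : ℝ,
    ∀ s : ℝ, 1 < s → s ≤ 2 → |∑' x : 𝓞 K, smoothAt s x -
      Ideal.absNorm J * ∑' x : J, smoothAt s (x : 𝓞 K)| ≤ C := by
  have := Ideal.finiteQuotientOfFreeOfNeBot J hJ
  choose h hh hle using fun q : 𝓞 K ⧸ J ↦ exists_smoothAt_sub_le (K := K) q.out
  refine ⟨∑' q, ∑' x : J, h q x, fun s hs hs2 ↦ ?_⟩
  exact abs_tsum_sub_card_mul_le J (summable_smoothAt (K := K) hs) hh fun q x ↦ hle q s hs.le hs2 x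

variable (K) in
/-- The partial zeta function of an ideal class. -/
noncomputable def classZeta (c : ClassGroup (𝓞 K)) (s : ℝ) : ℝ :=
  ∑' I : {I : (Ideal (𝓞 K))⁰ // ClassGroup.mk0 I = c}, (Ideal.absNorm (I.1 : Ideal (𝓞 K)) : ℝ) ^ (-s)

lemma exists_span_eq_mul {R : Type*} [CommRing R] [IsDedekindDomain R] {I J : (Ideal R)⁰}
    (hIJ : ClassGroup.mk0 I = (ClassGroup.mk0 J)⁻¹) :
    ∃ x : R, x ≠ 0 ∧ Ideal.span {x} = (I * J : Ideal R) := by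
  have h : ClassGroup.mk0 (I * J) = 1 := by rw [map_mul, hIJ, inv_mul_cancel]
  rw [ClassGroup.mk0_eq_one_iff (I * J).2] at h
  obtain ⟨x, hx⟩ := h
  rw [Ideal.submodule_span_eq, Submonoid.coe_mul] at hx
  refine ⟨x, ?_, hx.symm⟩
  rintro rfl
  rw [Ideal.span_singleton_zero] at hx
  exact nonZeroDivisors.coe_ne_zero (I * J) hx

lemma tsum_ideal_eq {R : Type*} [CommRing R] [IsDedekindDomain R] {f : R → ℝ} (hf : Summable f)
    (hf0 : f 0 = 0) {w : Ideal R → ℝ}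
    (hw : ∀ x, x ≠ 0 → HasSum (fun u : Rˣ ↦ f (u * x)) (w (Ideal.span {x}))) (J : (Ideal R)⁰) :
    ∑' x : (J : Ideal R), f x =
      ∑' I : {I : (Ideal R)⁰ // ClassGroup.mk0 I = (ClassGroup.mk0 J)⁻¹}, w (I.1 * J) := by
  choose gen hgen0 hgen using
    fun I : {I : (Ideal R)⁰ // ClassGroup.mk0 I = (ClassGroup.mk0 J)⁻¹} ↦ exists_span_eq_mul I.2
  have hmem : ∀ I, gen I ∈ (J : Ideal R) := fun I ↦ by
    rw [← Ideal.dvd_span_singleton, hgen]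
    exact Dvd.intro_left _ rfl
  let φ : {I : (Ideal R)⁰ // ClassGroup.mk0 I = (ClassGroup.mk0 J)⁻¹} × Rˣ → (J : Ideal R) :=
    fun p ↦ ⟨p.2 * gen p.1, Ideal.mul_mem_left _ _ (hmem p.1)⟩
  have hspan : ∀ p, Ideal.span {(φ p : R)} = p.1.1 * J := fun p ↦ by
    rw [← hgen]
    exact Ideal.span_singleton_mul_left_unit p.2.isUnit _
  have hinj : Function.Injective φ := by
    rintro ⟨I, u⟩ ⟨I', u'⟩ h
    have h1 := hspan ⟨I, u⟩
    rw [h, hspan] at h1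
    have hI : I = I' := Subtype.ext (Subtype.ext
      (mul_right_cancel₀ (nonZeroDivisors.coe_ne_zero J) h1).symm)
    subst hI
    have h2 : (u : R) * gen I = u' * gen I := congrArg Subtype.val h
    exact Prod.ext rfl (Units.ext (mul_right_cancel₀ (hgen0 I) h2))
  have hsupp : Function.support (fun x : (J : Ideal R) ↦ f x) ⊆ Set.range φ := by
    rintro ⟨x, hxJ⟩ hx
    have hx0 : x ≠ 0 := by
      rintro rfl
      exact hx hf0
    obtain ⟨I, hI⟩ := Ideal.dvd_span_singleton.mpr hxJ
    have hI0 : I ≠ 0 := by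
      rintro rfl
      rw [mul_zero] at hI
      exact hx0 (Ideal.span_singleton_eq_bot.mp hI)
    have hcls : ClassGroup.mk0 ⟨I, mem_nonZeroDivisors_of_ne_zero hI0⟩ = (ClassGroup.mk0 J)⁻¹ := by
      rw [eq_inv_iff_mul_eq_one, ← map_mul, ClassGroup.mk0_eq_one_iff]
      exact ⟨x, by rw [Ideal.submodule_span_eq, hI, mul_comm]; rfl⟩
    have h1 : Ideal.span {gen ⟨_, hcls⟩} = Ideal.span {x} := by
      rw [hgen, hI, mul_comm]
    obtain ⟨u, hu⟩ := Ideal.span_singleton_eq_span_singleton.mp h1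
    exact ⟨⟨⟨_, hcls⟩, u⟩, Subtype.ext ((mul_comm _ _).trans hu)⟩
  have hS : Summable fun p ↦ f (φ p) := hf.comp_injective (Subtype.val_injective.comp hinj)
  rw [← hinj.tsum_eq hsupp, hS.tsum_prod]
  refine tsum_congr fun I ↦ ?_
  rw [(hw _ (hgen0 I)).tsum_eq, hgen]

lemma tsum_smoothAt_ideal {s : ℝ} (hs : 1 < s) (J : (Ideal (𝓞 K))⁰) :
    ∑' x : (J : Ideal (𝓞 K)), smoothAt s (x : 𝓞 K) = Units.torsionOrder K *
      ((Ideal.absNorm (J : Ideal (𝓞 K)) : ℝ) ^ (-s) * classZeta K (ClassGroup.mk0 J)⁻¹ s) := by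
  rw [tsum_ideal_eq (w := fun I ↦ Units.torsionOrder K * (Ideal.absNorm I : ℝ) ^ (-s))
    (summable_smoothAt hs) (if_pos rfl) (fun x hx ↦ hasSum_smoothAt_units s hx) J,
    classZeta, ← tsum_mul_left, ← tsum_mul_left]
  refine tsum_congr fun I ↦ ?_
  rw [map_mul, Nat.cast_mul, Real.mul_rpow (Nat.cast_nonneg _) (Nat.cast_nonneg _)]
  ring

lemma classZeta_nonneg (c : ClassGroup (𝓞 K)) (s : ℝ) : 0 ≤ classZeta K c s :=
  tsum_nonneg fun _ ↦ by positivity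

lemma classZeta_le {s : ℝ} (hs : 1 < s) (c : ClassGroup (𝓞 K)) :
    classZeta K c s ≤ idealZeta K s :=
  (summable_absNorm K hs).tsum_subtype_le _ {I | ClassGroup.mk0 I = c} (fun _ ↦ by positivity)

/-- Partial zeta functions differ from each other by a function bounded near `1`. -/
lemma exists_abs_classZeta_sub_le (c : ClassGroup (𝓞 K)) : ∃ C : ℝ, ∀ᶠ s in 𝓝[>] (1 : ℝ),
    |classZeta K c s - classZeta K 1 s| ≤ C := by
  obtain ⟨J, hJ⟩ := ClassGroup.mk0_surjective c⁻¹
  obtain ⟨C, hC⟩ := exists_abs_tsum_smoothAt_sub_le (nonZeroDivisors.coe_ne_zero J)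
  set N : ℝ := (Ideal.absNorm (J : Ideal (𝓞 K)) : ℝ) with hN
  have hN1 : 1 ≤ N := Nat.one_le_cast.mpr (absNorm_pos K J)
  have hw : (1 : ℝ) ≤ Units.torsionOrder K := by exact_mod_cast Units.torsionOrder_pos K
  have hlim := (tendsto_idealZeta K).eventually_le_const (lt_add_one _)
  have h2 : ∀ᶠ s in 𝓝[>] (1 : ℝ), s ≤ 2 :=
    nhdsWithin_le_nhds (eventually_le_nhds one_lt_two)
  refine ⟨|C| + Real.log N * (dedekindZeta_residue K + 1), ?_⟩
  filter_upwards [hlim, h2, self_mem_nhdsWithin] with s hs hs2 hs1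
  rw [Set.mem_Ioi] at hs1
  have h3 := hC s hs1 hs2
  have h4 : ∑' x : 𝓞 K, smoothAt s x = Units.torsionOrder K * classZeta K 1 s := by
    have := tsum_smoothAt_ideal (K := K) hs1 1
    rw [map_one, inv_one, Submonoid.coe_one, Ideal.one_eq_top, Ideal.absNorm_top, Nat.cast_one,
      Real.one_rpow, one_mul] at this
    rw [← this]
    exact ((Equiv.subtypeUnivEquiv fun _ ↦ Submodule.mem_top).tsum_eq (smoothAt s)).symm
  rw [h4, tsum_smoothAt_ideal hs1, hJ, inv_inv] at h3
  have h5 : N * (Units.torsionOrder K * (N ^ (-s) * classZeta K c s)) =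
      Units.torsionOrder K * (N ^ (1 - s) * classZeta K c s) := by
    rw [sub_eq_add_neg, Real.rpow_add (by linarith), Real.rpow_one]
    ring
  rw [h5, ← mul_sub, abs_mul, abs_of_nonneg (by linarith)] at h3
  have h6 : |classZeta K 1 s - N ^ (1 - s) * classZeta K c s| ≤ |C| :=
    (le_mul_of_one_le_left (abs_nonneg _) hw).trans (h3.trans (le_abs_self C))
  have h7 : 1 - (s - 1) * Real.log N ≤ N ^ (1 - s) := by
    rw [Real.rpow_def_of_pos (by linarith)]
    have := Real.add_one_le_exp (Real.log N * (1 - s))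
    linarith
  have h8 : N ^ (1 - s) ≤ 1 := Real.rpow_le_one_of_one_le_of_nonpos hN1 (by linarith)
  have hc0 := classZeta_nonneg c s
  have h9 : (1 - N ^ (1 - s)) * classZeta K c s ≤
      Real.log N * (dedekindZeta_residue K + 1) := by
    calc (1 - N ^ (1 - s)) * classZeta K c s ≤ ((s - 1) * Real.log N) * idealZeta K s := by
          exact mul_le_mul (by linarith) (classZeta_le hs1 c) hc0
            (mul_nonneg (by linarith) (Real.log_nonneg hN1))
      _ = Real.log N * ((s - 1) * idealZeta K s) := by ring
      _ ≤ _ := by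
          exact mul_le_mul_of_nonneg_left hs (Real.log_nonneg hN1)
  have h10 : 0 ≤ (1 - N ^ (1 - s)) * classZeta K c s := mul_nonneg (by linarith) hc0
  rw [abs_le] at h6 ⊢
  constructor <;> nlinarith

end SumProd

namespace SumProd

open Filter Topology NumberField nonZeroDivisors IsDedekindDomain

variable {K M : Type*} [Field K] [NumberField K] [Field M] [NumberField M] [Algebra K M]

lemma tsum_weight_eq {χ : ClassGroup (𝓞 K) →* ℝ} (hχ : ∀ c, χ c = 1 ∨ χ c = -1) {s : ℝ}
    (hs : 1 < s) : ∑' I, weight (χ.comp ClassGroup.mk0) s I = ∑ c, χ c * classZeta K c s := by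
  have h1 : Summable (weight (χ.comp ClassGroup.mk0) s) := summable_weight _ (fun I ↦ hχ _) hs
  have h2 : Summable fun p ↦ weight (χ.comp ClassGroup.mk0) s
      (Equiv.sigmaFiberEquiv (ClassGroup.mk0 (R := 𝓞 K)) p) :=
    (Equiv.sigmaFiberEquiv _).summable_iff.mpr h1
  rw [← (Equiv.sigmaFiberEquiv (ClassGroup.mk0 (R := 𝓞 K))).tsum_eq, h2.tsum_sigma, tsum_fintype]
  refine Finset.sum_congr rfl fun c _ ↦ ?_
  rw [classZeta, ← tsum_mul_left]
  refine tsum_congr fun I ↦ ?_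
  change χ (ClassGroup.mk0 I.1) * _ = _
  rw [I.2]
  rfl

/-- The sum of a nontrivial quadratic class character is bounded near `1`. -/
lemma exists_abs_tsum_weight_le {χ : ClassGroup (𝓞 K) →* ℝ} (hχ : ∀ c, χ c = 1 ∨ χ c = -1)
    (hχ1 : χ ≠ 1) : ∃ C : ℝ, ∀ᶠ s in 𝓝[>] (1 : ℝ),
      |∑' I, weight (χ.comp ClassGroup.mk0) s I| ≤ C := by
  choose C hC using exists_abs_classZeta_sub_le (K := K)
  refine ⟨∑ c, C c, ?_⟩
  filter_upwards [eventually_all.mpr hC, self_mem_nhdsWithin] with s hs hs1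
  rw [tsum_weight_eq hχ hs1]
  have h0 : ∑ c, χ c = 0 := by
    classical exact sum_hom_units_eq_zero χ hχ1
  have h1 : ∑ c, χ c * classZeta K c s = ∑ c, χ c * (classZeta K c s - classZeta K 1 s) := by
    simp only [mul_sub, Finset.sum_sub_distrib]
    rw [← Finset.sum_mul, h0, zero_mul, sub_zero]
  rw [h1]
  refine (Finset.abs_sum_le_sum_abs _ _).trans (Finset.sum_le_sum fun c _ ↦ ?_)
  have h2 : |χ c| = 1 := by rcases hχ c with h | h <;> simp [h]
  rw [abs_mul, h2, one_mul]
  exact hs c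

/-- There are no two independent quadratic class characters trivial on norms from `M`. -/
theorem not_two_characters (hrank : Module.finrank K M = 2) (χ₁ χ₂ : ClassGroup (𝓞 K) →* ℝ)
    (h₁ : ∀ c, χ₁ c = 1 ∨ χ₁ c = -1) (h₂ : ∀ c, χ₂ c = 1 ∨ χ₂ c = -1)
    (h₁' : χ₁ ≠ 1) (h₂' : χ₂ ≠ 1) (h₁₂ : χ₁ * χ₂ ≠ 1)
    (hn : ∀ (I : (Ideal (𝓞 M))⁰) (J : (Ideal (𝓞 K))⁰), Ideal.relNorm (𝓞 K) (I : Ideal (𝓞 M)) = J →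
      χ₁ (ClassGroup.mk0 J) = 1 ∧ χ₂ (ClassGroup.mk0 J) = 1) : False := by
  obtain ⟨C₁, hC₁⟩ := exists_abs_tsum_weight_le h₁ h₁'
  obtain ⟨C₂, hC₂⟩ := exists_abs_tsum_weight_le h₂ h₂'
  obtain ⟨C₃, hC₃⟩ := exists_abs_tsum_weight_le (χ := χ₁ * χ₂) (fun c ↦ by
    rcases h₁ c with h | h <;> rcases h₂ c with h' | h' <;> simp [h, h']) h₁₂
  have hlim : Tendsto (fun s : ℝ ↦ s - 1) (𝓝[>] 1) (𝓝 0) := by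
    have : Tendsto (fun s : ℝ ↦ s - 1) (𝓝 1) (𝓝 (1 - 1)) := tendsto_id.sub_const 1
    rw [sub_self] at this
    exact this.mono_left nhdsWithin_le_nhds
  have hR : Tendsto (fun s ↦ (s - 1) * ((s - 1) * idealZeta K s) * (C₁ * C₂ * C₃)) (𝓝[>] 1)
      (𝓝 (0 * dedekindZeta_residue K * (C₁ * C₂ * C₃))) :=
    (hlim.mul (tendsto_idealZeta K)).mul_const _
  have hL := (tendsto_idealZeta M).pow 2
  have hle := le_of_tendsto_of_tendsto hL hR (by
    filter_upwards [hC₁, hC₂, hC₃, self_mem_nhdsWithin] with s h1 h2 h3 hs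
    rw [Set.mem_Ioi] at hs
    have h := idealZeta_sq_le (M := M) hrank (χ₁.comp ClassGroup.mk0) (χ₂.comp ClassGroup.mk0)
      (fun I ↦ h₁ _) (fun I ↦ h₂ _) (fun 𝔓 f hf ↦ by
        rw [← map_pow, ← map_pow]
        simp only [MonoidHom.comp_apply]
        exact hn ⟨𝔓.asIdeal, mem_nonZeroDivisors_of_ne_zero 𝔓.ne_bot⟩ _ hf) hs
    have hK : 0 ≤ idealZeta K s := tsum_nonneg fun _ ↦ by positivity
    have h4 : ∀ a b c : ℝ, |a| ≤ C₁ → |b| ≤ C₂ → |c| ≤ C₃ →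
        idealZeta K s * a * b * c ≤ idealZeta K s * (C₁ * C₂ * C₃) := fun a b c ha hb hc ↦ by
      have : a * b * c ≤ C₁ * C₂ * C₃ := by
        refine (le_abs_self _).trans ?_
        rw [abs_mul, abs_mul]
        have := abs_nonneg a
        have := abs_nonneg b
        have := (abs_nonneg a).trans ha
        have := (abs_nonneg b).trans hb
        gcongr
      calc _ = idealZeta K s * (a * b * c) := by ring
        _ ≤ _ := mul_le_mul_of_nonneg_left this hK
    have h5 := h.trans (h4 _ _ _ h1 h2 h3)
    calc ((s - 1) * idealZeta M s) ^ 2 = (s - 1) ^ 2 * idealZeta M s ^ 2 := by ring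
      _ ≤ (s - 1) ^ 2 * (idealZeta K s * (C₁ * C₂ * C₃)) := by gcongr
      _ = _ := by ring)
  rw [zero_mul, zero_mul] at hle
  exact absurd hle (not_le.mpr (pow_pos (dedekindZeta_residue_pos M) 2))

/-- An elementary abelian `2`-group with more than two elements has two independent characters. -/
lemma exists_two_characters {Q : Type*} [CommGroup Q] [Finite Q] (hQ : ∀ q : Q, q ^ 2 = 1)
    (hcard : 2 < Nat.card Q) : ∃ χ₁ χ₂ : Q →* ℝ, (∀ c, χ₁ c = 1 ∨ χ₁ c = -1) ∧
      (∀ c, χ₂ c = 1 ∨ χ₂ c = -1) ∧ χ₁ ≠ 1 ∧ χ₂ ≠ 1 ∧ χ₁ * χ₂ ≠ 1 := by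
  have h2 : HasEnoughRootsOfUnity ℝ 2 :=
    ⟨⟨-1, IsPrimitiveRoot.neg_one 0 (by norm_num)⟩, inferInstance⟩
  have : HasEnoughRootsOfUnity ℝ (Monoid.exponent Q) :=
    HasEnoughRootsOfUnity.of_dvd ℝ (Monoid.exponent_dvd_of_forall_pow_eq_one hQ)
  have hc := CommGroup.card_monoidHom_of_hasEnoughRootsOfUnity Q ℝ
  have hval : ∀ (χ : Q →* ℝˣ) (c : Q), ((Units.coeHom ℝ).comp χ) c = 1 ∨
      ((Units.coeHom ℝ).comp χ) c = -1 := fun χ c ↦ by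
    refine (sq_eq_sq_iff_eq_or_eq_neg.mp ?_ : _ = (1 : ℝ) ∨ _)
    rw [← map_pow, hQ, map_one, one_pow]
  have hinj : Function.Injective fun χ : Q →* ℝˣ ↦ (Units.coeHom ℝ).comp χ := fun χ χ' h ↦
    MonoidHom.ext fun c ↦ Units.ext (DFunLike.congr_fun h c)
  have hfin : Finite (Q →* ℝˣ) := Nat.finite_of_card_ne_zero (by omega)
  obtain ⟨χ₁, h₁⟩ : ∃ χ : Q →* ℝˣ, χ ≠ 1 := by
    by_contra! h
    have : Subsingleton (Q →* ℝˣ) := ⟨fun a b ↦ by rw [h a, h b]⟩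
    have := Finite.card_le_one_iff_subsingleton.mpr this
    omega
  obtain ⟨χ₂, h₂, h₁₂⟩ : ∃ χ : Q →* ℝˣ, χ ≠ 1 ∧ χ ≠ χ₁ := by
    by_contra! h
    have : Nat.card (Q →* ℝˣ) ≤ 2 := by
      have := Fintype.ofFinite (Q →* ℝˣ)
      classical
      rw [Nat.card_eq_fintype_card, ← Finset.card_univ]
      refine (Finset.card_le_card (t := {1, χ₁}) fun χ _ ↦ ?_).trans Finset.card_le_two
      by_cases hχ : χ = 1
      · simp [hχ]
      · simp [h χ hχ]
    omega
  refine ⟨_, _, hval χ₁, hval χ₂, fun h ↦ h₁ (hinj h), fun h ↦ h₂ (hinj h), fun h ↦ h₁₂ ?_⟩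
  have h3 : χ₁ * χ₂ = 1 := hinj h
  have h4 : χ₁ * χ₁ = 1 := MonoidHom.ext fun c ↦ by
    rw [MonoidHom.mul_apply, ← map_mul, ← sq, hQ, map_one, MonoidHom.one_apply]
  exact mul_left_cancel (h3.trans h4.symm)

lemma classLift_key {R G : Type*} [CommRing R] [IsDedekindDomain R] [CommGroup G]
    (f : (Ideal R)⁰ →* G) (hf : ∀ (I : (Ideal R)⁰) x, (I : Ideal R) = Ideal.span {x} → f I = 1)
    {I J : (Ideal R)⁰} (h : ClassGroup.mk0 I = ClassGroup.mk0 J) : f I = f J := by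
  obtain ⟨x, y, hx, hy, hxy⟩ := ClassGroup.mk0_eq_mk0_iff.mp h
  have hx' : Ideal.span {x} ∈ (Ideal R)⁰ :=
    mem_nonZeroDivisors_of_ne_zero (by rwa [ne_eq, Ideal.zero_eq_bot, Ideal.span_singleton_eq_bot])
  have hy' : Ideal.span {y} ∈ (Ideal R)⁰ :=
    mem_nonZeroDivisors_of_ne_zero (by rwa [ne_eq, Ideal.zero_eq_bot, Ideal.span_singleton_eq_bot])
  have := congrArg f (Subtype.ext hxy : (⟨_, hx'⟩ : (Ideal R)⁰) * I = ⟨_, hy'⟩ * J)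
  rwa [map_mul, map_mul, hf ⟨_, hx'⟩ x rfl, hf ⟨_, hy'⟩ y rfl, one_mul, one_mul] at this

/-- A homomorphism on ideals that is trivial on principal ideals factors through the class group. -/
noncomputable def classLift {R G : Type*} [CommRing R] [IsDedekindDomain R] [CommGroup G]
    (f : (Ideal R)⁰ →* G) (hf : ∀ (I : (Ideal R)⁰) x, (I : Ideal R) = Ideal.span {x} → f I = 1) :
    ClassGroup R →* G where
  toFun c := f (ClassGroup.mk0_surjective c).choose
  map_one' := by
    rw [← map_one f]
    exact classLift_key f hf (by rw [(ClassGroup.mk0_surjective _).choose_spec, map_one])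
  map_mul' c d := by
    rw [← map_mul f]
    exact classLift_key f hf (by simp only [map_mul, (ClassGroup.mk0_surjective _).choose_spec])

lemma classLift_mk0 {R G : Type*} [CommRing R] [IsDedekindDomain R] [CommGroup G]
    (f : (Ideal R)⁰ →* G) (hf : ∀ (I : (Ideal R)⁰) x, (I : Ideal R) = Ideal.span {x} → f I = 1)
    (I : (Ideal R)⁰) : classLift f hf (ClassGroup.mk0 I) = f I :=
  classLift_key f hf (ClassGroup.mk0_surjective _).choose_spec

variable (K M) in
/-- The relative norm of nonzero ideals. -/
noncomputable def idealNorm : (Ideal (𝓞 M))⁰ →* (Ideal (𝓞 K))⁰ where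
  toFun I := ⟨Ideal.relNorm (𝓞 K) (I : Ideal (𝓞 M)), mem_nonZeroDivisors_of_ne_zero fun h ↦
    nonZeroDivisors.coe_ne_zero I (Ideal.relNorm_eq_bot_iff.mp h)⟩
  map_one' := Subtype.ext (map_one _)
  map_mul' _ _ := Subtype.ext (map_mul _ _ _)

variable (K M) in
/-- The norm of ideal classes. -/
noncomputable def classNorm : ClassGroup (𝓞 M) →* ClassGroup (𝓞 K) :=
  classLift (ClassGroup.mk0.comp (idealNorm K M)) fun I x hx ↦ by
    rw [MonoidHom.comp_apply, ClassGroup.mk0_eq_one_iff]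
    refine ⟨Algebra.intNorm (𝓞 K) (𝓞 M) x, ?_⟩
    change Ideal.relNorm _ _ = _
    rw [hx, Ideal.relNorm_singleton]

lemma classNorm_mk0 (I : (Ideal (𝓞 M))⁰) :
    classNorm K M (ClassGroup.mk0 I) = ClassGroup.mk0 (idealNorm K M I) :=
  classLift_mk0 _ _ _

lemma classNorm_extended (I : (Ideal (𝓞 K))⁰) (J : (Ideal (𝓞 M))⁰)
    (h : (J : Ideal (𝓞 M)) = (I : Ideal (𝓞 K)).map (algebraMap (𝓞 K) (𝓞 M))) :
    classNorm K M (ClassGroup.mk0 J) = ClassGroup.mk0 I ^ Module.finrank K M := by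
  rw [classNorm_mk0, ← map_pow]
  congr 1
  refine Subtype.ext ?_
  change Ideal.relNorm _ _ = _
  rw [h, Ideal.relNorm_algebraMap, IsFractionRing.finrank_eq (𝓞 K) K (𝓞 M) M]
  rfl

/-- The first inequality: the norms of ideal classes have index at most two. -/
theorem index_range_classNorm_le (hrank : Module.finrank K M = 2) :
    (classNorm K M).range.index ≤ 2 := by
  by_contra! h
  have hQ : ∀ q : ClassGroup (𝓞 K) ⧸ (classNorm K M).range, q ^ 2 = 1 := fun q ↦ by
    obtain ⟨c, rfl⟩ := QuotientGroup.mk'_surjective _ q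
    obtain ⟨I, rfl⟩ := ClassGroup.mk0_surjective c
    rw [← map_pow, QuotientGroup.mk'_apply, QuotientGroup.eq_one_iff, ← hrank]
    exact ⟨_, classNorm_extended I ⟨_, mem_nonZeroDivisors_of_ne_zero fun h ↦
      nonZeroDivisors.coe_ne_zero I ((Ideal.map_eq_bot_iff_of_injective
        (FaithfulSMul.algebraMap_injective _ _)).mp h)⟩ rfl⟩
  obtain ⟨χ₁, χ₂, h₁, h₂, h₁', h₂', h₁₂⟩ := exists_two_characters hQ h
  have hinj : ∀ χ : ClassGroup (𝓞 K) ⧸ (classNorm K M).range →* ℝ,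
      χ.comp (QuotientGroup.mk' _) = 1 → χ = 1 := fun χ hχ ↦ by
    ext c
    exact DFunLike.congr_fun hχ c
  refine not_two_characters hrank (χ₁.comp (QuotientGroup.mk' _)) (χ₂.comp (QuotientGroup.mk' _))
    (fun _ ↦ h₁ _) (fun _ ↦ h₂ _) (fun h ↦ h₁' (hinj _ h)) (fun h ↦ h₂' (hinj _ h))
    (fun h ↦ h₁₂ (hinj _ h)) fun I J hIJ ↦ ?_
  have hJ : QuotientGroup.mk' (classNorm K M).range (ClassGroup.mk0 J) = 1 := by
    rw [QuotientGroup.mk'_apply, QuotientGroup.eq_one_iff]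
    refine ⟨ClassGroup.mk0 I, (classNorm_mk0 I).trans ?_⟩
    congr 1
    exact Subtype.ext hIJ
  simp only [MonoidHom.comp_apply, hJ, map_one, and_self]

end SumProd

namespace SumProd

open Pointwise

/-- The action of a group on a ring is unramified (Chase–Harrison–Rosenberg). -/
def Unr (G S : Type*) [Group G] [CommRing S] [MulSemiringAction G S] : Prop :=
  ∃ (n : ℕ) (a b : Fin n → S), ∀ g : G, (g = 1 → ∑ i, a i * g • b i = 1) ∧
    (g ≠ 1 → ∑ i, a i * g • b i = 0)

section

variable {G S : Type*} [Group G] [CommRing S] [MulSemiringAction G S]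

lemma Unr.subgroup (h : Unr G S) (H : Subgroup G) : Unr H S := by
  obtain ⟨n, a, b, hab⟩ := h
  exact ⟨n, a, b, fun g ↦ ⟨fun hg ↦ (hab g).1 (by simp [hg]), fun hg ↦ (hab g).2 (by simpa using hg)⟩⟩

lemma Unr.sum_eq [Fintype G] {n : ℕ} {a b : Fin n → S} 
    (hab : ∀ g : G, (g = 1 → ∑ i, a i * g • b i = 1) ∧ (g ≠ 1 → ∑ i, a i * g • b i = 0))
    (f : G → S) : ∑ i, a i * ∑ g, f g * g • b i = f 1 := by
  classical
  have h1 : ∀ g : G, ∑ i, a i * (f g * g • b i) = if g = 1 then f 1 else 0 := fun g ↦ by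
    have : ∑ i, a i * (f g * g • b i) = f g * ∑ i, a i * g • b i := by
      rw [Finset.mul_sum]
      exact Finset.sum_congr rfl fun i _ ↦ by ring
    rw [this]
    split_ifs with hg
    · rw [(hab g).1 hg, hg, mul_one]
    · rw [(hab g).2 hg, mul_zero]
  simp only [Finset.mul_sum]
  rw [Finset.sum_comm, Finset.sum_congr rfl fun g _ ↦ h1 g]
  simp

lemma smul_sum_smul [Fintype G] (g : G) (x : S) : g • ∑ h : G, h • x = ∑ h : G, h • x := by
  rw [Finset.smul_sum]
  simp only [smul_smul]
  exact Fintype.sum_equiv (Equiv.mulLeft g) _ _ fun _ ↦ rfl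

variable {R : Type*} [CommRing R] [Algebra R S]

/-- Invariant ideals are extended from the ring of invariants. -/
lemma Unr.map_comap_eq [Finite G] [Algebra.IsInvariant R S G] (h : Unr G S) {J : Ideal S}
    (hJ : ∀ g : G, g • J = J) : (J.comap (algebraMap R S)).map (algebraMap R S) = J := by
  refine le_antisymm Ideal.map_comap_le fun x hx ↦ ?_
  have := Fintype.ofFinite G
  obtain ⟨n, a, b, hab⟩ := h
  have hx1 := Unr.sum_eq hab fun g ↦ g • x
  rw [one_smul] at hx1
  rw [← hx1]
  refine Ideal.sum_mem _ fun i _ ↦ Ideal.mul_mem_left _ _ ?_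
  simp only [← smul_mul']
  obtain ⟨r, hr⟩ := Algebra.IsInvariant.isInvariant (A := R) (∑ g : G, g • (x * b i))
    fun g ↦ smul_sum_smul g _
  rw [← hr]
  refine Ideal.mem_map_of_mem _ (Ideal.mem_comap.mpr ?_)
  rw [hr]
  refine Ideal.sum_mem _ fun g _ ↦ ?_
  rw [← hJ g]
  exact Ideal.smul_mem_pointwise_smul _ _ _ (Ideal.mul_mem_right _ _ hx)

/-- The trace of an unramified action is onto. -/
lemma Unr.exists_trace_eq_one [Fintype G] [Algebra.IsInvariant R S G] [SMulCommClass G R S]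
    (hinj : Function.Injective (algebraMap R S)) (h : Unr G S) : ∃ t : S, ∑ g : G, g • t = 1 := by
  obtain ⟨n, a, b, hab⟩ := h
  have h1 := Unr.sum_eq hab fun _ ↦ 1
  simp only [one_mul] at h1
  let I : Ideal R :=
    { carrier := {r | ∃ t : S, ∑ g : G, g • t = algebraMap R S r}
      zero_mem' := ⟨0, by simp⟩
      add_mem' := fun {x y} ⟨t, ht⟩ ⟨u, hu⟩ ↦ ⟨t + u, by
        simp only [smul_add, Finset.sum_add_distrib, ht, hu, map_add]⟩
      smul_mem' := fun c {x} ⟨t, ht⟩ ↦ ⟨algebraMap R S c * t, by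
        simp only [smul_mul', smul_algebraMap, ← Finset.mul_sum, ht, smul_eq_mul, map_mul]⟩ }
  have hI : I.map (algebraMap R S) = ⊤ := by
    rw [Ideal.eq_top_iff_one, ← h1]
    refine Ideal.sum_mem _ fun i _ ↦ Ideal.mul_mem_left _ _ ?_
    obtain ⟨r, hr⟩ := Algebra.IsInvariant.isInvariant (A := R) (∑ g : G, g • b i)
      fun g ↦ smul_sum_smul g _
    rw [← hr]
    exact Ideal.mem_map_of_mem _ ⟨b i, hr.symm⟩
  have := Algebra.IsInvariant.isIntegral R S G
  rw [Ideal.map_eq_top_iff _ hinj (algebraMap_isIntegral_iff.mpr this)] at hI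
  obtain ⟨t, ht⟩ : (1 : R) ∈ I := hI ▸ Submodule.mem_top
  exact ⟨t, by rw [ht, map_one]⟩

/-- An unramified action descends to the ring of invariants of a subgroup. -/
lemma Unr.descend {Q : Type*} [Group Q] [MulSemiringAction Q R] [Finite G] {H : Subgroup G}
    [Algebra.IsInvariant R S H] [SMulCommClass H R S]
    (hinj : Function.Injective (algebraMap R S)) (h : Unr G S) (φ : G → Q)
    (hφ : Function.Surjective φ) (hH : ∀ g ∈ H, φ g = 1)
    (hact : ∀ g r, algebraMap R S (φ g • r) = g • algebraMap R S r) : Unr Q R := by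
  classical
  have := Fintype.ofFinite G
  obtain ⟨t, ht⟩ := (h.subgroup H).exists_trace_eq_one hinj
  obtain ⟨n, a, b, hab⟩ := h
  have hinv : ∀ x : S, ∃ r : R, algebraMap R S r = ∑ g : H, g • x := fun x ↦
    Algebra.IsInvariant.isInvariant (A := R) (G := H) _ fun g ↦ smul_sum_smul g _
  choose T hT using hinv
  have key : ∀ g : G, algebraMap R S (∑ i, T (t * a i) * φ g • T (b i)) =
      ∑ τ : H, ∑ ρ : H, τ • t * τ • ∑ i, a i * ((τ : G)⁻¹ * g * ρ) • b i := fun g ↦ by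
    simp only [map_sum, map_mul, hact, hT]
    have h1 : ∀ i, (∑ τ : H, τ • (t * a i)) * g • ∑ ρ : H, ρ • b i =
        ∑ τ : H, ∑ ρ : H, τ • (t * a i) * g • ρ • b i := fun i ↦ by
      rw [Finset.smul_sum, Finset.sum_mul_sum]
    rw [Finset.sum_congr rfl fun i _ ↦ h1 i, Finset.sum_comm]
    refine Finset.sum_congr rfl fun τ _ ↦ ?_
    rw [Finset.sum_comm]
    refine Finset.sum_congr rfl fun ρ _ ↦ ?_
    rw [Finset.smul_sum, Finset.mul_sum]
    refine Finset.sum_congr rfl fun i _ ↦ ?_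
    simp only [smul_mul', Subgroup.smul_def, smul_smul, mul_assoc, mul_inv_cancel_left]
  have hone : algebraMap R S (∑ i, T (t * a i) * (1 : Q) • T (b i)) = 1 := by
    rw [← hH 1 H.one_mem, key, ← ht]
    refine Finset.sum_congr rfl fun τ _ ↦ ?_
    rw [Finset.sum_eq_single τ, (hab _).1 (by simp), smul_one, mul_one]
    · intro ρ _ hρ
      rw [(hab _).2, smul_zero, mul_zero]
      rw [mul_one, ne_eq, inv_mul_eq_one]
      exact fun h ↦ hρ (Subtype.ext h.symm)
    · simp
  refine ⟨n, fun i ↦ T (t * a i), fun i ↦ T (b i), fun q ↦ ⟨fun hq ↦ ?_, fun hq ↦ ?_⟩⟩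
  · rw [hq]
    exact hinj (by rw [hone, map_one])
  · obtain ⟨g, rfl⟩ := hφ q
    refine hinj ?_
    rw [key, map_zero]
    refine Finset.sum_eq_zero fun τ _ ↦ Finset.sum_eq_zero fun ρ _ ↦ ?_
    rw [(hab _).2, smul_zero, mul_zero]
    intro h1
    have : g = τ * (ρ : G)⁻¹ := by
      rw [mul_assoc, inv_mul_eq_one] at h1
      rw [h1, mul_inv_cancel_right]
    exact hq (hH g (this ▸ H.mul_mem τ.2 (H.inv_mem ρ.2)))

/-- Unramified actions compose in towers. -/
lemma Unr.tower {H Q : Type*} [Group H] [MulSemiringAction H S] [Group Q] [MulSemiringAction Q R]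
    (hH : Unr H S) (hQ : Unr Q R) (φ : G → Q)
    (hact : ∀ g r, algebraMap R S (φ g • r) = g • algebraMap R S r)
    (hφ : ∀ g, φ g = 1 → ∃ h : H, (∀ s : S, h • s = g • s) ∧ (g = 1 → h = 1) ∧ (h = 1 → g = 1))
    (hφ1 : φ 1 = 1) : Unr G S := by
  obtain ⟨n, a, b, hab⟩ := hH
  obtain ⟨m, c, d, hcd⟩ := hQ
  have key : ∀ g : G, ∑ p : Fin n × Fin m, (a p.1 * algebraMap R S (c p.2)) *
      g • (b p.1 * algebraMap R S (d p.2)) =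
      (∑ i, a i * g • b i) * algebraMap R S (∑ j, c j * φ g • d j) := fun g ↦ by
    simp only [map_sum, map_mul, hact, Finset.sum_mul_sum, Fintype.sum_prod_type, smul_mul']
    exact Finset.sum_congr rfl fun i _ ↦ Finset.sum_congr rfl fun j _ ↦ by ring
  refine ⟨n * m, fun p ↦ a (finProdFinEquiv.symm p).1 * algebraMap R S (c (finProdFinEquiv.symm p).2),
    fun p ↦ b (finProdFinEquiv.symm p).1 * algebraMap R S (d (finProdFinEquiv.symm p).2), fun g ↦ ?_⟩
  rw [Equiv.sum_comp finProdFinEquiv.symm fun p : Fin n × Fin m ↦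
    (a p.1 * algebraMap R S (c p.2)) * g • (b p.1 * algebraMap R S (d p.2)), key]
  refine ⟨fun hg ↦ ?_, fun hg ↦ ?_⟩
  · obtain ⟨h, hs, h1, -⟩ := hφ g (hg ▸ hφ1)
    rw [(hcd _).1 (hg ▸ hφ1), map_one, mul_one]
    simp only [← hs]
    exact (hab h).1 (h1 hg)
  · by_cases hq : φ g = 1
    · obtain ⟨h, hs, -, h1⟩ := hφ g hq
      simp only [← hs]
      rw [(hab h).2 (mt h1 hg), zero_mul]
    · rw [(hcd _).2 hq, map_zero, mul_zero]

/-- A crossed homomorphism of an unramified action is, up to a factor from the ring, a coboundary: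
Hilbert's theorem 90. -/
lemma Unr.exists_sum_ne_zero [Fintype G] (h : Unr G S) {L : Type*} [CommRing L] [Algebra S L]
    [MulSemiringAction G L] (hact : ∀ (g : G) (s : S), algebraMap S L (g • s) = g • algebraMap S L s)
    (f : G → L) (hf : f 1 ≠ 0) : ∃ s : S, ∑ g, f g * g • algebraMap S L s ≠ 0 := by
  obtain ⟨n, a, b, hab⟩ := h
  by_contra! h0
  have h1 : ∀ g : G, ∑ i, algebraMap S L (a i) * (f g * g • algebraMap S L (b i)) =
      f g * algebraMap S L (∑ i, a i * g • b i) := fun g ↦ by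
    rw [map_sum, Finset.mul_sum]
    exact Finset.sum_congr rfl fun i _ ↦ by rw [map_mul, hact]; ring
  have h2 : ∑ i, algebraMap S L (a i) * ∑ g, f g * g • algebraMap S L (b i) = f 1 := by
    simp only [Finset.mul_sum]
    rw [Finset.sum_comm, Finset.sum_congr rfl fun g _ ↦ h1 g, Finset.sum_eq_single 1]
    · rw [(hab 1).1 rfl, map_one, mul_one]
    · intro g _ hg
      rw [(hab g).2 hg, map_zero, mul_zero]
    · simp
  refine hf ?_
  rw [← h2]
  exact Finset.sum_eq_zero fun i _ ↦ by rw [h0, mul_zero]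

end

end SumProd

namespace SumProd

section Group

variable {A : Type*} [CommGroup A]

lemma relIndex_map_of_ker_le {B : Type*} [CommGroup B] (f : A →* B) {H K : Subgroup A}
    (h : f.ker ≤ H) : (H.map f).relIndex (K.map f) = H.relIndex K := by
  rw [Subgroup.relIndex_map_map, sup_eq_left.mpr h, ← Subgroup.relIndex_sup_right (H := K ⊔ f.ker),
    sup_assoc, sup_eq_right.mpr h, Subgroup.relIndex_sup_right]

/-- The Herbrand quotient of an involution on a group like the units of a totally real field. -/
theorem herbrand (σ : A →* A) (hσ : ∀ a, σ (σ a) = a) {z : A} (hz : z ^ 2 = 1) (hz1 : z ≠ 1)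
    (hσz : σ z = z) (htors : ∀ a : A, a ^ 2 = 1 → a = 1 ∨ a = z) (hsq : ∀ a : A, a ^ 2 ≠ z)
    (P M D N : Subgroup A) (hP : ∀ a, a ∈ P ↔ σ a = a) (hM : ∀ a, a ∈ M ↔ a * σ a = 1)
    (hD : ∀ a, a ∈ D ↔ ∃ b, a = b / σ b) (hN : ∀ a, a ∈ N ↔ ∃ b, a = b * σ b) {n : ℕ}
    (hfin : (powMonoidHom 2 : A →* A).range.index = 2 ^ (2 * n))
    (hfinP : (P.map (powMonoidHom 2)).relIndex P = 2 ^ n) :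
    D.relIndex M = 2 * N.relIndex P := by
  set q2 : A →* A := powMonoidHom 2 with hsqdef
  have hsqker : ∀ a, a ∈ q2.ker ↔ a = 1 ∨ a = z := fun a ↦ by
    rw [MonoidHom.mem_ker, hsqdef, powMonoidHom_apply]
    exact ⟨htors a, by rintro (rfl | rfl) <;> simp [hz]⟩
  have hzP : z ∈ P := (hP z).mpr hσz
  have hzM : z ∈ M := (hM z).mpr (by rw [hσz, ← sq, hz])
  let δ : A →* A := MonoidHom.id A / σ
  let ν : A →* A := MonoidHom.id A * σ
  have hDr : D = (⊤ : Subgroup A).map δ := by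
    ext a
    rw [hD, Subgroup.mem_map]
    exact ⟨fun ⟨b, h⟩ ↦ ⟨b, trivial, h.symm⟩, fun ⟨b, _, h⟩ ↦ ⟨b, h.symm⟩⟩
  have hNr : N = (⊤ : Subgroup A).map ν := by
    ext a
    rw [hN, Subgroup.mem_map]
    exact ⟨fun ⟨b, h⟩ ↦ ⟨b, trivial, h.symm⟩, fun ⟨b, _, h⟩ ↦ ⟨b, h.symm⟩⟩
  have hδP : ∀ a, a ∈ δ.ker ↔ a ∈ P := fun a ↦ by
    rw [MonoidHom.mem_ker, hP]
    exact div_eq_one.trans eq_comm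
  have hνM : ∀ a, a ∈ ν.ker ↔ a ∈ M := fun a ↦ by rw [MonoidHom.mem_ker, hM]; rfl
  have hδM : M.map q2 = (P ⊔ M).map δ := by
    rw [Subgroup.map_sup, (Subgroup.map_eq_bot_iff _).mpr fun a ha ↦ (hδP a).mpr ha, bot_sup_eq]
    have : ∀ a ∈ M, q2 a = δ a := fun a ha ↦ by
      change a ^ 2 = a / σ a
      rw [eq_div_iff_mul_eq', sq, mul_right_comm, (hM a).mp ha, one_mul]
    ext a
    simp only [Subgroup.mem_map]
    exact ⟨fun ⟨b, hb, h⟩ ↦ ⟨b, hb, by rw [← this b hb, h]⟩,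
      fun ⟨b, hb, h⟩ ↦ ⟨b, hb, by rw [this b hb, h]⟩⟩
  have hνP : P.map q2 = (P ⊔ M).map ν := by
    rw [Subgroup.map_sup, (Subgroup.map_eq_bot_iff M).mpr fun a ha ↦ (hνM a).mpr ha, sup_bot_eq]
    have : ∀ a ∈ P, q2 a = ν a := fun a ha ↦ by
      change a ^ 2 = a * σ a
      rw [(hP a).mp ha, sq]
    ext a
    simp only [Subgroup.mem_map]
    exact ⟨fun ⟨b, hb, h⟩ ↦ ⟨b, hb, by rw [← this b hb, h]⟩,
      fun ⟨b, hb, h⟩ ↦ ⟨b, hb, by rw [this b hb, h]⟩⟩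
  have hkδ : δ.ker ≤ P ⊔ M := fun a ha ↦ Subgroup.mem_sup_left ((hδP a).mp ha)
  have hkν : ν.ker ≤ P ⊔ M := fun a ha ↦ Subgroup.mem_sup_right ((hνM a).mp ha)
  have hks : q2.ker ≤ P ⊔ M := fun a ha ↦ Subgroup.mem_sup_left (by
    rcases (hsqker a).mp ha with rfl | rfl
    exacts [P.one_mem, hzP])
  have hDM : D ≤ M := fun a ha ↦ by
    obtain ⟨b, rfl⟩ := (hD a).mp ha
    rw [hM, map_div, hσ, div_mul_div_cancel, div_self']
  have hNP : N ≤ P := fun a ha ↦ by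
    obtain ⟨b, rfl⟩ := (hN a).mp ha
    rw [hP, map_mul, hσ, mul_comm]
  have e1 : (P ⊔ M).index * D.relIndex M = (M.map q2).relIndex M := by
    rw [← Subgroup.relIndex_mul_relIndex (M.map q2) D M (by
      rw [hδM, hDr]; exact Subgroup.map_mono le_top) hDM, hδM, hDr, relIndex_map_of_ker_le δ hkδ,
      Subgroup.relIndex_top_right]
  have e2 : (P ⊔ M).index * N.relIndex P = (P.map q2).relIndex P := by
    rw [← Subgroup.relIndex_mul_relIndex (P.map q2) N P (by
      rw [hνP, hNr]; exact Subgroup.map_mono le_top) hNP, hνP, hNr, relIndex_map_of_ker_le ν hkν,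
      Subgroup.relIndex_top_right]
  have hc : (P ⊔ M).index ≠ 0 := by
    intro h
    rw [h, zero_mul, hfinP] at e2
    exact absurd e2.symm (by positivity)
  have e3 : ((P ⊔ M).map q2).relIndex (P ⊔ M) = 2 ^ (2 * n) := by
    have h1 : ((P ⊔ M).map q2).relIndex ((⊤ : Subgroup A).map q2) = (P ⊔ M).index := by
      rw [relIndex_map_of_ker_le q2 hks, Subgroup.relIndex_top_right]
    rw [← MonoidHom.range_eq_map] at h1
    have h2 := Subgroup.relIndex_mul_index (H := (P ⊔ M).map q2) (K := q2.range)
      (MonoidHom.range_eq_map q2 ▸ Subgroup.map_mono le_top)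
    have h3 := Subgroup.relIndex_mul_index (H := (P ⊔ M).map q2) (K := P ⊔ M) (by
      rintro _ ⟨a, ha, rfl⟩
      exact Subgroup.pow_mem _ ha 2)
    rw [h1, hfin, ← h3, mul_comm] at h2
    exact (Nat.eq_of_mul_eq_mul_right (Nat.pos_of_ne_zero hc) h2).symm
  have hPM : ∀ a, a ∈ P → a ∈ M → a = 1 ∨ a = z := fun a h1 h2 ↦ htors a (by
    rw [hM, (hP a).mp h1, ← sq] at h2
    exact h2)
  have e4 : ((P ⊔ M).map q2).relIndex (P ⊔ M) * 2 =
      (P.map q2).relIndex P * (M.map q2).relIndex M := by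
    have hM2 : M.map q2 ≤ M := by
      rintro _ ⟨a, ha, rfl⟩
      exact M.pow_mem ha 2
    have hP2 : P.map q2 ≤ P := by
      rintro _ ⟨a, ha, rfl⟩
      exact P.pow_mem ha 2
    have hz2 : z ∉ M.map q2 := by
      rintro ⟨a, -, h⟩
      exact hsq a h
    have h1 : (P ⊔ M.map q2) ⊔ M = P ⊔ M := by
      rw [sup_assoc, sup_eq_right.mpr hM2]
    have h2 : (P ⊔ M.map q2).relIndex (P ⊔ M) = (P ⊔ M.map q2).relIndex M := by
      rw [← h1, Subgroup.relIndex_sup_left]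
    have h3 : (P ⊔ M.map q2) ⊓ M = M.map q2 ⊔ Subgroup.zpowers z := by
      refine le_antisymm (fun a ha ↦ ?_) (le_inf (sup_le le_sup_right ?_) (sup_le hM2 ?_))
      · obtain ⟨h, h'⟩ := Subgroup.mem_inf.mp ha
        obtain ⟨b, hb, c, hc, rfl⟩ := Subgroup.mem_sup.mp h
        rw [mul_comm]
        refine Subgroup.mul_mem_sup hc ?_
        rcases hPM b hb (by simpa using M.mul_mem h' (M.inv_mem (hM2 hc))) with rfl | rfl
        exacts [one_mem _, Subgroup.mem_zpowers _]
      · exact (Subgroup.zpowers_le_of_mem hzP).trans le_sup_left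
      · exact Subgroup.zpowers_le_of_mem hzM
    have h4 : (M.map q2).relIndex (M.map q2 ⊔ Subgroup.zpowers z) = 2 := by
      rw [Subgroup.relIndex_sup_left, ← Subgroup.inf_relIndex_right, (_ : _ ⊓ _ = ⊥),
        Subgroup.relIndex_bot_left, Nat.card_zpowers, orderOf_eq_prime hz hz1]
      refine eq_bot_iff.mpr fun a ha ↦ ?_
      obtain ⟨h, h'⟩ := Subgroup.mem_inf.mp ha
      rcases hPM a (Subgroup.zpowers_le_of_mem hzP h') (hM2 h) with rfl | rfl
      exacts [one_mem _, absurd h hz2]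
    have h5 : (P.map q2 ⊔ M.map q2) ⊔ P = P ⊔ M.map q2 := by
      rw [sup_right_comm, sup_eq_right.mpr hP2]
    have h6 : (P.map q2 ⊔ M.map q2) ⊓ P = P.map q2 := by
      refine le_antisymm (fun a ha ↦ ?_) (le_inf le_sup_left hP2)
      obtain ⟨h, h'⟩ := Subgroup.mem_inf.mp ha
      obtain ⟨b, hb, c, hc, rfl⟩ := Subgroup.mem_sup.mp h
      rcases hPM c (by simpa using P.mul_mem (P.inv_mem (hP2 hb)) h') (hM2 hc) with rfl | rfl
      exacts [by simpa using hb, absurd hc hz2]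
    have h7 : (P.map q2 ⊔ M.map q2).relIndex (P ⊔ M.map q2) = (P.map q2).relIndex P := by
      rw [← h5, Subgroup.relIndex_sup_left, ← Subgroup.inf_relIndex_right, h6]
    have h8 : (M.map q2).relIndex M = 2 * (P ⊔ M.map q2).relIndex M := by
      rw [← h4, ← Subgroup.inf_relIndex_right (P ⊔ M.map q2) M, h3]
      refine (Subgroup.relIndex_mul_relIndex _ _ _ le_sup_left (h3 ▸ inf_le_right)).symm
    rw [h8, Subgroup.map_sup, ← h7, ← h2, ← Subgroup.relIndex_mul_relIndex
      (P.map q2 ⊔ M.map q2) (P ⊔ M.map q2) (P ⊔ M) (h5 ▸ le_sup_left) (h1 ▸ le_sup_left)]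
    ring
  rw [e3, hfinP, ← e1] at e4
  rw [hfinP] at e2
  have h5 : 2 ^ n * ((P ⊔ M).index * D.relIndex M) = 2 ^ n * ((P ⊔ M).index * (2 * N.relIndex P)) := by
    calc _ = 2 ^ (2 * n) * 2 := e4.symm
      _ = 2 ^ n * (2 * ((P ⊔ M).index * N.relIndex P)) := by rw [e2]; ring
      _ = _ := by ring
  exact Nat.eq_of_mul_eq_mul_left (Nat.pos_of_ne_zero hc)
    (Nat.eq_of_mul_eq_mul_left (by positivity) h5)

end Group

end SumProd

namespace SumProd

open NumberField

/-- The exponent map of a product of a `2`-torsion group and a free abelian group. -/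
lemma index_sq_of_equiv {A T : Type*} [CommGroup A] [CommGroup T] (hT : ∀ t : T, t ^ 2 = 1) {r : ℕ}
    (e : A ≃* T × (Fin r → Multiplicative ℤ)) :
    (powMonoidHom 2 : A →* A).range.index = Nat.card T * 2 ^ r := by
  let m : Multiplicative ℤ →* Multiplicative (ZMod 2) :=
    AddMonoidHom.toMultiplicative (Int.castAddHom (ZMod 2))
  let ψ : A →* T × (Fin r → Multiplicative (ZMod 2)) :=
    ((MonoidHom.id T).prodMap (MonoidHom.pi fun i ↦ m.comp (Pi.evalMonoidHom _ i))).comp e.toMonoidHom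
  have hψ : Function.Surjective ψ := by
    have hm : Function.Surjective m := fun x ↦ by
      obtain ⟨n, hn⟩ := ZMod.intCast_surjective x.toAdd
      exact ⟨Multiplicative.ofAdd n, congrArg Multiplicative.ofAdd hn⟩
    rintro ⟨t, f⟩
    choose g hg using fun i ↦ hm (f i)
    refine ⟨e.symm (t, g), ?_⟩
    change (_, _) = (_, _)
    simp only [MulEquiv.toMonoidHom_eq_coe, MonoidHom.coe_coe, MulEquiv.apply_symm_apply]
    exact Prod.ext rfl (funext hg)
  have hker : (powMonoidHom 2 : A →* A).range = ψ.ker := by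
    have hm : ∀ x : Multiplicative ℤ, m x = 1 ↔ ∃ y, y ^ 2 = x := fun x ↦ by
      change ((x.toAdd : ℤ) : ZMod 2) = 0 ↔ _
      rw [ZMod.intCast_zmod_eq_zero_iff_dvd]
      constructor
      · rintro ⟨k, hk⟩
        refine ⟨Multiplicative.ofAdd k, Multiplicative.toAdd.injective ?_⟩
        rw [toAdd_pow, hk, toAdd_ofAdd]
        simp
      · rintro ⟨y, rfl⟩
        exact ⟨y.toAdd, by rw [toAdd_pow]; simp⟩
    ext a
    rw [MonoidHom.mem_range, MonoidHom.mem_ker]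
    constructor
    · rintro ⟨b, rfl⟩
      rw [powMonoidHom_apply, map_pow]
      refine Prod.ext (hT _) (funext fun i ↦ ?_)
      exact (map_pow m _ 2).symm.trans ((hm _).mpr ⟨_, rfl⟩)
    · intro h
      have h1 : (e a).1 = 1 := congrArg Prod.fst h
      have h2 : ∀ i, m ((e a).2 i) = 1 := fun i ↦ congrFun (congrArg Prod.snd h) i
      choose g hg using fun i ↦ (hm _).mp (h2 i)
      refine ⟨e.symm (1, g), e.injective ?_⟩
      rw [powMonoidHom_apply, map_pow, e.apply_symm_apply]
      exact Prod.ext (by rw [h1]; exact one_pow 2) (funext hg)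
  rw [hker, Subgroup.index_ker, MonoidHom.range_eq_top.mpr hψ, Subgroup.card_top, Nat.card_prod,
    Nat.card_fun]
  simp [Nat.card_eq_fintype_card]

variable (F : Type*) [Field F] [NumberField F]

/-- Dirichlet's unit theorem as an isomorphism. -/
noncomputable def unitsMulEquiv :
    (𝓞 F)ˣ ≃* Units.torsion F × (Fin (Units.rank F) → Multiplicative ℤ) :=
  let f : Units.torsion F × (Fin (Units.rank F) → Multiplicative ℤ) →* (𝓞 F)ˣ :=
    { toFun p := p.1 * ∏ i, Units.fundSystem F i ^ (p.2 i).toAdd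
      map_one' := by simp
      map_mul' p q := by
        simp only [Prod.fst_mul, Prod.snd_mul, Pi.mul_apply, toAdd_mul, zpow_add,
          Finset.prod_mul_distrib, Subgroup.coe_mul]
        exact mul_mul_mul_comm _ _ _ _ }
  (MulEquiv.ofBijective f ⟨fun p q h ↦ (Units.exist_unique_eq_mul_prod F (f p)).unique
    (y₁ := p) (y₂ := q) rfl h, fun x ↦
      let ⟨p, hp, _⟩ := Units.exist_unique_eq_mul_prod F x
      ⟨p, hp.symm⟩⟩).symm

lemma neg_one_ne_one_units : (-1 : (𝓞 F)ˣ) ≠ 1 := fun h ↦ by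
  have := congrArg (fun u : (𝓞 F)ˣ ↦ ((u : 𝓞 F) : F)) h
  simp only [Units.val_neg, Units.val_one, map_neg, map_one] at this
  exact absurd this (by norm_num)

variable [IsTotallyReal F]

lemma mem_torsion_iff (x : (𝓞 F)ˣ) : x ∈ Units.torsion F ↔ x = 1 ∨ x = -1 := by
  constructor
  · intro h
    obtain ⟨w⟩ : Nonempty (InfinitePlace F) := inferInstance
    have h1 := (Units.mem_torsion F).mp h w
    have hw := IsTotallyReal.isReal w
    have h2 : |InfinitePlace.embedding_of_isReal hw x| = 1 := by
      rw [← Real.norm_eq_abs, InfinitePlace.norm_embedding_of_isReal, ← h1]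
    have h3 : ((x : 𝓞 F) : F) = 1 ∨ ((x : 𝓞 F) : F) = -1 := by
      rcases eq_or_eq_neg_of_abs_eq h2 with h | h
      · exact Or.inl ((InfinitePlace.embedding_of_isReal hw).injective (by rw [h, map_one]))
      · exact Or.inr ((InfinitePlace.embedding_of_isReal hw).injective (by rw [h, map_neg, map_one]))
    exact h3.imp (fun h ↦ Units.ext (RingOfIntegers.ext h)) fun h ↦
      Units.ext (RingOfIntegers.ext (by rw [h]; simp))
  · rintro (rfl | rfl)
    · exact one_mem _
    · rw [Units.torsion, CommGroup.mem_torsion, isOfFinOrder_iff_pow_eq_one]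
      exact ⟨2, by norm_num, by simp⟩

lemma unit_sq_eq_one {x : (𝓞 F)ˣ} (h : x ^ 2 = 1) : x = 1 ∨ x = -1 :=
  (mem_torsion_iff F x).mp ((CommGroup.mem_torsion _).mpr
    (isOfFinOrder_iff_pow_eq_one.mpr ⟨2, by norm_num, h⟩))

lemma index_sq_units :
    (powMonoidHom 2 : (𝓞 F)ˣ →* (𝓞 F)ˣ).range.index = 2 ^ Module.finrank ℚ F := by
  have hT : ∀ t : Units.torsion F, t ^ 2 = 1 := fun t ↦ Subtype.ext (by
    rcases (mem_torsion_iff F _).mp t.2 with h | h <;> simp [h])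
  rw [index_sq_of_equiv hT (unitsMulEquiv F)]
  have hc : Nat.card (Units.torsion F) = 2 := by
    rw [show Units.torsion F = Subgroup.zpowers (-1) from ?_, Nat.card_zpowers]
    · have := Fact.mk Nat.prime_two
      exact orderOf_eq_prime (by simp) (neg_one_ne_one_units F)
    refine le_antisymm (fun x hx ↦ ?_) (Subgroup.zpowers_le_of_mem ((mem_torsion_iff F _).mpr
      (Or.inr rfl)))
    rcases (mem_torsion_iff F x).mp hx with rfl | rfl
    exacts [one_mem _, Subgroup.mem_zpowers _]
  have hr : Units.rank F + 1 = Module.finrank ℚ F := by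
    rw [Units.rank, IsTotallyReal.finrank, Nat.sub_add_cancel Fintype.card_pos,
      InfinitePlace.card_eq_nrRealPlaces_add_nrComplexPlaces,
      IsTotallyReal.nrComplexPlaces_eq_zero, add_zero]
  rw [hc, ← hr, pow_succ']

end SumProd

namespace SumProd

open Pointwise nonZeroDivisors

section Group

/-- A map that is injective modulo subgroups bounds relative indices. -/
lemma relIndex_le_of_map {A B : Type*} [CommGroup A] [CommGroup B] {D M : Subgroup A}
    {N Q : Subgroup B} (hN : N.relIndex Q ≠ 0) (f : A → B) (hf : ∀ a ∈ M, f a ∈ Q)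
    (hfD : ∀ a ∈ M, ∀ b ∈ M, f a / f b ∈ N → a / b ∈ D) :
    D.relIndex M ≠ 0 ∧ D.relIndex M ≤ N.relIndex Q := by
  have : Finite (Q ⧸ N.subgroupOf Q) := Nat.finite_of_card_ne_zero hN
  let g : M ⧸ D.subgroupOf M → Q ⧸ N.subgroupOf Q := fun c ↦
    QuotientGroup.mk (⟨f c.out, hf _ c.out.2⟩ : Q)
  have hg : Function.Injective g := fun c d h ↦ by
    rw [← c.out_eq, ← d.out_eq]
    rw [QuotientGroup.eq, Subgroup.mem_subgroupOf] at h
    refine QuotientGroup.eq.mpr ?_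
    rw [Subgroup.mem_subgroupOf]
    have h1 := hfD _ d.out.2 _ c.out.2 (by
      rw [div_eq_inv_mul]; exact h)
    rw [div_eq_inv_mul] at h1
    exact h1
  have := Finite.of_injective g hg
  exact ⟨Nat.card_pos.ne', Nat.card_le_card_of_injective g hg⟩

lemma card_ker_mul_card_range {A B : Type*} [CommGroup A] [CommGroup B] (f : A →* B) :
    Nat.card f.ker * Nat.card f.range = Nat.card A := by
  rw [← Subgroup.index_ker, Subgroup.card_mul_index]

end Group

section Ring

variable {R S G : Type*} [CommRing R] [IsDedekindDomain R] [CommRing S] [IsDedekindDomain S]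
  [Algebra R S] [FaithfulSMul R S] [Group G] [MulSemiringAction G S] [Algebra.IsInvariant R S G]

lemma smul_span_singleton (g : G) (x : S) : g • Ideal.span {x} = Ideal.span {g • x} := by
  rw [Ideal.smul_closure, Set.smul_set_singleton]

lemma smul_ideal_ne_zero (g : G) {I : Ideal S} (hI : I ∈ (Ideal S)⁰) : g • I ∈ (Ideal S)⁰ := by
  rw [mem_nonZeroDivisors_iff_ne_zero] at hI ⊢
  exact fun h ↦ hI ((smul_eq_zero_iff_eq g).mp h)

/-- The action on nonzero ideals. -/
def smulIdeal (g : G) : (Ideal S)⁰ →* (Ideal S)⁰ where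
  toFun I := ⟨g • (I : Ideal S), smul_ideal_ne_zero g I.2⟩
  map_one' := Subtype.ext (smul_one g)
  map_mul' _ _ := Subtype.ext (smul_mul' g _ _)

variable (S) in
/-- The action on ideal classes. -/
noncomputable def smulClass (g : G) : ClassGroup S →* ClassGroup S :=
  classLift (ClassGroup.mk0.comp (smulIdeal g)) fun I x hx ↦ by
    rw [MonoidHom.comp_apply, ClassGroup.mk0_eq_one_iff]
    refine ⟨g • x, ?_⟩
    change g • (I : Ideal S) = _
    rw [hx, smul_span_singleton]

lemma smulClass_mk0 (g : G) (I : (Ideal S)⁰) :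
    smulClass S g (ClassGroup.mk0 I) = ClassGroup.mk0 (smulIdeal g I) :=
  classLift_mk0 _ _ _

/-- Stable nonzero ideals are extended from the fixed ring. -/
lemma exists_mk0_extended [Finite G] (h : Unr G S) {J : (Ideal S)⁰} (hJ : ∀ g : G, g • (J : Ideal S) = J) :
    ∃ I : (Ideal R)⁰, (I : Ideal R).map (algebraMap R S) = J ∧
      ClassGroup.extendedHom R S (ClassGroup.mk0 I) = ClassGroup.mk0 J := by
  have h1 := h.map_comap_eq (R := R) hJ
  have h0 : (J : Ideal S).comap (algebraMap R S) ∈ (Ideal R)⁰ :=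
    mem_nonZeroDivisors_of_ne_zero fun h0 ↦ nonZeroDivisors.coe_ne_zero J (by
      rw [← h1, h0]; exact Ideal.map_bot)
  refine ⟨⟨_, h0⟩, h1, ?_⟩
  rw [ClassGroup.extendedHom_mk0]
  congr 1
  exact Subtype.ext h1

variable {σ : G}

lemma invol_smul (hσ1 : σ ≠ 1) (hσ : ∀ g : G, g = 1 ∨ g = σ)
    {X : Type*} [MulAction G X] (x : X) : σ • σ • x = x := by
  rw [smul_smul]
  rcases hσ (σ * σ) with h | h
  · rw [h, one_smul]
  · exact absurd (mul_eq_left.mp h) hσ1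

/-- Hilbert's theorem 90 for an involution. -/
lemma exists_ne_zero_of_norm_eq (hσ1 : σ ≠ 1) (hσ : ∀ g : G, g = 1 ∨ g = σ)
    (h : Unr G S) {p q : S} (hp : p ≠ 0) (hpq : p * σ • p = q * σ • q) :
    ∃ y : S, y ≠ 0 ∧ p * y = q * σ • y := by
  classical
  let _ : Fintype G := ⟨{1, σ}, fun g ↦ by rcases hσ g with h | h <;> simp [h]⟩
  have hsum : ∀ F : G → S, ∑ g, F g = F 1 + F σ := fun F ↦ by
    change ∑ g ∈ {1, σ}, F g = _
    rw [Finset.sum_pair hσ1.symm]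
  obtain ⟨s, hs⟩ := h.exists_sum_ne_zero (L := S) (fun _ _ ↦ rfl)
    (fun g ↦ if g = 1 then p * σ • p else q * σ • p) (by
      simpa using ⟨hp, fun h0 ↦ hp ((smul_eq_zero_iff_eq σ).mp h0)⟩)
  refine ⟨_, hs, ?_⟩
  rw [hsum]
  simp only [if_true, hσ1, if_false, one_smul, Algebra.algebraMap_self_apply, smul_add, smul_mul',
    invol_smul hσ1 hσ]
  linear_combination (p * s) * hpq

lemma exists_extended_of_involution (hσ1 : σ ≠ 1) (hσ : ∀ g : G, g = 1 ∨ g = σ)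
    (h : Unr G S) {J : (Ideal S)⁰} (hJ : σ • (J : Ideal S) = J) :
    ∃ I : (Ideal R)⁰, (I : Ideal R).map (algebraMap R S) = J ∧
      ClassGroup.extendedHom R S (ClassGroup.mk0 I) = ClassGroup.mk0 J := by
  classical
  let _ : Fintype G := ⟨{1, σ}, fun g ↦ by rcases hσ g with h | h <;> simp [h]⟩
  exact exists_mk0_extended h fun g ↦ by
    rcases hσ g with rfl | rfl
    exacts [one_smul _ _, hJ]

/-- The action of `g` on units. -/
def smulUnits (g : G) : Sˣ →* Sˣ := Units.map (MulSemiringAction.toRingHom G S g : S →* S)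

lemma coe_smulUnits (g : G) (u : Sˣ) : ((smulUnits g u : Sˣ) : S) = g • (u : S) := rfl

lemma relIndex_units_le (hσ1 : σ ≠ 1) (hσ : ∀ g : G, g = 1 ∨ g = σ)
    [SMulCommClass G R S] (h : Unr G S) [Finite (ClassGroup R)] {M D : Subgroup Sˣ}
    (hM : ∀ a, a ∈ M ↔ a * smulUnits σ a = 1) (hD : ∀ a, a ∈ D ↔ ∃ b, a = b / smulUnits σ b) :
    D.relIndex M ≠ 0 ∧ D.relIndex M ≤ Nat.card (ClassGroup.extendedHom R S).ker := by
  have key : ∀ u ∈ M, ∃ (y : S) (I : (Ideal R)⁰), y ≠ 0 ∧ y = u * σ • y ∧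
      (I : Ideal R).map (algebraMap R S) = Ideal.span {y} ∧
      ClassGroup.extendedHom R S (ClassGroup.mk0 I) = 1 := fun u hu ↦ by
    obtain ⟨y, hy, hy1⟩ := exists_ne_zero_of_norm_eq hσ1 hσ h (p := 1) (q := (u : S)) one_ne_zero (by
      rw [smul_one, mul_one]
      exact (congrArg Units.val ((hM u).mp hu)).symm)
    rw [one_mul] at hy1
    have hJ : Ideal.span {y} ∈ (Ideal S)⁰ :=
      mem_nonZeroDivisors_of_ne_zero (by simpa using hy)
    obtain ⟨I, hI, hI1⟩ := exists_extended_of_involution (R := R) hσ1 hσ h (J := ⟨_, hJ⟩) (by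
      change σ • Ideal.span {y} = Ideal.span {y}
      rw [smul_span_singleton]
      conv_rhs => rw [hy1, mul_comm]
      exact (Ideal.span_singleton_mul_right_unit u.isUnit _).symm)
    refine ⟨y, I, hy, hy1, hI, hI1.trans ?_⟩
    rw [ClassGroup.mk0_eq_one_iff]
    exact ⟨y, rfl⟩
  choose! y I hy0 hy hI hI1 using key
  have := relIndex_le_of_map (D := D) (M := M) (N := (⊥ : Subgroup (ClassGroup R)))
    (Q := (ClassGroup.extendedHom R S).ker) (by rw [Subgroup.relIndex_bot_left]; exact Nat.card_pos.ne')
    (fun u ↦ ClassGroup.mk0 (I u)) (fun u hu ↦ hI1 u hu) (fun u hu v hv huv ↦ ?_)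
  · rwa [Subgroup.relIndex_bot_left] at this
  rw [Subgroup.mem_bot, div_eq_one, ClassGroup.mk0_eq_mk0_iff] at huv
  obtain ⟨r, s, hr, hs, hrs⟩ := huv
  replace hrs := congrArg (Ideal.map (algebraMap R S)) hrs
  rw [Ideal.map_mul, Ideal.map_mul, Ideal.map_span, Ideal.map_span, hI u hu, hI v hv,
    Set.image_singleton, Set.image_singleton, Ideal.span_singleton_mul_span_singleton,
    Ideal.span_singleton_mul_span_singleton, Ideal.span_singleton_eq_span_singleton] at hrs
  obtain ⟨w, hw⟩ := hrs
  have hr' : algebraMap R S r ≠ 0 := (map_ne_zero_iff _ (FaithfulSMul.algebraMap_injective R S)).mpr hr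
  have hs' : algebraMap R S s ≠ 0 := (map_ne_zero_iff _ (FaithfulSMul.algebraMap_injective R S)).mpr hs
  have hw' := congrArg (σ • ·) hw
  simp only [smul_mul', smul_algebraMap] at hw'
  have hyu : σ • y u ≠ 0 := fun h0 ↦ hy0 u hu ((smul_eq_zero_iff_eq σ).mp h0)
  have huw : u * w = v * smulUnits σ w := Units.ext (by
    rw [Units.val_mul, Units.val_mul, coe_smulUnits]
    apply mul_left_cancel₀ (mul_ne_zero hr' hyu)
    linear_combination hw - (v : S) * hw' - algebraMap R S r * w * hy u hu +
      algebraMap R S s * hy v hv)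
  refine (hD _).mpr ⟨w⁻¹, ?_⟩
  rw [map_inv, inv_div_inv, div_eq_div_iff_mul_eq_mul, huw, mul_comm]

lemma relIndex_fixed_le (hσ1 : σ ≠ 1) (hσ : ∀ g : G, g = 1 ∨ g = σ)
    [SMulCommClass G R S] (h : Unr G S) {Q N : Subgroup Sˣ} {C : Subgroup (ClassGroup S)}
    (hC : ∀ c, c ∈ C ↔ smulClass S σ c = c)
    (hQ : ∀ u : Sˣ, u ∈ Q ↔ ∃ y z : S, y ≠ 0 ∧ z ≠ 0 ∧ y * σ • y = u * (z * σ • z))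
    (hN : ∀ u : Sˣ, u ∈ N ↔ ∃ w, u = w * smulUnits σ w) (hfin : N.relIndex Q ≠ 0) :
    (ClassGroup.extendedHom R S).range.relIndex C ≤ N.relIndex Q := by
  have key : ∀ c ∈ C, ∃ (I : (Ideal S)⁰) (a b : S) (u : Sˣ), c = ClassGroup.mk0 I ∧ a ≠ 0 ∧ b ≠ 0 ∧
      Ideal.span {a} * (I : Ideal S) = Ideal.span {b} * σ • (I : Ideal S) ∧
      a * σ • a = u * (b * σ • b) := fun c hc ↦ by
    obtain ⟨I, rfl⟩ := ClassGroup.mk0_surjective c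
    have h1 := (hC _).mp hc
    rw [smulClass_mk0, eq_comm, ClassGroup.mk0_eq_mk0_iff] at h1
    obtain ⟨a, b, ha, hb, hab⟩ := h1
    change _ = _ * σ • (I : Ideal S) at hab
    have h2 := congrArg (σ • ·) hab
    simp only [smul_mul', invol_smul hσ1 hσ, smul_span_singleton] at h2
    have h3 : Ideal.span {b * σ • b} * (I : Ideal S) = Ideal.span {a * σ • a} * (I : Ideal S) := by
      rw [← Ideal.span_singleton_mul_span_singleton, ← Ideal.span_singleton_mul_span_singleton,
        mul_assoc, ← h2, mul_left_comm, ← hab]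
      ring
    rw [mul_left_inj' (nonZeroDivisors.coe_ne_zero I), Ideal.span_singleton_eq_span_singleton] at h3
    obtain ⟨u, hu⟩ := h3
    exact ⟨I, a, b, u, rfl, ha, hb, hab, by rw [← hu, mul_comm]⟩
  choose! I a b u hI ha hb hab hu using key
  refine (relIndex_le_of_map hfin u (fun c hc ↦ (hQ _).mpr ⟨a c, b c, ha c hc, hb c hc, hu c hc⟩)
    fun c hc d hd hcd ↦ ?_).2
  have hsm : ∀ x : S, x ≠ 0 → σ • x ≠ 0 := fun x hx h0 ↦ hx ((smul_eq_zero_iff_eq σ).mp h0)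
  obtain ⟨w, hw⟩ := (hN _).mp hcd
  rw [div_eq_iff_eq_mul] at hw
  replace hw := congrArg Units.val hw
  rw [Units.val_mul, Units.val_mul, coe_smulUnits] at hw
  obtain ⟨y, hy, hpq⟩ := exists_ne_zero_of_norm_eq hσ1 hσ h (p := w * b c * a d) (q := a c * b d)
    (mul_ne_zero (mul_ne_zero w.ne_zero (hb c hc)) (ha d hd)) (by
      rw [smul_mul', smul_mul', smul_mul']
      linear_combination (w * σ • (w : S) * b c * σ • b c) * hu d hd
        - (b d * σ • b d) * hu c hc - (b c * σ • b c * b d * σ • b d) * hw)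
  have hJ : Ideal.span {y} * I c * σ • (I d : Ideal S) ∈ (Ideal S)⁰ :=
    mul_mem (mul_mem (mem_nonZeroDivisors_of_ne_zero (by simpa using hy)) (I c).2)
      (smul_ideal_ne_zero σ (I d).2)
  have hst : σ • (Ideal.span {y} * I c * σ • (I d : Ideal S)) =
      Ideal.span {y} * I c * σ • (I d : Ideal S) := by
    simp only [smul_mul', invol_smul hσ1 hσ, smul_span_singleton]
    have hne : Ideal.span {a c * b d} ≠ (0 : Ideal S) := by
      simpa using ⟨ha c hc, hb d hd⟩
    apply mul_left_cancel₀ hne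
    have e1 : Ideal.span {a c * b d} * Ideal.span {σ • y} =
        Ideal.span {b c * a d} * Ideal.span {y} := by
      rw [Ideal.span_singleton_mul_span_singleton, Ideal.span_singleton_mul_span_singleton, ← hpq,
        Ideal.span_singleton_eq_span_singleton]
      exact ⟨w⁻¹, by
        linear_combination (b c * a d * y) * w.mul_inv⟩
    rw [← mul_assoc, ← mul_assoc, e1, ← Ideal.span_singleton_mul_span_singleton,
      ← Ideal.span_singleton_mul_span_singleton]
    calc _ = (Ideal.span {b c} * σ • (I c : Ideal S)) * (Ideal.span {a d} * (I d : Ideal S)) *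
          Ideal.span {y} := by ring
      _ = _ := by rw [← hab c hc, hab d hd]; ring
  have hd' : ClassGroup.mk0 (smulIdeal σ (I d)) = d := by
    rw [← smulClass_mk0, ← hI d hd]
    exact (hC d).mp hd
  obtain ⟨_, -, h1⟩ := exists_extended_of_involution (R := R) hσ1 hσ h (J := ⟨_, hJ⟩) hst
  obtain ⟨_, -, h2⟩ := exists_extended_of_involution (R := R) hσ1 hσ h (J := I d * smulIdeal σ (I d)) (by
    change σ • ((I d : Ideal S) * σ • (I d : Ideal S)) = (I d : Ideal S) * σ • (I d : Ideal S)
    rw [smul_mul', invol_smul hσ1 hσ, mul_comm])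
  have e1 : c * d = ClassGroup.mk0 ⟨_, hJ⟩ := by
    have e2 : (⟨_, hJ⟩ : (Ideal S)⁰) = ⟨Ideal.span {y}, mem_nonZeroDivisors_of_ne_zero
        (by simpa using hy)⟩ * I c * smulIdeal σ (I d) := rfl
    rw [e2, map_mul, map_mul, hd', ← hI c hc, (ClassGroup.mk0_eq_one_iff _).mpr ⟨y, rfl⟩, one_mul]
  have e3 : d * d = ClassGroup.mk0 (I d * smulIdeal σ (I d)) := by
    rw [map_mul, hd', ← hI d hd]
  rw [← mul_div_mul_right_eq_div c d d, e1, e3, ← h1, ← h2, ← map_div]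
  exact ⟨_, rfl⟩

theorem units_norm_of_index_le (hσ1 : σ ≠ 1) (hσ : ∀ g : G, g = 1 ∨ g = σ)
    [SMulCommClass G R S] (h : Unr G S) [Finite (ClassGroup R)]
    [Finite (ClassGroup S)] {P M D N Q : Subgroup Sˣ}
    (hP : ∀ u, u ∈ P ↔ smulUnits σ u = u) (hM : ∀ a, a ∈ M ↔ a * smulUnits σ a = 1)
    (hD : ∀ a, a ∈ D ↔ ∃ b, a = b / smulUnits σ b) (hN : ∀ u : Sˣ, u ∈ N ↔ ∃ w, u = w * smulUnits σ w)
    (hQ : ∀ u : Sˣ, u ∈ Q ↔ ∃ y z : S, y ≠ 0 ∧ z ≠ 0 ∧ y * σ • y = u * (z * σ • z))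
    (hherb : D.relIndex M = 2 * N.relIndex P) (ν : ClassGroup S →* ClassGroup R)
    (hν : ∀ c, ν (smulClass S σ c) = ν c) (hindex : ν.range.index ≤ 2) :
    P ≤ Q ∧ ∀ c, ν c = 1 → ∃ d, c = d / smulClass S σ d := by
  let δ : ClassGroup S →* ClassGroup S := MonoidHom.id _ / smulClass S σ
  have hC : ∀ c, c ∈ δ.ker ↔ smulClass S σ c = c := fun c ↦ by
    rw [MonoidHom.mem_ker]
    change c / smulClass S σ c = 1 ↔ _
    rw [div_eq_one, eq_comm]
  have hQP : Q ≤ P := fun u hu ↦ by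
    obtain ⟨y, z, hy, hz, hyz⟩ := (hQ u).mp hu
    have := congrArg (σ • ·) hyz
    simp only [smul_mul', invol_smul hσ1 hσ] at this
    refine (hP u).mpr (Units.ext ?_)
    rw [coe_smulUnits]
    have hz' : z * σ • z ≠ 0 := mul_ne_zero hz fun h0 ↦ hz ((smul_eq_zero_iff_eq σ).mp h0)
    apply mul_right_cancel₀ hz'
    linear_combination hyz - this
  have hNQ : N ≤ Q := fun u hu ↦ by
    obtain ⟨w, rfl⟩ := (hN u).mp hu
    exact (hQ _).mpr ⟨w, 1, w.ne_zero, one_ne_zero, by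
      rw [Units.val_mul, coe_smulUnits, smul_one, mul_one, mul_one]⟩
  obtain ⟨h1, h2⟩ := relIndex_units_le (R := R) hσ1 hσ h hM hD
  have h3 := Subgroup.relIndex_mul_relIndex _ _ _ hNQ hQP
  have h4 : N.relIndex Q ≠ 0 := fun h0 ↦ h1 (by rw [hherb, ← h3, h0]; simp)
  have h4' : Q.relIndex P ≠ 0 := fun h0 ↦ h1 (by rw [hherb, ← h3, h0]; simp)
  have h5 := relIndex_fixed_le (R := R) hσ1 hσ h hC hQ hN h4
  have h6 : (ClassGroup.extendedHom R S).range ≤ δ.ker := by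
    rintro _ ⟨c, rfl⟩
    obtain ⟨I, rfl⟩ := ClassGroup.mk0_surjective c
    rw [hC, ClassGroup.extendedHom_mk0, smulClass_mk0]
    congr 1
    refine Subtype.ext ?_
    change σ • Ideal.map _ _ = Ideal.map _ _
    rw [Ideal.pointwise_smul_def, Ideal.map_map]
    congr 1
    exact RingHom.ext fun r ↦ smul_algebraMap σ r
  have h7 : Nat.card (ClassGroup.extendedHom R S).range *
      (ClassGroup.extendedHom R S).range.relIndex δ.ker = Nat.card δ.ker := by
    rw [← Subgroup.relIndex_bot_left, ← Subgroup.relIndex_bot_left]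
    exact Subgroup.relIndex_mul_relIndex _ _ _ bot_le h6
  have h8 := card_ker_mul_card_range (ClassGroup.extendedHom R S)
  have h9 := card_ker_mul_card_range δ
  have h10 := card_ker_mul_card_range ν
  have h11 := ν.range.card_mul_index
  have h12 : δ.range ≤ ν.ker := by
    rintro _ ⟨c, rfl⟩
    rw [MonoidHom.mem_ker]
    change ν (c / smulClass S σ c) = 1
    rw [map_div, hν, div_self']
  have h13 : Nat.card δ.range ≤ Nat.card ν.ker := Subgroup.card_le_of_le h12
  have hCpos : 0 < Nat.card δ.ker := Nat.card_pos
  have hipos : 0 < Nat.card δ.range := Nat.card_pos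
  have hhpos : 0 < Nat.card (ClassGroup R) := Nat.card_pos
  rw [hherb, ← h3] at h2
  have h14 : 2 * Nat.card δ.ker * Q.relIndex P ≤ Nat.card (ClassGroup R) := by
    refine Nat.le_of_mul_le_mul_left (c := N.relIndex Q) ?_ (Nat.pos_of_ne_zero h4)
    calc _ = Nat.card δ.ker * (2 * (N.relIndex Q * Q.relIndex P)) := by ring
      _ ≤ (Nat.card (ClassGroup.extendedHom R S).range * N.relIndex Q) *
          Nat.card (ClassGroup.extendedHom R S).ker := by
        refine Nat.mul_le_mul ?_ h2
        rw [← h7]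
        exact Nat.mul_le_mul_left _ h5
      _ = _ := by rw [← h8]; ring
  have h15 : Nat.card (ClassGroup R) * Nat.card ν.ker ≤ 2 * (Nat.card δ.ker * Nat.card δ.range) := by
    rw [h9, ← h10, ← h11]
    calc _ = ν.range.index * (Nat.card ν.ker * Nat.card ν.range) := by ring
      _ ≤ _ := Nat.mul_le_mul_right _ hindex
  have h16 : Nat.card (ClassGroup R) * Nat.card δ.range ≤
      Nat.card (ClassGroup R) * Nat.card ν.ker := Nat.mul_le_mul_left _ h13
  have h17 : 2 * Nat.card δ.ker * Q.relIndex P * Nat.card δ.range ≤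
      Nat.card (ClassGroup R) * Nat.card δ.range := Nat.mul_le_mul_right _ h14
  have h18 : Q.relIndex P = 1 := by
    refine le_antisymm ?_ (Nat.pos_of_ne_zero h4')
    refine Nat.le_of_mul_le_mul_left (c := 2 * (Nat.card δ.ker * Nat.card δ.range)) ?_ (by positivity)
    calc _ = 2 * Nat.card δ.ker * Q.relIndex P * Nat.card δ.range := by ring
      _ ≤ _ := by linarith
  have h19 : Nat.card ν.ker ≤ Nat.card δ.range := by
    refine Nat.le_of_mul_le_mul_left (c := Nat.card (ClassGroup R)) ?_ hhpos
    calc _ ≤ _ := h15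
      _ = 2 * Nat.card δ.ker * Q.relIndex P * Nat.card δ.range := by rw [h18]; ring
      _ ≤ _ := h17
  refine ⟨Subgroup.relIndex_eq_one.mp h18, fun c hc ↦ ?_⟩
  have h20 : δ.range = ν.ker := Subgroup.eq_of_le_of_card_ge h12 h19
  obtain ⟨d, hd⟩ : c ∈ δ.range := h20 ▸ hc
  exact ⟨d, hd.symm⟩

theorem exists_norm_of_index_le (hσ1 : σ ≠ 1) (hσ : ∀ g : G, g = 1 ∨ g = σ)
    [SMulCommClass G R S] (h : Unr G S) [Finite (ClassGroup R)]
    [Finite (ClassGroup S)]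
    (hherb : ∀ {P N A D : Subgroup Sˣ}, (∀ u, u ∈ P ↔ smulUnits σ u = u) →
      (∀ a, a ∈ A ↔ a * smulUnits σ a = 1) → (∀ a, a ∈ D ↔ ∃ b, a = b / smulUnits σ b) →
      (∀ u, u ∈ N ↔ ∃ w, u = w * smulUnits σ w) → D.relIndex A = 2 * N.relIndex P)
    (ν : ClassGroup S →* ClassGroup R) (hν : ∀ c, ν (smulClass S σ c) = ν c)
    (hindex : ν.range.index ≤ 2) {b : S} (hb0 : b ≠ 0) (hb : σ • b = b) {I : (Ideal S)⁰}
    (hI : Ideal.span {b} = (I : Ideal S) * σ • (I : Ideal S)) (hνI : ν (ClassGroup.mk0 I) = 1) :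
    ∃ y z : S, y ≠ 0 ∧ z ≠ 0 ∧ y * σ • y = b * (z * σ • z) := by
  let τ := smulUnits (S := S) σ
  let P : Subgroup (S)ˣ := τ.eqLocus (MonoidHom.id _)
  let A : Subgroup (S)ˣ := (MonoidHom.id _ * τ).ker
  let D : Subgroup (S)ˣ := (MonoidHom.id _ / τ).range
  let N : Subgroup (S)ˣ := (MonoidHom.id _ * τ).range
  have hsm : ∀ {x : S}, x ≠ 0 → σ • x ≠ 0 := fun hx h0 ↦ hx ((smul_eq_zero_iff_eq σ).mp h0)
  let Q : Subgroup (S)ˣ :=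
    { carrier := {u | ∃ y z : S, y ≠ 0 ∧ z ≠ 0 ∧ y * σ • y = u * (z * σ • z)}
      one_mem' := ⟨1, 1, one_ne_zero, one_ne_zero, by simp⟩
      mul_mem' := by
        rintro u v ⟨y, z, hy, hz, h1⟩ ⟨y', z', hy', hz', h2⟩
        refine ⟨y * y', z * z', mul_ne_zero hy hy', mul_ne_zero hz hz', ?_⟩
        rw [Units.val_mul, smul_mul', smul_mul', mul_mul_mul_comm, h1, h2]
        ring
      inv_mem' := by
        rintro u ⟨y, z, hy, hz, h1⟩
        exact ⟨z, y, hz, hy, by rw [h1, u.inv_mul_cancel_left]⟩ }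
  have hP : ∀ u, u ∈ P ↔ smulUnits σ u = u := fun _ ↦ Iff.rfl
  have hA : ∀ a, a ∈ A ↔ a * smulUnits σ a = 1 := fun _ ↦ Iff.rfl
  have hD : ∀ a, a ∈ D ↔ ∃ b, a = b / smulUnits σ b := fun a ↦ exists_congr fun _ ↦ eq_comm
  have hN : ∀ a, a ∈ N ↔ ∃ b, a = b * smulUnits σ b := fun a ↦ exists_congr fun _ ↦ eq_comm
  obtain ⟨hPQ, hker⟩ := units_norm_of_index_le (R := R) (Q := Q) hσ1 hσ h hP hA hD hN
    (fun _ ↦ Iff.rfl) (hherb hP hA hD hN) ν hν hindex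
  obtain ⟨d, hd⟩ := hker _ hνI
  obtain ⟨J, rfl⟩ := ClassGroup.mk0_surjective d
  rw [smulClass_mk0, eq_div_iff_mul_eq', ← map_mul, ClassGroup.mk0_eq_mk0_iff] at hd
  obtain ⟨x, y, hx, hy, hxy⟩ := hd
  change Ideal.span {x} * ((I : Ideal S) * σ • (J : Ideal S)) = _ at hxy
  have h2 := congrArg (σ • ·) hxy
  simp only [smul_mul', invol_smul hσ1 hσ, smul_span_singleton] at h2
  have hJ0 : (J : Ideal (S)) * σ • (J : Ideal (S)) ≠ 0 :=
    mul_ne_zero (nonZeroDivisors.coe_ne_zero J)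
      (nonZeroDivisors.ne_zero (smul_ideal_ne_zero σ J.2))
  have h3 : Ideal.span {x * σ • x * b} = Ideal.span {y * σ • y} := by
    apply mul_right_cancel₀ hJ0
    rw [← Ideal.span_singleton_mul_span_singleton, ← Ideal.span_singleton_mul_span_singleton,
      ← Ideal.span_singleton_mul_span_singleton, hI]
    calc _ = (Ideal.span {x} * ((I : Ideal S) * σ • (J : Ideal S))) *
          (Ideal.span {σ • x} * (σ • (I : Ideal S) * ↑J)) := by ring
      _ = _ := by rw [hxy, h2]; ring
  rw [Ideal.span_singleton_eq_span_singleton] at h3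
  obtain ⟨u, hu⟩ := h3
  have hu' := congrArg (σ • ·) hu
  simp only [smul_mul', invol_smul hσ1 hσ, hb] at hu'
  have hne : x * σ • x * b ≠ 0 := mul_ne_zero (mul_ne_zero hx (hsm hx)) hb0
  obtain ⟨p, q, hp, hq, hpq⟩ := hPQ ((hP u).mpr (Units.ext (by
    rw [coe_smulUnits]
    apply mul_left_cancel₀ hne
    linear_combination hu' - hu)))
  refine ⟨y * q, x * p, mul_ne_zero hy hq, mul_ne_zero hx hp, ?_⟩
  rw [smul_mul', smul_mul']
  linear_combination - (q * σ • q) * hu - b * (x * σ • x) * hpq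

end Ring

end SumProd

namespace SumProd

open Pointwise nonZeroDivisors NumberField

lemma ideal_eq_of_sq_eq {R : Type*} [CommRing R] [IsDedekindDomain R] {I J : Ideal R}
    (h : I ^ 2 = J ^ 2) : I = J := by
  by_cases hI : I = 0
  · rw [hI, zero_pow two_ne_zero] at h
    rw [hI, pow_eq_zero_iff two_ne_zero |>.mp h.symm]
  have hJ : J ≠ 0 := fun hJ ↦ hI (by
    rw [hJ, zero_pow two_ne_zero] at h
    exact pow_eq_zero_iff two_ne_zero |>.mp h)
  have h1 := congrArg UniqueFactorizationMonoid.normalizedFactors h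
  rw [UniqueFactorizationMonoid.normalizedFactors_pow,
    UniqueFactorizationMonoid.normalizedFactors_pow] at h1
  rw [← associated_iff_eq,
    UniqueFactorizationMonoid.associated_iff_normalizedFactors_eq_normalizedFactors hI hJ]
  exact nsmul_right_injective two_ne_zero h1

variable (K : Type*) {M G : Type*} [Field K] [NumberField K] [Field M] [NumberField M] [Algebra K M]
  [Group G] [MulSemiringAction G M] [IsGaloisGroup G K M] {σ : G}

lemma finrank_eq_two (hσ1 : σ ≠ 1) (hσ : ∀ g : G, g = 1 ∨ g = σ)
    : Module.finrank K M = 2 := by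
  classical
  let _ : Fintype G := ⟨{1, σ}, fun g ↦ by rcases hσ g with h | h <;> simp [h]⟩
  rw [← IsGaloisGroup.card_eq_finrank G K M, Nat.card_eq_fintype_card]
  exact Finset.card_pair hσ1.symm

lemma classNorm_smulClass (σ : G) (c : ClassGroup (𝓞 M)) :
    classNorm K M (smulClass (𝓞 M) σ c) = classNorm K M c := by
  obtain ⟨I, rfl⟩ := ClassGroup.mk0_surjective c
  rw [smulClass_mk0, classNorm_mk0, classNorm_mk0]
  congr 1
  exact Subtype.ext (Ideal.relNorm_smul (𝓞 K) σ (I : Ideal (𝓞 M)))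

/-- An ideal whose norm is principal has trivial class norm. -/
lemma classNorm_eq_one (hσ1 : σ ≠ 1) (hσ : ∀ g : G, g = 1 ∨ g = σ)
    {I : (Ideal (𝓞 M))⁰} {b : 𝓞 M} (hb : σ • b = b)
    (hI : Ideal.span {b} = (I : Ideal (𝓞 M)) * σ • (I : Ideal (𝓞 M))) :
    classNorm K M (ClassGroup.mk0 I) = 1 := by
  obtain ⟨b₀, rfl⟩ := Algebra.IsInvariant.isInvariant (A := 𝓞 K) (G := G) b fun g ↦ by
    rcases hσ g with rfl | rfl
    exacts [one_smul _ _, hb]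
  have h2 : Module.finrank (𝓞 K) (𝓞 M) = 2 := by
    rw [← IsFractionRing.finrank_eq (𝓞 K) K (𝓞 M) M, finrank_eq_two K hσ1 hσ]
  have h1 := congrArg (Ideal.relNorm (𝓞 K)) hI
  rw [← Set.image_singleton, ← Ideal.map_span, Ideal.relNorm_algebraMap, map_mul,
    Ideal.relNorm_smul, h2, ← sq] at h1
  rw [classNorm_mk0, ClassGroup.mk0_eq_one_iff]
  exact ⟨b₀, (ideal_eq_of_sq_eq h1).symm⟩

variable [IsTotallyReal M]

lemma herbrand_units (hσ1 : σ ≠ 1) (hσ : ∀ g : G, g = 1 ∨ g = σ)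
    [IsTotallyReal K] {P N A D : Subgroup (𝓞 M)ˣ} (hP : ∀ u, u ∈ P ↔ smulUnits σ u = u)
    (hA : ∀ a, a ∈ A ↔ a * smulUnits σ a = 1) (hD : ∀ a, a ∈ D ↔ ∃ b, a = b / smulUnits σ b)
    (hN : ∀ u, u ∈ N ↔ ∃ w, u = w * smulUnits σ w) : D.relIndex A = 2 * N.relIndex P := by
  refine herbrand (smulUnits σ) (fun a ↦ Units.ext ?_) (z := -1) neg_one_sq
    (neg_one_ne_one_units M) (Units.ext ?_) (fun a ↦ unit_sq_eq_one M) (fun a ha ↦ ?_) P A D N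
    hP hA hD hN (n := Module.finrank ℚ K) ?_ ?_
  · rw [coe_smulUnits, coe_smulUnits, invol_smul hσ1 hσ]
  · rw [coe_smulUnits, Units.val_neg, Units.val_one, smul_neg, smul_one]
  · have h4 := (mem_torsion_iff M a).mp ((CommGroup.mem_torsion _).mpr
      (isOfFinOrder_iff_pow_eq_one.mpr ⟨4, by norm_num, by
        rw [show 4 = 2 * 2 from rfl, pow_mul, ha, neg_one_sq]⟩))
    refine neg_one_ne_one_units M (ha.symm.trans ?_)
    rcases h4 with rfl | rfl
    exacts [one_pow _, neg_one_sq]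
  · rw [index_sq_units, ← Module.finrank_mul_finrank ℚ K M, finrank_eq_two K hσ1 hσ, mul_comm]
  · let f : (𝓞 K)ˣ →* (𝓞 M)ˣ := Units.map (algebraMap (𝓞 K) (𝓞 M) : 𝓞 K →* 𝓞 M)
    have hf : Function.Injective f := Units.map_injective (FaithfulSMul.algebraMap_injective _ _)
    have hPf : P = (⊤ : Subgroup (𝓞 K)ˣ).map f := by
      ext u
      rw [hP, ← MonoidHom.range_eq_map, MonoidHom.mem_range]
      constructor
      · intro h
        have hinv : ∀ v : (𝓞 M)ˣ, smulUnits σ v = v → ∃ r : 𝓞 K, algebraMap (𝓞 K) (𝓞 M) r = v :=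
          fun v hv ↦ Algebra.IsInvariant.isInvariant (G := G) (v : 𝓞 M) fun g ↦ by
            rcases hσ g with rfl | rfl
            exacts [one_smul _ _, congrArg Units.val hv]
        obtain ⟨r, hr⟩ := hinv u h
        obtain ⟨s, hs⟩ := hinv u⁻¹ (by rw [map_inv, h])
        have hrs : r * s = 1 := FaithfulSMul.algebraMap_injective (𝓞 K) (𝓞 M) (by
          rw [map_mul, hr, hs, map_one, u.mul_inv])
        exact ⟨⟨r, s, hrs, (mul_comm _ _).trans hrs⟩, Units.ext hr⟩
      · rintro ⟨v, rfl⟩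
        exact Units.ext (smul_algebraMap σ _)
    have hmap : P.map (powMonoidHom 2) = (powMonoidHom 2 : (𝓞 K)ˣ →* (𝓞 K)ˣ).range.map f := by
      rw [hPf, Subgroup.map_map, ← MonoidHom.range_eq_map, ← MonoidHom.range_comp]
      congr 1
      ext1 u
      exact (map_pow f u 2).symm
    rw [hmap, hPf, Subgroup.relIndex_map_map_of_injective _ _ hf, Subgroup.relIndex_top_right,
      index_sq_units]

/-- In an unramified quadratic extension of totally real fields, elements which are norms of ideals
are norms. -/
theorem exists_norm_eq_of_unr (K : Type*) [Field K] [NumberField K] [Algebra K M]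
    [IsGaloisGroup G K M] (hσ1 : σ ≠ 1) (hσ : ∀ g : G, g = 1 ∨ g = σ)
    (h : Unr G (𝓞 M)) {b : 𝓞 M} (hb0 : b ≠ 0) (hb : σ • b = b)
    {I : Ideal (𝓞 M)} (hI : Ideal.span {b} = I * σ • I) :
    ∃ y z : 𝓞 M, y ≠ 0 ∧ z ≠ 0 ∧ y * σ • y = b * (z * σ • z) := by
  have : IsTotallyReal K := IsTotallyReal.of_algebra K M
  have hI0 : I ∈ (Ideal (𝓞 M))⁰ := mem_nonZeroDivisors_of_ne_zero fun h0 ↦ hb0 (by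
    rw [h0, zero_mul] at hI
    exact Ideal.span_singleton_eq_bot.mp hI)
  exact exists_norm_of_index_le (R := 𝓞 K) hσ1 hσ h (fun hP hA hD hN ↦ herbrand_units K hσ1 hσ hP hA hD hN)
    (classNorm K M) (classNorm_smulClass K σ)
    (index_range_classNorm_le (finrank_eq_two K hσ1 hσ)) hb0 hb (I := ⟨I, hI0⟩) hI
    (classNorm_eq_one K hσ1 hσ hb hI)

end SumProd

namespace SumProd

open Pointwise nonZeroDivisors NumberField

lemma exists_norm_eq_of_quotient {Γ : Type*} [Group Γ] [Finite Γ] {N : Subgroup Γ} [N.Normal]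
    (K F : Type*) {L : Type*} [Field K] [NumberField K] [Field F] [NumberField F] [Field L]
    [NumberField L] [Algebra K F] [Algebra F L] [MulSemiringAction Γ L] [IsGaloisGroup N F L]
    [MulSemiringAction (Γ ⧸ N) F] [IsGaloisGroup (Γ ⧸ N) K F] [IsTotallyReal L]
    (hact : ∀ (g : Γ) (x : F), algebraMap F L ((g : Γ ⧸ N) • x) = g • algebraMap F L x)
    (hN : ∀ g h : Γ, g ∉ N → h ∉ N → g * h ∈ N) (h : Unr Γ (𝓞 L)) {τ : Γ} (hτ : τ ∉ N)
    {B : 𝓞 L} (hB0 : B ≠ 0) (hB : ∀ g : Γ, g • B = B) {I : Ideal (𝓞 L)}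
    (hIN : ∀ g ∈ N, g • I = I) (hI : Ideal.span {B} = I * τ • I) :
    ∃ y z : 𝓞 L, y ≠ 0 ∧ z ≠ 0 ∧ (∀ g ∈ N, g • y = y) ∧ (∀ g ∈ N, g • z = z) ∧
      y * τ • y = B * (z * τ • z) := by
  have hact' : ∀ (g : Γ) (x : 𝓞 F),
      algebraMap (𝓞 F) (𝓞 L) ((g : Γ ⧸ N) • x) = g • algebraMap (𝓞 F) (𝓞 L) x :=
    fun g x ↦ RingOfIntegers.ext (hact g x)
  have hinv : IsGaloisGroup N (𝓞 F) (𝓞 L) := .of_isFractionRing N (𝓞 F) (𝓞 L) F L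
  have hinj : Function.Injective (algebraMap (𝓞 F) (𝓞 L)) := FaithfulSMul.algebraMap_injective _ _
  have hF : Unr (Γ ⧸ N) (𝓞 F) := h.descend (H := N) hinj (fun g ↦ (g : Γ ⧸ N))
    QuotientGroup.mk_surjective (fun g hg ↦ (QuotientGroup.eq_one_iff g).mpr hg) hact'
  have hfix : ∀ g ∈ N, ∀ x : 𝓞 F, g • algebraMap (𝓞 F) (𝓞 L) x = algebraMap (𝓞 F) (𝓞 L) x :=
    fun g hg x ↦ by rw [← hact', (QuotientGroup.eq_one_iff g).mpr hg, one_smul]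
  have hσ1 : (τ : Γ ⧸ N) ≠ 1 := fun h1 ↦ hτ ((QuotientGroup.eq_one_iff τ).mp h1)
  have hσ : ∀ g : Γ ⧸ N, g = 1 ∨ g = (τ : Γ ⧸ N) := fun g ↦ by
    obtain ⟨g, rfl⟩ := QuotientGroup.mk_surjective g
    by_cases hg : g ∈ N
    · exact .inl ((QuotientGroup.eq_one_iff g).mpr hg)
    · refine .inr (QuotientGroup.eq.mpr (hN _ _ (fun h ↦ hg ?_) hτ))
      simpa using N.inv_mem h
  obtain ⟨b, rfl⟩ := Algebra.IsInvariant.isInvariant (A := 𝓞 F) (G := N) B fun g ↦ hB g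
  have hb0 : b ≠ 0 := fun h ↦ hB0 (by rw [h, map_zero])
  have : IsTotallyReal F := IsTotallyReal.of_algebra F L
  have hJ := (h.subgroup N).map_comap_eq (R := 𝓞 F) (J := I) fun g ↦ hIN g g.2
  set J := I.comap (algebraMap (𝓞 F) (𝓞 L))
  have hmap : ((τ : Γ ⧸ N) • J).map (algebraMap (𝓞 F) (𝓞 L)) = τ • I := by
    rw [← hJ]
    refine le_antisymm (Ideal.map_le_iff_le_comap.mpr fun x hx ↦ ?_) ?_
    · have hy : ((τ : Γ ⧸ N)⁻¹ • x) ∈ J := Ideal.mem_pointwise_smul_iff_inv_smul_mem.mp hx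
      rw [Ideal.mem_comap, ← smul_inv_smul (τ : Γ ⧸ N) x, hact']
      exact Ideal.smul_mem_pointwise_smul _ _ _ (Ideal.mem_map_of_mem _ hy)
    · rw [Ideal.pointwise_smul_def, Ideal.map_map, Ideal.map_le_iff_le_comap]
      intro x hx
      rw [Ideal.mem_comap]
      change τ • algebraMap (𝓞 F) (𝓞 L) x ∈ _
      rw [← hact']
      exact Ideal.mem_map_of_mem _ (Ideal.smul_mem_pointwise_smul _ _ _ hx)
  obtain ⟨y, z, hy, hz, hyz⟩ := exists_norm_eq_of_unr K hσ1 hσ hF hb0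
    (hinj (by rw [hact', hB])) (I := J) (by
      have hmi : Function.Injective (Ideal.map (algebraMap (𝓞 F) (𝓞 L))) := fun P Q hPQ ↦ by
        rw [← P.comap_map_eq_self_of_faithfullyFlat (B := 𝓞 L), hPQ,
          Q.comap_map_eq_self_of_faithfullyFlat]
      refine hmi ?_
      rw [Ideal.map_mul, hmap, hJ, ← hI, Ideal.map_span, Set.image_singleton])
  refine ⟨algebraMap _ _ y, algebraMap _ _ z, (map_ne_zero_iff _ hinj).mpr hy,
    (map_ne_zero_iff _ hinj).mpr hz, fun g hg ↦ hfix g hg y, fun g hg ↦ hfix g hg z, ?_⟩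
  rw [← hact', ← hact', ← map_mul, hyz, map_mul, map_mul]

end SumProd

namespace SumProd

open Pointwise

section

variable {Γ E S : Type*} [Group Γ] [Group E] [CommRing S]
  [MulSemiringAction Γ S] {π : E →* Γ} {E' : Subgroup E} {z : E → S} {c : S}

/-- The ideal generated by the values of a crossed homomorphism. -/
def crossedIdeal (E' : Subgroup E) (z : E → S) : Ideal S := Ideal.span (z '' E')

lemma span_mul_smul_crossedIdeal (hz : ∀ e ∈ E', ∀ f ∈ E', c * z (e * f) = z e * π e • z f)
    {e : E} (he : e ∈ E') : Ideal.span {z e} * π e • crossedIdeal E' z =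
      Ideal.span {c} * crossedIdeal E' z := by
  rw [crossedIdeal, Ideal.pointwise_smul_def, Ideal.map_span, Ideal.span_mul_span',
    Ideal.span_mul_span']
  congr 1
  ext x
  simp only [Set.singleton_mul, Set.mem_image, SetLike.mem_coe, exists_exists_and_eq_and]
  constructor
  · rintro ⟨f, hf, rfl⟩
    exact ⟨e * f, E'.mul_mem he hf, hz e he f hf⟩
  · rintro ⟨f, hf, rfl⟩
    refine ⟨e⁻¹ * f, E'.mul_mem (E'.inv_mem he) hf, ?_⟩
    have := hz e he _ (E'.mul_mem (E'.inv_mem he) hf)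
    rw [mul_inv_cancel_left] at this
    exact this.symm

/-- If the twist of a crossed homomorphism of a normal subgroup of index two is cohomologous to it,
the ideal of the obstruction is a norm of an invariant ideal. -/
lemma exists_ideal_mul_smul [IsDedekindDomain S]
    (hz0 : ∀ e ∈ E', z e ≠ 0) (hc0 : c ≠ 0) (hc : ∀ g : Γ, g • c = c)
    (hz : ∀ e ∈ E', ∀ f ∈ E', c * z (e * f) = z e * π e • z f)
    (hn : ∀ J : Ideal S, J ≠ ⊥ → ∃ n ∈ J, n ≠ 0 ∧ ∀ g : Γ, g • n = n)
    {N : Subgroup Γ} (hN : ∀ g ∈ N, ∃ e ∈ E', π e = g) {t : E} (hconj : ∀ e ∈ E', t⁻¹ * e * t ∈ E')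
    (ht : t * t ∈ E') {w : S} 
    (hw : ∀ e ∈ E', π e • w * z e = w * π t • z (t⁻¹ * e * t)) :
    ∃ (I : Ideal S) (n : S), n ≠ 0 ∧ (∀ g : Γ, g • n = n) ∧ (∀ g ∈ N, g • I = I) ∧
      Ideal.span {z (t * t)} * (I * π t • I) = Ideal.span {w * π t • w * c * n ^ 2} := by
  set Z := crossedIdeal E' z with hZdef
  have hZ : ∀ e ∈ E', Ideal.span {z e} * π e • Z = Ideal.span {c} * Z :=
    fun e he ↦ span_mul_smul_crossedIdeal hz he
  have hZ0 : Z ≠ ⊥ := fun h ↦ hz0 1 E'.one_mem (by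
    have : z 1 ∈ Z := Ideal.subset_span ⟨1, E'.one_mem, rfl⟩
    rwa [h, Ideal.mem_bot] at this)
  obtain ⟨n, hnZ, hn0, hn⟩ := hn Z hZ0
  obtain ⟨Z', hZ'⟩ := Ideal.dvd_iff_le.mpr ((Ideal.span_singleton_le_iff_mem Z).mpr hnZ)
  have hsp : ∀ (g : Γ) (x : S), g • Ideal.span {x} = Ideal.span {g • x} :=
    fun g x ↦ by rw [Ideal.pointwise_smul_def, Ideal.map_span, Set.image_singleton]; rfl
  have hZ's : ∀ g : Γ, g • Z * g • Z' = Ideal.span {n} := fun g ↦ by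
    rw [← smul_mul', ← hZ', hsp, hn]
  have hcs : Ideal.span {c} ≠ 0 := by simpa [Ideal.zero_eq_bot] using hc0
  have hns : Ideal.span {n} ≠ 0 := by simpa [Ideal.zero_eq_bot] using hn0
  have hgZ : ∀ g : Γ, g • Z ≠ 0 := fun g h ↦ hns (by rw [← hZ's g, h, zero_mul])
  refine ⟨Ideal.span {w} * π t • Z * Z', n, hn0, hn, fun g hg ↦ ?_, ?_⟩
  · obtain ⟨e, he, rfl⟩ := hN g hg
    have h1 := congrArg (π t • ·) (hZ _ (hconj e he))
    simp only [smul_mul', hsp, hc, smul_smul, ← map_mul] at h1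
    rw [show t * (t⁻¹ * e * t) = e * t by group] at h1
    have h2 := congrArg (fun x ↦ Ideal.span {x}) (hw e he)
    simp only [← Ideal.span_singleton_mul_span_singleton] at h2
    have hze : Ideal.span {z e} ≠ 0 := by simpa [Ideal.zero_eq_bot] using hz0 e he
    refine mul_left_cancel₀ (mul_ne_zero hze (hgZ (π e))) ?_
    rw [smul_mul', smul_mul', hsp, smul_smul, ← map_mul]
    calc _ = (Ideal.span {π e • w} * Ideal.span {z e}) * π (e * t) • Z * (π e • Z * π e • Z') := by
          ring
      _ = Ideal.span {w} * (Ideal.span {π t • z (t⁻¹ * e * t)} * π (e * t) • Z) *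
          Ideal.span {n} := by rw [h2, hZ's]; ring
      _ = Ideal.span {w} * Ideal.span {c} * π t • Z * (Z * Z') := by rw [h1, hZ']; ring
      _ = (Ideal.span {c} * Z) * (Ideal.span {w} * π t • Z * Z') := by ring
      _ = _ := by rw [← hZ e he]
  · rw [smul_mul', smul_mul', hsp, smul_smul, ← map_mul]
    simp only [← Ideal.span_singleton_mul_span_singleton, sq]
    calc _ = Ideal.span {w} * Ideal.span {π t • w} * (Ideal.span {z (t * t)} * π (t * t) • Z) * Z' *
          (π t • Z * π t • Z') := by ring
      _ = Ideal.span {w} * Ideal.span {π t • w} * Ideal.span {c} * (Z * Z') * Ideal.span {n} := by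
          rw [hZ _ ht, hZ's]; ring
      _ = _ := by rw [← hZ']; ring

end

end SumProd

namespace SumProd

open Pointwise nonZeroDivisors NumberField

section

variable {Γ E L : Type*} [Group Γ] [Group E] [Field L] [MulSemiringAction Γ L] {π : E →* Γ}
  {E' : Subgroup E} {y : E → L}

/-- Extending a crossed homomorphism from a subgroup of index two. -/
lemma crossed_glue (hy : ∀ e ∈ E', ∀ f ∈ E', y (e * f) = y e * π e • y f)
    (hE : ∀ e f, e ∉ E' → f ∉ E' → e * f ∈ E') {t : E} (ht : t ∉ E') {W : L}
    (hW : W * π t • W = y (t * t))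
    (hWy : ∀ e ∈ E', y e * π e • W = W * π t • y (t⁻¹ * e * t))
    (hy0 : ∀ e ∈ E', y e ≠ 0) (hW0 : W ≠ 0) :
    ∃ x : E → L, (∀ e, x e ≠ 0) ∧ (∀ e f, x (e * f) = x e * π e • x f) ∧ ∀ e ∈ E', x e = y e := by
  classical
  have htE : ∀ e, e ∉ E' → t⁻¹ * e ∈ E' := fun e he ↦ hE _ _ (fun h ↦ ht (by simpa using E'.inv_mem h)) he
  have hconj : ∀ e ∈ E', t⁻¹ * e * t ∈ E' := fun e he ↦
    hE _ _ (fun h ↦ ht (by simpa using E'.mul_mem he (E'.inv_mem h))) ht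
  refine ⟨fun e ↦ if e ∈ E' then y e else W * π t • y (t⁻¹ * e), fun e ↦ ?_, fun e f ↦ ?_,
    fun e he ↦ if_pos he⟩
  · dsimp only
    split_ifs with he
    · exact hy0 e he
    · exact mul_ne_zero hW0 ((smul_ne_zero_iff_ne _).mpr (hy0 _ (htE e he)))
  · dsimp only
    by_cases he : e ∈ E' <;> by_cases hf : f ∈ E'
    · rw [if_pos he, if_pos hf, if_pos (E'.mul_mem he hf), hy e he f hf]
    · rw [if_pos he, if_neg hf, if_neg fun h ↦ hf ((E'.mul_mem_cancel_left he).mp h),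
        show t⁻¹ * (e * f) = (t⁻¹ * e * t) * (t⁻¹ * f) by group, hy _ (hconj e he) _ (htE f hf),
        smul_mul', smul_mul', ← mul_assoc, ← mul_assoc, ← hWy e he, smul_smul, smul_smul, ← map_mul,
        ← map_mul, show t * (t⁻¹ * e * t) = e * t by group]
    · rw [if_neg he, if_pos hf, if_neg fun h ↦ he ((E'.mul_mem_cancel_right hf).mp h),
        ← mul_assoc t⁻¹, hy _ (htE e he) _ hf, smul_mul', smul_smul, ← map_mul, mul_inv_cancel_left,
        mul_assoc]
    · rw [if_neg he, if_neg hf, if_pos (hE e f he hf)]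
      have h1 := htE e he
      have h2 := htE f hf
      obtain ⟨a, rfl⟩ : ∃ a, e = t * a := ⟨t⁻¹ * e, by group⟩
      obtain ⟨b, rfl⟩ : ∃ b, f = t * b := ⟨t⁻¹ * f, by group⟩
      rw [inv_mul_cancel_left] at h1 h2 ⊢
      rw [inv_mul_cancel_left]
      have h3 : t * a * (t * b) = (t * t) * (t⁻¹ * a * t) * b := by group
      have htt := hE t t ht ht
      rw [h3, hy _ (E'.mul_mem htt (hconj a h1)) _ h2, hy _ htt _ (hconj a h1), ← hW]
      have h4 := congrArg (π t • ·) (hWy a h1)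
      simp only [smul_mul', smul_smul, ← map_mul] at h4 ⊢
      rw [show t * t * (t⁻¹ * a * t) = t * a * t by group]
      calc _ = W * (π t • W * π (t * t) • y (t⁻¹ * a * t)) * π (t * a * t) • y b := by ring
        _ = _ := by rw [← h4]; ring

variable [Finite Γ] {N : Subgroup Γ} {S : Type*} [CommRing S] [MulSemiringAction Γ S] [Algebra S L]

/-- Hilbert's theorem 90 for crossed homomorphisms which factor through the group acting. -/
lemma exists_smul_eq_of_crossed (h : Unr Γ S)
    (hact : ∀ (g : Γ) (s : S), algebraMap S L (g • s) = g • algebraMap S L s)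
    (hN : ∀ g ∈ N, ∃ e ∈ E', π e = g) (hEN : ∀ e ∈ E', π e ∈ N)
    (hy : ∀ e ∈ E', ∀ f ∈ E', y (e * f) = y e * π e • y f)
    (hker : ∀ e ∈ E', π e = 1 → y e = 1) :
    ∃ W : L, W ≠ 0 ∧ ∀ e ∈ E', π e • W = y e * W := by
  have := Fintype.ofFinite N
  choose! s hsE hs using hN
  have hys : ∀ e ∈ E', y e = y (s (π e)) := fun e he ↦ by
    have h1 := E'.mul_mem (E'.inv_mem (hsE _ (hEN e he))) he
    have h2 : π ((s (π e))⁻¹ * e) = 1 := by rw [map_mul, map_inv, hs _ (hEN e he), inv_mul_cancel]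
    have h3 := hy _ (hsE _ (hEN e he)) _ h1
    rwa [mul_inv_cancel_left, hker _ h1 h2, smul_one, mul_one] at h3
  have hy1 : y (s 1) = 1 := hker _ (hsE 1 N.one_mem) (hs 1 N.one_mem)
  obtain ⟨a, ha⟩ := (h.subgroup N).exists_sum_ne_zero (L := L) (fun g s ↦ hact g s)
    (fun g : N ↦ y (s g)) (by
      change y (s ((1 : N) : Γ)) ≠ 0
      rw [Subgroup.coe_one, hy1]
      exact one_ne_zero)
  refine ⟨(∑ g : N, y (s g) * g • algebraMap S L a)⁻¹, inv_ne_zero ha, fun e he ↦ ?_⟩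
  have key : y e * π e • ∑ g : N, y (s g) * g • algebraMap S L a =
      ∑ g : N, y (s g) * g • algebraMap S L a := by
    rw [Finset.smul_sum, Finset.mul_sum]
    refine Fintype.sum_equiv (Equiv.mulLeft ⟨π e, hEN e he⟩) _ _ fun g ↦ ?_
    have h1 := hy e he (s g) (hsE g g.2)
    rw [hys _ (E'.mul_mem he (hsE g g.2)), map_mul, hs g g.2] at h1
    rw [smul_mul', ← mul_assoc, ← h1]
    simp only [Equiv.coe_mulLeft, Subgroup.coe_mul, Subgroup.smul_def, mul_smul]
  have h0 : π e • ∑ g : N, y (s g) * g • algebraMap S L a ≠ 0 := (smul_ne_zero_iff_ne _).mpr ha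
  generalize ∑ g : N, y (s g) * g • algebraMap S L a = X at ha key h0 ⊢
  rw [smul_inv'', inv_eq_iff_eq_inv, mul_inv, inv_inv]
  rw [eq_inv_mul_iff_mul_eq₀ fun h ↦ ha (by rw [← key, h, zero_mul]), key]

end

end SumProd

namespace SumProd

open Pointwise nonZeroDivisors NumberField

section

variable {Γ E L : Type*} [Group Γ] [Group E] [Field L] [MulSemiringAction Γ L] {π : E →* Γ}
  {E' : Subgroup E} {y : E → L}

lemma smul_obstruction (hy : ∀ e ∈ E', ∀ f ∈ E', y (e * f) = y e * π e • y f)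
    (hy0 : ∀ e ∈ E', y e ≠ 0) {t : E} (hconj : ∀ e ∈ E', t⁻¹ * e * t ∈ E') (htt : t * t ∈ E') {W : L}
    (hWy : ∀ e ∈ E', y e * π e • W = W * π t • y (t⁻¹ * e * t)) {e : E} (he : e ∈ E' ∨ e = t) :
    π e • (W * π t • W) * y (t * t) = W * π t • W * π e • y (t * t) := by
  rcases he with he | rfl
  · have h1 := hWy e he
    have h2 := congrArg (π t • ·) (hWy _ (hconj e he))
    simp only [smul_mul', smul_smul, ← map_mul] at h2 ⊢
    rw [show t * (t⁻¹ * e * t) = e * t by group] at h2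
    have h3 := hy _ htt _ (hconj _ (hconj e he))
    rw [show t * t * (t⁻¹ * (t⁻¹ * e * t) * t) = e * (t * t) by group, hy e he _ htt] at h3
    refine mul_left_cancel₀ (mul_ne_zero (hy0 e he)
      ((smul_ne_zero_iff_ne (π t)).mpr (hy0 _ (hconj e he)))) ?_
    calc _ = (y e * π e • W) * (π t • y (t⁻¹ * e * t) * π (e * t) • W) * y (t * t) := by ring
      _ = (W * π t • y (t⁻¹ * e * t)) * π t • W *
          (y (t * t) * π (t * t) • y (t⁻¹ * (t⁻¹ * e * t) * t)) := by rw [h1, h2]; ring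
      _ = _ := by rw [← h3]; ring
  · have h1 := hWy _ htt
    rw [show e⁻¹ * (e * e) * e = e * e by group] at h1
    rw [smul_mul', smul_smul, ← map_mul]
    calc _ = π e • W * (y (e * e) * π (e * e) • W) := by ring
      _ = _ := by rw [h1]; ring

end

/-- The norm step for crossed homomorphisms in an unramified extension. -/
lemma exists_crossed_step {Γ E : Type*} [Group Γ] [Group E] [Finite Γ] [Finite E] {π : E →* Γ}
    {K L : Type*} [Field K] [NumberField K] [Field L] [NumberField L] [Algebra K L]
    [MulSemiringAction Γ L] [IsGaloisGroup Γ K L] [IsTotallyReal L] (h : Unr Γ (𝓞 L)) {N : Subgroup Γ} [N.Normal]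
    (hN : ∀ g h : Γ, g ∉ N → h ∉ N → g * h ∈ N) (hπ : Function.Surjective π)
    {y : E → L} (hy : ∀ e ∈ N.comap π, ∀ f ∈ N.comap π, y (e * f) = y e * π e • y f)
    (hy0 : ∀ e ∈ N.comap π, y e ≠ 0)
    (hker : ∀ e t, π e = 1 → y (t⁻¹ * e * t) = y e) (hker' : ∀ e t : E, π e = 1 → π t • y e = y e)
    {t : E} (ht : t ∉ N.comap π) : ∃ W : L, W ≠ 0 ∧ W * π t • W = y (t * t) ∧
    ∀ e ∈ N.comap π, y e * π e • W = W * π t • y (t⁻¹ * e * t) := by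
  set E' := N.comap π with hE'
  have hmem : ∀ e, e ∈ E' ↔ π e ∈ N := fun e ↦ Iff.rfl
  have hconj : ∀ e ∈ E', t⁻¹ * e * t ∈ E' := fun e he ↦ by
    simpa using (inferInstance : E'.Normal).conj_mem e he t⁻¹
  have htt : t * t ∈ E' := by
    rw [hmem, map_mul]
    exact hN _ _ ht ht
  have hcoe : ∀ (g : Γ) (s : 𝓞 L), algebraMap (𝓞 L) L (g • s) = g • algebraMap (𝓞 L) L s :=
    fun g s ↦ rfl
  have hinj : Function.Injective (algebraMap (𝓞 L) L) := RingOfIntegers.coe_injective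
  have hsurj : ∀ g ∈ N, ∃ e ∈ E', π e = g := fun g hg ↦ by
    obtain ⟨e, rfl⟩ := hπ g
    exact ⟨e, hg, rfl⟩
  have h_int : ∀ (g : Γ) (m : ℤ) (S : Type _) [Ring S] [MulSemiringAction Γ S],
      g • (m : S) = m := fun g m S _ _ ↦ map_intCast (MulSemiringAction.toRingHom Γ S g) m
  obtain ⟨W₀, hW₀, hW₀y⟩ := exists_smul_eq_of_crossed (N := N) (E' := E') (π := π)
    (y := fun e ↦ π t • y (t⁻¹ * e * t) / y e) h hcoe hsurj (fun e he ↦ he) (fun e he f hf ↦ by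
      have h1 := hy0 e he
      have h2 := (smul_ne_zero_iff_ne (π e)).mpr (hy0 f hf)
      rw [show t⁻¹ * (e * f) * t = (t⁻¹ * e * t) * (t⁻¹ * f * t) by group, hy e he f hf,
        hy _ (hconj e he) _ (hconj f hf), smul_mul', smul_smul, ← map_mul,
        show t * (t⁻¹ * e * t) = e * t by group, map_mul, mul_smul, div_eq_mul_inv (π t • y _),
        div_eq_mul_inv (π t • y (t⁻¹ * f * t)), smul_mul', smul_inv'']
      field_simp) (fun e he h1 ↦ by
      rw [hker e t h1, hker' e t h1, div_self (hy0 e he)])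
  classical
  obtain ⟨c, hc0, hc⟩ := exists_integral_multiples ℤ ℚ
    (Set.toFinite (Set.range y ∪ {W₀})).toFinset
  simp only [Set.Finite.mem_toFinset] at hc
  choose z hz using fun e ↦ show ∃ z : 𝓞 L, algebraMap (𝓞 L) L z = c * y e from
    ⟨⟨_, hc (y e) (.inl ⟨e, rfl⟩)⟩, by simp [zsmul_eq_mul]⟩
  obtain ⟨w, hw⟩ : ∃ w : 𝓞 L, algebraMap (𝓞 L) L w = c * W₀ :=
    ⟨⟨_, hc W₀ (.inr rfl)⟩, by simp [zsmul_eq_mul]⟩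
  have hcL : (c : L) ≠ 0 := Int.cast_ne_zero.mpr hc0
  set W₁ := algebraMap (𝓞 L) L w with hW₁
  have hW₁0 : W₁ ≠ 0 := by
    rw [hw]
    exact mul_ne_zero hcL hW₀
  have hW₁y : ∀ e ∈ E', y e * π e • W₁ = W₁ * π t • y (t⁻¹ * e * t) := fun e he ↦ by
    have := hy0 e he
    rw [hw, smul_mul', h_int, hW₀y e he]
    field_simp
  have hz0 : ∀ e ∈ E', z e ≠ 0 := fun e he h0 ↦ mul_ne_zero hcL (hy0 e he) (by
    rw [← hz, h0, map_zero])
  obtain ⟨I, n, hn0, hn, hIN, hI⟩ := exists_ideal_mul_smul (S := 𝓞 L) (π := π) (z := z) (c := c)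
    (E' := E') hz0 (Int.cast_ne_zero.mpr hc0) (fun g ↦ h_int g c _) (fun e he f hf ↦ hinj (by
      rw [map_mul, map_mul, hcoe, hz, hz, hz, hy e he f hf, map_intCast, smul_mul', h_int]
      ring)) (fun J hJ ↦ ⟨Ideal.absNorm J, Ideal.absNorm_mem J, by
        rwa [Nat.cast_ne_zero, ne_eq, Ideal.absNorm_eq_zero_iff], fun g ↦ by
        exact_mod_cast h_int g (Ideal.absNorm J : ℤ) (𝓞 L)⟩) hsurj hconj htt (w := w)
    (fun e he ↦ hinj (by
      rw [map_mul, map_mul, hcoe, hcoe, hz, hz, smul_mul', h_int, ← hW₁]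
      linear_combination (c : L) * hW₁y e he))
  obtain ⟨B, hB⟩ : z (t * t) ∣ w * π t • w * c * n ^ 2 := by
    rw [← Ideal.mem_span_singleton]
    refine Ideal.mul_le_left (J := I * π t • I) ?_
    rw [hI]
    exact Ideal.mem_span_singleton_self _
  have hztt := hz0 _ htt
  have hIB : Ideal.span {B} = I * π t • I := by
    rw [hB, ← Ideal.span_singleton_mul_span_singleton] at hI
    refine (mul_left_cancel₀ ?_ hI).symm
    simpa [Ideal.zero_eq_bot] using hztt
  have hBL : algebraMap _ L B * y (t * t) = W₁ * π t • W₁ * (algebraMap _ L n) ^ 2 := by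
    have := congrArg (algebraMap (𝓞 L) L) hB
    simp only [map_mul, map_pow, hcoe, map_intCast, hz] at this
    refine mul_left_cancel₀ hcL ?_
    linear_combination -this
  have hnL : algebraMap _ L n ≠ 0 := (map_ne_zero_iff _ hinj).mpr hn0
  have hyt := hy0 _ htt
  have htW : ∀ g : Γ, g • W₁ ≠ 0 := fun g ↦ (smul_ne_zero_iff_ne _).mpr hW₁0
  have hBfix : ∀ e : E, e ∈ E' ∨ e = t → π e • B = B := fun e he ↦ hinj (by
    have h1 := smul_obstruction hy hy0 hconj htt hW₁y he
    have h2 := congrArg (π e • ·) hBL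
    simp only [smul_mul', smul_pow', ← hcoe, hn] at h2 h1 ⊢
    have h3 : π e • y (t * t) ≠ 0 := (smul_ne_zero_iff_ne _).mpr hyt
    refine mul_right_cancel₀ (mul_ne_zero h3 hyt) ?_
    linear_combination y (t * t) * h2 + algebraMap _ L n ^ 2 * h1 - π e • y (t * t) * hBL)
  have hBΓ : ∀ g : Γ, g • B = B := fun g ↦ by
    obtain ⟨e, rfl⟩ := hπ g
    by_cases he : e ∈ E'
    · exact hBfix e (.inl he)
    · have h1 : t⁻¹ * e ∈ E' := by
        rw [hmem, map_mul, map_inv]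
        exact hN _ _ (fun h ↦ ht (by simpa [hmem] using h)) he
      rw [show e = t * (t⁻¹ * e) by group, map_mul, mul_smul, hBfix _ (.inl h1), hBfix _ (.inr rfl)]
  have hB0 : B ≠ 0 := fun h0 ↦ by
    rw [h0, map_zero, zero_mul] at hBL
    exact mul_ne_zero (mul_ne_zero hW₁0 (htW _)) (pow_ne_zero 2 hnL) hBL.symm
  obtain ⟨b, a, hb0, ha0, hbN, haN, hab⟩ := exists_norm_eq_of_quotient (N := N) K
    (FixedPoints.intermediateField N : IntermediateField K L) (fun g x ↦ by
      exact IsGaloisGroup.algebraMap_smulOfNormal Γ _ L N g x) hN h ht hB0 hBΓ hIN hIB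
  have hbL : algebraMap _ L b ≠ 0 := (map_ne_zero_iff _ hinj).mpr hb0
  have haL : algebraMap _ L a ≠ 0 := (map_ne_zero_iff _ hinj).mpr ha0
  have hgb : ∀ g : Γ, g • algebraMap _ L b ≠ 0 := fun g ↦ (smul_ne_zero_iff_ne _).mpr hbL
  refine ⟨W₁ * (algebraMap _ L n * algebraMap _ L a) / algebraMap _ L b,
    div_ne_zero (mul_ne_zero hW₁0 (mul_ne_zero hnL haL)) hbL, ?_, fun e he ↦ ?_⟩
  · have h1 := congrArg (algebraMap (𝓞 L) L) hab
    simp only [map_mul, hcoe] at h1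
    have h2 := hgb (π t)
    rw [div_eq_mul_inv, smul_mul', smul_mul', smul_mul', smul_inv'', ← hcoe _ n, hn]
    field_simp
    have hBL0 : algebraMap _ L B ≠ 0 := (map_ne_zero_iff _ hinj).mpr hB0
    refine mul_left_cancel₀ hBL0 ?_
    rw [h1]
    linear_combination (-(algebraMap _ L B) * algebraMap _ L a * (π t • algebraMap _ L a)) * hBL
  · have h1 := hW₁y e he
    rw [div_eq_mul_inv, smul_mul', smul_mul', smul_mul', smul_inv'', ← hcoe _ n, ← hcoe _ a,
      ← hcoe _ b, hn, haN _ he, hbN _ he]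
    linear_combination (algebraMap _ L n * algebraMap _ L a * (algebraMap _ L b)⁻¹) * h1

end SumProd

namespace SumProd

open Pointwise nonZeroDivisors NumberField

lemma exists_index_two {Γ : Type*} [Group Γ] [Finite Γ] [Nontrivial Γ] (h : IsPGroup 2 Γ) :
    ∃ N : Subgroup Γ, N.index = 2 := by
  obtain ⟨n, hn⟩ := IsPGroup.iff_card.mp h
  obtain ⟨m, rfl⟩ : ∃ m, n = m + 1 := Nat.exists_eq_succ_of_ne_zero fun h0 ↦ by
    rw [h0, pow_zero] at hn
    exact Finite.one_lt_card.ne' hn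
  obtain ⟨N, hN⟩ := Sylow.exists_subgroup_card_pow_prime (G := Γ) 2 (n := m)
    (hn ▸ pow_dvd_pow 2 m.le_succ)
  refine ⟨N, ?_⟩
  have := N.card_mul_index
  rw [hN, hn, pow_succ] at this
  exact Nat.eq_of_mul_eq_mul_left (by positivity) this

/-- In an unramified Galois `2`-extension of totally real fields, central extensions of the Galois
group by a group of order two are split by crossed homomorphisms. -/
theorem exists_crossed {L : Type*} [Field L] [NumberField L] [IsTotallyReal L] (m : ℕ) :
    ∀ {Γ E : Type} [Group Γ] [Group E] [Finite Γ] [Finite E] [MulSemiringAction Γ L]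
    [FaithfulSMul Γ L], Nat.card Γ = m → IsPGroup 2 Γ → Unr Γ (𝓞 L) → ∀ {π : E →* Γ},
    Function.Surjective π → ∀ {ζ : E}, ζ ≠ 1 → (∀ e, π e = 1 ↔ e = 1 ∨ e = ζ) →
    (∀ e, e * ζ = ζ * e) →
    ∃ x : E → L, (∀ e, x e ≠ 0) ∧ (∀ e f, x (e * f) = x e * π e • x f) ∧ x ζ = -1 := by
  induction m using Nat.strong_induction_on with
  | _ m ih =>
  intro Γ E _ _ _ _ _ _ hm h2 hΓ π hπ ζ hζ hker hcen
  rcases subsingleton_or_nontrivial Γ with hs | hs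
  · classical
    have hE : ∀ e, e = 1 ∨ e = ζ := fun e ↦ (hker e).mp (Subsingleton.elim _ _)
    have hζζ : ζ * ζ = 1 := (hE (ζ * ζ)).resolve_right fun h ↦ hζ (by simpa using h)
    refine ⟨fun e ↦ if e = 1 then 1 else -1, fun e ↦ ?_, fun e f ↦ ?_, if_neg hζ⟩
    · dsimp only
      split_ifs <;> simp
    · rw [Subsingleton.elim (π e) 1, one_smul]
      rcases hE e with rfl | rfl <;> rcases hE f with rfl | rfl <;> simp [hζζ, hζ]
  obtain ⟨N, hN⟩ := exists_index_two h2
  have hNn : N.Normal := Subgroup.normal_of_index_eq_two hN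
  have hmul : ∀ g h : Γ, g ∉ N → h ∉ N → g * h ∈ N := fun g h hg hh ↦ by
    rw [Subgroup.mul_mem_iff_of_index_two hN]
    simp [hg, hh]
  have hcard : Nat.card N < m := by
    have := N.card_mul_index
    rw [hN, hm] at this
    have h3 : 0 < Nat.card N := Nat.card_pos
    omega
  have hζE : ζ ∈ N.comap π := by
    rw [Subgroup.mem_comap, (hker ζ).mpr (.inr rfl)]
    exact N.one_mem
  obtain ⟨y, hy0, hy, hyζ⟩ := ih _ hcard (Γ := N) (E := N.comap π) rfl (h2.to_subgroup N)
    (hΓ.subgroup N) (π := (π.comp (N.comap π).subtype).codRestrict N fun e ↦ e.2)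
    (fun g ↦ by
      obtain ⟨e, he⟩ := hπ g
      exact ⟨⟨e, by rw [Subgroup.mem_comap, he]; exact g.2⟩, Subtype.ext he⟩) (ζ := ⟨ζ, hζE⟩)
    (fun h ↦ hζ (congrArg Subtype.val h)) (fun e ↦ by
      rw [Subtype.ext_iff, Subtype.ext_iff, Subtype.ext_iff]
      exact hker e) (fun e ↦ Subtype.ext (hcen e))
  classical
  let Y : E → L := fun e ↦ if h : e ∈ N.comap π then y ⟨e, h⟩ else 1
  have hY : ∀ (e : E) (h : e ∈ N.comap π), Y e = y ⟨e, h⟩ := fun e h ↦ dif_pos h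
  have hYmul : ∀ e ∈ N.comap π, ∀ f ∈ N.comap π, Y (e * f) = Y e * π e • Y f := fun e he f hf ↦ by
    rw [hY _ he, hY _ hf, hY _ (mul_mem he hf)]
    exact hy ⟨e, he⟩ ⟨f, hf⟩
  have hY0 : ∀ e ∈ N.comap π, Y e ≠ 0 := fun e he ↦ by
    rw [hY _ he]
    exact hy0 _
  have hYζ : Y ζ = -1 := by rw [hY _ hζE, hyζ]
  have hY1 : Y 1 = 1 := by
    have h1 := hYmul 1 (one_mem _) 1 (one_mem _)
    rw [mul_one, map_one, one_smul] at h1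
    exact mul_left_cancel₀ (hY0 1 (one_mem _)) (by rw [← h1, mul_one])
  obtain ⟨τ, hτ⟩ : ∃ τ, τ ∉ N := by
    by_contra! h
    rw [(Subgroup.eq_top_iff' N).mpr h, Subgroup.index_top] at hN
    omega
  obtain ⟨t, rfl⟩ := hπ τ
  obtain ⟨W, hW0, hW, hWy⟩ := exists_crossed_step (K := FixedPoints.subfield Γ L) hΓ hmul hπ hYmul hY0
    (fun e t he ↦ by
      rcases (hker e).mp he with rfl | rfl
      · simp
      · rw [mul_assoc, ← hcen, inv_mul_cancel_left])
    (fun e t he ↦ by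
      rcases (hker e).mp he with rfl | rfl
      · rw [hY1, smul_one]
      · rw [hYζ, smul_neg, smul_one]) (t := t) hτ
  obtain ⟨x, hx0, hx, hxY⟩ := crossed_glue hYmul (fun e f he hf ↦ by
    rw [Subgroup.mem_comap, map_mul]
    exact hmul _ _ he hf) (t := t) hτ hW hWy hY0 hW0
  exact ⟨x, hx0, hx, by rw [hxY _ hζE, hYζ]⟩

end SumProd

namespace SumProd

open Module

section

/-- A stable subgroup of a `2`-group action on an abelian group of exponent two, larger than another
one, contains an element outside of it that is invariant modulo it. -/
lemma exists_invariant_mod {G : Type*} [Group G] [Finite G]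
    (h2 : ∀ H : Subgroup G, Nontrivial H → ∃ N : Subgroup H, N.index = 2)
    {X : Type*} [AddCommGroup X] (ρ : G →* AddMonoid.End X) {U P : AddSubgroup X}
    (hX : ∀ x ∈ P, x + x ∈ U) (hU : ∀ g, ∀ x ∈ U, ρ g x ∈ U) (hP : ∀ g, ∀ x ∈ P, ρ g x ∈ P)
    {x : X} (hxP : x ∈ P) (hxU : x ∉ U) : ∃ y ∈ P, y ∉ U ∧ ∀ g, ρ g y - y ∈ U := by
  suffices H : ∀ m, ∀ H : Subgroup G, Nat.card H = m → ∃ y ∈ P, y ∉ U ∧ ∀ g ∈ H, ρ g y - y ∈ U by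
    obtain ⟨y, h⟩ := H _ ⊤ rfl
    exact ⟨y, h.1, h.2.1, fun g ↦ h.2.2 g trivial⟩
  intro m
  induction m using Nat.strong_induction_on with
  | _ m ih =>
  intro H hH
  rcases subsingleton_or_nontrivial H with hs | hs
  · refine ⟨x, hxP, hxU, fun g hg ↦ ?_⟩
    have : g = 1 := congrArg Subtype.val (Subsingleton.elim (⟨g, hg⟩ : H) 1)
    rw [this, map_one, AddMonoid.End.one_apply, sub_self]
    exact U.zero_mem
  obtain ⟨N, hN⟩ := h2 H hs
  have hcard : Nat.card (N.map H.subtype) < m := by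
    rw [Nat.card_congr (N.equivMapOfInjective _ H.subtype_injective).symm.toEquiv]
    have := N.card_mul_index
    rw [hN, hH] at this
    have h3 : 0 < Nat.card N := Nat.card_pos
    omega
  obtain ⟨y, hyP, hyU, hy⟩ := ih _ hcard (N.map H.subtype) rfl
  have hyN : ∀ g : H, g ∈ N → ρ g y - y ∈ U := fun g hg ↦ hy g ⟨g, hg, rfl⟩
  by_cases hall : ∀ g ∈ H, ρ g y - y ∈ U
  · exact ⟨y, hyP, hyU, hall⟩
  push Not at hall
  obtain ⟨t, htH, ht⟩ := hall
  set τ : H := ⟨t, htH⟩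
  have hmul : ∀ g h : H, (g * h ∈ N ↔ (g ∈ N ↔ h ∈ N)) := fun g h ↦
    Subgroup.mul_mem_iff_of_index_two hN
  have hτ : τ ∉ N := fun h ↦ ht (hyN τ h)
  have hmulρ : ∀ (g h : G) z, ρ (g * h) z = ρ g (ρ h z) := fun g h z ↦ by rw [map_mul]; rfl
  have key : ∀ g : H, (g ∈ N → ρ g (ρ t y) - ρ t y ∈ U) ∧ (g ∉ N → ρ g y - ρ t y ∈ U) := fun g ↦ by
    have h1 : ∀ g : H, τ⁻¹ * g ∈ N → ρ g y - ρ t y ∈ U := fun g hg ↦ by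
      have := hU t _ (hyN _ hg)
      rwa [map_sub, ← hmulρ, Subgroup.coe_mul, Subgroup.coe_inv, mul_inv_cancel_left] at this
    refine ⟨fun hg ↦ ?_, fun hg ↦ ?_⟩
    · have := h1 (g * τ) (by simp [hmul, hg, hτ])
      rwa [Subgroup.coe_mul, hmulρ] at this
    · exact h1 g (by simp [hmul, hg, hτ])
  refine ⟨ρ t y - y, P.sub_mem (hP t y hyP) hyP, ht, fun g hg ↦ ?_⟩
  by_cases hgN : (⟨g, hg⟩ : H) ∈ N
  · have h3 := U.sub_mem ((key ⟨g, hg⟩).1 hgN) (hyN _ hgN)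
    rw [map_sub]
    convert h3 using 1
    abel
  · have h3 := (key ⟨g, hg⟩).2 hgN
    have h4 := hyN (⟨g, hg⟩ * τ) (by simp [hmul, hgN, hτ])
    rw [Subgroup.coe_mul, hmulρ] at h4
    have h5 := hX _ (P.sub_mem (hP t y hyP) hyP)
    rw [map_sub]
    convert U.sub_mem (U.sub_mem h4 h3) h5 using 1
    abel

end

section

variable {F G W W' : Type*} [Field F] [Group G] [AddCommGroup W] [Module F W] [AddCommGroup W']
  [Module F W']

/-- The socle series of a representation relative to a subspace. -/
def soc (ρ : Representation F G W) (U : Submodule F W) : ℕ → Submodule F W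
  | 0 => U
  | n + 1 => ⨅ g, (soc ρ U n).comap (ρ g - 1)

variable {ρ : Representation F G W} {U : Submodule F W} {ρ' : Representation F G W'}
  {U' : Submodule F W'}

lemma mem_soc_succ {n : ℕ} {w : W} : w ∈ soc ρ U (n + 1) ↔ ∀ g, ρ g w - w ∈ soc ρ U n := by
  simp [soc]

lemma apply_mem_soc (hU : ∀ g, ∀ u ∈ U, ρ g u ∈ U) {n : ℕ} (g : G) {w : W} (hw : w ∈ soc ρ U n) :
    ρ g w ∈ soc ρ U n := by
  cases n with
  | zero => exact hU g w hw
  | succ n =>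
    rw [mem_soc_succ] at hw ⊢
    intro h
    convert Submodule.sub_mem _ (hw (h * g)) (hw g) using 1
    rw [map_mul, Module.End.mul_apply]
    abel

lemma soc_le_succ (hU : ∀ g, ∀ u ∈ U, ρ g u ∈ U) (n : ℕ) : soc ρ U n ≤ soc ρ U (n + 1) :=
  fun _ hw ↦ mem_soc_succ.2 fun g ↦ Submodule.sub_mem _ (apply_mem_soc hU g hw) hw

lemma le_soc (hU : ∀ g, ∀ u ∈ U, ρ g u ∈ U) (n : ℕ) : U ≤ soc ρ U n := by
  induction n with
  | zero => exact le_rfl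
  | succ n ih => exact ih.trans (soc_le_succ hU n)

lemma map_mem_soc {T : W →ₗ[F] W'} (hT : ∀ g w, T (ρ g w) = ρ' g (T w)) (hTU : ∀ w ∈ U, T w ∈ U')
    {n : ℕ} : ∀ {w : W}, w ∈ soc ρ U n → T w ∈ soc ρ' U' n := by
  induction n with
  | zero => exact hTU _
  | succ n ih =>
    intro w hw
    rw [mem_soc_succ] at hw ⊢
    intro g
    rw [← hT, ← map_sub]
    exact ih (hw g)

lemma mem_of_map_mem_soc {T : W →ₗ[F] W'} (hT : ∀ g w, T (ρ g w) = ρ' g (T w))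
    (hTU : ∀ w, T w ∈ U' → w ∈ U) {n : ℕ} : ∀ {w : W}, T w ∈ soc ρ' U' n → w ∈ soc ρ U n := by
  induction n with
  | zero => exact hTU _
  | succ n ih =>
    intro w hw
    rw [mem_soc_succ] at hw ⊢
    intro g
    apply ih
    rw [map_sub, hT]
    exact hw g

lemma soc_soc (k n : ℕ) : soc ρ (soc ρ U k) n = soc ρ U (n + k) := by
  induction n with
  | zero => rw [zero_add]; rfl
  | succ n ih => rw [Nat.add_right_comm]; ext w; rw [mem_soc_succ, mem_soc_succ, ih]

lemma soc_mono {U₂ : Submodule F W} (h : U ≤ U₂) (n : ℕ) : soc ρ U n ≤ soc ρ U₂ n :=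
  fun _ hw ↦ map_mem_soc (T := LinearMap.id) (fun _ _ ↦ rfl) (fun _ hw ↦ h hw) hw

variable (F G) in
/-- The coinduced representation of functions on a group. -/
def regRep (V : Type*) [AddCommGroup V] [Module F V] : Representation F G (G → V) where
  toFun g := LinearMap.funLeft F V (· * g)
  map_one' := by ext; simp [LinearMap.funLeft]
  map_mul' g h := by ext; simp [LinearMap.funLeft, mul_assoc]

variable {V : Type*} [AddCommGroup V] [Module F V]

@[simp] lemma regRep_apply (g h : G) (f : G → V) : regRep F G V g f h = f (h * g) := rfl

/-- The equivariant map to functions induced by a linear map. -/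
def toReg (ρ : Representation F G W) (l : W →ₗ[F] V) : W →ₗ[F] G → V :=
  LinearMap.pi fun g ↦ l ∘ₗ ρ g

@[simp] lemma toReg_apply (l : W →ₗ[F] V) (w : W) (g : G) : toReg ρ l w g = l (ρ g w) := rfl

lemma toReg_rho (l : W →ₗ[F] V) (g : G) (w : W) :
    toReg ρ l (ρ g w) = regRep F G V g (toReg ρ l w) := by
  ext h
  simp

lemma mem_of_toReg_eq_zero {l : W →ₗ[F] V} (hlS : ∀ w ∈ soc ρ U 1, l w = 0 → w ∈ U)
    {n : ℕ} : ∀ {w : W}, w ∈ soc ρ U n → toReg ρ l w = 0 → w ∈ U := by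
  induction n with
  | zero => exact fun hw _ ↦ hw
  | succ n ih =>
    intro w hw h0
    rw [mem_soc_succ] at hw
    refine hlS w (mem_soc_succ.2 fun g ↦ ih (hw g) ?_) ?_
    · rw [map_sub, toReg_rho, h0, map_zero, sub_zero]
    · simpa using congrFun h0 1

lemma exists_linearMap_of_finrank_le [FiniteDimensional F W] {U S : Submodule F W} {r : ℕ}
    (hUS : U ≤ S) (h : finrank F S ≤ finrank F U + r) :
    ∃ l : W →ₗ[F] (Fin r → F), (∀ u ∈ U, l u = 0) ∧ ∀ w ∈ S, l w = 0 → w ∈ U := by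
  set S' := S.map U.mkQ
  have h1 : finrank F S' ≤ finrank F (Fin r → F) := by
    have h2 := (U.mkQ.domRestrict S).finrank_range_add_finrank_ker
    have h3 : (U.mkQ.domRestrict S).range = S' := by
      ext; simp [S']
    have h4 : finrank F (U.mkQ.domRestrict S).ker = finrank F U := by
      rw [LinearMap.ker_domRestrict, Submodule.ker_mkQ]
      exact (Submodule.comapSubtypeEquivOfLe hUS).finrank_eq
    rw [h3, h4] at h2
    rw [finrank_fin_fun]
    omega
  obtain ⟨i, hi⟩ := finrank_le_iff_exists_linearMap.1 h1
  obtain ⟨j, hj⟩ := i.exists_extend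
  refine ⟨j ∘ₗ U.mkQ, fun u hu ↦ ?_, fun w hw h0 ↦ ?_⟩
  · simp [(Submodule.Quotient.mk_eq_zero U).2 hu]
  · have h2 : i ⟨U.mkQ w, Submodule.mem_map_of_mem hw⟩ = 0 := by
      rw [← hj]; exact h0
    have h3 := congrArg Subtype.val (hi (h2.trans (map_zero i).symm))
    exact (Submodule.Quotient.mk_eq_zero U).1 h3

lemma mem_soc_regRep {n : ℕ} {ι : Type*} {f : G → ι → F} :
    f ∈ soc (regRep F G (ι → F)) ⊥ n ↔ ∀ i, (fun g ↦ f g i) ∈ soc (regRep F G F) ⊥ n := by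
  induction n generalizing f with
  | zero =>
    simp only [soc, Submodule.mem_bot, funext_iff, Pi.zero_apply]
    exact forall_comm
  | succ n ih =>
    simp only [mem_soc_succ, ih]
    exact forall_comm

lemma finrank_soc_regRep [Finite G] (n r : ℕ) :
    finrank F (soc (regRep F G (Fin r → F)) ⊥ n) = r * finrank F (soc (regRep F G F) ⊥ n) := by
  let e : soc (regRep F G (Fin r → F)) ⊥ n ≃ₗ[F] Fin r → soc (regRep F G F) ⊥ n :=
    { toFun f i := ⟨fun g ↦ f.1 g i, mem_soc_regRep.1 f.2 i⟩
      invFun a := ⟨fun g i ↦ (a i).1 g, mem_soc_regRep.2 fun i ↦ (a i).2⟩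
      map_add' _ _ := rfl
      map_smul' _ _ := rfl }
  rw [e.finrank_eq, finrank_pi_fintype]
  simp

lemma mem_soc_regRep_one {f : G → V} : f ∈ soc (regRep F G V) ⊥ 1 ↔ ∀ g, f g = f 1 := by
  rw [mem_soc_succ]
  simp only [soc, Submodule.mem_bot, sub_eq_zero, funext_iff, regRep_apply]
  exact ⟨fun h g ↦ by simpa using h g 1, fun h g k ↦ (h _).trans (h k).symm⟩

lemma apply_mem_bot {g : G} : ∀ w ∈ (⊥ : Submodule F W), ρ g w ∈ (⊥ : Submodule F W) := by
  simp

lemma one_le_finrank_soc [Finite G] : 1 ≤ finrank F (soc (regRep F G F) ⊥ 1) := by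
  refine Nat.one_le_iff_ne_zero.2 fun h ↦ ?_
  have h1 := Submodule.finrank_eq_zero.1 h
  have h2 : (1 : G → F) ∈ soc (regRep F G F) ⊥ 1 := mem_soc_regRep_one.2 fun g ↦ rfl
  rw [h1] at h2
  exact one_ne_zero ((Submodule.mem_bot F).1 h2)

/-- The inequality between the dimensions of the socle series behind the theorem of Golod and
Shafarevich. -/
lemma finrank_soc_le [Finite G] {d r : ℕ} {P : (G → F) →ₗ[F] (G → Fin d → F)}
    (hP : ∀ g f, P (regRep F G F g f) = regRep F G (Fin d → F) g (P f))
    (hker : ∀ f, P f = 0 ↔ f ∈ soc (regRep F G F) ⊥ 1)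
    (hinv : soc (regRep F G (Fin d → F)) ⊥ 1 ≤ P.range)
    (hr : finrank F (soc (regRep F G (Fin d → F)) P.range 1) ≤ finrank F P.range + r) (n : ℕ) :
    d * finrank F (soc (regRep F G F) ⊥ (n + 1)) + 1 ≤
      finrank F (soc (regRep F G F) ⊥ (n + 2)) + r * finrank F (soc (regRep F G F) ⊥ n) := by
  have := Fintype.ofFinite G
  have hst : ∀ g, ∀ u ∈ P.range, regRep F G (Fin d → F) g u ∈ P.range := by
    rintro g _ ⟨f, rfl⟩
    exact ⟨_, hP g f⟩
  obtain ⟨l, hl0, hl⟩ := exists_linearMap_of_finrank_le (le_soc hst 1) hr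
  set L := toReg (regRep F G (Fin d → F)) l
  have hL0 : ∀ u ∈ P.range, L u = 0 := fun u hu ↦ funext fun g ↦ hl0 _ (hst g u hu)
  set S := soc (regRep F G (Fin d → F)) ⊥ (n + 1)
  have hS : S ≤ soc (regRep F G (Fin d → F)) P.range n := by
    have := soc_soc (ρ := regRep F G (Fin d → F)) (U := ⊥) 1 n
    rw [show S = _ from this.symm]
    exact soc_mono hinv n
  have h1 := (L.domRestrict S).finrank_range_add_finrank_ker
  have h2 : (L.domRestrict S).range ≤ soc (regRep F G (Fin r → F)) ⊥ n := by
    rintro _ ⟨w, rfl⟩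
    exact map_mem_soc (fun g w ↦ toReg_rho l g w) (fun w hw ↦ by simpa using hL0 w hw) (hS w.2)
  have h3 := Submodule.finrank_mono h2
  set S₂ := soc (regRep F G F) ⊥ (n + 2)
  have h4 := (P.domRestrict S₂).finrank_range_add_finrank_ker
  have h5 : (L.domRestrict S).ker.map S.subtype ≤ (P.domRestrict S₂).range := by
    rintro _ ⟨w, hw, rfl⟩
    obtain ⟨f, hf⟩ := mem_of_toReg_eq_zero hl (hS w.2) hw
    refine ⟨⟨f, ?_⟩, hf⟩
    have h6 : P f ∈ S := by rw [hf]; exact w.2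
    change f ∈ soc _ _ (n + 1 + 1)
    rw [← soc_soc]
    exact mem_of_map_mem_soc hP (fun w hw ↦ (hker w).1 hw) h6
  have h6 := Submodule.finrank_mono h5
  rw [(Submodule.equivMapOfInjective _ S.subtype_injective _).finrank_eq.symm] at h6
  have h7 : 1 ≤ finrank F (P.domRestrict S₂).ker := by
    refine Nat.one_le_iff_ne_zero.2 fun h ↦ ?_
    have h8 := Submodule.finrank_eq_zero.1 h
    have h9 : (1 : G → F) ∈ soc (regRep F G F) ⊥ 1 := mem_soc_regRep_one.2 fun g ↦ rfl
    have h10 : (1 : G → F) ∈ S₂ := by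
      change _ ∈ soc _ _ (n + 1 + 1)
      rw [← soc_soc]
      refine le_soc (fun g u hu ↦ ?_) _ h9
      exact apply_mem_soc (fun g ↦ apply_mem_bot) g hu
    have h11 : (⟨1, h10⟩ : S₂) ∈ (P.domRestrict S₂).ker := (hker 1).2 h9
    rw [h8, Submodule.mem_bot] at h11
    exact one_ne_zero (congrArg Subtype.val h11)
  rw [finrank_soc_regRep] at h1 h3
  omega

end

section

variable {G : Type*} [Group G] [Finite G]

lemma finrank_le_of_forall_eq {X T : Type*} [AddCommGroup X] [Module (ZMod 2) X] [Finite X]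
    {U S : Submodule (ZMod 2) X} {r : ℕ} [Finite T] (hT : Nat.card T ≤ 2 ^ r) (inv : X → T)
    (h : ∀ w ∈ S, ∀ w' ∈ S, inv w = inv w' → w - w' ∈ U) :
    finrank (ZMod 2) S ≤ finrank (ZMod 2) U + r := by
  classical
  have h1 : ∀ t : T, ∃ w : X, (∃ w ∈ S, inv w = t) → w ∈ S ∧ inv w = t := fun t ↦ by
    by_cases ht : ∃ w ∈ S, inv w = t
    · obtain ⟨w, hw⟩ := ht
      exact ⟨w, fun _ ↦ hw⟩
    · exact ⟨0, fun h ↦ absurd h ht⟩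
  choose s hs using h1
  have h2 : ∀ w : S, (w : X) - s (inv w) ∈ U := fun w ↦
    have h3 := hs (inv w) ⟨w, w.2, rfl⟩
    h _ w.2 _ h3.1 h3.2.symm
  have h3 : Nat.card S ≤ Nat.card (T × U) := by
    refine Nat.card_le_card_of_injective (fun w : S ↦ (inv w, (⟨_, h2 w⟩ : U))) fun w w' hw ↦ ?_
    simp only [Prod.mk.injEq, Subtype.mk.injEq] at hw
    rw [hw.1] at hw
    exact Subtype.ext (sub_left_injective hw.2)
  have h4 (Y : Submodule (ZMod 2) X) : Nat.card Y = 2 ^ finrank (ZMod 2) Y := by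
    rw [Module.natCard_eq_pow_finrank (K := ZMod 2), Nat.card_zmod]
  rw [Nat.card_prod, h4, h4] at h3
  have h5 := h3.trans (Nat.mul_le_mul_right _ hT)
  rw [← pow_add] at h5
  have := (Nat.pow_le_pow_iff_right (by norm_num)).1 h5
  omega

/-- The theorem of Golod and Shafarevich, in a form avoiding group cohomology: a finite `2`-group
with `d₀` independent characters of order two does not have few relations. -/
theorem golodShafarevich (h2 : ∀ H : Subgroup G, Nontrivial H → ∃ N : Subgroup H, N.index = 2)
    {d₀ r : ℕ} (hdr : r + 4 ≤ 2 * d₀) {χ : Fin d₀ → G → ZMod 2}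
    (hχ : ∀ i g h, χ i (g * h) = χ i g + χ i h) (hli : LinearIndependent (ZMod 2) χ)
    (H : ∀ (d : ℕ) (P : (G → ZMod 2) →ₗ[ZMod 2] (G → Fin d → ZMod 2)),
      (∀ g f, P (regRep (ZMod 2) G (ZMod 2) g f) = regRep (ZMod 2) G (Fin d → ZMod 2) g (P f)) →
      (∀ f, P f = 0 ↔ ∀ g, f g = f 1) → (∀ w, (∀ g, w g = w 1) → w ∈ P.range) →
      ∃ (T : Type) (_ : Finite T) (inv : (G → Fin d → ZMod 2) → T), Nat.card T ≤ 2 ^ r ∧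
        ∀ w w', (∀ g, regRep (ZMod 2) G (Fin d → ZMod 2) g w - w ∈ P.range) →
          (∀ g, regRep (ZMod 2) G (Fin d → ZMod 2) g w' - w' ∈ P.range) →
          inv w = inv w' → w - w' ∈ P.range) : False := by
  set b : ℕ → ℕ := fun n ↦ finrank (ZMod 2) (soc (regRep (ZMod 2) G (ZMod 2)) ⊥ n) with hb
  set S₁ := soc (regRep (ZMod 2) G (ZMod 2)) ⊥ 1
  set S₂ := soc (regRep (ZMod 2) G (ZMod 2)) ⊥ 2
  have hb0 : b 0 = 0 := finrank_bot _ _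
  have hb1 : b 1 = 1 := by
    refine le_antisymm (le_trans ?_ (finrank_self (ZMod 2)).le) one_le_finrank_soc
    refine LinearMap.finrank_le_finrank_of_injective
      (f := (LinearMap.proj 1 : (G → ZMod 2) →ₗ[ZMod 2] ZMod 2).domRestrict S₁) fun f f' h ↦ ?_
    refine Subtype.ext (funext fun g ↦ ?_)
    rw [mem_soc_regRep_one.1 f.2 g, mem_soc_regRep_one.1 f'.2 g]
    exact h
  have hS12 : S₁ ≤ S₂ := soc_le_succ (fun _ ↦ apply_mem_bot) 1
  have hS2 : ∀ f, (∀ g h, f (g * h) - f g = f h - f 1) → f ∈ S₂ := fun f hf ↦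
    mem_soc_succ.2 fun g ↦ mem_soc_regRep_one.2 fun h ↦ by simp [hf]
  have hb2 : d₀ + 1 ≤ b 2 := by
    set e := (LinearMap.proj 1 : (G → ZMod 2) →ₗ[ZMod 2] ZMod 2).domRestrict S₂
    have h3 := e.finrank_range_add_finrank_ker
    have h4 : e.range = ⊤ := by
      refine LinearMap.range_eq_top.2 fun c ↦ ⟨⟨fun _ ↦ c, hS2 _ fun _ _ ↦ by simp⟩, rfl⟩
    have h5 : Submodule.span (ZMod 2) (Set.range χ) ≤ e.ker.map S₂.subtype := by
      refine Submodule.span_le.2 ?_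
      rintro _ ⟨i, rfl⟩
      have h6 : χ i 1 = 0 := by simpa using hχ i 1 1
      exact ⟨⟨χ i, hS2 _ fun g h ↦ by rw [hχ, h6]; ring⟩, h6, rfl⟩
    have h6 := Submodule.finrank_mono h5
    rw [finrank_span_eq_card hli, (Submodule.equivMapOfInjective _
      S₂.subtype_injective _).finrank_eq.symm, Fintype.card_fin] at h6
    rw [h4, finrank_top, finrank_self] at h3
    change _ ≤ finrank _ S₂
    omega
  obtain ⟨d, hd⟩ : ∃ d, b 2 = d + 1 := ⟨b 2 - 1, by omega⟩
  obtain ⟨l, hl0, hl⟩ := exists_linearMap_of_finrank_le hS12 (r := d)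
    (show b 2 ≤ b 1 + d by omega)
  have hlsurj : ∀ v, ∃ f ∈ S₂, l f = v := by
    have h3 := (l.domRestrict S₂).finrank_range_add_finrank_ker
    have h4 : (l.domRestrict S₂).ker.map S₂.subtype ≤ S₁ := by
      rintro _ ⟨f, hf, rfl⟩
      exact hl _ f.2 hf
    have h5 := Submodule.finrank_mono h4
    rw [(Submodule.equivMapOfInjective _ S₂.subtype_injective _).finrank_eq.symm] at h5
    change _ ≤ b 1 at h5
    change _ = b 2 at h3
    have h6 : (l.domRestrict S₂).range = ⊤ :=
      Submodule.eq_top_of_finrank_eq (le_antisymm (Submodule.finrank_le _)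
        (by rw [finrank_fin_fun]; omega))
    intro v
    obtain ⟨f, hf⟩ := LinearMap.range_eq_top.1 h6 v
    exact ⟨f, f.2, hf⟩
  set P := toReg (regRep (ZMod 2) G (ZMod 2)) l
  have hst : ∀ g, ∀ u ∈ S₁, regRep (ZMod 2) G (ZMod 2) g u ∈ S₁ := fun g u hu ↦
    apply_mem_soc (fun _ ↦ apply_mem_bot) g hu
  have hP : ∀ g f, P (regRep (ZMod 2) G (ZMod 2) g f) =
    regRep (ZMod 2) G (Fin d → ZMod 2) g (P f) := toReg_rho l
  have hPker : ∀ f, P f = 0 ↔ f ∈ S₁ := by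
    refine fun f ↦ ⟨fun hf ↦ ?_, fun hf ↦ funext fun g ↦ hl0 _ (hst g f hf)⟩
    by_contra hfS
    let ρ : G →* AddMonoid.End (G → ZMod 2) :=
      { toFun g := (regRep (ZMod 2) G (ZMod 2) g).toAddMonoidHom
        map_one' := by rw [map_one]; rfl
        map_mul' g h := by rw [map_mul]; rfl }
    obtain ⟨y, hy, hyS, hyi⟩ := exists_invariant_mod h2 ρ (U := S₁.toAddSubgroup)
      (P := P.ker.toAddSubgroup) (fun x _ ↦ by
        have : x + x = 0 := funext fun _ ↦ CharTwo.add_self_eq_zero _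
        rw [this]; exact zero_mem _) (fun g x hx ↦ hst g x hx) (fun g x hx ↦ by
        change P _ = 0
        change P x = 0 at hx
        refine (hP g x).trans ?_
        rw [hx, map_zero]) (x := f) hf hfS
    refine hyS (hl y (mem_soc_succ.2 hyi) ?_)
    have := congrFun (show P y = 0 from hy) 1
    simpa [P] using this
  have hPinv : ∀ w, (∀ g, w g = w 1) → w ∈ P.range := fun w hw ↦ by
    obtain ⟨f, hf, hfw⟩ := hlsurj (w 1)
    refine ⟨f, funext fun g ↦ ?_⟩
    rw [hw g, ← hfw, toReg_apply, ← sub_eq_zero, ← map_sub]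
    exact hl0 _ (mem_soc_succ.1 hf g)
  obtain ⟨T, _, inv, hT, hinv⟩ := H d P hP (fun f ↦ (hPker f).trans mem_soc_regRep_one) hPinv
  have key := finrank_soc_le hP hPker (fun w hw ↦ hPinv w (mem_soc_regRep_one.1 hw))
    (finrank_le_of_forall_eq hT inv fun w hw w' hw' h ↦
      hinv w w' (mem_soc_succ.1 hw) (mem_soc_succ.1 hw') h)
  replace key : ∀ n, d * b (n + 1) + 1 ≤ b (n + 2) + r * b n := key
  have hgrow : ∀ n, 2 * b n + 1 ≤ b (n + 1) := by
    intro n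
    induction n with
    | zero => simp [hb0, hb1]
    | succ n ih =>
      have h3 := key n
      obtain ⟨c, rfl⟩ : ∃ c, d = c + 2 := ⟨d - 2, by omega⟩
      have h4 : r * b n ≤ (2 * c) * b n := Nat.mul_le_mul_right _ (by omega)
      have h5 := Nat.mul_le_mul_left c ih
      change _ ≤ b (n + 2)
      nlinarith
  have hle : ∀ n, n ≤ b n := by
    intro n
    induction n with
    | zero => simp
    | succ n ih => have := hgrow n; omega
  have := hle (finrank (ZMod 2) (G → ZMod 2) + 1)
  have h3 := Submodule.finrank_le
    (soc (regRep (ZMod 2) G (ZMod 2)) ⊥ (finrank (ZMod 2) (G → ZMod 2) + 1))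
  change b _ ≤ _ at h3
  omega

end

end SumProd

namespace SumProd

open Pointwise nonZeroDivisors NumberField

section

variable {G : Type} [Group G] {d : ℕ} {P : (G → ZMod 2) →ₗ[ZMod 2] (G → Fin d → ZMod 2)}

/-- The pairs of a group element and a function which form the extension of the group belonging to an
element that is invariant modulo the image of `P`. -/
def ExtPair (P : (G → ZMod 2) →ₗ[ZMod 2] (G → Fin d → ZMod 2)) (w : G → Fin d → ZMod 2) (g : G)
    (f : G → ZMod 2) : Prop :=
  regRep (ZMod 2) G (Fin d → ZMod 2) g w - w = P f

lemma regRep_one_apply {V : Type*} [AddCommGroup V] [Module (ZMod 2) V] (f : G → V) :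
    regRep (ZMod 2) G V 1 f = f := by rw [map_one]; rfl

lemma regRep_mul_apply {V : Type*} [AddCommGroup V] [Module (ZMod 2) V] (g h : G) (f : G → V) :
    regRep (ZMod 2) G V (g * h) f = regRep (ZMod 2) G V g (regRep (ZMod 2) G V h f) := by
  rw [map_mul]; rfl

lemma ExtPair.mul
    (hP : ∀ g f, P (regRep (ZMod 2) G (ZMod 2) g f) = regRep (ZMod 2) G (Fin d → ZMod 2) g (P f))
    {w : G → Fin d → ZMod 2} {g h : G} {f f' : G → ZMod 2} (h1 : ExtPair P w g f)
    (h2 : ExtPair P w h f') : ExtPair P w (g * h) (f + regRep (ZMod 2) G (ZMod 2) g f') := by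
  unfold ExtPair at *
  rw [regRep_mul_apply, map_add, hP, ← h1, ← h2, map_sub]
  abel

lemma ExtPair.inv
    (hP : ∀ g f, P (regRep (ZMod 2) G (ZMod 2) g f) = regRep (ZMod 2) G (Fin d → ZMod 2) g (P f))
    {w : G → Fin d → ZMod 2} {g : G} {f : G → ZMod 2} (h1 : ExtPair P w g f) :
    ExtPair P w g⁻¹ (-regRep (ZMod 2) G (ZMod 2) g⁻¹ f) := by
  unfold ExtPair at *
  rw [map_neg, hP, ← h1, map_sub, ← regRep_mul_apply, inv_mul_cancel, regRep_one_apply]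
  abel

lemma ExtPair.one (w : G → Fin d → ZMod 2) : ExtPair P w 1 0 := by
  rw [ExtPair, regRep_one_apply, sub_self, map_zero]

/-- The group structure on the extension of a group. -/
abbrev extGroup
    (hP : ∀ g f, P (regRep (ZMod 2) G (ZMod 2) g f) = regRep (ZMod 2) G (Fin d → ZMod 2) g (P f))
    (w : G → Fin d → ZMod 2) :
    Group {p : G × (G → ZMod 2) // ExtPair P w p.1 p.2} :=
  letI : Mul {p : G × (G → ZMod 2) // ExtPair P w p.1 p.2} :=
    ⟨fun p q ↦ ⟨(p.1.1 * q.1.1, p.1.2 + regRep (ZMod 2) G (ZMod 2) p.1.1 q.1.2), p.2.mul hP q.2⟩⟩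
  letI : Inv {p : G × (G → ZMod 2) // ExtPair P w p.1 p.2} :=
    ⟨fun p ↦ ⟨(p.1.1⁻¹, -regRep (ZMod 2) G (ZMod 2) p.1.1⁻¹ p.1.2), p.2.inv hP⟩⟩
  letI : One {p : G × (G → ZMod 2) // ExtPair P w p.1 p.2} := ⟨⟨(1, 0), ExtPair.one w⟩⟩
  Group.ofLeftAxioms
    (fun a b c ↦ Subtype.ext (Prod.ext (mul_assoc _ _ _) (by
      change a.1.2 + regRep _ _ _ _ _ + regRep _ _ _ (_ * _) _ =
        a.1.2 + regRep _ _ _ _ (b.1.2 + regRep _ _ _ _ _)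
      rw [regRep_mul_apply, map_add, add_assoc])))
    (fun a ↦ Subtype.ext (Prod.ext (one_mul _) (by
      change 0 + regRep _ _ _ 1 _ = _
      rw [regRep_one_apply, zero_add])))
    (fun a ↦ Subtype.ext (Prod.ext (inv_mul_cancel _) (by
      change -regRep _ _ _ _ _ + regRep _ _ _ _ _ = 0
      exact neg_add_cancel _)))

lemma ExtPair.add_one
    (hPker : ∀ f, P f = 0 ↔ ∀ g, f g = f 1)
    {w : G → Fin d → ZMod 2} {g : G} {f : G → ZMod 2} (h1 : ExtPair P w g f) :
    ExtPair P w g (f + 1) := by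
  unfold ExtPair at *
  rw [map_add, (hPker 1).2 fun _ ↦ rfl, add_zero, h1]

lemma ExtPair.eq_or_eq
    (hPker : ∀ f, P f = 0 ↔ ∀ g, f g = f 1)
    {w : G → Fin d → ZMod 2} {g : G} {f f' : G → ZMod 2} (h1 : ExtPair P w g f)
    (h2 : ExtPair P w g f') : f' = f ∨ f' = f + 1 := by
  unfold ExtPair at *
  have h3 := (hPker (f' - f)).1 (by rw [map_sub, ← h1, ← h2, sub_self])
  have h4 : ∀ c : ZMod 2, c = 0 ∨ c = 1 := by decide
  rcases h4 ((f' - f) 1) with h5 | h5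
  · left
    ext g
    exact sub_eq_zero.1 ((h3 g).trans h5)
  · right
    ext g
    have := (h3 g).trans h5
    rw [Pi.sub_apply, sub_eq_iff_eq_add] at this
    rw [this, Pi.add_apply, Pi.one_apply, add_comm]

variable {L : Type*} [Field L] [MulSemiringAction G L]

/-- A crossed homomorphism on the extension belonging to `w`, which splits it, together with an
element `α` measuring the squares of its values. -/
structure IsCrossed (P : (G → ZMod 2) →ₗ[ZMod 2] (G → Fin d → ZMod 2)) (w : G → Fin d → ZMod 2)
    (α : L) (x : G → (G → ZMod 2) → L) : Prop where
  ne_zero' : α ≠ 0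
  ne_zero : ∀ {g f}, ExtPair P w g f → x g f ≠ 0
  mul : ∀ {g f h f'}, ExtPair P w g f → ExtPair P w h f' →
    x (g * h) (f + regRep (ZMod 2) G (ZMod 2) g f') = x g f * g • x h f'
  sign : x 1 1 = -1
  smul : ∀ {g f}, ExtPair P w g f → g • α = α * x g f ^ 2

lemma exists_isCrossed
    (hP : ∀ g f, P (regRep (ZMod 2) G (ZMod 2) g f) = regRep (ZMod 2) G (Fin d → ZMod 2) g (P f))
    (hPker : ∀ f, P f = 0 ↔ ∀ g, f g = f 1)
    [Finite G] [NumberField L] [IsTotallyReal L] [FaithfulSMul G L]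
    (hG : IsPGroup 2 G) (hunr : Unr G (𝓞 L)) {w : G → Fin d → ZMod 2}
    (hw : ∀ g, regRep (ZMod 2) G (Fin d → ZMod 2) g w - w ∈ P.range) :
    ∃ (α : L) (x : G → (G → ZMod 2) → L), IsCrossed P w α x := by
  classical
  let E := {p : G × (G → ZMod 2) // ExtPair P w p.1 p.2}
  let : Group E := extGroup hP w
  let π : E →* G := ⟨⟨fun p ↦ p.1.1, rfl⟩, fun _ _ ↦ rfl⟩
  have hζE : ExtPair P w 1 1 := by simpa using (ExtPair.one w).add_one hPker
  let ζ : E := ⟨(1, 1), hζE⟩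
  have hπ : Function.Surjective π := fun g ↦ by
    obtain ⟨f, hf⟩ := hw g
    exact ⟨⟨(g, f), hf.symm⟩, rfl⟩
  have hζ1 : ζ ≠ 1 := fun h ↦
    absurd (congrFun (congrArg (fun e : E ↦ e.1.2) h) 1) (by change ¬((1 : ZMod 2) = 0); decide)
  obtain ⟨x, hx0, hx, hxζ⟩ := exists_crossed (L := L) _ rfl hG hunr hπ (ζ := ζ) hζ1
    (fun e ↦ by
      refine ⟨fun h ↦ ?_, by rintro (rfl | rfl) <;> rfl⟩
      obtain ⟨⟨g, f⟩, hf⟩ := e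
      obtain rfl : g = 1 := h
      rcases (ExtPair.one w).eq_or_eq hPker hf with h | h
      · exact Or.inl (Subtype.ext (Prod.ext rfl h))
      · exact Or.inr (Subtype.ext (Prod.ext rfl (h.trans (zero_add _)))))
    (fun e ↦ Subtype.ext (Prod.ext ((mul_one _).trans (one_mul _).symm) (by
      change e.1.2 + regRep _ _ _ _ 1 = 1 + regRep _ _ _ 1 e.1.2
      rw [regRep_one_apply, add_comm]
      rfl)))
  have hζ2 : ∀ e, π e = 1 → x e ^ 2 = 1 := by
    intro e he
    have h11 : x 1 = 1 := by
      have := hx 1 1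
      rw [mul_one, map_one, one_smul] at this
      exact (mul_left_cancel₀ (hx0 1) (by rw [mul_one, ← this])).symm
    obtain ⟨⟨g, f⟩, hf⟩ := e
    obtain rfl : g = 1 := he
    rcases (ExtPair.one w).eq_or_eq hPker hf with h | h
    · rw [show (⟨(1, f), hf⟩ : E) = 1 from Subtype.ext (Prod.ext rfl h), h11, one_pow]
    · rw [show (⟨(1, f), hf⟩ : E) = ζ from Subtype.ext (Prod.ext rfl (h.trans (zero_add _))), hxζ]
      ring
  obtain ⟨α, hα0, hα⟩ := exists_smul_eq_of_crossed (N := ⊤) (E' := ⊤) (π := π)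
    (y := fun e ↦ x e ^ 2) hunr (fun _ _ ↦ rfl) (fun g _ ↦ ⟨_, trivial, (hπ g).choose_spec⟩)
    (fun _ _ ↦ trivial) (fun e _ f _ ↦ by rw [hx, mul_pow, smul_pow']) (fun e _ ↦ hζ2 e)
  refine ⟨α, fun g f ↦ if h : ExtPair P w g f then x ⟨(g, f), h⟩ else 0, hα0, fun h ↦ ?_,
    fun h h' ↦ ?_, ?_, fun h ↦ ?_⟩
  · rw [dif_pos h]
    exact hx0 _
  · rw [dif_pos h, dif_pos h', dif_pos (h.mul hP h')]
    exact hx ⟨(_, _), h⟩ ⟨(_, _), h'⟩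
  · rw [dif_pos hζE, hxζ]
  · rw [dif_pos h, mul_comm]
    exact hα ⟨(_, _), h⟩ trivial

lemma IsCrossed.add_one
    (hPker : ∀ f, P f = 0 ↔ ∀ g, f g = f 1)
    {w : G → Fin d → ZMod 2} {α : L} {x : G → (G → ZMod 2) → L}
    (h : IsCrossed P w α x) {g : G} {f : G → ZMod 2} (hf : ExtPair P w g f) :
    x g (f + 1) = -x g f := by
  have h1 : ExtPair P w 1 1 := by simpa using (ExtPair.one w).add_one hPker
  have := h.mul h1 hf
  rwa [one_mul, regRep_one_apply, one_smul, h.sign, neg_one_mul, add_comm 1] at this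

/-- Elements whose measuring elements differ by the product of an invariant and a square are
congruent modulo the image of `P`. -/
lemma IsCrossed.sub_mem_range
    (hP : ∀ g f, P (regRep (ZMod 2) G (ZMod 2) g f) = regRep (ZMod 2) G (Fin d → ZMod 2) g (P f))
    (hPker : ∀ f, P f = 0 ↔ ∀ g, f g = f 1)
    [CharZero L] (hPinv : ∀ w, (∀ g, w g = w 1) → w ∈ P.range)
    {w w' : G → Fin d → ZMod 2} {α α' : L} {x x' : G → (G → ZMod 2) → L}
    (hw : ∀ g, regRep (ZMod 2) G (Fin d → ZMod 2) g w - w ∈ P.range)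
    (hw' : ∀ g, regRep (ZMod 2) G (Fin d → ZMod 2) g w' - w' ∈ P.range)
    (h : IsCrossed P w α x) (h' : IsCrossed P w' α' x') {β γ : L} (hβ : ∀ g : G, g • β = β)
    (hαα : α = β * γ ^ 2 * α') : w - w' ∈ P.range := by
  have hγ0 : γ ≠ 0 := by
    rintro rfl
    exact h.ne_zero' (by rw [hαα]; ring)
  have hβ0 : β ≠ 0 := by
    rintro rfl
    exact h.ne_zero' (by rw [hαα]; ring)
  have hgγ : ∀ g : G, g • γ ≠ 0 := fun g ↦ (smul_ne_zero_iff_ne _).mpr hγ0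
  have hex : ∀ g, ∃ f f', ExtPair P w g f ∧ ExtPair P w' g f' ∧ x g f * γ = g • γ * x' g f' := by
    intro g
    obtain ⟨f, hf⟩ := hw g
    obtain ⟨f', hf'⟩ := hw' g
    replace hf : ExtPair P w g f := hf.symm
    replace hf' : ExtPair P w' g f' := hf'.symm
    have h1 := h.smul hf
    have h2 := h'.smul hf'
    rw [hαα, smul_mul', smul_mul', hβ, h2, smul_pow'] at h1
    have h3 : (g • γ * x' g f') ^ 2 = (x g f * γ) ^ 2 := by
      refine mul_left_cancel₀ (mul_ne_zero hβ0 h'.ne_zero') ?_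
      linear_combination h1
    rcases sq_eq_sq_iff_eq_or_eq_neg.1 h3 with h4 | h4
    · exact ⟨f, f', hf, hf', h4.symm⟩
    · exact ⟨f, f' + 1, hf, hf'.add_one hPker, by rw [h'.add_one hPker hf', mul_neg, h4, neg_neg]⟩
  have huniq : ∀ {g f₁ f₁' f₂ f₂'}, ExtPair P w g f₁ → ExtPair P w' g f₁' →
      x g f₁ * γ = g • γ * x' g f₁' → ExtPair P w g f₂ → ExtPair P w' g f₂' →
      x g f₂ * γ = g • γ * x' g f₂' → f₁ - f₁' = f₂ - f₂' := by
    intro g f₁ f₁' f₂ f₂' h1 h1' e1 h2 h2' e2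
    have hne : x g f₁ * γ ≠ 0 := mul_ne_zero (h.ne_zero h1) hγ0
    rcases h1.eq_or_eq hPker h2 with rfl | rfl <;> rcases h1'.eq_or_eq hPker h2' with rfl | rfl
    · rfl
    · rw [h'.add_one hPker h1', mul_neg, ← e1] at e2
      exact absurd (self_eq_neg.1 e2) hne
    · rw [h.add_one hPker h1, neg_mul, ← e1] at e2
      exact absurd (neg_eq_self.1 e2) hne
    · abel
  choose f f' hf hf' hff using hex
  have hmul : ∀ g g₂ : G, f (g * g₂) - f' (g * g₂) =
      f g - f' g + regRep (ZMod 2) G (ZMod 2) g (f g₂ - f' g₂) := by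
    intro g g₂
    rw [huniq (hf _) (hf' _) (hff _) ((hf g).mul hP (hf g₂)) ((hf' g).mul hP (hf' g₂)), map_sub]
    · abel
    rw [h.mul (hf g) (hf g₂), h'.mul (hf' g) (hf' g₂), mul_smul]
    have h1 := congrArg (g • ·) (hff g₂)
    simp only [smul_mul'] at h1
    refine mul_left_cancel₀ (hgγ g) ?_
    linear_combination (g • x g₂ (f g₂)) * (g • γ) * hff g + (g • γ) * x' g (f' g) * h1
  set y : G → ZMod 2 := fun g ↦ (f g - f' g) 1
  have hy : ∀ g, f g - f' g = regRep (ZMod 2) G (ZMod 2) g y - y := by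
    intro g
    ext k
    have := congrFun (hmul k g) 1
    simp only [Pi.add_apply, regRep_apply, one_mul] at this
    simp only [Pi.sub_apply, regRep_apply, y] at this ⊢
    rw [this]
    ring
  have hfix : ∀ g, regRep (ZMod 2) G (Fin d → ZMod 2) g (w - w' - P y) = w - w' - P y := by
    intro g
    have h1 := congrArg P (hy g)
    rw [map_sub, map_sub, hP, ← hf g, ← hf' g] at h1
    rw [map_sub, map_sub, ← sub_eq_zero]
    rw [← sub_eq_zero] at h1
    rw [← h1]
    abel
  have h1 := hPinv (w - w' - P y) fun g ↦ by
    have := congrFun (hfix g) 1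
    rwa [regRep_apply, one_mul] at this
  have h2 := P.range.add_mem h1 (LinearMap.mem_range_self P y)
  rwa [sub_add_cancel] at h2

end

end SumProd

namespace SumProd

open Pointwise

section

variable {S : Type*} [CommRing S]

lemma two_dvd_sum_sq_sub {ι : Type*} (s : Finset ι) (f : ι → S) :
    2 ∣ (∑ i ∈ s, f i) ^ 2 - ∑ i ∈ s, f i ^ 2 := by
  classical
  induction s using Finset.induction_on with
  | empty => simp
  | insert i s hi ih =>
    rw [Finset.sum_insert hi, Finset.sum_insert hi]
    obtain ⟨c, hc⟩ := ih
    exact ⟨c + f i * ∑ j ∈ s, f j, by linear_combination hc⟩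

/-- In a ring whose quotient by `2` is finite and reduced, all elements are squares modulo `2`. -/
lemma exists_sq_add_two_mul [Finite (S ⧸ Ideal.span {(2 : S)})] (hS : ∀ x : S, 2 ∣ x ^ 2 → 2 ∣ x)
    (u : S) : ∃ s y, u = s ^ 2 + 2 * y := by
  have hmk : ∀ x y : S, (Ideal.Quotient.mk (Ideal.span {(2 : S)}) x = Ideal.Quotient.mk _ y ↔
      2 ∣ x - y) := fun x y ↦ by rw [Ideal.Quotient.mk_eq_mk_iff_sub_mem, Ideal.mem_span_singleton]
  have hinj : Function.Injective fun x : S ⧸ Ideal.span {(2 : S)} ↦ x ^ 2 := by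
    intro x y hxy
    obtain ⟨x, rfl⟩ := Ideal.Quotient.mk_surjective x
    obtain ⟨y, rfl⟩ := Ideal.Quotient.mk_surjective y
    simp only [← map_pow] at hxy
    rw [hmk] at hxy ⊢
    refine hS _ ?_
    obtain ⟨c, hc⟩ := hxy
    exact ⟨c + y ^ 2 - x * y, by linear_combination hc⟩
  obtain ⟨s, hs⟩ := Finite.surjective_of_injective hinj (Ideal.Quotient.mk _ u)
  obtain ⟨s, rfl⟩ := Ideal.Quotient.mk_surjective s
  simp only [← map_pow] at hs
  obtain ⟨y, hy⟩ := (hmk _ _).1 hs.symm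
  exact ⟨s, y, by linear_combination hy⟩

/-- `u` is congruent modulo `4` to `1 + 2 z` up to a square that is prime to `2`. -/
def TwoAdic (u z : S) : Prop :=
  ∃ s s' e t, s * s' = 1 + 2 * e ∧ u = s ^ 2 * (1 + 2 * z) + 4 * t

lemma TwoAdic.mul {u z u' z' : S} (h : TwoAdic u z) (h' : TwoAdic u' z') :
    TwoAdic (u * u') (z + z') := by
  obtain ⟨s, a, e, t, h1, rfl⟩ := h
  obtain ⟨s', a', e', t', h1', rfl⟩ := h'
  exact ⟨s * s', a * a', e + e' + 2 * e * e',
    s ^ 2 * s' ^ 2 * z * z' + t * s' ^ 2 * (1 + 2 * z') + t' * s ^ 2 * (1 + 2 * z) + 4 * t * t',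
    by linear_combination (s' * a') * h1 + (1 + 2 * e) * h1', by ring⟩

lemma two_smul_eq {G : Type*} [Group G] [MulSemiringAction G S] (g : G) : g • (2 : S) = 2 :=
  map_ofNat (MulSemiringAction.toRingHom G S g) 2

lemma four_smul_eq {G : Type*} [Group G] [MulSemiringAction G S] (g : G) : g • (4 : S) = 4 :=
  map_ofNat (MulSemiringAction.toRingHom G S g) 4

lemma TwoAdic.smul {G : Type*} [Group G] [MulSemiringAction G S] {u z : S} (h : TwoAdic u z) (g : G) :
    TwoAdic (g • u) (g • z) := by
  obtain ⟨s, a, e, t, h1, rfl⟩ := h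
  refine ⟨g • s, g • a, g • e, g • t, ?_, ?_⟩
  · rw [← smul_mul', h1, smul_add, smul_mul', smul_one, two_smul_eq]
  · simp only [smul_add, smul_mul', smul_one, smul_pow', two_smul_eq, four_smul_eq]

lemma TwoAdic.congr {u z z' : S} (h : TwoAdic u z) (hz : 2 ∣ z' - z) : TwoAdic u z' := by
  obtain ⟨s, a, e, t, h1, rfl⟩ := h
  obtain ⟨c, hc⟩ := hz
  exact ⟨s, a, e, t - s ^ 2 * c, h1, by linear_combination -2 * s ^ 2 * hc⟩

lemma TwoAdic.two_dvd (hS : ∀ x : S, 2 ∣ x ^ 2 → 2 ∣ x) (h0 : IsLeftRegular (2 : S)) {r z : S}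
    (h : TwoAdic (r ^ 2) z) : 2 ∣ z := by
  obtain ⟨s, a, e, t, h1, h2⟩ := h
  obtain ⟨c, hc⟩ := hS (r - s) ⟨s ^ 2 * z + 2 * t + s ^ 2 - r * s, by linear_combination h2⟩
  obtain rfl : r = s + 2 * c := by linear_combination hc
  have h3 : s ^ 2 * z = 2 * (c * s + c ^ 2 - t) := h0 (by
    change 2 * _ = 2 * _
    linear_combination -h2)
  exact ⟨a ^ 2 * (c * s + c ^ 2 - t) - 2 * (e + e ^ 2) * z, by
    linear_combination a ^ 2 * h3 - z * (s * a + 1 + 2 * e) * h1⟩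

lemma exists_twoAdic [Finite (S ⧸ Ideal.span {(2 : S)})] (hS : ∀ x : S, 2 ∣ x ^ 2 → 2 ∣ x)
    {u u' e : S} (hu : u * u' = 1 + 2 * e) : ∃ z, TwoAdic u z := by
  obtain ⟨s, y, rfl⟩ := exists_sq_add_two_mul hS u
  set s' := s * u'
  have h1 : s * s' = 1 + 2 * (e - y * u') := by
    simp only [s']
    linear_combination hu
  exact ⟨y * s' ^ 2, s, s', e - y * u', -2 * y * ((e - y * u') + (e - y * u') ^ 2), h1, by
    linear_combination (-2 * y) * (s * s' + 1 + 2 * (e - y * u')) * h1⟩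

variable {G R : Type*} [Group G] [Fintype G] [CommRing R] [Algebra R S] [MulSemiringAction G S]
  [Algebra.IsInvariant R S G] [SMulCommClass G R S]

lemma Unr.two_dvd_of_sq (hinj : Function.Injective (algebraMap R S)) (h : Unr G S)
    (hR : ∀ x : R, 2 ∣ x ^ 2 → 2 ∣ x) (x : S) (hx : 2 ∣ x ^ 2) : 2 ∣ x := by
  have hdesc : ∀ r : R, (2 : S) ∣ algebraMap R S r → 2 ∣ r := by
    rintro r ⟨y, hy⟩
    obtain ⟨t, ht⟩ := h.exists_trace_eq_one hinj
    obtain ⟨q, hq⟩ := Algebra.IsInvariant.isInvariant (A := R) (∑ g : G, g • (t * y))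
      fun g ↦ smul_sum_smul g _
    refine ⟨q, hinj ?_⟩
    rw [map_mul, hq, map_ofNat, Finset.mul_sum]
    calc _ = ∑ g : G, g • (t * algebraMap R S r) := by
          simp only [smul_mul', smul_algebraMap]
          rw [← Finset.sum_mul, ht, one_mul]
      _ = _ := Finset.sum_congr rfl fun g _ ↦ by
          rw [hy]
          simp only [smul_mul', two_smul_eq]
          ring
  obtain ⟨n, a, b, hab⟩ := h
  have hx1 := Unr.sum_eq hab fun g ↦ g • x
  rw [one_smul] at hx1
  rw [← hx1]
  refine Finset.dvd_sum fun i _ ↦ Dvd.dvd.mul_left ?_ _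
  simp only [← smul_mul']
  obtain ⟨r, hr⟩ := Algebra.IsInvariant.isInvariant (A := R) (∑ g : G, g • (x * b i))
    fun g ↦ smul_sum_smul g _
  rw [← hr]
  obtain ⟨c, hc⟩ := hR r (hdesc _ (by
    rw [map_pow, hr]
    refine (dvd_iff_dvd_of_dvd_sub (two_dvd_sum_sq_sub _ _)).2 (Finset.dvd_sum fun g _ ↦ ?_)
    obtain ⟨y, hy⟩ := hx
    rw [← smul_pow', mul_pow, hy]
    simp only [smul_mul', two_smul_eq, mul_assoc]
    exact dvd_mul_right _ _))
  exact ⟨algebraMap R S c, by rw [hc, map_mul, map_ofNat]⟩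

lemma Unr.exists_two_dvd_sub (hinj : Function.Injective (algebraMap R S)) (h : Unr G S) {z : S}
    (hz : ∀ g : G, 2 ∣ g • z - z) : ∃ r : R, 2 ∣ z - algebraMap R S r := by
  obtain ⟨t, ht⟩ := h.exists_trace_eq_one hinj
  obtain ⟨q, hq⟩ := Algebra.IsInvariant.isInvariant (A := R) (∑ g : G, g • (t * z))
    fun g ↦ smul_sum_smul g _
  refine ⟨q, ?_⟩
  have h1 : z - algebraMap R S q = -∑ g : G, g • t * (g • z - z) := by
    rw [hq]
    simp only [mul_sub, Finset.sum_sub_distrib, ← Finset.sum_mul, ht, smul_mul']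
    ring
  rw [h1]
  exact (Finset.dvd_sum fun g _ ↦ (hz g).mul_left _).neg_right

end

end SumProd

namespace SumProd

open Pointwise

section

variable {S : Type*} [CommRing S] [IsDedekindDomain S]

lemma exists_sq_mul_squarefree {I : Ideal S} (hI : I ≠ 0) :
    ∃ J N : Ideal S, Squarefree N ∧ I = J ^ 2 * N := by
  refine (_root_.wellFounded_dvdNotUnit (α := Ideal S)).induction (C := fun I : Ideal S ↦ I ≠ 0 →
    ∃ J N : Ideal S, Squarefree N ∧ I = J ^ 2 * N) I (fun I ih hI ↦ ?_) hI
  by_cases hsq : Squarefree I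
  · exact ⟨1, I, hsq, by ring⟩
  · unfold Squarefree at hsq
    push Not at hsq
    obtain ⟨P, ⟨T, rfl⟩, hP⟩ := hsq
    have hT : T ≠ 0 := right_ne_zero_of_mul hI
    obtain ⟨J, N, hN, h⟩ := ih T ⟨hT, P * P, fun h ↦ hP (isUnit_of_mul_isUnit_left h), by ring⟩ hT
    exact ⟨P * J, N, hN, by rw [h]; ring⟩

lemma squarefree_eq_of_sq_mul_eq {I J N N' : Ideal S} (hI : I ≠ 0) (hN : Squarefree N)
    (hN' : Squarefree N') (h : I ^ 2 * N = J ^ 2 * N') : N = N' := by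
  obtain ⟨A, B, C, hAB, rfl, rfl⟩ := UniqueFactorizationMonoid.exists_reduced_factors I hI J
  have hC : C ≠ 0 := left_ne_zero_of_mul hI
  have h1 : A ^ 2 * N = B ^ 2 * N' := by
    apply mul_left_cancel₀ (pow_ne_zero 2 hC)
    calc _ = (C * A) ^ 2 * N := by ring
      _ = _ := h
      _ = _ := by ring
  have key : ∀ {A B N N' : Ideal S}, IsRelPrime A B → Squarefree N' → A ^ 2 * N = B ^ 2 * N' →
      IsUnit A := by
    intro A B N N' hr hs h
    refine hs A ?_
    rw [← pow_two]
    exact hr.pow_left.pow_right.dvd_of_dvd_mul_left (Dvd.intro _ h)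
  have hA := key hAB hN' h1
  have hB := key hAB.symm hN h1.symm
  rw [Ideal.isUnit_iff] at hA hB
  rw [hA, hB] at h1
  simpa only [← Ideal.one_eq_top, one_pow, one_mul] using h1

lemma exists_coprime_of_span_eq_sq {u : S} (hu : u ≠ 0) {Y M : Ideal S} (hY : Ideal.span {u} = Y ^ 2)
    (hM : M ≠ 0) : ∃ a n v : S, a ≠ 0 ∧ n ≠ 0 ∧ v * n ^ 2 = u * a ^ 2 ∧
      Ideal.span {v} ⊔ M = ⊤ ∧ ∃ B : Ideal S, Ideal.span {v} = B ^ 2 := by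
  have hY0 : Y ≠ 0 := by
    rintro rfl
    rw [zero_pow two_ne_zero, Ideal.zero_eq_bot, Ideal.span_singleton_eq_bot] at hY
    exact hu hY
  obtain ⟨n, hn, hn0⟩ := Submodule.exists_mem_ne_zero_of_ne_bot hY0
  obtain ⟨Z, hZ⟩ : Y ∣ Ideal.span {n} := by
    rwa [Ideal.dvd_span_singleton]
  have hn' : Ideal.span {n} ≠ 0 := by
    rwa [Ideal.zero_eq_bot, Ne, Ideal.span_singleton_eq_bot]
  have hZ0 : Z ≠ 0 := by
    rintro rfl
    rw [mul_zero] at hZ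
    exact hn' hZ
  obtain ⟨a, ha⟩ := IsDedekindDomain.exists_sup_span_eq (I := Z * M) (J := Z) Ideal.mul_le_left
    (mul_ne_zero hZ0 hM)
  obtain rfl | ha0 := eq_or_ne a 0
  · refine ⟨1, 1, u, one_ne_zero, one_ne_zero, by ring, ?_, Y, hY⟩
    have h1 : Z * M = Z * 1 := by simpa using ha
    rw [mul_left_cancel₀ hZ0 h1, Ideal.one_eq_top, sup_top_eq]
  obtain ⟨B, hB⟩ : Z ∣ Ideal.span {a} := by
    rw [Ideal.dvd_span_singleton, ← ha]
    exact Ideal.mem_sup_right (Ideal.mem_span_singleton_self a)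
  have hMB : IsCoprime B M := by
    rw [Ideal.isCoprime_iff_sup_eq, sup_comm, ← Ideal.one_eq_top]
    apply mul_left_cancel₀ hZ0
    rw [Ideal.mul_sup, ← hB, ha, mul_one]
  have h1 : Ideal.span {u * a ^ 2} = Ideal.span {n ^ 2} * B ^ 2 := by
    rw [← Ideal.span_singleton_mul_span_singleton, ← Ideal.span_singleton_pow,
      ← Ideal.span_singleton_pow, hY, hB, hZ]
    ring
  obtain ⟨v, hv⟩ : n ^ 2 ∣ u * a ^ 2 := by
    rw [← Ideal.mem_span_singleton, ← Ideal.dvd_span_singleton, h1]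
    exact Dvd.intro _ rfl
  have hvB : Ideal.span {v} = B ^ 2 := by
    apply mul_left_cancel₀ (pow_ne_zero 2 hn')
    rw [Ideal.span_singleton_pow, ← h1, hv, Ideal.span_singleton_mul_span_singleton]
  refine ⟨a, n, v, ha0, hn0, by rw [hv]; ring, ?_, B, hvB⟩
  rw [hvB, ← Ideal.isCoprime_iff_sup_eq]
  exact hMB.pow_left

end

end SumProd

namespace SumProd

open Pointwise nonZeroDivisors

section

lemma relIndex_le_of_separates {A T : Type*} [CommGroup A] [Finite T] {D M : Subgroup A} (f : A → T)
    (hf : ∀ a ∈ M, ∀ b ∈ M, f a = f b → a / b ∈ D) :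
    D.relIndex M ≠ 0 ∧ D.relIndex M ≤ Nat.card T := by
  let g : M ⧸ D.subgroupOf M → T := fun c ↦ f c.out
  have hg : Function.Injective g := fun c d h ↦ by
    rw [← c.out_eq, ← d.out_eq]
    refine QuotientGroup.eq.2 ?_
    rw [Subgroup.mem_subgroupOf]
    have := hf _ d.out.2 _ c.out.2 h.symm
    rwa [div_eq_inv_mul] at this
  have : Finite (M ⧸ D.subgroupOf M) := Finite.of_injective g hg
  exact ⟨Nat.card_pos.ne', Nat.card_le_card_of_injective g hg⟩

lemma relIndex_sup_ne_zero_and_le {A : Type*} [CommGroup A] {K X Y : Subgroup A} {n : ℕ}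
    (hYX : Y ≤ X) (h : Y.relIndex X ≠ 0 ∧ Y.relIndex X ≤ n) :
    (K ⊔ Y).relIndex (K ⊔ X) ≠ 0 ∧ (K ⊔ Y).relIndex (K ⊔ X) ≤ n := by
  have h1 : K ⊔ X = X ⊔ (K ⊔ Y) := by
    rw [sup_comm K X, sup_comm K Y, ← sup_assoc, sup_eq_left.2 hYX]
  rw [h1, Subgroup.relIndex_sup_right]
  exact ⟨fun h0 ↦ h.1 (Subgroup.relIndex_eq_zero_of_le_left le_sup_right h0),
    (Subgroup.relIndex_le_of_le_left le_sup_right h.1).trans h.2⟩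

variable (G S L : Type*) [CommRing S] [Field L] [Algebra S L]

/-- The units which represent invariant classes modulo squares. -/
def stableUnits [Group G] [MulSemiringAction G L] : Subgroup Lˣ where
  carrier := {α | ∀ g : G, ∃ γ : L, g • (α : L) = α * γ ^ 2}
  one_mem' g := ⟨1, by simp⟩
  mul_mem' {α β} hα hβ g := by
    obtain ⟨γ, h⟩ := hα g
    obtain ⟨δ, h'⟩ := hβ g
    exact ⟨γ * δ, by rw [Units.val_mul, smul_mul', h, h']; ring⟩
  inv_mem' {α} hα g := by
    obtain ⟨γ, h⟩ := hα g
    exact ⟨γ⁻¹, by rw [Units.val_inv_eq_inv_val, smul_inv'', h, mul_inv, inv_pow]⟩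

/-- The units that up to squares generate the square of an ideal of `S`. -/
def evenUnits : Subgroup Lˣ where
  carrier := {α | ∃ (c : Lˣ) (u : S) (Y : Ideal S), (α : L) * c ^ 2 = algebraMap S L u ∧
    Ideal.span {u} = Y ^ 2}
  one_mem' := ⟨1, 1, 1, by simp, by rw [one_pow, Ideal.span_singleton_one, Ideal.one_eq_top]⟩
  mul_mem' {α β} := by
    rintro ⟨c, u, Y, h1, h2⟩ ⟨c', u', Y', h1', h2'⟩
    refine ⟨c * c', u * u', Y * Y', ?_, ?_⟩
    · rw [map_mul, ← h1, ← h1', Units.val_mul, Units.val_mul]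
      ring
    · rw [← Ideal.span_singleton_mul_span_singleton, h2, h2']
      ring
  inv_mem' {α} := by
    rintro ⟨c, u, Y, h1, h2⟩
    refine ⟨α * c, u, Y, ?_, h2⟩
    rw [← h1, Units.val_mul, Units.val_inv_eq_inv_val]
    field_simp

/-- The totally positive units. -/
def posUnits : Subgroup Lˣ where
  carrier := {α | ∀ φ : L →+* ℝ, 0 < φ α}
  one_mem' φ := by simp
  mul_mem' {α β} hα hβ φ := by
    rw [Units.val_mul, map_mul]
    exact mul_pos (hα φ) (hβ φ)
  inv_mem' {α} hα φ := by
    rw [Units.val_inv_eq_inv_val, map_inv₀]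
    exact inv_pos.2 (hα φ)

/-- The units whose square roots generate extensions that are unramified over all primes. -/
def goodUnits : Subgroup Lˣ where
  carrier := {α | ∀ P : Ideal S, P.IsPrime → ∃ s t : S, s ^ 2 - 4 * t ∉ P ∧ ∃ c : Lˣ,
    (α : L) * c ^ 2 = algebraMap S L (s ^ 2 - 4 * t)}
  one_mem' P hP := ⟨1, 0, by simpa using (Ideal.ne_top_iff_one P).1 hP.ne_top, 1, by simp⟩
  mul_mem' {α β} hα hβ P hP := by
    obtain ⟨s, t, h1, c, h2⟩ := hα P hP
    obtain ⟨s', t', h1', c', h2'⟩ := hβ P hP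
    have h3 : (s * s') ^ 2 - 4 * (s ^ 2 * t' + s' ^ 2 * t - 4 * t * t') =
        (s ^ 2 - 4 * t) * (s' ^ 2 - 4 * t') := by ring
    refine ⟨s * s', s ^ 2 * t' + s' ^ 2 * t - 4 * t * t', ?_, c * c', ?_⟩
    · rw [h3]
      exact fun h ↦ (hP.mem_or_mem h).elim h1 h1'
    · rw [h3, map_mul, ← h2, ← h2', Units.val_mul, Units.val_mul]
      ring
  inv_mem' {α} hα P hP := by
    obtain ⟨s, t, h1, c, h2⟩ := hα P hP
    refine ⟨s, t, h1, α * c, ?_⟩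
    rw [← h2, Units.val_mul, Units.val_inv_eq_inv_val]
    field_simp

end

section

variable {G R S k L : Type*} [Group G] [Finite G] [CommRing R] [IsDedekindDomain R] [CommRing S]
  [IsDedekindDomain S] [Field k] [Field L] [Algebra R S] [Algebra S L] [Algebra R k] [Algebra k L]
  [Algebra R L] [IsScalarTower R S L] [IsScalarTower R k L] [IsFractionRing S L] [IsFractionRing R k]
  [MulSemiringAction G S] [MulSemiringAction G L] [Algebra.IsInvariant R S G] [SMulCommClass G k L]

lemma range_le_stableUnits :
    (Units.map (algebraMap k L).toMonoidHom).range ≤ stableUnits G L := by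
  rintro _ ⟨a, rfl⟩ g
  exact ⟨1, by simp [smul_algebraMap]⟩

/-- Elements of invariant square class define ideals of the ground field modulo squares. -/
lemma exists_ideal_of_mem_stableUnits (hunr : Unr G S)
    (hsmul : ∀ (g : G) (s : S), algebraMap S L (g • s) = g • algebraMap S L s) {α : Lˣ}
    (hα : α ∈ stableUnits G L) : ∃ (c : Lˣ) (u : S) (Y : Ideal S) (N : Ideal R), N ≠ 0 ∧
      (α : L) * c ^ 2 = algebraMap S L u ∧
      Ideal.span {u} = Y ^ 2 * N.map (algebraMap R S) := by
  obtain ⟨x, y, hy, hxy⟩ := IsFractionRing.div_surjective (A := S) (α : L)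
  have hinj := IsFractionRing.injective S L
  have hy0 : algebraMap S L y ≠ 0 := by
    rw [Ne, map_eq_zero_iff _ hinj]
    exact nonZeroDivisors.ne_zero hy
  have hu : (α : L) * (Units.mk0 _ hy0 : Lˣ) ^ 2 = algebraMap S L (x * y) := by
    rw [← hxy, Units.val_mk0, map_mul]
    field_simp
  have hu0 : x * y ≠ 0 := by
    intro h
    rw [h, map_zero] at hu
    exact mul_ne_zero α.ne_zero (pow_ne_zero 2 (Units.ne_zero _)) hu
  have hI0 : Ideal.span {x * y} ≠ 0 := by
    rwa [Ideal.zero_eq_bot, Ne, Ideal.span_singleton_eq_bot]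
  obtain ⟨Y, N, hN, h⟩ := exists_sq_mul_squarefree hI0
  have hY0 : Y ≠ 0 := by
    rintro rfl
    rw [zero_pow two_ne_zero, zero_mul] at h
    exact hI0 h
  have hinv : ∀ g : G, g • N = N := by
    intro g
    obtain ⟨γ, hγ⟩ := hα g
    obtain ⟨p, q, hq, hpq⟩ := IsFractionRing.div_surjective (A := S)
      (γ * (g • algebraMap S L y) / algebraMap S L y)
    have hq0 : algebraMap S L q ≠ 0 := by
      rw [Ne, map_eq_zero_iff _ hinj]
      exact nonZeroDivisors.ne_zero hq
    have h1 : (g • (x * y)) * q ^ 2 = (x * y) * p ^ 2 := by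
      apply hinj
      rw [Units.val_mk0] at hu
      rw [map_mul, map_mul (algebraMap S L) (x * y), hsmul, ← hu, smul_mul', hγ, smul_pow', map_pow,
        map_pow]
      rw [div_eq_div_iff hq0 hy0] at hpq
      linear_combination (-α : L) * (γ * (g • algebraMap S L y) * algebraMap S L q +
        algebraMap S L p * algebraMap S L y) * hpq
    have hgN : Squarefree (g • N) := by
      intro J hJ
      obtain ⟨T, hT⟩ := hJ
      have := hN (g⁻¹ • J) ⟨g⁻¹ • T, by rw [← smul_mul', ← smul_mul', ← hT, inv_smul_smul]⟩
      rw [Ideal.isUnit_iff, Ideal.eq_top_iff_one, Ideal.mem_pointwise_smul_iff_inv_smul_mem,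
        smul_one] at this
      rwa [Ideal.isUnit_iff, Ideal.eq_top_iff_one]
    have h2 : (g • Y * Ideal.span {q}) ^ 2 * (g • N) = (Y * Ideal.span {p}) ^ 2 * N := by
      have h3 := congrArg (fun z ↦ Ideal.span {z}) h1
      simp only [← Ideal.span_singleton_mul_span_singleton, ← Ideal.span_singleton_pow] at h3
      rw [← smul_span_singleton, Ideal.span_singleton_mul_span_singleton, h, smul_mul',
        smul_pow'] at h3
      calc _ = _ := by ring
        _ = _ := h3
        _ = _ := by ring
    refine squarefree_eq_of_sq_mul_eq (mul_ne_zero ?_ ?_) hgN hN h2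
    · rwa [Ne, smul_eq_zero_iff_eq]
    · rw [Ideal.zero_eq_bot, Ne, Ideal.span_singleton_eq_bot]
      exact nonZeroDivisors.ne_zero hq
  have hmap := Unr.map_comap_eq (R := R) hunr hinv
  refine ⟨Units.mk0 _ hy0, x * y, Y, N.comap (algebraMap R S), ?_, hu, by rw [hmap, h]⟩
  intro h0
  rw [h0, Ideal.zero_eq_bot, Ideal.map_bot] at hmap
  rw [← hmap] at h
  exact hI0 (by rw [h, ← Ideal.zero_eq_bot, mul_zero])

variable (R S k L) in
lemma relIndex_evenUnits_le [Finite (ClassGroup R)] (hunr : Unr G S)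
    (hsmul : ∀ (g : G) (s : S), algebraMap S L (g • s) = g • algebraMap S L s) :
    ((Units.map (algebraMap k L).toMonoidHom).range ⊔ (stableUnits G L ⊓ evenUnits S L)).relIndex
      (stableUnits G L) ≠ 0 ∧
    ((Units.map (algebraMap k L).toMonoidHom).range ⊔ (stableUnits G L ⊓ evenUnits S L)).relIndex
      (stableUnits G L) ≤ Nat.card (ClassGroup R ⧸ (powMonoidHom 2 : ClassGroup R →* _).range) := by
  choose! c u Y N h1 h2 h3 using fun (α : Lˣ) (hα : α ∈ stableUnits G L) ↦
    exists_ideal_of_mem_stableUnits (R := R) hunr hsmul hα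
  classical
  refine relIndex_le_of_separates (fun α ↦ if h : α ∈ stableUnits G L then QuotientGroup.mk
    (ClassGroup.mk0 ⟨N α, mem_nonZeroDivisors_of_ne_zero (h1 α h)⟩) else 1) fun α hα β hβ h ↦ ?_
  simp only [dif_pos hα, dif_pos hβ] at h
  rw [QuotientGroup.eq] at h
  obtain ⟨C, hC⟩ := h
  obtain ⟨T, rfl⟩ := ClassGroup.mk0_surjective C
  rw [eq_inv_mul_iff_mul_eq, powMonoidHom_apply, ← map_pow, ← map_mul,
    ClassGroup.mk0_eq_mk0_iff] at hC
  obtain ⟨a, b, ha, hb, hab⟩ := hC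
  have hmap := congrArg (Ideal.map (algebraMap R S)) hab
  simp only [Submonoid.coe_mul, SubmonoidClass.coe_pow, Ideal.map_mul, Ideal.map_pow, Ideal.map_span,
    Set.image_singleton] at hmap
  have hk : ∀ a : R, a ≠ 0 → algebraMap R k a ≠ 0 := fun a ha ↦ by
    rwa [Ne, map_eq_zero_iff _ (IsFractionRing.injective R k)]
  set ab : kˣ := Units.mk0 _ (hk a ha) * Units.mk0 _ (hk b hb)
  set K := (Units.map (algebraMap k L).toMonoidHom).range
  have hab' : Units.map (algebraMap k L).toMonoidHom ab ∈ K := ⟨ab, rfl⟩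
  have hval : ((Units.map (algebraMap k L).toMonoidHom ab : Lˣ) : L) =
      algebraMap S L (algebraMap R S a * algebraMap R S b) := by
    rw [map_mul (algebraMap S L), ← IsScalarTower.algebraMap_apply, ← IsScalarTower.algebraMap_apply,
      IsScalarTower.algebraMap_apply R k L, IsScalarTower.algebraMap_apply R k L]
    simp [ab]
  set r := Units.map (algebraMap k L).toMonoidHom ab
  suffices α / β * r ∈ stableUnits G L ⊓ evenUnits S L by
    rw [← mul_div_cancel_right (α / β) r]
    exact Subgroup.div_mem _ (Subgroup.mem_sup_right this) (Subgroup.mem_sup_left hab')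
  refine ⟨Subgroup.mul_mem _ (Subgroup.div_mem _ hα hβ) (range_le_stableUnits hab'), c α * c β * β,
    u α * u β * (algebraMap R S a * algebraMap R S b), Y α * Y β * (N α).map (algebraMap R S) *
    Ideal.span {algebraMap R S a} * (T : Ideal R).map (algebraMap R S), ?_, ?_⟩
  · rw [map_mul, map_mul, ← h2 α hα, ← h2 β hβ, ← hval]
    simp only [Units.val_mul, Units.val_div_eq_div_val]
    field_simp
  · simp only [← Ideal.span_singleton_mul_span_singleton, h3 α hα, h3 β hβ]
    calc _ = Y α ^ 2 * (N α).map (algebraMap R S) * Y β ^ 2 * Ideal.span {algebraMap R S a} *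
          (Ideal.span {algebraMap R S b} * (N β).map (algebraMap R S)) := by ring
      _ = _ := by rw [← hmap]; ring

end

end SumProd

namespace SumProd

open Pointwise nonZeroDivisors NumberField

section

variable {G k L : Type*} [Group G] [Finite G] [Field k] [Field L] [NumberField k] [Algebra k L]
  [MulSemiringAction G L] [IsGaloisGroup G k L]

instance finite_ringHom_real : Finite (k →+* ℝ) :=
  Finite.of_injective (fun φ : k →+* ℝ ↦ Complex.ofRealHom.comp φ) fun φ ψ h ↦ by
    ext x
    exact Complex.ofReal_injective (congrArg (fun f : k →+* ℂ ↦ f x) h)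

variable (k) in
lemma card_ringHom_real_le : Nat.card (k →+* ℝ) ≤ Module.finrank ℚ k := by
  rw [← NumberField.Embeddings.card k ℂ, ← Nat.card_eq_fintype_card]
  refine Nat.card_le_card_of_injective (fun φ : k →+* ℝ ↦ Complex.ofRealHom.comp φ) fun φ ψ h ↦ ?_
  ext x
  exact Complex.ofReal_injective (congrArg (fun f : k →+* ℂ ↦ f x) h)

variable (G) in
lemma exists_smul_of_comp_eq (φ ψ : L →+* ℝ)
    (h : φ.comp (algebraMap k L) = ψ.comp (algebraMap k L)) :
    ∃ g : G, ∀ x, ψ x = φ (g • x) := by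
  have : IsGalois k L := IsGaloisGroup.isGalois G k L
  obtain ⟨σ, hσ⟩ := NumberField.ComplexEmbedding.exists_comp_symm_eq_of_comp_eq (k := k)
    (Complex.ofRealHom.comp φ) (Complex.ofRealHom.comp ψ)
    (by rw [RingHom.comp_assoc, h, RingHom.comp_assoc])
  refine ⟨(IsGaloisGroup.mulEquivAlgEquiv G k L).symm σ.symm, fun x ↦ ?_⟩
  have h1 := congrArg (fun f : L →+* ℂ ↦ f x) hσ
  have h2 : (IsGaloisGroup.mulEquivAlgEquiv G k L).symm σ.symm • x = σ.symm x := by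
    conv_rhs => rw [← (IsGaloisGroup.mulEquivAlgEquiv G k L).apply_symm_apply σ.symm]
    rfl
  rw [h2]
  exact Complex.ofReal_injective h1.symm

lemma pos_iff_of_mem_stableUnits {α : Lˣ} (hα : α ∈ stableUnits G L) {φ ψ : L →+* ℝ}
    (h : φ.comp (algebraMap k L) = ψ.comp (algebraMap k L)) : 0 < φ α ↔ 0 < ψ α := by
  obtain ⟨g, hg⟩ := exists_smul_of_comp_eq G φ ψ h
  obtain ⟨γ, hγ⟩ := hα g
  have h0 : φ γ ≠ 0 := by
    rw [Ne, map_eq_zero]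
    rintro rfl
    rw [zero_pow two_ne_zero, mul_zero, smul_eq_zero_iff_eq] at hγ
    exact α.ne_zero hγ
  rw [hg, hγ, map_mul, map_pow, mul_pos_iff_of_pos_right (by positivity)]

variable (k) in
lemma relIndex_posUnits_le {X : Subgroup Lˣ} (hX : X ≤ stableUnits G L) :
    (X ⊓ posUnits L).relIndex X ≠ 0 ∧
    (X ⊓ posUnits L).relIndex X ≤ 2 ^ Module.finrank ℚ k := by
  have h := relIndex_le_of_separates (D := X ⊓ posUnits L) (M := X)
    (fun α φ ↦ ∃ ψ : L →+* ℝ, ψ.comp (algebraMap k L) = φ ∧ 0 < ψ α : Lˣ → (k →+* ℝ) → Prop)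
    fun α hα β hβ hf ↦ ⟨Subgroup.div_mem _ hα hβ, fun φ ↦ ?_⟩
  · refine ⟨h.1, h.2.trans ?_⟩
    rw [Nat.card_fun, Nat.card_eq_fintype_card, Fintype.card_prop]
    exact Nat.pow_le_pow_right two_pos (card_ringHom_real_le k)
  have h1 := congrFun hf (φ.comp (algebraMap k L))
  have key : ∀ γ ∈ X, (∃ ψ : L →+* ℝ, ψ.comp (algebraMap k L) = φ.comp (algebraMap k L) ∧ 0 < ψ γ) ↔
      0 < φ γ := fun γ hγ ↦
    ⟨fun ⟨ψ, h2, h3⟩ ↦ (pos_iff_of_mem_stableUnits (hX hγ) h2).1 h3, fun h3 ↦ ⟨φ, rfl, h3⟩⟩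
  rw [eq_iff_iff, key α hα, key β hβ] at h1
  have hα0 : φ α ≠ 0 := (map_ne_zero φ).2 α.ne_zero
  have hβ0 : φ β ≠ 0 := (map_ne_zero φ).2 β.ne_zero
  rw [Units.val_div_eq_div_val, map_div₀]
  rcases hα0.lt_or_gt with h2 | h2
  · refine div_pos_of_neg_of_neg h2 (hβ0.lt_or_gt.resolve_right fun h3 ↦ ?_)
    exact (h1.2 h3).not_gt h2
  · exact div_pos h2 (h1.1 h2)

end

section

variable {S L : Type*} [CommRing S] [IsDedekindDomain S] [Field L] [Algebra S L] [IsFractionRing S L]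

/-- Even elements are represented up to squares by integers that are prime to a given ideal. -/
lemma exists_coprime_of_mem_evenUnits {α : Lˣ} (hα : α ∈ evenUnits S L) {M : Ideal S} (hM : M ≠ 0) :
    ∃ (c : Lˣ) (v : S), (α : L) * c ^ 2 = algebraMap S L v ∧ Ideal.span {v} ⊔ M = ⊤ := by
  obtain ⟨c, u, Y, h1, h2⟩ := hα
  have hinj := IsFractionRing.injective S L
  have hu : u ≠ 0 := by
    rintro rfl
    rw [map_zero] at h1
    exact mul_ne_zero α.ne_zero (pow_ne_zero 2 c.ne_zero) h1
  obtain ⟨a, n, v, ha, hn, h3, h4, -⟩ := exists_coprime_of_span_eq_sq hu h2 hM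
  have ha' : algebraMap S L a ≠ 0 := by rwa [Ne, map_eq_zero_iff _ hinj]
  have hn' : algebraMap S L n ≠ 0 := by rwa [Ne, map_eq_zero_iff _ hinj]
  refine ⟨c * Units.mk0 _ ha' / Units.mk0 _ hn', v, ?_, h4⟩
  have h5 := congrArg (algebraMap S L) h3
  simp only [map_mul, map_pow, ← h1] at h5
  simp only [Units.val_mul, Units.val_div_eq_div_val, Units.val_mk0]
  field_simp
  linear_combination -h5

/-- Even elements that are squares modulo `4` at the primes over `2` are good. -/
lemma mem_goodUnits_of_twoAdic [CharZero S] {α c : Lˣ} {u : S} (hα : α ∈ evenUnits S L)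
    (h1 : (α : L) * c ^ 2 = algebraMap S L u) (h2 : TwoAdic u 0) : α ∈ goodUnits S L := by
  obtain ⟨s, s', e, t, hs, hu⟩ := h2
  have hinj := IsFractionRing.injective S L
  have hu0 : u ≠ 0 := by
    rintro rfl
    rw [map_zero] at h1
    exact mul_ne_zero α.ne_zero (pow_ne_zero 2 c.ne_zero) h1
  have hu' : u = s ^ 2 - 4 * (-t) := by linear_combination hu
  intro P hP
  by_cases h2P : (2 : S) ∈ P
  · refine ⟨s, -t, ?_, c, by rw [h1, hu']⟩
    intro h
    have h3 : s ^ 2 ∈ P := by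
      have h4 : s ^ 2 = s ^ 2 - 4 * (-t) + 2 * (-2 * t) := by ring
      rw [h4]
      exact P.add_mem h (P.mul_mem_right _ h2P)
    have h4 : s * s' ∈ P := P.mul_mem_right _ (hP.mem_of_pow_mem _ h3)
    refine hP.ne_top ((Ideal.eq_top_iff_one P).2 ?_)
    have h5 : (1 : S) = s * s' - 2 * e := by linear_combination -hs
    rw [h5]
    exact P.sub_mem h4 (P.mul_mem_right _ h2P)
  · obtain rfl | hP0 := eq_or_ne P 0
    · refine ⟨s, -t, ?_, c, by rw [h1, hu']⟩
      rwa [← hu', Ideal.zero_eq_bot, Ideal.mem_bot]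
    · obtain ⟨d, v, h3, h4⟩ := exists_coprime_of_mem_evenUnits hα hP0
      have h20 : (2 : L) ≠ 0 := by
        rw [← map_ofNat (algebraMap S L), Ne, map_eq_zero_iff _ hinj]
        exact two_ne_zero
      refine ⟨0, -v, ?_, d * Units.mk0 2 h20, ?_⟩
      · intro h
        have h5 : 2 * (2 * v) ∈ P := by
          convert h using 1
          ring
        have h6 := ((hP.mem_or_mem ((hP.mem_or_mem h5).resolve_left h2P)).resolve_left h2P)
        rw [sup_eq_right.2 ((Ideal.span_singleton_le_iff_mem _).2 h6)] at h4
        exact hP.ne_top h4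
      · have h5 : (0 : S) ^ 2 - 4 * -v = 2 ^ 2 * v := by ring
        rw [h5, map_mul, ← h3, map_pow, map_ofNat]
        simp only [Units.val_mul, Units.val_mk0]
        ring

end

end SumProd

namespace SumProd

open Pointwise nonZeroDivisors NumberField

section

variable {G R S L : Type*} [Group G] [Fintype G] [CommRing R] [CommRing S]
  [IsDedekindDomain S] [CharZero S] [Field L] [Algebra R S] [Algebra S L]
  [IsFractionRing S L] [MulSemiringAction G S] [MulSemiringAction G L] [Algebra.IsInvariant R S G]
  [SMulCommClass G R S]

/-- The residue modulo `2` that describes an even element of invariant class modulo `4`. -/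
lemma exists_twoAdic_of_mem [Finite (S ⧸ Ideal.span {(2 : S)})] (hunr : Unr G S)
    (hinj : Function.Injective (algebraMap R S)) (hR : ∀ x : R, 2 ∣ x ^ 2 → 2 ∣ x)
    (hsmul : ∀ (g : G) (s : S), algebraMap S L (g • s) = g • algebraMap S L s) {α : Lˣ}
    (hα : α ∈ stableUnits G L) (hα' : α ∈ evenUnits S L) : ∃ (c : Lˣ) (u : S) (r : R),
      (α : L) * c ^ 2 = algebraMap S L u ∧ TwoAdic u (algebraMap R S r) := by
  have hS := Unr.two_dvd_of_sq hinj hunr hR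
  have h20 : Ideal.span {(2 : S)} ≠ 0 := by
    rw [Ideal.zero_eq_bot, Ne, Ideal.span_singleton_eq_bot]
    exact two_ne_zero
  obtain ⟨c, u, h1, h2⟩ := exists_coprime_of_mem_evenUnits hα' h20
  obtain ⟨e, u', hu⟩ : ∃ e u', u * u' = 1 + 2 * e := by
    have h3 := (Ideal.eq_top_iff_one _).1 h2
    rw [Ideal.mem_span_singleton_sup] at h3
    obtain ⟨a, b, hb, hab⟩ := h3
    obtain ⟨b, rfl⟩ := Ideal.mem_span_singleton.1 hb
    exact ⟨-b, a, by linear_combination hab⟩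
  obtain ⟨z, hz⟩ := exists_twoAdic hS hu
  obtain ⟨r, hr⟩ := Unr.exists_two_dvd_sub hinj hunr (z := z) fun g ↦ by
    obtain ⟨γ, hγ⟩ := hα g
    have h3 := (hz.smul g).mul hz
    have h4 : algebraMap S L (g • u * u) =
        (algebraMap S L u * (γ * (g • (c : L)) / c)) ^ 2 := by
      rw [map_mul, hsmul, ← h1, smul_mul', hγ, smul_pow']
      field_simp
    obtain ⟨q, hq⟩ : ∃ q : S, algebraMap S L q = algebraMap S L u * (γ * (g • (c : L)) / c) := by
      refine IsIntegrallyClosed.isIntegral_iff.1 (IsIntegral.of_pow two_pos ?_)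
      rw [← h4]
      exact isIntegral_algebraMap
    rw [← hq, ← map_pow] at h4
    rw [IsFractionRing.injective S L h4] at h3
    obtain ⟨y, hy⟩ := h3.two_dvd hS (mul_right_injective₀ two_ne_zero)
    exact ⟨y - z, by linear_combination hy⟩
  refine ⟨c, u, r, h1, hz.congr ?_⟩
  rwa [← dvd_neg, neg_sub]

variable (R S) in
lemma relIndex_goodUnits_le [Finite (S ⧸ Ideal.span {(2 : S)})] [Finite (R ⧸ Ideal.span {(2 : R)})]
    (hunr : Unr G S)
    (hinj : Function.Injective (algebraMap R S)) (hR : ∀ x : R, 2 ∣ x ^ 2 → 2 ∣ x)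
    (hsmul : ∀ (g : G) (s : S), algebraMap S L (g • s) = g • algebraMap S L s) :
    (stableUnits G L ⊓ evenUnits S L ⊓ posUnits L ⊓ goodUnits S L).relIndex
      (stableUnits G L ⊓ evenUnits S L ⊓ posUnits L) ≠ 0 ∧
    (stableUnits G L ⊓ evenUnits S L ⊓ posUnits L ⊓ goodUnits S L).relIndex
      (stableUnits G L ⊓ evenUnits S L ⊓ posUnits L) ≤ Nat.card (R ⧸ Ideal.span {(2 : R)}) := by
  choose! c u r h1 h2 using fun (α : Lˣ) (hα : α ∈ stableUnits G L ⊓ evenUnits S L ⊓ posUnits L) ↦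
    exists_twoAdic_of_mem (R := R) (S := S) hunr hinj hR hsmul hα.1.1 hα.1.2
  refine relIndex_le_of_separates (fun α ↦ Ideal.Quotient.mk _ (r α)) fun α hα β hβ h ↦
    ⟨Subgroup.div_mem _ hα hβ, ?_⟩
  rw [Ideal.Quotient.mk_eq_mk_iff_sub_mem, Ideal.mem_span_singleton] at h
  obtain ⟨y, hy⟩ := h
  refine mem_goodUnits_of_twoAdic (c := c α * c β * β) (u := u α * u β)
    (Subgroup.div_mem _ hα.1.2 hβ.1.2) ?_ (((h2 α hα).mul (h2 β hβ)).congr ?_)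
  · rw [map_mul, ← h1 α hα, ← h1 β hβ]
    simp only [Units.val_mul, Units.val_div_eq_div_val]
    field_simp
  · refine ⟨-algebraMap R S (y + r β), ?_⟩
    rw [← map_add, sub_eq_add_neg, ← map_neg, zero_add, ← map_neg, ← map_ofNat (algebraMap R S),
      ← map_mul]
    congr 1
    linear_combination -hy

end

section

variable {G k L : Type*} [Group G] [Fintype G] [Field k] [Field L] [NumberField k] [NumberField L]
  [Algebra k L] [MulSemiringAction G L] [IsGaloisGroup G k L]

lemma finite_quotient_two (k : Type*) [Field k] [NumberField k] :
    Finite (𝓞 k ⧸ Ideal.span {(2 : 𝓞 k)}) :=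
  Ideal.finiteQuotientOfFreeOfNeBot _ (by
    rw [Ne, Ideal.span_singleton_eq_bot]
    exact two_ne_zero)

lemma card_quotient_two (k : Type*) [Field k] [NumberField k] :
    Nat.card (𝓞 k ⧸ Ideal.span {(2 : 𝓞 k)}) = 2 ^ Module.finrank ℚ k := by
  have h := Ideal.absNorm_span_singleton (2 : 𝓞 k)
  rw [← map_ofNat (algebraMap ℤ (𝓞 k)), Algebra.norm_algebraMap, RingOfIntegers.rank,
    map_ofNat] at h
  rw [← Submodule.cardQuot_apply, ← Ideal.absNorm_apply, h, Int.natAbs_pow]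
  rfl

variable (G k L) in
/-- If all good totally positive elements are squares, then there are few invariant classes modulo
squares apart from those coming from the ground field. -/
theorem exists_invariant_of_stableUnits (hunr : Unr G (𝓞 L))
    (hR : ∀ x : 𝓞 k, 2 ∣ x ^ 2 → 2 ∣ x)
    (hV : ∀ α ∈ posUnits L ⊓ goodUnits (𝓞 L) L, ∃ γ : Lˣ, γ ^ 2 = α) :
    ∃ (T : Type) (_ : Finite T) (inv : Lˣ → T), Nat.card T ≤
      Nat.card (ClassGroup (𝓞 k) ⧸ (powMonoidHom 2 : ClassGroup (𝓞 k) →* _).range) *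
        2 ^ Module.finrank ℚ k * 2 ^ Module.finrank ℚ k ∧
      ∀ α ∈ stableUnits G L, ∀ β ∈ stableUnits G L, inv α = inv β →
        ∃ (a : kˣ) (c : Lˣ), (α : L) = algebraMap k L a * c ^ 2 * β := by
  have := finite_quotient_two k
  have := finite_quotient_two L
  have hsmul : ∀ (g : G) (s : 𝓞 L), algebraMap (𝓞 L) L (g • s) = g • algebraMap (𝓞 L) L s :=
    fun g s ↦ rfl
  have hinj := FaithfulSMul.algebraMap_injective (𝓞 k) (𝓞 L)
  set K := (Units.map (algebraMap k L).toMonoidHom).range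
  set A := stableUnits G L
  set X := A ⊓ evenUnits (𝓞 L) L
  set Y := X ⊓ posUnits L
  set V := Y ⊓ goodUnits (𝓞 L) L
  have h1 : (K ⊔ X).relIndex A ≠ 0 ∧ (K ⊔ X).relIndex A ≤ _ :=
    relIndex_evenUnits_le (𝓞 k) (𝓞 L) k L hunr hsmul
  have h2 := relIndex_sup_ne_zero_and_le (K := K) inf_le_left
    (relIndex_posUnits_le k (X := X) inf_le_left)
  have h3 := relIndex_sup_ne_zero_and_le (K := K) inf_le_left
    (relIndex_goodUnits_le (𝓞 k) (𝓞 L) hunr hinj hR hsmul)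
  rw [card_quotient_two] at h3
  have hKA : K ≤ A := range_le_stableUnits
  have h4 : (K ⊔ V).relIndex A = (K ⊔ V).relIndex (K ⊔ Y) * ((K ⊔ Y).relIndex (K ⊔ X) *
      (K ⊔ X).relIndex A) := by
    rw [Subgroup.relIndex_mul_relIndex _ _ _ (sup_le_sup_left inf_le_left _)
      (sup_le hKA inf_le_left), Subgroup.relIndex_mul_relIndex _ _ _
      (sup_le_sup_left inf_le_left _) (sup_le hKA (inf_le_left.trans inf_le_left))]
  have h5 : (K ⊔ V).relIndex A ≠ 0 := by
    rw [h4]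
    exact mul_ne_zero h3.1 (mul_ne_zero h2.1 h1.1)
  have : Finite (A ⧸ (K ⊔ V).subgroupOf A) := Nat.finite_of_card_ne_zero h5
  have : NeZero ((K ⊔ V).relIndex A) := ⟨h5⟩
  classical
  let e : (A ⧸ (K ⊔ V).subgroupOf A) ≃ Fin ((K ⊔ V).relIndex A) := Finite.equivFin _
  refine ⟨Fin ((K ⊔ V).relIndex A), inferInstance,
    fun α ↦ if h : α ∈ A then e (QuotientGroup.mk ⟨α, h⟩) else 0, ?_, fun α hα β hβ h ↦ ?_⟩
  · rw [Nat.card_fin, h4]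
    calc _ ≤ _ := Nat.mul_le_mul h3.2 (Nat.mul_le_mul h2.2 h1.2)
      _ = _ := by ring
  · beta_reduce at h
    rw [dif_pos hα, dif_pos hβ, e.apply_eq_iff_eq, eq_comm, QuotientGroup.eq,
      Subgroup.mem_subgroupOf] at h
    obtain ⟨_, ⟨a, rfl⟩, v, hv, hav⟩ := Subgroup.mem_sup.1 h
    obtain ⟨c, rfl⟩ := hV v ⟨hv.1.2, hv.2⟩
    refine ⟨a, c, ?_⟩
    have h6 := congrArg (fun z : Lˣ ↦ (z : L)) hav
    simp only [Subgroup.coe_mul, Subgroup.coe_inv, Units.val_mul, Units.val_inv_eq_inv_val,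
      Units.val_pow_eq_pow_val] at h6
    rw [inv_mul_eq_div, eq_div_iff β.ne_zero] at h6
    exact h6.symm

end

end SumProd

namespace SumProd

open Pointwise nonZeroDivisors NumberField

section

variable {k L : Type*} [Field k] [Field L] [Algebra k L]

/-- The quadratic characters that belong to independent square roots are independent. -/
lemma exists_characters {G : Type*} [Group G] [MulSemiringAction G L] [CharZero L]
    [Algebra.IsInvariant k L G] [SMulCommClass G k L] {d₀ : ℕ} {a : Fin d₀ → kˣ} {γ : Fin d₀ → Lˣ}
    (hγ : ∀ i, (γ i : L) ^ 2 = algebraMap k L (a i))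
    (ha : ∀ s : Finset (Fin d₀), s.Nonempty → ¬IsSquare ((∏ i ∈ s, a i : kˣ) : k)) :
    ∃ χ : Fin d₀ → G → ZMod 2, (∀ i g h, χ i (g * h) = χ i g + χ i h) ∧
      LinearIndependent (ZMod 2) χ := by
  classical
  have hg : ∀ (g : G) i, g • (γ i : L) = γ i ∨ g • (γ i : L) = -γ i := fun g i ↦ by
    rw [← sq_eq_sq_iff_eq_or_eq_neg, ← smul_pow', hγ, smul_algebraMap]
  have hne : ∀ i, -(γ i : L) ≠ γ i := fun i h ↦ (γ i).ne_zero (neg_eq_self.1 h)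
  have hne' : ∀ i, (γ i : L) ≠ -γ i := fun i ↦ (hne i).symm
  set χ : Fin d₀ → G → ZMod 2 := fun i g ↦ if g • (γ i : L) = γ i then 0 else 1
  have hχ : ∀ (g : G) i, g • (γ i : L) = (-1) ^ (χ i g).val * γ i := fun g i ↦ by
    obtain h | h := hg g i
    · simp [χ, h]
    · simp [χ, h, hne, ZMod.val_one]
  refine ⟨χ, fun i g h ↦ ?_, ?_⟩
  · have h11 : (0 : ZMod 2) = 1 + 1 := by decide
    obtain h1 | h1 := hg g i <;> obtain h2 | h2 := hg h i <;> simp [χ, mul_smul, h1, h2, hne, h11]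
  · rw [Fintype.linearIndependent_iff]
    intro c hc
    by_contra! hi
    set s := Finset.univ.filter fun i ↦ c i ≠ 0
    have hcs : ∀ i ∈ s, c i = 1 := fun i hi ↦ by
      have h1 := (Finset.mem_filter.1 hi).2
      generalize c i = e at h1
      revert e
      decide
    obtain ⟨b, hb⟩ := Algebra.IsInvariant.isInvariant (A := k) (G := G) (∏ i ∈ s, (γ i : L))
      fun g ↦ by
        rw [Finset.smul_prod']
        simp only [hχ, Finset.prod_mul_distrib]
        rw [Finset.prod_pow_eq_pow_sum, Even.neg_one_pow, one_mul]
        rw [← ZMod.natCast_eq_zero_iff_even, Nat.cast_sum]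
        have h1 := congrFun hc g
        rw [Finset.sum_apply, Pi.zero_apply] at h1
        rw [← h1, Finset.sum_filter]
        refine Finset.sum_congr rfl fun i _ ↦ ?_
        by_cases h2 : c i = 0
        · simp [h2]
        · rw [if_pos h2, Pi.smul_apply, hcs i (Finset.mem_filter.2 ⟨Finset.mem_univ _, h2⟩), one_smul,
            ZMod.natCast_zmod_val]
    refine ha s (hi.imp fun i h ↦ Finset.mem_filter.2 ⟨Finset.mem_univ _, h⟩) ⟨b, ?_⟩
    apply (algebraMap k L).injective
    rw [map_mul, hb, ← Finset.prod_mul_distrib, Units.coe_prod, map_prod]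
    exact Finset.prod_congr rfl fun i _ ↦ by rw [← hγ, pow_two]

lemma map_mem_posUnits {α : kˣ} (hα : α ∈ posUnits k) :
    Units.map (algebraMap k L).toMonoidHom α ∈ posUnits L :=
  fun φ ↦ hα (φ.comp (algebraMap k L))

lemma map_mem_goodUnits {R S : Type*} [CommRing R] [CommRing S] [Algebra R S] [Algebra S L]
    [Algebra R k] [Algebra R L] [IsScalarTower R S L] [IsScalarTower R k L] {α : kˣ}
    (hα : α ∈ goodUnits R k) : Units.map (algebraMap k L).toMonoidHom α ∈ goodUnits S L := by
  intro P hP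
  obtain ⟨s, t, h1, c, h2⟩ := hα (P.comap (algebraMap R S)) inferInstance
  refine ⟨algebraMap R S s, algebraMap R S t, ?_, Units.map (algebraMap k L).toMonoidHom c, ?_⟩
  · simpa only [Ideal.mem_comap, map_sub, map_pow, map_mul, map_ofNat] using h1
  · have h3 := congrArg (algebraMap k L) h2
    rw [← IsScalarTower.algebraMap_apply, IsScalarTower.algebraMap_apply R S L] at h3
    simp only [map_sub, map_pow, map_mul, map_ofNat] at h3 ⊢
    exact h3

end

/-- A criterion of Golod-Shafarevich type for the existence of an unramified quadratic extension of a
given unramified extension. -/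
theorem exists_good_not_square {G : Type} {k L : Type*} [Group G] [Fintype G] [Field k] [Field L]
    [NumberField k] [NumberField L] [IsTotallyReal L] [Algebra k L] [MulSemiringAction G L]
    [IsGaloisGroup G k L] (hG : IsPGroup 2 G) (hunr : Unr G (𝓞 L))
    (hR : ∀ x : 𝓞 k, 2 ∣ x ^ 2 → 2 ∣ x) {d₀ r : ℕ} (hdr : r + 4 ≤ 2 * d₀)
    (hr : Nat.card (ClassGroup (𝓞 k) ⧸ (powMonoidHom 2 : ClassGroup (𝓞 k) →* _).range) *
        2 ^ Module.finrank ℚ k * 2 ^ Module.finrank ℚ k ≤ 2 ^ r) {a : Fin d₀ → kˣ}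
    (hgood : ∀ i, a i ∈ posUnits k ⊓ goodUnits (𝓞 k) k)
    (ha : ∀ s : Finset (Fin d₀), s.Nonempty → ¬IsSquare ((∏ i ∈ s, a i : kˣ) : k)) :
    ∃ α ∈ posUnits L ⊓ goodUnits (𝓞 L) L, ¬∃ γ : Lˣ, γ ^ 2 = α := by
  by_contra! hV
  obtain ⟨T, hT, inv, hcard, hinv⟩ := exists_invariant_of_stableUnits G k L hunr hR hV
  choose γ hγ using fun i ↦ hV _ ⟨map_mem_posUnits (L := L) (hgood i).1,
    map_mem_goodUnits (S := 𝓞 L) (hgood i).2⟩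
  have : SMulCommClass G k L := IsGaloisGroup.commutes
  have : Algebra.IsInvariant k L G := IsGaloisGroup.isInvariant
  have : FaithfulSMul G L := IsGaloisGroup.faithful k
  obtain ⟨χ, hχ, hli⟩ := exists_characters (G := G) (γ := γ) (fun i ↦ by
    rw [← Units.val_pow_eq_pow_val, hγ]; rfl) ha
  refine golodShafarevich (fun H _ ↦ exists_index_two (hG.to_subgroup H)) hdr hχ hli
    fun d P hP hPker hPinv ↦ ?_
  choose! α x hα using fun (w : G → Fin d → ZMod 2)
    (hw : ∀ g, regRep (ZMod 2) G (Fin d → ZMod 2) g w - w ∈ P.range) ↦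
    exists_isCrossed (L := L) hP hPker hG hunr hw
  classical
  have hst : ∀ w, (∀ g, regRep (ZMod 2) G (Fin d → ZMod 2) g w - w ∈ P.range) →
      ∃ β ∈ stableUnits G L, (β : L) = α w := fun w hw ↦
    ⟨Units.mk0 _ (hα w hw).ne_zero', fun g ↦ by
      obtain ⟨f, hf⟩ := hw g
      exact ⟨_, (hα w hw).smul hf.symm⟩, rfl⟩
  choose! β hβ hβα using hst
  refine ⟨T, hT, fun w ↦ inv (β w), hcard.trans hr, fun w w' hw hw' h ↦ ?_⟩
  obtain ⟨b, c, hbc⟩ := hinv _ (hβ w hw) _ (hβ w' hw') h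
  rw [hβα w hw, hβα w' hw'] at hbc
  exact (hα w hw).sub_mem_range hP hPker hPinv hw hw' (hα w' hw')
    (fun g ↦ smul_algebraMap g (b : k)) hbc

end SumProd

namespace SumProd

open Pointwise nonZeroDivisors NumberField IntermediateField

section

variable {k L : Type*} [Field k] [Field L] [Algebra k L]

lemma mem_adjoin_sqrt_iff {M : Type*} [Field M] [Algebra L M] {x : M} {α : L}
    (hx : x ^ 2 = algebraMap L M α) {y : M} :
    y ∈ L⟮x⟯ ↔ ∃ a b : L, y = algebraMap L M a + algebraMap L M b * x := by
  refine ⟨fun h ↦ ?_, ?_⟩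
  · have h_int : IsAlgebraic L x := by
      refine IsIntegral.isAlgebraic (IsIntegral.of_pow two_pos ?_)
      rw [hx]
      exact isIntegral_algebraMap
    rw [← IntermediateField.mem_toSubalgebra, adjoin_simple_toSubalgebra_of_isAlgebraic h_int] at h
    induction h using Algebra.adjoin_induction with
    | mem y hy => exact ⟨0, 1, by rw [Set.mem_singleton_iff.1 hy]; simp⟩
    | algebraMap r => exact ⟨r, 0, by simp⟩
    | add y z _ _ hy hz =>
      obtain ⟨a, b, rfl⟩ := hy
      obtain ⟨c, d, rfl⟩ := hz
      exact ⟨a + c, b + d, by simp only [map_add]; ring⟩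
    | mul y z _ _ hy hz =>
      obtain ⟨a, b, rfl⟩ := hy
      obtain ⟨c, d, rfl⟩ := hz
      refine ⟨a * c + b * d * α, a * d + b * c, ?_⟩
      simp only [map_add, map_mul, ← hx]
      ring
  · rintro ⟨a, b, rfl⟩
    exact add_mem (IntermediateField.algebraMap_mem _ _) (mul_mem (IntermediateField.algebraMap_mem _ _) (mem_adjoin_simple_self L x))

lemma normal_adjoin_sqrt {Ω : Type*} [Field Ω] [Algebra L Ω] [Algebra k Ω] [IsScalarTower k L Ω]
    [Normal k L] [Normal k Ω] {x : Ω} {α : L} (hx : x ^ 2 = algebraMap L Ω α)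
    (hα : ∀ σ : L ≃ₐ[k] L, ∃ γ : L, σ α = α * γ ^ 2) : Normal k L⟮x⟯ := by
  suffices Normal k (L⟮x⟯.restrictScalars k) from this
  rw [normal_iff_forall_map_le']
  rintro σ _ ⟨y, hy, rfl⟩
  obtain ⟨γ, hγ⟩ := hα (σ.restrictNormal L)
  have hσ : ∀ a : L, σ (algebraMap L Ω a) = algebraMap L Ω (σ.restrictNormal L a) := fun a ↦
    (AlgEquiv.restrictNormal_commutes σ L a).symm
  have hxx : σ x = algebraMap L Ω γ * x ∨ σ x = -(algebraMap L Ω γ * x) := by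
    rw [← sq_eq_sq_iff_eq_or_eq_neg, ← map_pow, hx, hσ, hγ, mul_pow, hx, map_mul, map_pow, mul_comm]
  obtain ⟨a, b, rfl⟩ := (mem_adjoin_sqrt_iff hx).1 hy
  refine (mem_adjoin_sqrt_iff hx).2 ?_
  change ∃ c d, σ _ = _
  rw [map_add, map_mul, hσ, hσ]
  obtain h | h := hxx
  · exact ⟨σ.restrictNormal L a, σ.restrictNormal L b * γ, by rw [h, map_mul]; ring⟩
  · exact ⟨σ.restrictNormal L a, -(σ.restrictNormal L b * γ), by rw [h, map_neg, map_mul]; ring⟩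

end

lemma exists_quadratic_extension {k L : Type} [Field k] [Field L] [Algebra k L] [CharZero L]
    [IsGalois k L] {α : L} (hα : ∀ σ : L ≃ₐ[k] L, ∃ γ : L, σ α = α * γ ^ 2) (hsq : ¬IsSquare α) :
    ∃ (M : Type) (_ : Field M) (_ : Algebra L M) (_ : Algebra k M) (_ : IsScalarTower k L M) (x : M),
      Normal k M ∧ x ^ 2 = algebraMap L M α ∧
      (∀ y, ∃ a b : L, y = algebraMap L M a + algebraMap L M b * x) ∧ Module.finrank L M = 2 := by
  obtain ⟨x, hx⟩ := IsAlgClosed.exists_pow_nat_eq (algebraMap L (AlgebraicClosure L) α) two_pos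
  have : Algebra.IsAlgebraic k (AlgebraicClosure L) := Algebra.IsAlgebraic.trans k L _
  have : Normal k (AlgebraicClosure L) := inferInstance
  refine ⟨L⟮x⟯, inferInstance, inferInstance, inferInstance, inferInstance, AdjoinSimple.gen L x,
    normal_adjoin_sqrt hx hα, ?_, fun y ↦ ?_, ?_⟩
  · exact Subtype.ext hx
  · obtain ⟨a, b, h⟩ := (mem_adjoin_sqrt_iff hx).1 y.2
    exact ⟨a, b, Subtype.ext h⟩
  · have hirr : Irreducible (Polynomial.X ^ 2 - Polynomial.C α) := by
      rw [X_pow_sub_C_irreducible_iff_of_prime Nat.prime_two]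
      exact fun b hb ↦ hsq ⟨b, by rw [← hb, pow_two]⟩
    have hmin : Polynomial.X ^ 2 - Polynomial.C α = minpoly L x :=
      minpoly.eq_of_irreducible_of_monic hirr (by simp [hx]) (Polynomial.monic_X_pow_sub_C _ two_ne_zero)
    rw [adjoin.finrank (minpoly.ne_zero_iff.1 (hmin ▸ hirr.ne_zero)), ← hmin,
      Polynomial.natDegree_X_pow_sub_C]

end SumProd

namespace SumProd

open Pointwise nonZeroDivisors NumberField

lemma Unr.of_fintype {G S ι : Type*} [Group G] [CommRing S] [MulSemiringAction G S] [Fintype ι]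
    (a b : ι → S) (hab : ∀ g : G, (g = 1 → ∑ i, a i * g • b i = 1) ∧
      (g ≠ 1 → ∑ i, a i * g • b i = 0)) : Unr G S := by
  let e := Fintype.equivFin ι
  refine ⟨Fintype.card ι, a ∘ e.symm, b ∘ e.symm, fun g ↦ ?_⟩
  rw [← show ∑ i, a i * g • b i = ∑ i, (a ∘ e.symm) i * g • (b ∘ e.symm) i from
    (Equiv.sum_comp e.symm fun i ↦ a i * g • b i).symm]
  exact hab g

lemma Unr.of_involution {G S : Type*} [Group G] [CommRing S] [MulSemiringAction G S] {σ : G}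
    (hσ : ∀ g, g = 1 ∨ g = σ) (h : Ideal.span (Set.range fun θ : S ↦ θ - σ • θ) = ⊤) :
    Unr G S := by
  obtain ⟨c, hc⟩ := (Finsupp.mem_ideal_span_range_iff_exists_finsupp).1 ((Ideal.eq_top_iff_one _).1 h)
  have hc' : ∑ i : c.support, (c i * i - c i * σ • (i : S)) = 1 := by
    rw [← hc, Finsupp.sum, ← Finset.sum_coe_sort c.support fun θ ↦ c θ * (θ - σ • θ)]
    simp only [mul_sub]
  refine Unr.of_fintype (ι := Option c.support)
    (fun o ↦ o.elim (-∑ i : c.support, c i * σ • (i : S)) fun i ↦ c i)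
    (fun o ↦ o.elim 1 fun i ↦ i) fun g ↦ ?_
  simp only [Fintype.sum_option, Option.elim, smul_one, mul_one]
  refine ⟨?_, fun hg ↦ ?_⟩
  · rintro rfl
    rw [← hc', Finset.sum_sub_distrib]
    simp only [one_smul]
    ring
  · rw [(hσ g).resolve_left hg]
    ring

lemma span_range_sub_smul_eq_top {L M G : Type*} [Field L] [Field M] [CharZero M] [Algebra L M]
    [Group G] [MulSemiringAction G M] [SMulCommClass G L M] {α : Lˣ}
    (hα : α ∈ goodUnits (𝓞 L) L) {x : M} (hx : x ^ 2 = algebraMap L M α) {σ : G}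
    (hσ : σ • x = -x) : Ideal.span (Set.range fun θ : 𝓞 M ↦ θ - σ • θ) = ⊤ := by
  by_contra h
  obtain ⟨P, hP, hle⟩ := Ideal.exists_le_maximal _ h
  obtain ⟨s, t, h1, c, h2⟩ := hα (P.comap (algebraMap (𝓞 L) (𝓞 M))) inferInstance
  replace h2 := congrArg (algebraMap L M) h2
  have hsm : algebraMap L M (algebraMap (𝓞 L) L s) = algebraMap (𝓞 M) M (algebraMap (𝓞 L) (𝓞 M) s) := rfl
  have htm : algebraMap L M (algebraMap (𝓞 L) L t) = algebraMap (𝓞 M) M (algebraMap (𝓞 L) (𝓞 M) t) := rfl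
  rw [map_mul, map_pow, ← hx, map_sub, map_sub, map_mul, map_mul, map_pow, map_pow, hsm, htm,
    map_ofNat, map_ofNat] at h2
  set s' := algebraMap (𝓞 L) (𝓞 M) s
  set t' := algebraMap (𝓞 L) (𝓞 M) t
  have hcs : σ • algebraMap L M c = algebraMap L M c := smul_algebraMap σ _
  have hss : σ • algebraMap (𝓞 M) M s' = algebraMap (𝓞 M) M s' := hsm ▸ smul_algebraMap σ _
  have h_int : IsIntegral ℤ ((algebraMap (𝓞 M) M s' + algebraMap L M c * x) / 2) := by
    have : IsIntegral (𝓞 M) ((algebraMap (𝓞 M) M s' + algebraMap L M c * x) / 2) := by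
      refine ⟨Polynomial.X ^ 2 - Polynomial.C s' * Polynomial.X + Polynomial.C t', ?_, ?_⟩
      · monicity!
      · simp only [Polynomial.eval₂_add, Polynomial.eval₂_sub, Polynomial.eval₂_mul,
          Polynomial.eval₂_pow, Polynomial.eval₂_X, Polynomial.eval₂_C]
        linear_combination h2 / 4
    exact isIntegral_trans _ this
  let θ : 𝓞 M := ⟨_, h_int⟩
  have hθ : algebraMap (𝓞 M) M (θ - σ • θ) = algebraMap L M c * x := by
    change (algebraMap (𝓞 M) M s' + algebraMap L M c * x) / 2 -
      σ • ((algebraMap (𝓞 M) M s' + algebraMap L M c * x) / 2) = _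
    rw [div_eq_mul_inv, smul_mul', smul_add, smul_mul', hσ, hcs, hss, smul_inv'',
      show σ • (2 : M) = 2 from map_ofNat (MulSemiringAction.toRingHom G M σ) 2]
    ring
  have hsq : (θ - σ • θ) ^ 2 = s' ^ 2 - 4 * t' := by
    refine RingOfIntegers.coe_injective ?_
    rw [map_pow, hθ, map_sub, map_mul, map_pow, map_ofNat, ← h2]
    ring
  refine h1 ?_
  rw [Ideal.mem_comap, map_sub, map_mul, map_pow, map_ofNat, ← hsq]
  exact P.pow_mem_of_mem (hle (Ideal.subset_span ⟨θ, rfl⟩)) 2 two_pos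

lemma isTotallyReal_of_sqrt {L M : Type*} [Field L] [Field M] [Algebra L M] [IsTotallyReal L] {α : Lˣ}
    (hα : α ∈ posUnits L) {x : M} (hx : x ^ 2 = algebraMap L M α)
    (hM : ∀ y, ∃ a b : L, y = algebraMap L M a + algebraMap L M b * x) : IsTotallyReal M := by
  refine ⟨fun v ↦ ?_⟩
  rw [InfinitePlace.isReal_iff, ComplexEmbedding.isReal_iff]
  set φ := v.embedding
  have hφ := IsTotallyReal.complexEmbedding_isReal (φ.comp (algebraMap L M))
  have hφr : ∀ a : L, φ (algebraMap L M a) = (hφ.embedding a : ℂ) := fun a ↦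
    (hφ.coe_embedding_apply a).symm
  have hsq : φ x ^ 2 = ((√(hφ.embedding α) : ℝ) : ℂ) ^ 2 := by
    rw [← map_pow, hx, hφr, ← Complex.ofReal_pow, Real.sq_sqrt (hα _).le]
  obtain ⟨u, hu⟩ : ∃ u : ℝ, φ x = u := by
    obtain h | h := sq_eq_sq_iff_eq_or_eq_neg.1 hsq
    · exact ⟨_, h⟩
    · exact ⟨-√(hφ.embedding α), by rw [h, Complex.ofReal_neg]⟩
  ext y
  obtain ⟨a, b, rfl⟩ := hM y
  rw [ComplexEmbedding.conjugate_coe_eq, map_add, map_mul, hφr, hφr, hu]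
  simp only [map_add, map_mul, Complex.conj_ofReal]

/-- An unramified totally real Galois extension of `k` of degree `2 ^ n` exists. -/
def HasTower (k : Type) [Field k] (n : ℕ) : Prop :=
  ∃ (L : Type) (_ : Field L) (_ : NumberField L) (_ : Algebra k L), IsGalois k L ∧ IsTotallyReal L ∧
    Unr (L ≃ₐ[k] L) (𝓞 L) ∧ Module.finrank k L = 2 ^ n

lemma map_algEquiv_mem {k L : Type*} [Field k] [Field L] [Algebra k L] {α : Lˣ}
    (hα : α ∈ posUnits L ⊓ goodUnits (𝓞 L) L) (σ : L ≃ₐ[k] L) :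
    Units.map (σ : L →* L) α ∈ posUnits L ⊓ goodUnits (𝓞 L) L := by
  refine ⟨fun φ ↦ hα.1 (φ.comp (σ : L →+* L)), fun P hP ↦ ?_⟩
  obtain ⟨s, t, h1, c, h2⟩ := hα.2 (P.comap (MulSemiringAction.toRingHom _ (𝓞 L) σ)) inferInstance
  refine ⟨σ • s, σ • t, fun h ↦ h1 ?_, Units.map (σ : L →* L) c, ?_⟩
  · simpa only [Ideal.mem_comap, map_sub, map_pow, map_mul, map_ofNat,
      MulSemiringAction.toRingHom_apply] using h
  · have := congrArg σ h2
    simp only [map_sub, map_pow, map_mul, map_ofNat] at this ⊢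
    exact this

lemma exists_stable_good_unit {k L : Type} [Field k] [Field L] [NumberField k] [NumberField L]
    [Algebra k L] (hG : IsPGroup 2 (L ≃ₐ[k] L)) {α : Lˣ} (hα : α ∈ posUnits L ⊓ goodUnits (𝓞 L) L)
    (hsq : ¬∃ γ : Lˣ, γ ^ 2 = α) : ∃ β ∈ posUnits L ⊓ goodUnits (𝓞 L) L, ¬IsSquare (β : L) ∧
      ∀ σ : L ≃ₐ[k] L, ∃ γ : L, σ β = β * γ ^ 2 := by
  have : Finite (L ≃ₐ[k] L) := inferInstance
  let ρ : (L ≃ₐ[k] L) →* AddMonoid.End (Additive Lˣ) :=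
    { toFun σ := (Units.map (σ : L →* L)).toAdditive
      map_one' := by ext; rfl
      map_mul' _ _ := by ext; rfl }
  obtain ⟨y, hyP, hyU, hy⟩ := exists_invariant_mod
    (fun H _ ↦ exists_index_two (hG.to_subgroup H)) ρ
    (U := (powMonoidHom 2 : Lˣ →* Lˣ).range.toAddSubgroup)
    (P := (posUnits L ⊓ goodUnits (𝓞 L) L).toAddSubgroup)
    (fun x _ ↦ ⟨x.toMul, pow_two x.toMul⟩)
    (fun σ x ⟨γ, hγ⟩ ↦ ⟨Units.map (σ : L →* L) γ, by
      have : γ ^ 2 = x.toMul := hγ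
      change Units.map (σ : L →* L) γ ^ 2 = Units.map (σ : L →* L) x.toMul
      rw [← map_pow, this]⟩)
    (fun σ x hx ↦ map_algEquiv_mem hx σ) (x := Additive.ofMul α) hα hsq
  refine ⟨y.toMul, hyP, fun ⟨γ, hγ⟩ ↦ hyU ?_, fun σ ↦ ?_⟩
  · have hγ0 : γ ≠ 0 := by
      rintro rfl
      simp at hγ
    exact ⟨Units.mk0 γ hγ0, Units.ext (by rw [hγ]; exact pow_two γ)⟩
  · obtain ⟨γ, hγ⟩ := hy σ
    have : γ ^ 2 = Units.map (σ : L →* L) y.toMul / y.toMul := hγ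
    refine ⟨γ, ?_⟩
    have h2 := congrArg Units.val (eq_div_iff_mul_eq'.1 this)
    rw [Units.val_mul, Units.val_pow_eq_pow_val, mul_comm] at h2
    exact h2.symm

/-- A quadratic extension of a member of the tower. -/
lemma unr_of_tower {k L M : Type} [Field k] [Field L] [Field M] [NumberField k] [NumberField L]
    [NumberField M] [Algebra k L] [Algebra L M] [Algebra k M] [IsScalarTower k L M] [IsGalois k L]
    [IsGalois k M] (hL : Unr (L ≃ₐ[k] L) (𝓞 L)) (hM : Unr (M ≃ₐ[L] M) (𝓞 M)) :
    Unr (M ≃ₐ[k] M) (𝓞 M) := by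
  refine Unr.tower hM hL (AlgEquiv.restrictNormalHom L) (fun g r ↦ RingOfIntegers.coe_injective ?_)
    (fun g hg ↦ ?_) (map_one _)
  · exact AlgEquiv.restrictNormal_commutes g L r
  · have hgL : ∀ a, g (algebraMap L M a) = algebraMap L M a := fun a ↦ by
      rw [← AlgEquiv.restrictNormal_commutes g L a]
      exact congrArg (algebraMap L M) (DFunLike.congr_fun hg a)
    refine ⟨{ (g : M ≃+* M) with commutes' := hgL }, fun s ↦ rfl, ?_, fun h ↦ ?_⟩
    · rintro rfl
      rfl
    · ext x
      exact DFunLike.congr_fun h x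

lemma exists_double {k L : Type} [Field k] [Field L] [NumberField k] [NumberField L]
    [Algebra k L] [IsGalois k L] [IsTotallyReal L] (hL : Unr (L ≃ₐ[k] L) (𝓞 L)) {n : ℕ}
    (hn : Module.finrank k L = 2 ^ n) {α : Lˣ} (hα : α ∈ posUnits L ⊓ goodUnits (𝓞 L) L)
    (hsq : ¬IsSquare (α : L)) (hst : ∀ σ : L ≃ₐ[k] L, ∃ γ : L, σ α = α * γ ^ 2) :
    HasTower k (n + 1) := by
  obtain ⟨M, _, _, _, _, x, hN, hx, hM, hdeg⟩ := exists_quadratic_extension hst hsq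
  have : CharZero M := charZero_of_injective_algebraMap (algebraMap L M).injective
  have : FiniteDimensional L M := Module.finite_of_finrank_pos (by rw [hdeg]; exact two_pos)
  have : FiniteDimensional ℚ M := Module.Finite.trans L M
  have : NumberField M := ⟨⟩
  have : IsGalois k M := ⟨⟩
  have : IsGalois L M := IsGalois.tower_top_of_isGalois k L M
  refine ⟨M, inferInstance, inferInstance, inferInstance, inferInstance,
    isTotallyReal_of_sqrt hα.1 hx hM, unr_of_tower hL ?_, ?_⟩
  · have hcard : Nat.card (M ≃ₐ[L] M) = 2 := by rw [IsGalois.card_aut_eq_finrank, hdeg]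
    obtain ⟨σ, hσ1⟩ : ∃ σ : M ≃ₐ[L] M, σ ≠ 1 := by
      have : Nontrivial (M ≃ₐ[L] M) := Finite.one_lt_card_iff_nontrivial.1 (by rw [hcard]; decide)
      exact exists_ne 1
    have hσ : ∀ g : M ≃ₐ[L] M, g = 1 ∨ g = σ := by
      obtain ⟨a, b, hab, h⟩ := Nat.card_eq_two_iff.1 hcard
      have h' : ∀ g : M ≃ₐ[L] M, g = a ∨ g = b := fun g ↦ by
        simpa using h.ge (Set.mem_univ g)
      intro g
      obtain h1 | h1 := h' 1 <;> obtain h2 | h2 := h' σ <;> obtain h3 | h3 := h' g <;> simp_all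
    have hσx : σ • x = -x := by
      have h1 : σ x ^ 2 = x ^ 2 := by rw [← map_pow, hx, AlgEquiv.commutes]
      refine (sq_eq_sq_iff_eq_or_eq_neg.1 h1).resolve_left fun h2 ↦ hσ1 ?_
      ext y
      obtain ⟨a, b, rfl⟩ := hM y
      rw [map_add, map_mul, h2, AlgEquiv.commutes, AlgEquiv.commutes]
      rfl
    exact Unr.of_involution hσ (span_range_sub_smul_eq_top hα.2 hx hσx)
  · rw [← Module.finrank_mul_finrank k L M, hn, hdeg, pow_succ]

theorem hasTower_of_good {k : Type} [Field k] [NumberField k] [IsTotallyReal k]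
    (hR : ∀ x : 𝓞 k, 2 ∣ x ^ 2 → 2 ∣ x) {d₀ r : ℕ} (hdr : r + 4 ≤ 2 * d₀)
    (hr : Nat.card (ClassGroup (𝓞 k) ⧸ (powMonoidHom 2 : ClassGroup (𝓞 k) →* _).range) *
        2 ^ Module.finrank ℚ k * 2 ^ Module.finrank ℚ k ≤ 2 ^ r) {a : Fin d₀ → kˣ}
    (hgood : ∀ i, a i ∈ posUnits k ⊓ goodUnits (𝓞 k) k)
    (ha : ∀ s : Finset (Fin d₀), s.Nonempty → ¬IsSquare ((∏ i ∈ s, a i : kˣ) : k)) (n : ℕ) :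
    HasTower k n := by
  induction n with
  | zero =>
    refine ⟨k, inferInstance, inferInstance, Algebra.id k, inferInstance, inferInstance,
      ⟨1, 1, 1, fun g ↦ ⟨fun _ ↦ by simp, fun h ↦ (h ?_).elim⟩⟩, Module.finrank_self k⟩
    ext x
    exact g.commutes x
  | succ n ih =>
    obtain ⟨L, _, _, _, _, _, hL, hn⟩ := ih
    have hG : IsPGroup 2 (L ≃ₐ[k] L) := IsPGroup.of_card (n := n) (by
      rw [IsGalois.card_aut_eq_finrank, hn])
    have : Fintype (L ≃ₐ[k] L) := Fintype.ofFinite _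
    obtain ⟨α, hα, hα2⟩ := exists_good_not_square hG hL hR hdr hr hgood ha
    obtain ⟨β, hβ, hβ2, hβ3⟩ := exists_stable_good_unit hG hα hα2
    exact exists_double hL hn hβ hβ2 hβ3

end SumProd

namespace SumProd

open Pointwise nonZeroDivisors

section

variable {O : Type*} [CommRing O] {ω : O} {q : ℤ}

lemma two_dvd_of_two_dvd_sq (hω : ω ^ 2 = ω + q) (hO : ∀ x : O, ∃ a b : ℤ, x = a + b * ω)
    (hind : ∀ a b : ℤ, (a : O) + b * ω = 0 → a = 0 ∧ b = 0) {x : O} (hx : 2 ∣ x ^ 2) : 2 ∣ x := by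
  obtain ⟨y, hy⟩ := hx
  obtain ⟨a, b, rfl⟩ := hO x
  obtain ⟨c, d, rfl⟩ := hO y
  obtain ⟨h1, h2⟩ := hind (a ^ 2 + b ^ 2 * q - 2 * c) (2 * a * b + b ^ 2 - 2 * d) (by
    push_cast
    linear_combination hy - b ^ 2 * hω)
  have hb : Even b := by
    have : Even (b ^ 2) := ⟨d - a * b, by linear_combination h2⟩
    exact (Int.even_pow.1 this).1
  obtain ⟨b, rfl⟩ := hb
  have ha : Even a := by
    have : Even (a ^ 2) := ⟨c - 2 * b ^ 2 * q, by linear_combination h1⟩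
    exact (Int.even_pow.1 this).1
  obtain ⟨a, rfl⟩ := ha
  exact ⟨a + b * ω, by push_cast; ring⟩

variable {σ : O →+* O}

lemma exists_int_eq_add_conj (hO : ∀ x : O, ∃ a b : ℤ, x = a + b * ω) (hσ : σ ω = 1 - ω) (x : O) :
    ∃ n : ℤ, x + σ x = n := by
  obtain ⟨a, b, rfl⟩ := hO x
  exact ⟨2 * a + b, by simp only [map_add, map_mul, map_intCast, hσ]; push_cast; ring⟩

lemma exists_int_eq_mul_conj (hω : ω ^ 2 = ω + q) (hO : ∀ x : O, ∃ a b : ℤ, x = a + b * ω)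
    (hσ : σ ω = 1 - ω) (x : O) : ∃ n : ℤ, x * σ x = n := by
  obtain ⟨a, b, rfl⟩ := hO x
  refine ⟨a ^ 2 + a * b - q * b ^ 2, ?_⟩
  simp only [map_add, map_mul, map_intCast, hσ]
  push_cast
  linear_combination -b ^ 2 * hω

lemma conj_conj (hO : ∀ x : O, ∃ a b : ℤ, x = a + b * ω) (hσ : σ ω = 1 - ω) (x : O) :
    σ (σ x) = x := by
  obtain ⟨a, b, rfl⟩ := hO x
  simp only [map_add, map_mul, map_intCast, hσ, map_sub, map_one, sub_sub_cancel]

lemma dvd_of_sq_eq [IsDomain O] [IsIntegrallyClosed O] {z n t u : O} (h : z ^ 2 = n * t * z - n ^ 2 * u) :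
    n ∣ z := by
  rcases eq_or_ne n 0 with rfl | hn
  · have : z ^ 2 = 0 := by rw [h]; ring
    rw [pow_eq_zero_iff two_ne_zero] at this
    rw [this]
  have hn' : algebraMap O (FractionRing O) n ≠ 0 := by simpa using hn
  have h_int : IsIntegral O (algebraMap O (FractionRing O) z / algebraMap O (FractionRing O) n) := by
    refine ⟨Polynomial.X ^ 2 - Polynomial.C t * Polynomial.X + Polynomial.C u, ?_, ?_⟩
    · monicity!
    · simp only [Polynomial.eval₂_add, Polynomial.eval₂_sub, Polynomial.eval₂_mul,
        Polynomial.eval₂_pow, Polynomial.eval₂_X, Polynomial.eval₂_C]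
      have := congrArg (algebraMap O (FractionRing O)) h
      simp only [map_sub, map_pow, map_mul] at this
      field_simp
      linear_combination this
  obtain ⟨y, hy⟩ := IsIntegrallyClosed.isIntegral_iff.1 h_int
  refine ⟨y, IsFractionRing.injective O (FractionRing O) ?_⟩
  rw [map_mul, hy, mul_div_cancel₀ _ hn']

lemma mem_map_conj (hσ2 : ∀ x, σ (σ x) = x) {I : Ideal O} {x : O} : x ∈ I.map σ ↔ σ x ∈ I := by
  refine ⟨fun h ↦ ?_, fun h ↦ hσ2 x ▸ Ideal.mem_map_of_mem σ h⟩
  have : I.map σ ≤ I.comap σ := Ideal.map_le_iff_le_comap.2 fun y hy ↦ by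
    rw [Ideal.mem_comap, Ideal.mem_comap, hσ2]
    exact hy
  exact this h

lemma exists_mul_map_conj_eq [IsDomain O] [IsIntegrallyClosed O] (hω : ω ^ 2 = ω + q)
    (hO : ∀ x : O, ∃ a b : ℤ, x = a + b * ω) (hσ : σ ω = 1 - ω) (I : Ideal O) :
    ∃ n : ℤ, I * I.map σ = Ideal.span {(n : O)} := by
  have hσ2 := conj_conj hO hσ
  let 𝔫 : Ideal ℤ := Ideal.span {z | ∃ x ∈ I, (z : O) = x * σ x}
  obtain ⟨n, hn⟩ : ∃ n, 𝔫 = Ideal.span {n} := (IsPrincipalIdealRing.principal 𝔫).principal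
  have hdvd : ∀ x ∈ I, ∃ z : ℤ, x * σ x = n * z := fun x hx ↦ by
    obtain ⟨z, hz⟩ := exists_int_eq_mul_conj hω hO hσ x
    have : z ∈ 𝔫 := Ideal.subset_span ⟨x, hx, hz.symm⟩
    rw [hn, Ideal.mem_span_singleton] at this
    obtain ⟨c, rfl⟩ := this
    exact ⟨c, by rw [hz]; push_cast; rfl⟩
  refine ⟨n, le_antisymm (Ideal.mul_le.2 fun x hx y hy ↦ ?_) ?_⟩
  · rw [mem_map_conj hσ2] at hy
    rw [Ideal.mem_span_singleton]
    obtain ⟨a, ha⟩ := hdvd x hx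
    obtain ⟨b, hb⟩ := hdvd (σ y) hy
    obtain ⟨c, hc⟩ := hdvd (x + σ y) (I.add_mem hx hy)
    rw [hσ2] at hb
    rw [map_add, hσ2] at hc
    refine dvd_of_sq_eq (t := (c - a - b : O)) (u := (a * b : O)) ?_
    linear_combination (x * y) * hc - (x * y) * ha - (x * y) * hb - x * σ x * hb - n * b * ha
  · rw [Ideal.span_singleton_le_iff_mem]
    have hle : 𝔫 ≤ (I * I.map σ).comap (Int.castRingHom O) := Ideal.span_le.2 fun z ⟨x, hx, hz⟩ ↦ by
      change ((z : ℤ) : O) ∈ I * I.map σ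
      rw [hz]
      exact Ideal.mul_mem_mul hx (Ideal.mem_map_of_mem σ hx)
    exact hle (hn ▸ Ideal.mem_span_singleton_self n)

/-- An invariant ideal is equivalent to an ideal containing the different. -/
lemma exists_smul_eq_of_invariant [IsDedekindDomain O] (hω : ω ^ 2 = ω + q)
    (hO : ∀ x : O, ∃ a b : ℤ, x = a + b * ω) (hσ : σ ω = 1 - ω) {J : Ideal O}
    (hJ : J ≠ ⊥) (hJσ : J.map σ = J) : ∃ (n : O) (I : Ideal O), n ≠ 0 ∧
      Ideal.span {2 * ω - 1} * J = Ideal.span {n} * I ∧ 2 * ω - 1 ∈ I := by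
  have hσ2 := conj_conj hO hσ
  obtain ⟨n, hn⟩ : ∃ n, J.comap (Int.castRingHom O) = Ideal.span {n} :=
    (IsPrincipalIdealRing.principal _).principal
  have hmem : ∀ z : ℤ, (z : O) ∈ J ↔ n ∣ z := fun z ↦ by
    rw [← Ideal.mem_span_singleton, ← hn]
    rfl
  have htr : ∀ x ∈ J, ∃ z : ℤ, x + σ x = n * z := fun x hx ↦ by
    obtain ⟨z, hz⟩ := exists_int_eq_add_conj hO hσ x
    obtain ⟨c, rfl⟩ := (hmem z).1 (hz ▸ J.add_mem hx (by rw [← hJσ]; exact Ideal.mem_map_of_mem σ hx))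
    exact ⟨c, by rw [hz]; push_cast; rfl⟩
  have hn0 : (n : O) ≠ 0 := by
    intro h0
    obtain ⟨x, hx, hx0⟩ := Submodule.exists_mem_ne_zero_of_ne_bot hJ
    obtain ⟨z, hz⟩ := exists_int_eq_mul_conj hω hO hσ x
    obtain ⟨c, rfl⟩ := (hmem z).1 (hz ▸ J.mul_mem_right _ hx)
    rw [Int.cast_mul, h0, zero_mul] at hz
    refine (mul_eq_zero.1 hz).elim hx0 fun h ↦ hx0 ?_
    rw [← hσ2 x, h, map_zero]
  have hdvd : ∀ x ∈ J, (n : O) ∣ (2 * ω - 1) * x := fun x hx ↦ by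
    obtain ⟨a, ha⟩ := htr x hx
    obtain ⟨b, hb⟩ := htr _ (J.mul_mem_left ω hx)
    rw [map_mul, hσ] at hb
    exact ⟨b - (1 - ω) * a, by linear_combination hb - (1 - ω) * ha⟩
  have hle : Ideal.span {2 * ω - 1} * J ≤ Ideal.span {(n : O)} := Ideal.mul_le.2 fun a ha x hx ↦ by
    obtain ⟨c, rfl⟩ := Ideal.mem_span_singleton.1 ha
    rw [Ideal.mem_span_singleton, mul_right_comm]
    exact (hdvd x hx).mul_right c
  obtain ⟨I, hI⟩ := Ideal.dvd_iff_le.2 hle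
  refine ⟨n, I, hn0, hI, ?_⟩
  have h1 : (2 * ω - 1) * n ∈ Ideal.span {(n : O)} * I :=
    hI ▸ Ideal.mul_mem_mul (Ideal.mem_span_singleton_self _) ((hmem n).2 dvd_rfl)
  obtain ⟨z, hz, h2⟩ := Ideal.mem_span_singleton_mul.1 h1
  rw [mul_comm] at h2
  rwa [← mul_right_cancel₀ hn0 h2]

lemma exists_invariant_of_norm_eq_sq [IsDedekindDomain O] (hσ2 : ∀ x, σ (σ x) = x) {I : Ideal O}
    (hI : I ≠ ⊥) {n : ℤ} {y : O} (hIn : I * I.map σ = Ideal.span {(n : O)})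
    (hIy : I * I = Ideal.span {y}) (hy : y * σ y = n ^ 2) :
    ∃ (δ : O) (J : Ideal O), δ ≠ 0 ∧ J = Ideal.span {δ} * I ∧ J.map σ = J := by
  have hy0 : y ≠ 0 := by
    rintro rfl
    rw [Set.singleton_zero, Ideal.span_zero, Ideal.mul_eq_bot] at hIy
    exact hIy.elim hI hI
  have hσy0 : σ y ≠ 0 := fun h ↦ hy0 (by rw [← hσ2 y, h, map_zero])
  have hn0 : (n : O) ≠ 0 := by
    intro h
    rw [h, zero_pow two_ne_zero] at hy
    exact (mul_eq_zero.1 hy).elim hy0 hσy0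
  have key : Ideal.span {y} * I.map σ = Ideal.span {(n : O)} * I := by
    rw [← hIy, ← hIn]
    ring
  by_cases h : y + n = 0
  · refine ⟨1, I, one_ne_zero, by rw [Ideal.span_singleton_one, Ideal.top_mul], ?_⟩
    rw [eq_neg_of_add_eq_zero_left h, Ideal.span_singleton_neg] at key
    exact mul_left_cancel₀ (by simpa using hn0) key
  · refine ⟨σ y * (y + n), _, mul_ne_zero hσy0 h, rfl, ?_⟩
    rw [Ideal.map_mul, Ideal.map_span, Set.image_singleton]
    refine mul_left_cancel₀ (a := Ideal.span {y}) (by simpa using hy0) ?_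
    calc _ = Ideal.span {σ (σ y * (y + n))} * (Ideal.span {y} * I.map σ) := by ring
      _ = (Ideal.span {σ (σ y * (y + n))} * Ideal.span {(n : O)}) * I := by rw [key]; ring
      _ = (Ideal.span {y} * Ideal.span {σ y * (y + n)}) * I := by
        rw [Ideal.span_singleton_mul_span_singleton, Ideal.span_singleton_mul_span_singleton]
        congr 3
        rw [map_mul, map_add, map_intCast, hσ2]
        linear_combination -y * hy
      _ = _ := by ring

lemma norm_eq_or_of_sq_eq [IsDomain O] [CharZero O] (hω : ω ^ 2 = ω + q)
    (hO : ∀ x : O, ∃ a b : ℤ, x = a + b * ω)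
    (hind : ∀ a b : ℤ, (a : O) + b * ω = 0 → a = 0 ∧ b = 0) (hσ : σ ω = 1 - ω) {I : Ideal O} {n : ℤ} {y : O}
    (hIn : I * I.map σ = Ideal.span {(n : O)}) (hIy : I * I = Ideal.span {y}) :
    y * σ y = n ^ 2 ∨ y * σ y = -n ^ 2 := by
  obtain ⟨z, hz⟩ := exists_int_eq_mul_conj hω hO hσ y
  have h1 : Ideal.span {(z : O)} = Ideal.span {((n ^ 2 : ℤ) : O)} := by
    rw [← hz, ← Ideal.span_singleton_mul_span_singleton, Int.cast_pow, ← Ideal.span_singleton_pow,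
      ← hIn, ← Set.image_singleton, ← Ideal.map_span, ← hIy, Ideal.map_mul]
    ring
  have hdvd : ∀ a b : ℤ, (a : O) ∣ b → a ∣ b := fun a b ⟨c, hc⟩ ↦ by
    obtain ⟨u, v, rfl⟩ := hO c
    obtain ⟨h, -⟩ := hind (b - a * u) (-(a * v)) (by push_cast; linear_combination hc)
    exact ⟨u, sub_eq_zero.1 h⟩
  have h2 := (Ideal.span_singleton_eq_span_singleton.1 h1)
  have h3 : Associated z (n ^ 2) :=
    associated_of_dvd_dvd (hdvd _ _ h2.dvd) (hdvd _ _ h2.symm.dvd)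
  rw [hz]
  rcases Int.associated_iff.1 h3 with h | h
  · exact .inl (by rw [h, Int.cast_pow])
  · exact .inr (by rw [h, Int.cast_neg, Int.cast_pow])

/-- Ideals containing the different are determined by their intersection with `ℤ`. -/
lemma eq_of_comap_eq (hω : ω ^ 2 = ω + q) (hO : ∀ x : O, ∃ a b : ℤ, x = a + b * ω)
    {I J : Ideal O} (hI : 2 * ω - 1 ∈ I) (hJ : 2 * ω - 1 ∈ J)
    (h : I.comap (Int.castRingHom O) = J.comap (Int.castRingHom O)) : I = J := by
  have key : ∀ I : Ideal O, 2 * ω - 1 ∈ I → ∀ a b : ℤ, (a : O) + b * ω ∈ I ↔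
      2 * a + b ∈ I.comap (Int.castRingHom O) := fun I hI a b ↦ by
    have hm : ((4 * q + 1 : ℤ) : O) ∈ I := by
      have : ((4 * q + 1 : ℤ) : O) = (2 * ω - 1) * (2 * ω - 1) := by
        push_cast; linear_combination -4 * hω
      exact this ▸ I.mul_mem_left _ hI
    have h2 : ((2 * a + b : ℤ) : O) = 2 * (a + b * ω) - b * (2 * ω - 1) := by push_cast; ring
    have h3 : (a : O) + b * ω = ((4 * q + 1 : ℤ) : O) * (a + b * ω) - 2 * q * (((2 * a + b : ℤ) : O) +
      b * (2 * ω - 1)) := by push_cast; ring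
    rw [Ideal.mem_comap]
    change _ ↔ ((2 * a + b : ℤ) : O) ∈ I
    refine ⟨fun h ↦ h2 ▸ I.sub_mem (I.mul_mem_left _ h) (I.mul_mem_left _ hI), fun h ↦ h3 ▸ ?_⟩
    exact I.sub_mem (I.mul_mem_right _ hm) (I.mul_mem_left _ (I.add_mem h (I.mul_mem_left _ hI)))
  ext x
  obtain ⟨a, b, rfl⟩ := hO x
  rw [key I hI, key J hJ, h]

end

end SumProd

namespace SumProd

open Pointwise nonZeroDivisors

lemma card_le_two_mul_card {C : Type*} [CommGroup C] [Finite C] (E B : Set C)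
    (hB : ∀ c ∈ E, ∀ d ∈ E, c ∈ B ∨ d ∈ B ∨ c * d ∈ B) : E.ncard ≤ 2 * B.ncard := by
  by_cases h : E ⊆ B
  · exact (Set.ncard_le_ncard h).trans (by omega)
  · obtain ⟨c, hc, hcB⟩ := Set.not_subset.1 h
    have h1 : (E \ B).ncard ≤ B.ncard :=
      Set.ncard_le_ncard_of_injOn (c * ·) (fun d hd ↦ by
        simpa [hcB, hd.2] using hB c hc d hd.1) (mul_right_injective c).injOn
    have h2 := Set.ncard_le_ncard_sdiff_add_ncard E B
    omega

variable {O : Type*} [CommRing O] {ω : O} {q : ℤ}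

lemma card_ideals_le (hω : ω ^ 2 = ω + q) (hO : ∀ x : O, ∃ a b : ℤ, x = a + b * ω)
    {m : ℕ} (hm0 : m ≠ 0) (hm : (m : ℤ) = 4 * q + 1) :
    {I : Ideal O | 2 * ω - 1 ∈ I}.Finite ∧ {I : Ideal O | 2 * ω - 1 ∈ I}.ncard ≤ m.divisors.card := by
  have h : ∀ I : Ideal O, ∃ n : ℕ, I.comap (Int.castRingHom O) = Ideal.span {(n : ℤ)} := fun I ↦ by
    obtain ⟨n, hn⟩ := (IsPrincipalIdealRing.principal (I.comap (Int.castRingHom O))).principal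
    exact ⟨n.natAbs, by rw [Int.span_natAbs]; exact hn⟩
  choose f hf using h
  have hmaps : ∀ I ∈ {I : Ideal O | 2 * ω - 1 ∈ I}, f I ∈ (m.divisors : Set ℕ) := fun I hI ↦ by
    have : (m : ℤ) ∈ I.comap (Int.castRingHom O) := by
      have h1 : ((m : ℤ) : O) = (2 * ω - 1) * (2 * ω - 1) := by
        rw [hm]; push_cast; linear_combination -4 * hω
      change ((m : ℤ) : O) ∈ I
      exact h1 ▸ I.mul_mem_left _ hI
    rw [hf, Ideal.mem_span_singleton, Int.natCast_dvd_natCast] at this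
    exact Nat.mem_divisors.2 ⟨this, hm0⟩
  have hinj : Set.InjOn f {I : Ideal O | 2 * ω - 1 ∈ I} := fun I hI J hJ hIJ ↦
    eq_of_comap_eq hω hO hI hJ (by rw [hf, hf, hIJ])
  have himg : f '' {I : Ideal O | 2 * ω - 1 ∈ I} ⊆ (m.divisors : Set ℕ) := by
    rintro _ ⟨I, hI, rfl⟩
    exact hmaps I hI
  refine ⟨Set.Finite.of_finite_image ((Finset.finite_toSet _).subset himg) hinj, ?_⟩
  rw [← Set.ncard_coe_finset]
  exact Set.ncard_le_ncard_of_injOn f hmaps hinj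

lemma card_quotient_range_pow_two (C : Type*) [CommGroup C] [Finite C] :
    Nat.card (C ⧸ (powMonoidHom 2 : C →* _).range) = {c : C | c ^ 2 = 1}.ncard := by
  have h1 := Subgroup.card_eq_card_quotient_mul_card_subgroup (powMonoidHom 2 : C →* _).ker
  have h2 := Subgroup.card_eq_card_quotient_mul_card_subgroup (powMonoidHom 2 : C →* _).range
  rw [Nat.card_congr (QuotientGroup.quotientKerEquivRange (powMonoidHom 2 : C →* _)).toEquiv, h2,
    mul_comm] at h1
  exact Nat.eq_of_mul_eq_mul_left Nat.card_pos h1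

lemma exists_mul_self_eq_span [IsDedekindDomain O] {I : (Ideal O)⁰} (hI : ClassGroup.mk0 I ^ 2 = 1) :
    ∃ y : O, (I : Ideal O) * I = Ideal.span {y} := by
  rw [pow_two, ← map_mul] at hI
  exact ((ClassGroup.mk0_eq_one_iff (I * I).2).1 hI).principal

lemma mk0_eq_of_norm_eq_sq [IsDedekindDomain O]
    (hω : ω ^ 2 = ω + q) (hO : ∀ x : O, ∃ a b : ℤ, x = a + b * ω) {σ : O →+* O} (hσ : σ ω = 1 - ω)
    (hw0 : 2 * ω - 1 ≠ 0) {I : (Ideal O)⁰} {n : ℤ} {y : O}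
    (hIn : (I : Ideal O) * (I : Ideal O).map σ = Ideal.span {(n : O)})
    (hIy : (I : Ideal O) * I = Ideal.span {y}) (hy : y * σ y = n ^ 2) :
    ∃ I' : (Ideal O)⁰, 2 * ω - 1 ∈ (I' : Ideal O) ∧ ClassGroup.mk0 I' = ClassGroup.mk0 I := by
  have hσ2 := conj_conj hO hσ
  have hI0 := nonZeroDivisors.coe_ne_zero I
  obtain ⟨δ, J, hδ, hJ, hJσ⟩ := exists_invariant_of_norm_eq_sq hσ2 hI0 hIn hIy hy
  have hJ0 : J ≠ ⊥ := by
    rw [hJ]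
    exact mul_ne_zero (by simpa using hδ) hI0
  obtain ⟨c, I', hc, h1, h2⟩ := exists_smul_eq_of_invariant hω hO hσ hJ0 hJσ
  have hI'0 : I' ∈ (Ideal O)⁰ := mem_nonZeroDivisors_of_ne_zero fun h ↦ hw0 (by simpa [h] using h2)
  refine ⟨⟨I', hI'0⟩, h2, (ClassGroup.mk0_eq_mk0_iff (R := O)).2 ⟨c, (2 * ω - 1) * δ, hc, mul_ne_zero hw0 hδ, ?_⟩⟩
  rw [← Ideal.span_singleton_mul_span_singleton, ← h1, hJ, mul_assoc]

lemma ncard_mk0_le [IsDedekindDomain O]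
    (hω : ω ^ 2 = ω + q) (hO : ∀ x : O, ∃ a b : ℤ, x = a + b * ω) {m : ℕ} (hm0 : m ≠ 0) (hm : (m : ℤ) = 4 * q + 1) :
    {c : ClassGroup O | ∃ I : (Ideal O)⁰, 2 * ω - 1 ∈ (I : Ideal O) ∧ ClassGroup.mk0 I = c}.ncard ≤
      m.divisors.card := by
  obtain ⟨hfin, hle⟩ := card_ideals_le hω hO hm0 hm
  refine le_trans ?_ hle
  classical
  refine (Set.ncard_le_ncard (t := (fun I : Ideal O ↦ if h : I ∈ (Ideal O)⁰ then
    ClassGroup.mk0 ⟨I, h⟩ else 1) '' {I : Ideal O | 2 * ω - 1 ∈ I}) ?_ (hfin.image _)).trans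
    (Set.ncard_image_le hfin)
  rintro _ ⟨I, hI, rfl⟩
  exact ⟨I, hI, dif_pos I.2⟩

theorem card_classGroup_quotient_le [IsDedekindDomain O] [CharZero O] [Finite (ClassGroup O)]
    (hω : ω ^ 2 = ω + q) (hO : ∀ x : O, ∃ a b : ℤ, x = a + b * ω)
    (hind : ∀ a b : ℤ, (a : O) + b * ω = 0 → a = 0 ∧ b = 0) {σ : O →+* O} (hσ : σ ω = 1 - ω)
    {m : ℕ} (hm0 : m ≠ 0) (hm : (m : ℤ) = 4 * q + 1) :
    Nat.card (ClassGroup O ⧸ (powMonoidHom 2 : ClassGroup O →* _).range) ≤ 2 * m.divisors.card := by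
  have hw0 : 2 * ω - 1 ≠ 0 := fun h ↦ by
    have := (hind (-1) 2 (by push_cast; linear_combination h)).1
    omega
  rw [card_quotient_range_pow_two]
  refine (card_le_two_mul_card _ _ fun c hc d hd ↦ ?_).trans
    (Nat.mul_le_mul_left 2 (ncard_mk0_le hω hO hm0 hm))
  rw [Set.mem_ofPred_eq] at hc hd
  obtain ⟨I, rfl⟩ := ClassGroup.mk0_surjective c
  obtain ⟨J, rfl⟩ := ClassGroup.mk0_surjective d
  obtain ⟨n, h1⟩ := exists_mul_map_conj_eq hω hO hσ (I : Ideal O)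
  obtain ⟨n', h1'⟩ := exists_mul_map_conj_eq hω hO hσ (J : Ideal O)
  obtain ⟨y, h2⟩ := exists_mul_self_eq_span hc
  obtain ⟨y', h2'⟩ := exists_mul_self_eq_span hd
  rcases norm_eq_or_of_sq_eq hω hO hind hσ h1 h2 with h3 | h3
  · exact .inl (mk0_eq_of_norm_eq_sq hω hO hσ hw0 h1 h2 h3)
  rcases norm_eq_or_of_sq_eq hω hO hind hσ h1' h2' with h3' | h3'
  · exact .inr (.inl (mk0_eq_of_norm_eq_sq hω hO hσ hw0 h1' h2' h3'))
  refine .inr (.inr ?_)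
  rw [← map_mul]
  refine mk0_eq_of_norm_eq_sq (n := n * n') (y := y * y') hω hO hσ hw0 ?_ ?_ ?_
  · rw [Submonoid.coe_mul, Ideal.map_mul, mul_mul_mul_comm, h1, h1', Int.cast_mul,
      Ideal.span_singleton_mul_span_singleton]
  · rw [Submonoid.coe_mul, mul_mul_mul_comm, h2, h2', Ideal.span_singleton_mul_span_singleton]
  · rw [map_mul, mul_mul_mul_comm, h3, h3', Int.cast_mul]
    ring

end SumProd

namespace SumProd

open NumberField

lemma exists_int_eq_of_sq_mul {m : ℕ} (hm : Squarefree m) {b : ℚ} {z : ℤ} (h : b ^ 2 * m = z) :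
    ∃ n : ℤ, b = n := by
  have h1 : b.num ^ 2 * m = z * (b.den : ℤ) ^ 2 := by
    have h2 : (b.num : ℚ) ^ 2 * m = z * (b.den : ℚ) ^ 2 := by
      have h3 := Rat.mul_den_eq_num b
      rw [← h3, ← h]
      ring
    exact_mod_cast h2
  have hcop : IsCoprime ((b.den : ℤ) ^ 2) (b.num ^ 2) := by
    refine IsCoprime.pow (Int.isCoprime_iff_gcd_eq_one.2 ?_)
    rw [Int.gcd_comm]
    exact b.reduced
  have h2 : (b.den : ℤ) ^ 2 ∣ m := hcop.dvd_of_dvd_mul_left ⟨z, by rw [h1, mul_comm]⟩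
  have h3 : b.den * b.den ∣ m := by
    rw [← pow_two]
    exact_mod_cast h2
  have h4 := Nat.isUnit_iff.1 (hm _ h3)
  exact ⟨b.num, (Rat.den_eq_one_iff b).1 h4 |>.symm⟩

variable {k : Type} [Field k] [NumberField k] {w : k} {m : ℕ}

lemma eq_zero_of_add_mul_eq_zero (hw : w ^ 2 = m) (hsq : ¬ IsSquare (m : ℚ)) {a b : ℚ}
    (h : (a : k) + b * w = 0) : a = 0 ∧ b = 0 := by
  rcases eq_or_ne b 0 with rfl | hb
  · simpa using h
  · refine (hsq ⟨a / b, ?_⟩).elim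
    have hb' : (b : k) ≠ 0 := by exact_mod_cast hb
    have h1 : w = -(a / b) := by
      field_simp
      linear_combination h
    have h2 : ((m : ℚ) : k) = ((a / b * (a / b) : ℚ) : k) := by
      push_cast
      rw [← hw, h1]
      ring
    exact_mod_cast h2

lemma exists_conj [IsGalois ℚ k] (hw : w ^ 2 = m) (hk : ∀ x : k, ∃ a b : ℚ, x = a + b * w)
    (h2 : Module.finrank ℚ k = 2) : ∃ τ : k ≃ₐ[ℚ] k, τ w = -w := by
  have hcard : 1 < Nat.card (k ≃ₐ[ℚ] k) := by rw [IsGalois.card_aut_eq_finrank, h2]; omega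
  have : Nontrivial (k ≃ₐ[ℚ] k) := Finite.one_lt_card_iff_nontrivial.1 hcard
  obtain ⟨τ, hτ⟩ := exists_ne (1 : k ≃ₐ[ℚ] k)
  refine ⟨τ, ?_⟩
  have h1 : (τ w) ^ 2 = w ^ 2 := by rw [← map_pow, hw, map_natCast]
  refine (sq_eq_sq_iff_eq_or_eq_neg.1 h1).resolve_left fun h ↦ hτ ?_
  ext x
  obtain ⟨a, b, rfl⟩ := hk x
  simp [h]

lemma exists_int_of_isIntegral (hw : w ^ 2 = m) (hk : ∀ x : k, ∃ a b : ℚ, x = a + b * w)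
    (hm : Squarefree m) {q : ℤ} (hq : (m : ℤ) = 4 * q + 1) {τ : k ≃ₐ[ℚ] k} (hτ : τ w = -w) {x : k}
    (hx : IsIntegral ℤ x) : ∃ a b : ℤ, x = a + b * ((1 + w) / 2) := by
  obtain ⟨a, b, rfl⟩ := hk x
  have hx' : IsIntegral ℤ (τ (a + b * w)) := hx.map (τ.toAlgHom.restrictScalars ℤ)
  have h1 : τ (a + b * w) = a - b * w := by simp [hτ]; ring
  rw [h1] at hx'
  have hrat : ∀ r : ℚ, IsIntegral ℤ (r : k) → ∃ n : ℤ, r = n := fun r hr ↦ by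
    have h2 : IsIntegral ℤ (algebraMap ℚ k r) := by simpa using hr
    rw [isIntegral_algebraMap_iff (algebraMap ℚ k).injective] at h2
    obtain ⟨n, hn⟩ := IsIntegrallyClosed.isIntegral_iff.1 h2
    exact ⟨n, by simpa using hn.symm⟩
  obtain ⟨A, hA⟩ := hrat (2 * a) (by
    have h2 : ((2 * a : ℚ) : k) = (a + b * w) + (a - b * w) := by push_cast; ring
    exact h2 ▸ hx.add hx')
  obtain ⟨N, hN⟩ := hrat (a ^ 2 - b ^ 2 * m) (by
    have h2 : ((a ^ 2 - b ^ 2 * m : ℚ) : k) = (a + b * w) * (a - b * w) := by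
      push_cast
      rw [← hw]
      ring
    exact h2 ▸ hx.mul hx')
  obtain ⟨B, hB⟩ := exists_int_eq_of_sq_mul (b := 2 * b) (z := A ^ 2 - 4 * N) hm (by
    push_cast
    rw [← hA, ← hN]
    ring)
  have h3 : A ^ 2 - B ^ 2 * m = 4 * N := by
    have : (A : ℚ) ^ 2 - B ^ 2 * m = 4 * N := by
      rw [← hA, ← hN, ← hB]
      ring
    exact_mod_cast this
  have h4 : Even (A - B) := by
    have h5 : Even ((A - B) * (A + B)) := by
      rw [hq] at h3
      refine ⟨2 * N + 2 * B ^ 2 * q, by linear_combination h3⟩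
    rcases Int.even_mul.1 h5 with h | h
    · exact h
    · have : A - B = A + B - 2 * B := by ring
      rw [this]
      exact h.sub (even_two_mul B)
  obtain ⟨c, hc⟩ := h4
  refine ⟨c, B, ?_⟩
  have ha : (a : k) = c + B / 2 := by
    have : a = c + B / 2 := by
      have : (A : ℚ) - B = c + c := by exact_mod_cast hc
      linarith
    rw [this]; push_cast; ring
  have hb : (b : k) = B / 2 := by
    have : b = B / 2 := by linarith
    rw [this]; push_cast; ring
  rw [ha, hb]
  ring

lemma isIntegral_half (hw : w ^ 2 = m) {q : ℤ} (hq : (m : ℤ) = 4 * q + 1) : IsIntegral ℤ ((1 + w) / 2) := by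
  refine ⟨Polynomial.X ^ 2 - Polynomial.X - Polynomial.C q, ?_, ?_⟩
  · rw [sub_sub, ← add_comm]
    monicity!
  · have : (m : k) = 4 * q + 1 := by exact_mod_cast congrArg (Int.cast : ℤ → k) hq
    simp only [Polynomial.eval₂_sub, Polynomial.eval₂_X_pow, Polynomial.eval₂_X, Polynomial.eval₂_C]
    simp
    linear_combination (hw + this) / 4

theorem exists_omega [IsGalois ℚ k] (hw : w ^ 2 = m) (hk : ∀ x : k, ∃ a b : ℚ, x = a + b * w)
    (h2 : Module.finrank ℚ k = 2) (hsq : ¬ IsSquare (m : ℚ)) (hm : Squarefree m) {q : ℤ}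
    (hq : (m : ℤ) = 4 * q + 1) : ∃ (ω : 𝓞 k) (σ : 𝓞 k →+* 𝓞 k), ω ^ 2 = ω + q ∧
      (∀ x : 𝓞 k, ∃ a b : ℤ, x = a + b * ω) ∧ (∀ a b : ℤ, (a : 𝓞 k) + b * ω = 0 → a = 0 ∧ b = 0) ∧
      σ ω = 1 - ω ∧ algebraMap (𝓞 k) k ω = (1 + w) / 2 := by
  obtain ⟨τ, hτ⟩ := exists_conj hw hk h2
  have hmq : (m : k) = 4 * q + 1 := by exact_mod_cast congrArg (Int.cast : ℤ → k) hq
  let ω : 𝓞 k := ⟨(1 + w) / 2, isIntegral_half hw hq⟩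
  have hω : algebraMap (𝓞 k) k ω = (1 + w) / 2 := rfl
  refine ⟨ω, RingOfIntegers.mapRingHom τ, ?_, fun x ↦ ?_, fun a b h ↦ ?_, ?_, hω⟩
  · apply RingOfIntegers.coe_injective
    rw [map_pow, map_add, map_intCast, hω]
    linear_combination (hw + hmq) / 4
  · obtain ⟨a, b, h⟩ := exists_int_of_isIntegral hw hk hm hq hτ x.isIntegral_coe
    refine ⟨a, b, RingOfIntegers.coe_injective ?_⟩
    rw [map_add, map_mul, map_intCast, map_intCast, hω]
    exact h
  · have h' := congrArg (algebraMap (𝓞 k) k) h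
    rw [map_add, map_mul, map_intCast, map_intCast, hω, map_zero] at h'
    obtain ⟨h3, h4⟩ := eq_zero_of_add_mul_eq_zero (a := a + b / 2) (b := b / 2) hw hsq (by
      push_cast
      linear_combination h')
    have hb : (b : ℚ) = 0 := by linarith
    have ha : (a : ℚ) = 0 := by linarith
    exact ⟨by exact_mod_cast ha, by exact_mod_cast hb⟩
  · apply RingOfIntegers.coe_injective
    rw [map_sub, map_one, hω]
    change τ ((1 + w) / 2) = _
    rw [map_div₀, map_add, hτ, map_one, map_ofNat]
    ring

end SumProd

namespace SumProd

open NumberField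

section Primes

variable {ι : Type*} {P : ι → ℕ}

lemma squarefree_prod_primes (hP : ∀ i, (P i).Prime) (hinj : Function.Injective P) (T : Finset ι) :
    Squarefree (∏ i ∈ T, P i) := by
  classical
  induction T using Finset.induction_on with
  | empty => simp
  | insert i T hi ih =>
    rw [Finset.prod_insert hi, Nat.squarefree_mul (Nat.Coprime.prod_right fun j hj ↦
      (Nat.coprime_primes (hP i) (hP j)).2 fun h ↦ hi (hinj h ▸ hj))]
    exact ⟨(hP i).squarefree, ih⟩

lemma card_divisors_prod_primes (hP : ∀ i, (P i).Prime) (hinj : Function.Injective P) (T : Finset ι) :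
    (∏ i ∈ T, P i).divisors.card = 2 ^ T.card := by
  classical
  induction T using Finset.induction_on with
  | empty => simp
  | insert i T hi ih =>
    rw [Finset.prod_insert hi, Nat.Coprime.card_divisors_mul (Nat.Coprime.prod_right fun j hj ↦
      (Nat.coprime_primes (hP i) (hP j)).2 fun h ↦ hi (hinj h ▸ hj)), ih, (hP i).divisors,
      Finset.card_pair (hP i).one_lt.ne, Finset.card_insert_of_notMem hi, pow_succ, mul_comm]

lemma not_isSquare_prod_primes (hP : ∀ i, (P i).Prime) (hinj : Function.Injective P) {T : Finset ι}
    (hT : T.Nonempty) : ¬ IsSquare ((∏ i ∈ T, P i : ℕ) : ℚ) := by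
  rw [Rat.isSquare_natCast_iff]
  rintro ⟨r, hr⟩
  have h1 := Nat.isUnit_iff.1 (squarefree_prod_primes hP hinj T r ⟨1, by rw [hr, mul_one]⟩)
  obtain ⟨i, hi⟩ := hT
  have h2 : P i ∣ 1 := by
    have := Finset.dvd_prod_of_mem P hi
    rwa [hr, h1] at this
  exact (hP i).one_lt.ne' (Nat.dvd_one.1 h2)

lemma prod_mod_four (h : ∀ i, P i % 4 = 1) (T : Finset ι) : (∏ i ∈ T, P i) % 4 = 1 :=
  Finset.prod_induction P (fun x ↦ x % 4 = 1) (fun a b ha hb ↦ by rw [Nat.mul_mod, ha, hb]) rfl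
    fun i _ ↦ h i

end Primes

variable {k : Type} [Field k] {w : k} {m : ℕ}

lemma mem_goodUnits_of_mul_eq {S : Type*} [CommRing S] [Algebra S k] (hw : w ^ 2 = m) (hw0 : w ≠ 0) {p p' : ℕ} (hpp : p * p' = m)
    (hp : p % 4 = 1) (hp' : p' % 4 = 1) (hcop : p.Coprime p') {a : kˣ} (ha : (a : k) = p) :
    a ∈ goodUnits S k := by
  have hmod : ∀ p : ℕ, p % 4 = 1 → ∃ t : ℤ, (1 : ℤ) ^ 2 - 4 * t = p := fun p hp ↦
    ⟨-(p / 4 : ℕ), by omega⟩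
  intro Q hQ
  by_cases h : (p : S) ∈ Q
  · obtain ⟨t, ht⟩ := hmod p' hp'
    have ht' : (1 : S) ^ 2 - 4 * t = p' := by exact_mod_cast congrArg (Int.cast : ℤ → S) ht
    refine ⟨1, t, ?_, Units.mk0 w hw0 / a, ?_⟩
    · rw [ht']
      intro h'
      obtain ⟨u, v, huv⟩ := Nat.isCoprime_iff_coprime.2 hcop
      have h1 : (1 : S) = u * p + v * p' := by exact_mod_cast congrArg (Int.cast : ℤ → S) huv.symm
      exact hQ.ne_top ((Ideal.eq_top_iff_one _).2 (h1 ▸ Q.add_mem (Q.mul_mem_left _ h) (Q.mul_mem_left _ h')))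
    · rw [ht', map_natCast, Units.val_div_eq_div_val, Units.val_mk0, div_pow, hw, ← hpp, Nat.cast_mul, ← ha]
      have := a.ne_zero
      field_simp
  · obtain ⟨t, ht⟩ := hmod p hp
    have ht' : (1 : S) ^ 2 - 4 * t = p := by exact_mod_cast congrArg (Int.cast : ℤ → S) ht
    exact ⟨1, t, by rwa [ht'], 1, by rw [ht', map_natCast, ha, Units.val_one, one_pow, mul_one]⟩

lemma not_isSquare_of_mul_eq [NumberField k] (hw : w ^ 2 = m) (hk : ∀ x : k, ∃ a b : ℚ, x = a + b * w)
    (hsq : ¬ IsSquare (m : ℚ)) {D E : ℕ} (hDE : D * E = m) (hD0 : D ≠ 0) (hD : ¬ IsSquare (D : ℚ))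
    (hE : ¬ IsSquare (E : ℚ)) : ¬ IsSquare (D : k) := by
  rintro ⟨x, hx⟩
  obtain ⟨a, b, rfl⟩ := hk x
  obtain ⟨h1, h2⟩ := eq_zero_of_add_mul_eq_zero (a := a ^ 2 + b ^ 2 * m - D) (b := 2 * a * b) hw hsq (by
    push_cast
    linear_combination - hx - b ^ 2 * hw)
  rcases eq_or_ne b 0 with rfl | hb
  · exact hD ⟨a, by linear_combination -h1⟩
  · have ha : a = 0 := by simpa [hb] using h2
    subst ha
    have hD0' : (D : ℚ) ≠ 0 := by exact_mod_cast hD0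
    have h3 : b ^ 2 * E = 1 := mul_left_cancel₀ hD0' (by
      rw [← hDE] at h1
      push_cast at h1
      linear_combination h1)
    exact hE ⟨b⁻¹, by field_simp; linear_combination h3⟩

theorem exists_hasTower_of_primes {d : ℕ} (hd : 10 ≤ d) {P : Fin (d + 1) → ℕ} (hP : ∀ i, (P i).Prime)
    (hinj : Function.Injective P) (h4 : ∀ i, P i % 4 = 1) :
    ∃ (k : Type) (_ : Field k) (_ : NumberField k), ∀ n, HasTower k n := by
  obtain ⟨m, hm⟩ : ∃ m, m = ∏ i, P i := ⟨_, rfl⟩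
  have hsf : Squarefree m := hm ▸ squarefree_prod_primes hP hinj _
  have hsq : ¬ IsSquare (m : ℚ) := hm ▸ not_isSquare_prod_primes hP hinj Finset.univ_nonempty
  have hm4 : m % 4 = 1 := hm ▸ prod_mod_four h4 _
  have hm0 : m ≠ 0 := fun h ↦ by simp [h] at hm4
  obtain ⟨k, _, _, hA, _, w, _, hw, hk, h2⟩ := exists_quadratic_extension (k := ℚ) (L := ℚ) (α := (m : ℚ))
    (fun σ ↦ ⟨1, by simp⟩) hsq
  have : CharZero k := algebraRat.charZero k
  obtain rfl := Subsingleton.elim hA DivisionRing.toRatAlgebra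
  rename_i hB _ _
  obtain rfl := Subsingleton.elim hB DivisionRing.toRatAlgebra
  have : Module.Finite ℚ k := Module.finite_of_finrank_pos (by omega)
  have : NumberField k := ⟨⟩
  have : IsGalois ℚ k := ⟨⟩
  have htr : IsTotallyReal k := isTotallyReal_of_sqrt (L := ℚ) (α := Units.mk0 (m : ℚ) (by exact_mod_cast hm0))
    (fun φ ↦ by
      rw [Units.val_mk0, map_natCast]
      exact_mod_cast Nat.pos_of_ne_zero hm0) hw hk
  have hk' : ∀ x : k, ∃ a b : ℚ, x = a + b * w := by simpa using hk
  have hw' : w ^ 2 = m := by simpa using hw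
  have hw0 : w ≠ 0 := fun h ↦ by
    rw [h, zero_pow two_ne_zero] at hw'
    exact hm0 (by exact_mod_cast hw'.symm)
  obtain ⟨q, hq⟩ : ∃ q : ℤ, (m : ℤ) = 4 * q + 1 := ⟨(m / 4 : ℕ), by omega⟩
  obtain ⟨ω, σ, hω, hO, hind, hσ, -⟩ := exists_omega hw' hk' h2 hsq hsf hq
  refine ⟨k, inferInstance, inferInstance, fun n ↦ ?_⟩
  have hPk : ∀ i, (P i : k) ≠ 0 := fun i ↦ by exact_mod_cast (hP i).ne_zero
  refine hasTower_of_good (d₀ := d) (r := d + 6) (fun x ↦ two_dvd_of_two_dvd_sq hω hO hind) (by omega) ?_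
    (a := fun i ↦ Units.mk0 (P i.castSucc : k) (hPk _)) (fun i ↦ ⟨fun φ ↦ ?_, ?_⟩) (fun s hs ↦ ?_) n
  · have := card_classGroup_quotient_le hω hO hind hσ hm0 hq
    have h3 : m.divisors.card = 2 ^ (d + 1) := by
      rw [hm, card_divisors_prod_primes hP hinj, Finset.card_univ, Fintype.card_fin]
    rw [h3] at this
    rw [h2]
    refine (Nat.mul_le_mul_right _ (Nat.mul_le_mul_right _ this)).trans (le_of_eq ?_)
    ring
  · rw [Units.val_mk0, map_natCast]
    exact_mod_cast (hP _).pos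
  · have hpp : P i.castSucc * ∏ j ∈ Finset.univ.erase i.castSucc, P j = m := by
      rw [hm, Finset.mul_prod_erase _ _ (Finset.mem_univ _)]
    refine mem_goodUnits_of_mul_eq hw' hw0 hpp (h4 _) (prod_mod_four h4 _) ?_ (Units.val_mk0 _)
    exact Nat.Coprime.prod_right fun j hj ↦ (Nat.coprime_primes (hP _) (hP j)).2 fun h ↦
      Finset.ne_of_mem_erase hj (hinj h).symm
  · have h5 := Finset.prod_mul_prod_compl (s.map Fin.castSuccEmb) P
    rw [← hm] at h5
    have h6 : ((∏ i ∈ s, Units.mk0 (P i.castSucc : k) (hPk _) : kˣ) : k) =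
        ((∏ i ∈ s.map Fin.castSuccEmb, P i : ℕ) : k) := by
      simp [Units.coe_prod]
    rw [h6]
    refine not_isSquare_of_mul_eq hw' hk' hsq h5 (Finset.prod_ne_zero_iff.2 fun i _ ↦ (hP i).ne_zero)
      (not_isSquare_prod_primes hP hinj (hs.map)) (not_isSquare_prod_primes hP hinj ⟨Fin.last d, ?_⟩)
    simp [Fin.castSucc_ne_last]

theorem exists_hasTower : ∃ (k : Type) (_ : Field k) (_ : NumberField k), ∀ n, HasTower k n := by
  refine exists_hasTower_of_primes (d := 10) le_rfl (P := ![5, 13, 17, 29, 37, 41, 53, 61, 73, 89, 97])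
    (fun i ↦ ?_) (by decide) (by decide)
  fin_cases i <;> norm_num

end SumProd

namespace SumProd

open NumberField nonZeroDivisors

theorem differentIdeal_eq_top_of_unr {k L : Type*} [Field k] [NumberField k] [Field L] [NumberField L]
    [Algebra k L] [IsGalois k L] (h : Unr (L ≃ₐ[k] L) (𝓞 L)) : differentIdeal (𝓞 k) (𝓞 L) = ⊤ := by
  have hdual : FractionalIdeal.dual (𝓞 k) k (1 : FractionalIdeal (𝓞 L)⁰ L) = 1 := by
    refine le_antisymm (fun y hy ↦ ?_) (FractionalIdeal.one_le_dual_one (𝓞 k) k)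
    change y ∈ FractionalIdeal.dual (𝓞 k) k (1 : FractionalIdeal (𝓞 L)⁰ L) at hy
    rw [FractionalIdeal.mem_dual (one_ne_zero (α := FractionalIdeal (𝓞 L)⁰ L))] at hy
    rw [FractionalIdeal.mem_one_iff]
    obtain ⟨n, a, b, hab⟩ := h
    have hL : ∀ g : L ≃ₐ[k] L, (g = 1 → ∑ i, algebraMap (𝓞 L) L (a i) * g • algebraMap (𝓞 L) L (b i) = 1) ∧
        (g ≠ 1 → ∑ i, algebraMap (𝓞 L) L (a i) * g • algebraMap (𝓞 L) L (b i) = 0) := fun g ↦ by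
      have h1 : ∑ i, algebraMap (𝓞 L) L (a i) * g • algebraMap (𝓞 L) L (b i) =
          algebraMap (𝓞 L) L (∑ i, a i * g • b i) := by
        rw [map_sum]
        exact Finset.sum_congr rfl fun i _ ↦ by rw [map_mul]; rfl
      rw [h1]
      exact ⟨fun hg ↦ by rw [(hab g).1 hg, map_one], fun hg ↦ by rw [(hab g).2 hg, map_zero]⟩
    have key := Unr.sum_eq hL fun g ↦ g • y
    rw [one_smul] at key
    have htr : ∀ i, ∃ z : 𝓞 k, ∑ g : L ≃ₐ[k] L, g • y * g • algebraMap (𝓞 L) L (b i) =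
        algebraMap (𝓞 L) L (algebraMap (𝓞 k) (𝓞 L) z) := fun i ↦ by
      obtain ⟨z, hz⟩ := hy (algebraMap (𝓞 L) L (b i)) ((FractionalIdeal.mem_one_iff _).2 ⟨b i, rfl⟩)
      refine ⟨z, ?_⟩
      rw [← IsScalarTower.algebraMap_apply (𝓞 k) (𝓞 L) L, IsScalarTower.algebraMap_apply (𝓞 k) k L, hz,
        Algebra.traceForm_apply, trace_eq_sum_automorphisms]
      exact Finset.sum_congr rfl fun g _ ↦ (map_mul g _ _).symm
    choose z hz using htr
    refine ⟨∑ i, a i * algebraMap (𝓞 k) (𝓞 L) (z i), ?_⟩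
    rw [← key, map_sum]
    exact Finset.sum_congr rfl fun i _ ↦ by rw [map_mul, hz]
  have h1 := coeIdeal_differentIdeal (𝓞 k) k L (𝓞 L)
  rw [hdual, inv_one] at h1
  exact FractionalIdeal.coeIdeal_injective (K := L) (h1.trans (FractionalIdeal.coeIdeal_top _).symm)

theorem natAbs_discr_eq_of_unr {k L : Type*} [Field k] [NumberField k] [Field L] [NumberField L]
    [Algebra k L] [IsGalois k L] (h : Unr (L ≃ₐ[k] L) (𝓞 L)) :
    (discr L).natAbs = (discr k).natAbs ^ Module.finrank k L := by
  rw [natAbs_discr_eq_absNorm_differentIdeal_mul_natAbs_discr_pow k (𝓞 k) L (𝓞 L),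
    differentIdeal_eq_top_of_unr h, Ideal.absNorm_top, one_mul]

/-- Totally real number fields of arbitrarily large degree with bounded root discriminant. -/
theorem exists_isTotallyReal_discr_le : ∃ B : ℕ, ∀ n : ℕ, ∃ (L : Type) (_ : Field L) (_ : NumberField L),
    IsTotallyReal L ∧ n ≤ Module.finrank ℚ L ∧ (discr L).natAbs ≤ B ^ Module.finrank ℚ L := by
  obtain ⟨k, _, _, hk⟩ := exists_hasTower
  refine ⟨(discr k).natAbs, fun n ↦ ?_⟩
  obtain ⟨L, _, _, _, _, h1, h2, h3⟩ := hk n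
  have h4 : Module.finrank ℚ k * Module.finrank k L = Module.finrank ℚ L := Module.finrank_mul_finrank ℚ k L
  have h5 : Module.finrank k L ≤ Module.finrank ℚ L := by
    rw [← h4]
    exact Nat.le_mul_of_pos_left _ Module.finrank_pos
  refine ⟨L, inferInstance, inferInstance, h1, ?_, ?_⟩
  · rw [h3] at h5
    exact (Nat.lt_two_pow_self.le).trans h5
  · rw [natAbs_discr_eq_of_unr h2]
    exact Nat.pow_le_pow_right (Int.natAbs_pos.2 (discr_ne_zero k)) h5

end SumProd

namespace SumProd

open NumberField nonZeroDivisors IsDedekindDomain Filter Topology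

lemma half_le_prod_one_sub_inv_sq (F : Finset ℕ) (hF : ∀ n ∈ F, 2 ≤ n) :
    (1 / 2 : ℝ) ≤ ∏ n ∈ F, (1 - ((n : ℝ) ^ 2)⁻¹) := by
  have h1 : ∀ N : ℕ, ∏ n ∈ Finset.range N, (1 - (((n + 2 : ℕ) : ℝ) ^ 2)⁻¹) = (N + 2) / (2 * (N + 1)) := fun N ↦ by
    induction N with
    | zero => simp
    | succ N ih =>
      rw [Finset.prod_range_succ, ih]
      push_cast
      field_simp
      ring
  have h0 : ∀ n : ℕ, 2 ≤ n → 0 ≤ 1 - ((n : ℝ) ^ 2)⁻¹ := fun n hn ↦ by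
    have : (1 : ℝ) ≤ (n : ℝ) ^ 2 := one_le_pow₀ (by exact_mod_cast (by omega : 1 ≤ n))
    exact sub_nonneg.2 (inv_le_one_of_one_le₀ this)
  have hle : ∀ n : ℕ, 1 - ((n : ℝ) ^ 2)⁻¹ ≤ 1 := fun n ↦ sub_le_self _ (by positivity)
  let N := F.sup id
  have hsub : F ⊆ (Finset.range N).map (addRightEmbedding 2) := fun n hn ↦ by
    have h2 : n ≤ N := Finset.le_sup (f := id) hn
    have h3 := hF n hn
    refine Finset.mem_map.2 ⟨n - 2, Finset.mem_range.2 (by omega), ?_⟩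
    simp only [addRightEmbedding_apply]
    omega
  calc (1 / 2 : ℝ) ≤ (N + 2) / (2 * (N + 1)) := by
        rw [div_le_div_iff₀ (by norm_num) (by positivity)]
        linarith
    _ = ∏ n ∈ (Finset.range N).map (addRightEmbedding 2), (1 - ((n : ℝ) ^ 2)⁻¹) := by
        rw [Finset.prod_map, ← h1]
        rfl
    _ ≤ _ := by
        rw [← Finset.prod_sdiff hsub]
        refine mul_le_of_le_one_left (Finset.prod_nonneg fun n hn ↦ h0 n (hF n hn))
          (Finset.prod_le_one (fun n hn ↦ h0 n ?_) fun n _ ↦ hle n)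
        obtain ⟨m, -, rfl⟩ := Finset.mem_map.1 (Finset.mem_sdiff.1 hn).1
        exact Nat.le_add_left 2 m

variable {L : Type*} [Field L] [NumberField L]

lemma exists_prime_mem (P : HeightOneSpectrum (𝓞 L)) : ∃ p : ℕ, p.Prime ∧ (p : 𝓞 L) ∈ P.asIdeal ∧
    p ≤ Ideal.absNorm P.asIdeal := by
  have h0 : Ideal.absNorm P.asIdeal ≠ 0 := fun h ↦ P.ne_bot (Ideal.absNorm_eq_zero_iff.1 h)
  have h1 : ∀ n : ℕ, n ≠ 0 → (n : 𝓞 L) ∈ P.asIdeal → ∃ p : ℕ, p.Prime ∧ p ∣ n ∧ (p : 𝓞 L) ∈ P.asIdeal := by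
    intro n
    induction n using Nat.recOnMul with
    | zero => exact fun h ↦ (h rfl).elim
    | one => exact fun _ h ↦ (P.isPrime.ne_top ((Ideal.eq_top_iff_one _).2 (by simpa using h))).elim
    | prime p hp => exact fun _ h ↦ ⟨p, hp, dvd_rfl, h⟩
    | mul a b iha ihb =>
      intro hab h
      rw [Nat.cast_mul] at h
      rcases P.isPrime.mem_or_mem h with h | h
      · obtain ⟨p, hp, h1, h2⟩ := iha (left_ne_zero_of_mul hab) h
        exact ⟨p, hp, h1.mul_right _, h2⟩
      · obtain ⟨p, hp, h1, h2⟩ := ihb (right_ne_zero_of_mul hab) h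
        exact ⟨p, hp, h1.mul_left _, h2⟩
  obtain ⟨p, hp, h2, h3⟩ := h1 _ h0 (Ideal.absNorm_mem _)
  exact ⟨p, hp, h3, Nat.le_of_dvd (Nat.pos_of_ne_zero h0) h2⟩

lemma card_le_finrank_of_mem {p : ℕ} (hp : p.Prime) (T : Finset (HeightOneSpectrum (𝓞 L)))
    (hT : ∀ P ∈ T, (p : 𝓞 L) ∈ P.asIdeal ∧ p ≤ Ideal.absNorm P.asIdeal) :
    T.card ≤ Module.finrank ℚ L := by
  classical
  have h1 : ∏ P ∈ T, P.asIdeal ∣ Ideal.span {(p : 𝓞 L)} := by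
    rw [← Finset.prod_image (f := fun I : Ideal (𝓞 L) ↦ I) (fun _ _ _ _ h ↦ HeightOneSpectrum.ext h)]
    refine Finset.prod_primes_dvd _ ?_ ?_
    · intro I hI
      obtain ⟨P, -, rfl⟩ := Finset.mem_image.1 hI
      exact P.prime
    · intro I hI
      obtain ⟨P, hP, rfl⟩ := Finset.mem_image.1 hI
      exact Ideal.dvd_span_singleton.2 (hT P hP).1
  have h2 := map_dvd Ideal.absNorm h1
  have h3 : Ideal.absNorm (Ideal.span {(p : 𝓞 L)}) = p ^ Module.finrank ℚ L := by
    rw [Ideal.absNorm_span_singleton, ← RingOfIntegers.rank]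
    have : (p : 𝓞 L) = algebraMap ℤ (𝓞 L) p := by simp
    rw [this, Algebra.norm_algebraMap]
    simp
  rw [h3, map_prod] at h2
  have h4 : p ^ T.card ≤ ∏ P ∈ T, Ideal.absNorm P.asIdeal := by
    rw [← Finset.prod_const]
    exact Finset.prod_le_prod' fun P hP ↦ (hT P hP).2
  exact (Nat.pow_le_pow_iff_right hp.one_lt).1 (h4.trans (Nat.le_of_dvd (pow_pos hp.pos _) h2))

lemma half_pow_le_prod (S : Finset (HeightOneSpectrum (𝓞 L))) :
    (1 / 2 : ℝ) ^ Module.finrank ℚ L ≤ ∏ P ∈ S, (1 - ((Ideal.absNorm P.asIdeal : ℝ) ^ 2)⁻¹) := by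
  classical
  choose p hp hmem hle using exists_prime_mem (L := L)
  have h0 : ∀ n : ℕ, 2 ≤ n → 0 ≤ 1 - ((n : ℝ) ^ 2)⁻¹ := fun n hn ↦ by
    have : (1 : ℝ) ≤ (n : ℝ) ^ 2 := one_le_pow₀ (by exact_mod_cast (by omega : 1 ≤ n))
    exact sub_nonneg.2 (inv_le_one_of_one_le₀ this)
  calc (1 / 2 : ℝ) ^ Module.finrank ℚ L
      ≤ (∏ n ∈ S.image p, (1 - ((n : ℝ) ^ 2)⁻¹)) ^ Module.finrank ℚ L := by
        refine pow_le_pow_left₀ (by norm_num) (half_le_prod_one_sub_inv_sq _ fun n hn ↦ ?_) _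
        obtain ⟨P, -, rfl⟩ := Finset.mem_image.1 hn
        exact (hp P).two_le
    _ ≤ ∏ n ∈ S.image p, ∏ P ∈ S with p P = n, (1 - ((n : ℝ) ^ 2)⁻¹) := by
        rw [← Finset.prod_pow]
        refine Finset.prod_le_prod (fun n hn ↦ ?_) fun n hn ↦ ?_
        · obtain ⟨P, -, rfl⟩ := Finset.mem_image.1 hn
          exact pow_nonneg (h0 _ (hp P).two_le) _
        · obtain ⟨P, -, rfl⟩ := Finset.mem_image.1 hn
          rw [Finset.prod_const]
          refine pow_le_pow_of_le_one (h0 _ (hp P).two_le) (sub_le_self _ (by positivity))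
            (card_le_finrank_of_mem (hp P) _ fun Q hQ ↦ ?_)
          rw [← (Finset.mem_filter.1 hQ).2]
          exact ⟨hmem Q, hle Q⟩
    _ = ∏ P ∈ S, (1 - ((p P : ℝ) ^ 2)⁻¹) := by
        rw [← Finset.prod_fiberwise_of_maps_to (g := p) (t := S.image p) fun P hP ↦ Finset.mem_image_of_mem p hP]
        refine Finset.prod_congr rfl fun n _ ↦ Finset.prod_congr rfl fun P hP ↦ ?_
        rw [(Finset.mem_filter.1 hP).2]
    _ ≤ _ := by
        refine Finset.prod_le_prod (fun P _ ↦ h0 _ (hp P).two_le) fun P _ ↦ ?_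
        have h1 : (0 : ℝ) < p P := by exact_mod_cast (hp P).pos
        have h2 : (p P : ℝ) ≤ Ideal.absNorm P.asIdeal := by exact_mod_cast hle P
        gcongr

theorem card_ideals_absNorm_le (F : Finset ((Ideal (𝓞 L))⁰)) {X : ℕ} (hX : X ≠ 0)
    (hF : ∀ I ∈ F, Ideal.absNorm (I : Ideal (𝓞 L)) ≤ X) : F.card ≤ 2 ^ Module.finrank ℚ L * X ^ 2 := by
  have hs : Summable (weight (K := L) 1 2) := summable_weight 1 (fun _ ↦ .inl rfl) one_lt_two
  have hw : ∀ I : (Ideal (𝓞 L))⁰, weight (K := L) 1 2 I = ((Ideal.absNorm (I : Ideal (𝓞 L)) : ℝ) ^ 2)⁻¹ := fun I ↦ by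
    change 1 * (Ideal.absNorm (I : Ideal (𝓞 L)) : ℝ) ^ (-2 : ℝ) = _
    rw [one_mul, Real.rpow_neg (Nat.cast_nonneg _)]
    norm_cast
  have h0 : ∀ I : (Ideal (𝓞 L))⁰, 0 ≤ weight (K := L) 1 2 I := fun I ↦ by rw [hw]; positivity
  have h1 : (1 / 2 : ℝ) ^ Module.finrank ℚ L * ∑' I, weight (K := L) 1 2 I ≤ 1 := by
    refine ge_of_tendsto (tendsto_euler _ hs) (Eventually.of_forall fun S ↦ ?_)
    refine mul_le_mul_of_nonneg_right ((half_pow_le_prod S).trans_eq ?_) (tsum_nonneg h0)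
    exact Finset.prod_congr rfl fun P _ ↦ by rw [hw]; rfl
  have h2 : (F.card : ℝ) * ((X : ℝ) ^ 2)⁻¹ ≤ ∑' I, weight (K := L) 1 2 I := by
    refine le_trans ?_ (hs.sum_le_tsum F fun I _ ↦ h0 I)
    rw [← nsmul_eq_mul]
    refine Finset.card_nsmul_le_sum _ _ _ fun I hI ↦ ?_
    rw [hw]
    have h3 : (0 : ℝ) < Ideal.absNorm (I : Ideal (𝓞 L)) := by
      exact_mod_cast Nat.pos_of_ne_zero fun h ↦ nonZeroDivisors.coe_ne_zero I (Ideal.absNorm_eq_zero_iff.1 h)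
    have h4 : (Ideal.absNorm (I : Ideal (𝓞 L)) : ℝ) ≤ X := by exact_mod_cast hF I hI
    gcongr
  have hX' : (0 : ℝ) < X ^ 2 := by positivity
  have h5 : (F.card : ℝ) ≤ 2 ^ Module.finrank ℚ L * X ^ 2 := by
    have h6 := (mul_le_mul_of_nonneg_left h2 (by positivity : (0 : ℝ) ≤ (1 / 2) ^ Module.finrank ℚ L)).trans h1
    rw [one_div, inv_pow] at h6
    have h7 : (0 : ℝ) < 2 ^ Module.finrank ℚ L := by positivity
    field_simp at h6
    linarith
  exact_mod_cast h5

end SumProd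

namespace SumProd

open NumberField nonZeroDivisors

section Box

variable {L : Type*} [Field L] [NumberField L] [IsTotallyReal L]

lemma card_infinitePlace_of_isTotallyReal :
    Fintype.card (InfinitePlace L) = Module.finrank ℚ L := by
  rw [← InfinitePlace.sum_mult_eq]
  simp [IsTotallyReal.mult_eq]

lemma prod_infinitePlace_eq_absNorm (x : 𝓞 L) :
    ∏ w : InfinitePlace L, w (x : L) = Ideal.absNorm (Ideal.span {x}) := by
  have h := InfinitePlace.prod_eq_abs_norm (x : L)
  simp only [IsTotallyReal.mult_eq, pow_one] at h
  rw [h, Ideal.absNorm_span_singleton, ← Algebra.coe_norm_int, Nat.cast_natAbs]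
  simp

lemma one_le_prod_infinitePlace {x : 𝓞 L} (hx : x ≠ 0) :
    1 ≤ ∏ w : InfinitePlace L, w (x : L) := by
  rw [prod_infinitePlace_eq_absNorm, Nat.one_le_cast, Nat.one_le_iff_ne_zero, ne_eq,
    Ideal.absNorm_eq_zero_iff, Ideal.span_singleton_eq_bot]
  exact hx

/-- A set of algebraic integers of a totally real field whose conjugates are all at most `X` in
absolute value has at most `(2 * X + 1) ^ d` elements. -/
lemma card_le_of_forall_infinitePlace_le (F : Finset (𝓞 L)) {X : ℕ}
    (hF : ∀ x ∈ F, ∀ w : InfinitePlace L, w (x : L) ≤ X) :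
    F.card ≤ (2 * X + 1) ^ Module.finrank ℚ L := by
  classical
  let e (w : InfinitePlace L) : L →+* ℝ :=
    InfinitePlace.embedding_of_isReal (IsTotallyReal.isReal w)
  have he (w : InfinitePlace L) (x : L) : |e w x| = w x := InfinitePlace.norm_embedding_of_isReal _ x
  have := Finset.card_le_card_of_injOn (s := F)
    (t := Fintype.piFinset fun _ : InfinitePlace L ↦ Finset.Icc (-X : ℤ) X)
    (fun x w ↦ ⌊e w x⌋) (fun x hx ↦ by
      simp only [Finset.mem_coe, Fintype.mem_piFinset, Finset.mem_Icc]
      intro w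
      have h := abs_le.1 ((he w x).trans_le (hF x hx w))
      exact ⟨Int.le_floor.2 (by push_cast; exact h.1),
        by exact_mod_cast (Int.floor_le _).trans h.2⟩)
    (fun x _ y _ hxy ↦ by
      by_contra hne
      have h1 := one_le_prod_infinitePlace (sub_ne_zero.2 hne)
      refine h1.not_gt ?_
      have h2 (w : InfinitePlace L) : w ((x - y : 𝓞 L) : L) < 1 := by
        rw [← he, show ((x - y : 𝓞 L) : L) = x - y from map_sub _ x y, map_sub]
        exact Int.abs_sub_lt_one_of_floor_eq_floor (congrFun hxy w)
      have h3 := Finset.prod_lt_prod_of_nonempty (s := Finset.univ)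
        (fun (w : InfinitePlace L) _ ↦ InfinitePlace.pos_iff.2
          (RingOfIntegers.coe_ne_zero_iff.2 (sub_ne_zero.2 hne))) (fun w _ ↦ h2 w)
        Finset.univ_nonempty
      rwa [Finset.prod_const_one] at h3)
  refine this.trans_eq ?_
  rw [Fintype.card_piFinset, Finset.prod_const, Finset.card_univ,
    card_infinitePlace_of_isTotallyReal, Int.card_Icc]
  congr 1
  omega

end Box

/-- The number of lattice points of the simplex of size `T * card ι`. -/
lemma card_le_of_sum_le {α ι : Type*} [Fintype ι] (F : Finset α) (f : α → ι → ℤ)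
    (hinj : Set.InjOn f F) {T : ℕ} (hT : 1 ≤ T) (h0 : ∀ a ∈ F, ∀ i, 0 ≤ f a i)
    (hs : ∀ a ∈ F, ∑ i, f a i ≤ T * Fintype.card ι) :
    F.card ≤ (4 * (T + 1)) ^ Fintype.card ι := by
  classical
  set d := Fintype.card ι
  let z : ℝ := T / (T + 1)
  have hT' : (0 : ℝ) < T := by exact_mod_cast hT
  have hz0 : 0 < z := by positivity
  have hz1 : z < 1 := (div_lt_one (by positivity)).2 (by linarith)
  let M := T * d + 1
  let P : Finset (ι → ℕ) := Fintype.piFinset fun _ ↦ Finset.range M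
  have key : ∑ n ∈ P, ∏ i, z ^ n i ≤ ((T : ℝ) + 1) ^ d := by
    rw [← Finset.prod_univ_sum (fun _ : ι ↦ Finset.range M) (fun _ n ↦ z ^ n), Finset.prod_const,
      Finset.card_univ]
    refine pow_le_pow_left₀ (Finset.sum_nonneg fun _ _ ↦ by positivity) ?_ _
    refine (Summable.sum_le_tsum _ (fun _ _ ↦ by positivity)
      (summable_geometric_of_lt_one hz0.le hz1)).trans_eq ?_
    rw [tsum_geometric_of_lt_one hz0.le hz1]
    simp only [z]
    field_simp
    ring
  have hsumnat : ∀ a ∈ F, ∑ i, (f a i).toNat ≤ T * d := fun a ha ↦ by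
    have : ((∑ i, (f a i).toNat : ℕ) : ℤ) = ∑ i, f a i := by
      push_cast
      exact Finset.sum_congr rfl fun i _ ↦ by simp [h0 a ha i]
    have h2 := hs a ha
    rw [← this] at h2
    exact_mod_cast h2
  have h1 : (F.card : ℝ) * z ^ (T * d) ≤ ∑ n ∈ P, ∏ i, z ^ n i := by
    rw [← nsmul_eq_mul]
    let g : α → ι → ℕ := fun a i ↦ (f a i).toNat
    have hg : Set.InjOn g F := fun a ha b hb hab ↦ hinj ha hb <| funext fun i ↦ by
      have := congrFun hab i
      have h1 := h0 a ha i
      have h2 := h0 b hb i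
      simp only [g] at this
      omega
    have hsub : F.image g ⊆ P := fun n hn ↦ by
      obtain ⟨a, ha, rfl⟩ := Finset.mem_image.1 hn
      refine Fintype.mem_piFinset.2 fun i ↦ Finset.mem_range.2 ?_
      have h3 := hsumnat a ha
      have : g a i ≤ ∑ i, g a i := Finset.single_le_sum (fun _ _ ↦ Nat.zero_le _) (Finset.mem_univ i)
      exact Nat.lt_succ_of_le (this.trans h3)
    refine le_trans ?_ (Finset.sum_le_sum_of_subset_of_nonneg hsub fun _ _ _ ↦ by positivity)
    rw [Finset.sum_image hg]
    refine Finset.card_nsmul_le_sum _ _ _ fun a ha ↦ ?_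
    rw [Finset.prod_pow_eq_pow_sum]
    exact pow_le_pow_of_le_one hz0.le hz1.le (hsumnat a ha)
  have h4 : (1 / 4 : ℝ) ≤ z ^ T := by
    have : z = (1 + 1 / (T : ℝ))⁻¹ := by simp only [z]; field_simp
    rw [this, inv_pow, one_div]
    refine inv_anti₀ (by positivity) ?_
    calc (1 + 1 / (T : ℝ)) ^ T ≤ (Real.exp (1 / T)) ^ T :=
          pow_le_pow_left₀ (by positivity) (by rw [add_comm]; exact Real.add_one_le_exp _) _
      _ = Real.exp 1 := by rw [← Real.exp_nat_mul]; congr 1; field_simp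
      _ ≤ 4 := by linarith [Real.exp_one_lt_d9]
  have h5 : (F.card : ℝ) * (1 / 4) ^ d ≤ ((T : ℝ) + 1) ^ d := by
    refine le_trans ?_ (h1.trans key)
    rw [pow_mul]
    gcongr
  have h6 : (F.card : ℝ) ≤ (4 * (T + 1)) ^ d := by
    rw [mul_pow]
    calc (F.card : ℝ) = 4 ^ d * (F.card * (1 / 4) ^ d) := by
          rw [mul_left_comm, ← mul_pow]; norm_num
      _ ≤ _ := by gcongr
  exact_mod_cast h6

end SumProd

namespace SumProd

open NumberField nonZeroDivisors

section Dyadic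

variable {L : Type*} [Field L]

/-- The dyadic size of `x` at the infinite place `w`. -/
noncomputable def dyadicSize (x : 𝓞 L) (w : InfinitePlace L) : ℤ :=
  Int.log 2 (w (x : L))

lemma pos_of_ne_zero {x : 𝓞 L} (hx : x ≠ 0) (w : InfinitePlace L) : 0 < w (x : L) :=
  InfinitePlace.pos_iff.2 (RingOfIntegers.coe_ne_zero_iff.2 hx)

lemma zpow_dyadicSize_le {x : 𝓞 L} (hx : x ≠ 0) (w : InfinitePlace L) :
    (2 : ℝ) ^ dyadicSize x w ≤ w (x : L) := by
  exact_mod_cast Int.zpow_log_le_self (b := 2) one_lt_two (pos_of_ne_zero hx w)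

lemma lt_zpow_dyadicSize (x : 𝓞 L) (w : InfinitePlace L) :
    w (x : L) < (2 : ℝ) ^ (dyadicSize x w + 1) := by
  exact_mod_cast Int.lt_zpow_succ_log_self (b := 2) one_lt_two (w (x : L))

lemma dyadicSize_lt {x : 𝓞 L} (hx : x ≠ 0) {w : InfinitePlace L} {R : ℤ}
    (h : w (x : L) < (2 : ℝ) ^ R) : dyadicSize x w < R :=
  (zpow_lt_zpow_iff_right₀ one_lt_two).1 ((zpow_dyadicSize_le hx w).trans_lt h)

end Dyadic

lemma prod_zpow_eq {ι : Type*} (s : Finset ι) (f : ι → ℤ) :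
    ∏ i ∈ s, (2 : ℝ) ^ f i = 2 ^ ∑ i ∈ s, f i := by
  classical
  induction s using Finset.induction_on with
  | empty => simp
  | insert a s ha ih => rw [Finset.prod_insert ha, Finset.sum_insert ha, ih, zpow_add₀ two_ne_zero]

variable {L : Type*} [Field L] [NumberField L] [IsTotallyReal L]

lemma sum_dyadicSize_nonneg {x : 𝓞 L} (hx : x ≠ 0) :
    0 ≤ ∑ w : InfinitePlace L, (dyadicSize x w + 1) := by
  rw [← zpow_le_zpow_iff_right₀ (one_lt_two (α := ℝ)), zpow_zero, ← prod_zpow_eq]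
  exact (one_le_prod_infinitePlace hx).trans
    (Finset.prod_le_prod (fun _ _ ↦ apply_nonneg _ _) fun w _ ↦ (lt_zpow_dyadicSize x w).le)

lemma card_le_of_dyadicSize_eq (F : Finset (𝓞 L)) (h0 : ∀ y ∈ F, y ≠ 0)
    (hI : ∀ y ∈ F, ∀ z ∈ F, Ideal.span {y} = Ideal.span {z})
    (hr : ∀ y ∈ F, ∀ z ∈ F, dyadicSize y = dyadicSize z) :
    F.card ≤ 5 ^ Module.finrank ℚ L := by
  classical
  obtain rfl | ⟨z, hz⟩ := F.eq_empty_or_nonempty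
  · simp
  have hu : ∀ y, y ∈ F → ∃ u, y = z * u := fun y hy ↦
    Ideal.span_singleton_le_span_singleton.1 (hI y hy z hz).le
  choose! u hu using hu
  have hinj : Set.InjOn u F := fun a ha b hb hab ↦ by rw [hu a ha, hu b hb, hab]
  rw [← Finset.card_image_of_injOn hinj]
  refine card_le_of_forall_infinitePlace_le (X := 2) _ fun x hx w ↦ ?_
  obtain ⟨y, hy, rfl⟩ := Finset.mem_image.1 hx
  have h1 := lt_zpow_dyadicSize y w
  have h2 := zpow_dyadicSize_le (h0 z hz) w
  have h3 : w (y : L) = w (z : L) * w (u y : L) := by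
    conv_lhs => rw [hu y hy]
    exact map_mul w (z : L) (u y : L)
  rw [hr y hy z hz, h3, zpow_add_one₀ two_ne_zero] at h1
  have h4 := pos_of_ne_zero (h0 z hz) w
  refine le_of_mul_le_mul_left ?_ h4
  push_cast
  nlinarith

/-- The number of generators of a given ideal all whose conjugates are less than `2 ^ R`. -/
lemma card_generators_le (F : Finset (𝓞 L)) (h0 : ∀ y ∈ F, y ≠ 0)
    (hI : ∀ y ∈ F, ∀ z ∈ F, Ideal.span {y} = Ideal.span {z}) {R : ℕ} (hR : 1 ≤ R)
    (hF : ∀ y ∈ F, ∀ w : InfinitePlace L, w (y : L) < 2 ^ R) :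
    F.card ≤ (20 * (R + 1)) ^ Module.finrank ℚ L := by
  classical
  have h1 : (F.image dyadicSize).card ≤ (4 * (R + 1)) ^ Module.finrank ℚ L := by
    rw [← card_infinitePlace_of_isTotallyReal]
    refine card_le_of_sum_le (F.image dyadicSize) (fun r w ↦ R - r w - 1)
      (fun a _ b _ hab ↦ funext fun w ↦ by have := congrFun hab w; dsimp only at this; omega) hR
      ?_ ?_
    · intro a ha w
      obtain ⟨y, hy, rfl⟩ := Finset.mem_image.1 ha
      have := dyadicSize_lt (R := R) (h0 y hy) (by simpa using hF y hy w)
      omega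
    · intro a ha
      obtain ⟨y, hy, rfl⟩ := Finset.mem_image.1 ha
      have := sum_dyadicSize_nonneg (h0 y hy)
      have h : ∑ w, ((R : ℤ) - dyadicSize y w - 1)
          = R * Fintype.card (InfinitePlace L) - ∑ w, (dyadicSize y w + 1) := by
        simp only [sub_sub, Finset.sum_sub_distrib, Finset.sum_const, Finset.card_univ,
          nsmul_eq_mul]
        ring
      rw [h]
      omega
  have h2 := Finset.card_le_mul_card_image (s := F) (f := dyadicSize) (5 ^ Module.finrank ℚ L)
    fun r _ ↦ card_le_of_dyadicSize_eq _ (fun y hy ↦ h0 y (Finset.mem_filter.1 hy).1)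
      (fun y hy z hz ↦ hI y (Finset.mem_filter.1 hy).1 z (Finset.mem_filter.1 hz).1)
      (fun y hy z hz ↦ (Finset.mem_filter.1 hy).2.trans (Finset.mem_filter.1 hz).2.symm)
  calc F.card ≤ 5 ^ Module.finrank ℚ L * (4 * (R + 1)) ^ Module.finrank ℚ L :=
        h2.trans (Nat.mul_le_mul_left _ h1)
    _ = _ := by rw [← mul_pow]; ring

end SumProd

namespace SumProd

open NumberField mixedEmbedding nonZeroDivisors
open scoped NNReal ENNReal

variable {L : Type*} [Field L] [NumberField L] [IsTotallyReal L]

/-- Minkowski's theorem for boxes in a totally real field. -/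
lemma exists_ne_zero_forall_lt (f : InfinitePlace L → ℝ≥0)
    (hf : NNReal.sqrt ‖discr L‖₊ < ∏ w, f w) :
    ∃ x : 𝓞 L, x ≠ 0 ∧ ∀ w : InfinitePlace L, w (x : L) < f w := by
  classical
  refine exists_ne_zero_mem_ringOfIntegers_lt L (f := f) ?_
  have hr : InfinitePlace.nrRealPlaces L = Module.finrank ℚ L := (IsTotallyReal.finrank L).symm
  rw [minkowskiBound, volume_fundamentalDomain_fractionalIdealLatticeBasis,
    Units.val_one, FractionalIdeal.absNorm_one, Rat.cast_one, ENNReal.ofReal_one, one_mul,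
    mixedEmbedding.finrank, volume_fundamentalDomain_latticeBasis, convexBodyLT_volume]
  simp only [IsTotallyReal.nrComplexPlaces_eq_zero, pow_zero, one_mul, mul_one, hr,
    IsTotallyReal.mult_eq, pow_one, convexBodyLTFactor]
  rw [mul_comm, ENNReal.coe_pow, ENNReal.coe_ofNat]
  refine ENNReal.mul_lt_mul_right (by simp) (by simp) ?_
  exact_mod_cast hf

end SumProd

namespace SumProd

open NumberField nonZeroDivisors
open scoped NNReal

variable {L : Type*} [Field L] [NumberField L] [IsTotallyReal L]

lemma exists_ne_zero_forall_lt_zpow {δ : ℕ}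
    (hδ : (discr L).natAbs < 4 ^ (δ * Module.finrank ℚ L)) (g : InfinitePlace L → ℤ)
    (hg : δ * Module.finrank ℚ L ≤ ∑ w, g w) :
    ∃ x : 𝓞 L, x ≠ 0 ∧ ∀ w : InfinitePlace L, w (x : L) < (2 : ℝ) ^ g w := by
  obtain ⟨x, hx, h⟩ := exists_ne_zero_forall_lt (L := L) (fun w ↦ (2 : ℝ≥0) ^ g w) (by
    rw [← NNReal.coe_lt_coe, NNReal.coe_prod]
    push_cast
    rw [prod_zpow_eq, Real.sqrt_lt' (by positivity), Int.norm_eq_abs, ← Int.cast_abs,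
      ← Nat.cast_natAbs]
    calc ((discr L).natAbs : ℝ) < 4 ^ (δ * Module.finrank ℚ L) := by exact_mod_cast hδ
      _ = ((2 : ℝ) ^ ((δ * Module.finrank ℚ L : ℕ) : ℤ)) ^ 2 := by
        rw [zpow_natCast, ← pow_mul, mul_comm _ 2, pow_mul 2 2]; norm_num
      _ ≤ _ := by
        refine pow_le_pow_left₀ (by positivity) (zpow_le_zpow_right₀ one_le_two ?_) 2
        exact_mod_cast hg)
  exact ⟨x, hx, fun w ↦ by simpa using h w⟩

/-- A totally real field of small discriminant has many integers generating the same ideal all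
whose conjugates are small. -/
lemma exists_many_generators {δ M : ℕ}
    (hδ : (discr L).natAbs < 4 ^ (δ * Module.finrank ℚ L)) (hM : M + 1 ≤ 2 ^ Module.finrank ℚ L) :
    ∃ A : Finset (𝓞 L), (∀ y ∈ A, y ≠ 0) ∧
      (∀ y ∈ A, ∀ z ∈ A, Ideal.span {y} = Ideal.span {z}) ∧
      (∀ y ∈ A, ∀ w : InfinitePlace L, w (y : L) < 2 ^ (δ + M)) ∧
      (M + 1) ^ Module.finrank ℚ L
        ≤ (16 * 4 ^ (δ + 1) * (δ + 2)) ^ Module.finrank ℚ L * A.card := by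
  classical
  set d := Module.finrank ℚ L with hd
  have hd0 : 0 < d := Module.finrank_pos
  have hcard : Fintype.card (InfinitePlace L) = d := card_infinitePlace_of_isTotallyReal
  let e (n : InfinitePlace L → ℕ) : ℕ := (∑ w, n w) / d
  have hsum (n : InfinitePlace L → ℕ) :
      ∑ w, ((δ : ℤ) + n w - e n) = δ * d + ((∑ w, n w) % d : ℕ) := by
    have h := Nat.div_add_mod (∑ w, n w) d
    have h' : (d : ℤ) * e n + ((∑ w, n w) % d : ℕ) = ∑ w, (n w : ℤ) := by exact_mod_cast h
    simp only [Finset.sum_sub_distrib, Finset.sum_add_distrib, Finset.sum_const, Finset.card_univ,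
      nsmul_eq_mul, hcard, ← h']
    ring
  have hlt (n : InfinitePlace L → ℕ) : (((∑ w, n w) % d : ℕ) : ℤ) < d := by
    exact_mod_cast Nat.mod_lt (∑ w, n w) hd0
  have hex (n : InfinitePlace L → ℕ) := exists_ne_zero_forall_lt_zpow (L := L) hδ
    (fun w ↦ (δ : ℤ) + n w - e n) (by rw [hsum, ← hd]; omega)
  choose x hx0 hx using hex
  let P : Finset (InfinitePlace L → ℕ) := Fintype.piFinset fun _ ↦ Finset.range (M + 1)
  have hP : P.card = (M + 1) ^ d := by
    rw [Fintype.card_piFinset, Finset.prod_const, Finset.card_univ, hcard, Finset.card_range]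
  let I (n : InfinitePlace L → ℕ) : (Ideal (𝓞 L))⁰ :=
    ⟨Ideal.span {x n}, mem_nonZeroDivisors_of_ne_zero (by
      rw [Ne, Ideal.zero_eq_bot, Ideal.span_singleton_eq_bot]; exact hx0 n)⟩
  have hI : (P.image I).card ≤ (2 * 4 ^ (δ + 1)) ^ d := by
    refine (card_ideals_absNorm_le (P.image I) (X := 2 ^ ((δ + 1) * d)) (by positivity) ?_).trans_eq ?_
    · intro J hJ
      obtain ⟨n, -, rfl⟩ := Finset.mem_image.1 hJ
      have h : ((Ideal.absNorm (Ideal.span {x n}) : ℕ) : ℝ) ≤ 2 ^ ((δ + 1) * d) := by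
        rw [← prod_infinitePlace_eq_absNorm]
        refine (Finset.prod_le_prod (fun _ _ ↦ apply_nonneg _ _) fun w _ ↦ (hx n w).le).trans ?_
        rw [prod_zpow_eq, hsum, ← zpow_natCast]
        refine zpow_le_zpow_right₀ one_le_two ?_
        rw [Nat.cast_mul, Nat.cast_add, Nat.cast_one, add_mul, one_mul]
        linarith [hlt n]
      exact_mod_cast h
    · rw [mul_pow, ← pow_mul, ← pow_mul, show (4 : ℕ) = 2 ^ 2 from rfl, ← pow_mul]
      ring
  have hPne : P.Nonempty := ⟨0, by simp [P]⟩
  obtain ⟨J, -, hJ⟩ := Finset.exists_max_image (P.image I)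
    (fun J ↦ (P.filter fun n ↦ I n = J).card) (hPne.image I)
  let S := P.filter fun n ↦ I n = J
  have hS : (M + 1) ^ d ≤ S.card * (2 * 4 ^ (δ + 1)) ^ d := by
    rw [← hP]
    exact (Finset.card_le_mul_card_image (s := P) (f := I) S.card hJ).trans
      (Nat.mul_le_mul_left _ hI)
  have hle (n : InfinitePlace L → ℕ) (hn : n ∈ S) (w) : n w ≤ M :=
    Nat.lt_succ_iff.1 <| Finset.mem_range.1 <| Fintype.mem_piFinset.1 (Finset.mem_filter.1 hn).1 w
  have hspan (n : InfinitePlace L → ℕ) (hn : n ∈ S) : Ideal.span {x n} = (J : Ideal (𝓞 L)) :=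
    congrArg Subtype.val (Finset.mem_filter.1 hn).2
  have hfib : ∀ y ∈ S.image x, (S.filter fun n ↦ x n = y).card ≤ 2 ^ d * (4 * (δ + 2)) ^ d := by
    intro y _
    have h1 : ((S.filter fun n ↦ x n = y).image e).card ≤ M + 1 := by
      rw [← Finset.card_range (M + 1)]
      refine Finset.card_le_card fun m hm ↦ ?_
      obtain ⟨n, hn, rfl⟩ := Finset.mem_image.1 hm
      refine Finset.mem_range.2 (Nat.lt_succ_of_le (Nat.div_le_of_le_mul ?_))
      rw [← hcard, ← Finset.card_univ, ← smul_eq_mul]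
      exact Finset.sum_le_card_nsmul _ _ _ fun w _ ↦ hle n (Finset.mem_filter.1 hn).1 w
    refine (Finset.card_le_mul_card_image (s := S.filter fun n ↦ x n = y) (f := e) ((4 * (δ + 2)) ^ d) fun m _ ↦ ?_).trans ?_
    · rw [← hcard]
      refine card_le_of_sum_le ((S.filter fun n ↦ x n = y).filter fun n ↦ e n = m)
        (fun n w ↦ (δ : ℤ) + n w - m - dyadicSize y w - 1)
        (fun a _ b _ hab ↦ funext fun w ↦ by have := congrFun hab w; dsimp only at this; omega)
        (T := δ + 1) (by omega) ?_ ?_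
      · intro n hn w
        obtain ⟨hn', rfl⟩ := Finset.mem_filter.1 hn
        obtain ⟨-, rfl⟩ := Finset.mem_filter.1 hn'
        have := dyadicSize_lt (hx0 n) (hx n w)
        omega
      · intro n hn
        obtain ⟨hn', rfl⟩ := Finset.mem_filter.1 hn
        obtain ⟨-, rfl⟩ := Finset.mem_filter.1 hn'
        have h2 := sum_dyadicSize_nonneg (hx0 n)
        have h3 : ∑ w, ((δ : ℤ) + n w - e n - dyadicSize (x n) w - 1)
            = ∑ w, ((δ : ℤ) + n w - e n) - ∑ w, (dyadicSize (x n) w + 1) := by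
          rw [← Finset.sum_sub_distrib]
          exact Finset.sum_congr rfl fun w _ ↦ by ring
        rw [h3, hsum, hcard]
        rw [Nat.cast_add, Nat.cast_one, add_mul, one_mul]
        linarith [hlt n]
    · rw [mul_comm]
      exact Nat.mul_le_mul_right _ (h1.trans hM)
  refine ⟨S.image x, ?_, ?_, ?_, ?_⟩
  · intro y hy
    obtain ⟨n, -, rfl⟩ := Finset.mem_image.1 hy
    exact hx0 n
  · intro y hy z hz
    obtain ⟨n, hn, rfl⟩ := Finset.mem_image.1 hy
    obtain ⟨m, hm, rfl⟩ := Finset.mem_image.1 hz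
    rw [hspan n hn, hspan m hm]
  · intro y hy w
    obtain ⟨n, hn, rfl⟩ := Finset.mem_image.1 hy
    refine (hx n w).trans_le ?_
    rw [← zpow_natCast]
    refine zpow_le_zpow_right₀ one_le_two ?_
    have := hle n hn w
    push_cast
    omega
  · refine hS.trans ((Nat.mul_le_mul_right _ (Finset.card_le_mul_card_image _ _ hfib)).trans_eq ?_)
    rw [mul_right_comm, ← mul_pow, ← mul_pow]
    congr 2
    ring

end SumProd

namespace SumProd

open NumberField nonZeroDivisors

lemma ncard_le_of_forall_finset {α : Type*} {S : Set α} {n : ℕ}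
    (h : ∀ F : Finset α, (F : Set α) ⊆ S → F.card ≤ n) : S.ncard ≤ n := by
  by_cases hS : S.Finite
  · have := h hS.toFinset (by simp)
    rwa [Set.ncard_eq_toFinset_card S hS]
  · rw [Set.Infinite.ncard hS]
    exact Nat.zero_le n

lemma kfoldSumSet_image {R R' : Type*} [CommRing R] [CommRing R'] (σ : R →+* R') (k : ℕ)
    (A : Set R) : kfoldSumSet k (σ '' A) = σ '' kfoldSumSet k A := by
  ext y
  constructor
  · rintro ⟨f, hf, rfl⟩
    choose g hg hgf using hf
    exact ⟨∑ i, g i, ⟨g, hg, rfl⟩, by simp [hgf]⟩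
  · rintro ⟨-, ⟨g, hg, rfl⟩, rfl⟩
    exact ⟨fun i ↦ σ (g i), fun i ↦ ⟨g i, hg i, rfl⟩, (map_sum σ _ _).symm⟩

lemma kfoldProdSet_image {R R' : Type*} [CommRing R] [CommRing R'] (σ : R →+* R') (k : ℕ)
    (A : Set R) : kfoldProdSet k (σ '' A) = σ '' kfoldProdSet k A := by
  ext y
  constructor
  · rintro ⟨f, hf, rfl⟩
    choose g hg hgf using hf
    exact ⟨∏ i, g i, ⟨g, hg, rfl⟩, by simp [hgf]⟩
  · rintro ⟨-, ⟨g, hg, rfl⟩, rfl⟩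
    exact ⟨fun i ↦ σ (g i), fun i ↦ ⟨g i, hg i, rfl⟩, (map_prod σ _ _).symm⟩

section Bounds

variable {L : Type*} [Field L] [NumberField L] [IsTotallyReal L]

lemma ncard_kfoldSumSet_le {A : Set (𝓞 L)} {r : ℕ}
    (hA : ∀ y ∈ A, ∀ w : InfinitePlace L, w (y : L) < 2 ^ r) (k : ℕ) :
    (kfoldSumSet k A).ncard ≤ (2 * (k * 2 ^ r) + 1) ^ Module.finrank ℚ L := by
  refine ncard_le_of_forall_finset fun F hF ↦ card_le_of_forall_infinitePlace_le F fun y hy w ↦ ?_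
  obtain ⟨f, hf, rfl⟩ := hF hy
  calc w ((∑ i, f i : 𝓞 L) : L) = w (∑ i, (f i : L)) := by
        rw [show ((∑ i, f i : 𝓞 L) : L) = ∑ i, (f i : L) from map_sum (algebraMap (𝓞 L) L) _ _]
    _ ≤ ∑ i, w (f i : L) := w.1.sum_le _ _
    _ ≤ ∑ _i : Fin k, (2 : ℝ) ^ r := Finset.sum_le_sum fun i _ ↦ (hA _ (hf i) w).le
    _ = ((k * 2 ^ r : ℕ) : ℝ) := by simp

lemma ncard_kfoldProdSet_le {A : Set (𝓞 L)} {r : ℕ} (h0 : ∀ y ∈ A, y ≠ 0)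
    (hI : ∀ y ∈ A, ∀ z ∈ A, Ideal.span {y} = Ideal.span {z})
    (hA : ∀ y ∈ A, ∀ w : InfinitePlace L, w (y : L) < 2 ^ r) {k : ℕ} (hk : 1 ≤ k) :
    (kfoldProdSet k A).ncard ≤ (20 * (k * (r + 1) + 1)) ^ Module.finrank ℚ L := by
  refine ncard_le_of_forall_finset fun F hF ↦
    card_generators_le F ?_ ?_ (Nat.mul_pos hk (Nat.succ_pos r)) ?_
  · intro y hy
    obtain ⟨f, hf, rfl⟩ := hF hy
    exact Finset.prod_ne_zero_iff.2 fun i _ ↦ h0 _ (hf i)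
  · intro y hy z hz
    obtain ⟨f, hf, rfl⟩ := hF hy
    obtain ⟨g, hg, rfl⟩ := hF hz
    rw [← Ideal.prod_span_singleton, ← Ideal.prod_span_singleton]
    exact Finset.prod_congr rfl fun i _ ↦ hI _ (hf i) _ (hg i)
  · intro y hy w
    obtain ⟨f, hf, rfl⟩ := hF hy
    calc w ((∏ i, f i : 𝓞 L) : L) = ∏ i, w (f i : L) := by
          rw [show ((∏ i, f i : 𝓞 L) : L) = ∏ i, (f i : L) from
            map_prod (algebraMap (𝓞 L) L) _ _, map_prod]
      _ ≤ ∏ _i : Fin k, (2 : ℝ) ^ r :=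
          Finset.prod_le_prod (fun _ _ ↦ apply_nonneg _ _) fun i _ ↦ (hA _ (hf i) w).le
      _ = 2 ^ (k * r) := by simp [← pow_mul, mul_comm]
      _ < 2 ^ (k * (r + 1)) := pow_lt_pow_right₀ one_lt_two (by nlinarith)

end Bounds

/-- Arbitrarily large finite sets of reals all whose iterated sum sets and product sets are
small. -/
theorem exists_finite_set_small_sum_prod : ∃ c : ℕ, 2 ≤ c ∧ ∀ M N : ℕ, ∃ d : ℕ, N ≤ d ∧ 1 ≤ d ∧
    ∃ A : Set ℝ, A.Finite ∧ (M + 1) ^ d ≤ c ^ d * A.ncard ∧ ∀ k : ℕ, 1 ≤ k →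
      (kfoldSumSet k A).ncard ≤ (c * k * 2 ^ M) ^ d ∧
      (kfoldProdSet k A).ncard ≤ (c * k * (M + 1)) ^ d := by
  obtain ⟨δ, hδ⟩ := exists_isTotallyReal_discr_le
  have h4 : 1 ≤ 4 ^ (δ + 1) := Nat.one_le_pow _ _ (by norm_num)
  refine ⟨16 * 4 ^ (δ + 1) * (δ + 2), by nlinarith, fun M N ↦ ?_⟩
  obtain ⟨L, _, _, hL, hn, hdisc⟩ := hδ (N + M + 1)
  have hd0 : 0 < Module.finrank ℚ L := Module.finrank_pos
  obtain ⟨A, h0, hI, hA, hcard⟩ := exists_many_generators (L := L) (δ := δ) (M := M)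
    (hdisc.trans_lt (by
      rw [pow_mul]
      exact Nat.pow_lt_pow_left (Nat.lt_pow_self (by norm_num)) hd0.ne'))
    ((by omega : M + 1 ≤ Module.finrank ℚ L).trans (Nat.lt_pow_self one_lt_two).le)
  obtain ⟨w⟩ : Nonempty (InfinitePlace L) := inferInstance
  let τ : L →+* ℝ := InfinitePlace.embedding_of_isReal (IsTotallyReal.isReal w)
  let σ : 𝓞 L →+* ℝ := τ.comp (algebraMap (𝓞 L) L)
  have hσ : Function.Injective σ := τ.injective.comp RingOfIntegers.coe_injective
  refine ⟨Module.finrank ℚ L, by omega, hd0, σ '' A, A.finite_toSet.image σ, ?_, fun k hk ↦ ⟨?_, ?_⟩⟩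
  · rwa [Set.ncard_image_of_injective _ hσ, Set.ncard_coe_finset]
  · rw [kfoldSumSet_image, Set.ncard_image_of_injective _ hσ]
    refine (ncard_kfoldSumSet_le hA k).trans (Nat.pow_le_pow_left ?_ _)
    have h1 : 1 ≤ k * 2 ^ (δ + M) := Nat.mul_pos hk (by positivity)
    have h2 : 2 ^ δ ≤ 4 ^ (δ + 1) :=
      (Nat.pow_le_pow_left (by norm_num) δ).trans (Nat.pow_le_pow_right (by norm_num) (by omega))
    calc 2 * (k * 2 ^ (δ + M)) + 1 ≤ 3 * 2 ^ δ * (k * 2 ^ M) := by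
          rw [pow_add] at h1 ⊢; nlinarith
      _ ≤ 16 * 4 ^ (δ + 1) * (δ + 2) * (k * 2 ^ M) := by
          refine Nat.mul_le_mul_right _ ?_
          nlinarith
      _ = _ := by ring
  · rw [kfoldProdSet_image, Set.ncard_image_of_injective _ hσ]
    refine (ncard_kfoldProdSet_le (fun y hy ↦ h0 y hy) (fun y hy z hz ↦ hI y hy z hz) hA hk).trans
      (Nat.pow_le_pow_left ?_ _)
    have h2 : 4 ≤ 4 ^ (δ + 1) := by rw [pow_succ]; linarith [Nat.one_le_pow δ 4 (by norm_num)]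
    calc 20 * (k * (δ + M + 1) + 1) ≤ 20 * (k * ((δ + 2) * (M + 1))) := by
          have : k * (δ + M + 1) + 1 ≤ k * (δ + M + 2) := by nlinarith
          have h5 : δ + M + 2 ≤ (δ + 2) * (M + 1) := by nlinarith
          linarith [Nat.mul_le_mul_left k h5]
      _ ≤ 16 * 4 ^ (δ + 1) * (k * ((δ + 2) * (M + 1))) := Nat.mul_le_mul_right _ (by linarith)
      _ = _ := by ring

end SumProd

namespace SumProd

lemma ncard_kfoldSumSet_le_pow {R : Type*} [AddCommMonoid R] (k : ℕ) (A : Finset R) :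
    (kfoldSumSet k (A : Set R)).ncard ≤ A.card ^ k := by
  classical
  have h : kfoldSumSet k (A : Set R) ⊆
      ((Fintype.piFinset fun _ : Fin k ↦ A).image fun f ↦ ∑ i, f i : Finset R) := by
    rintro x ⟨f, hf, rfl⟩
    exact Finset.mem_coe.2 (Finset.mem_image_of_mem _ (Fintype.mem_piFinset.2 hf))
  refine (Set.ncard_le_ncard h (Finset.finite_toSet _)).trans ?_
  rw [Set.ncard_coe_finset]
  exact Finset.card_image_le.trans_eq (by simp [Fintype.card_piFinset])

lemma ncard_kfoldProdSet_le_pow {R : Type*} [CommMonoid R] (k : ℕ) (A : Finset R) :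
    (kfoldProdSet k (A : Set R)).ncard ≤ A.card ^ k := by
  classical
  have h : kfoldProdSet k (A : Set R) ⊆
      ((Fintype.piFinset fun _ : Fin k ↦ A).image fun f ↦ ∏ i, f i : Finset R) := by
    rintro x ⟨f, hf, rfl⟩
    exact Finset.mem_coe.2 (Finset.mem_image_of_mem _ (Fintype.mem_piFinset.2 hf))
  refine (Set.ncard_le_ncard h (Finset.finite_toSet _)).trans ?_
  rw [Set.ncard_coe_finset]
  exact Finset.card_image_le.trans_eq (by simp [Fintype.card_piFinset])

lemma one_lt_log_of_three_le {k : ℕ} (hk : 3 ≤ k) : 1 < Real.log k := by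
  rw [Real.lt_log_iff_exp_lt (by positivity)]
  have : (3 : ℝ) ≤ k := by exact_mod_cast hk
  linarith [Real.exp_one_lt_d9]

lemma exists_finite_set_of_le {C : ℝ} {k : ℕ} (hk : 3 ≤ k) (hC : (k : ℝ) ≤ C) (N : ℕ) :
    ∃ A : Set ℝ, A.Finite ∧ N ≤ A.ncard ∧
      max ((kfoldSumSet k A).ncard : ℝ) ((kfoldProdSet k A).ncard : ℝ) ≤
        (A.ncard : ℝ) ^ (C * Real.log k / Real.log (Real.log k)) := by
  let F : Finset ℝ := (Finset.range (N + 1)).map Nat.castEmbedding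
  have hF : F.card = N + 1 := by simp [F]
  have hl := one_lt_log_of_three_le hk
  have hll : 0 < Real.log (Real.log k) := Real.log_pos hl
  have hexp : (k : ℝ) ≤ C * Real.log k / Real.log (Real.log k) := by
    rw [le_div_iff₀ hll]
    have := Real.log_le_self (by linarith : 0 ≤ Real.log k)
    have hC0 : (0 : ℝ) ≤ C := (Nat.cast_nonneg k).trans hC
    gcongr
  have hpow : ((F.card ^ k : ℕ) : ℝ) ≤
      (F.card : ℝ) ^ (C * Real.log k / Real.log (Real.log k)) := by
    rw [Nat.cast_pow, ← Real.rpow_natCast]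
    exact Real.rpow_le_rpow_of_exponent_le (by rw [hF]; push_cast; linarith [Nat.cast_nonneg (α := ℝ) N]) hexp
  refine ⟨F, F.finite_toSet, ?_, ?_⟩ <;> rw [Set.ncard_coe_finset]
  · omega
  · exact max_le ((Nat.cast_le.2 (ncard_kfoldSumSet_le_pow k F)).trans hpow)
      ((Nat.cast_le.2 (ncard_kfoldProdSet_le_pow k F)).trans hpow)

lemma exists_finite_set_of_log_ge {c : ℕ} (hc : 2 ≤ c)
    (h : ∀ M N : ℕ, ∃ d : ℕ, N ≤ d ∧ 1 ≤ d ∧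
      ∃ A : Set ℝ, A.Finite ∧ (M + 1) ^ d ≤ c ^ d * A.ncard ∧ ∀ k : ℕ, 1 ≤ k →
        (kfoldSumSet k A).ncard ≤ (c * k * 2 ^ M) ^ d ∧
        (kfoldProdSet k A).ncard ≤ (c * k * (M + 1)) ^ d)
    {C : ℝ} (hC : 6 ≤ C) {k : ℕ} (hk : 3 ≤ k) (hkc : (c : ℝ) ^ 2 ≤ Real.log k) (N : ℕ) :
    ∃ A : Set ℝ, A.Finite ∧ N ≤ A.ncard ∧
      max ((kfoldSumSet k A).ncard : ℝ) ((kfoldProdSet k A).ncard : ℝ) ≤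
        (A.ncard : ℝ) ^ (C * Real.log k / Real.log (Real.log k)) := by
  have hl := one_lt_log_of_three_le hk
  have hll : 0 < Real.log (Real.log k) := Real.log_pos hl
  have hk0 : (0 : ℝ) < k := by positivity
  set M := Nat.log 2 k
  have hM1 : 2 ^ M ≤ k := Nat.pow_log_le_self 2 (by omega)
  have hM2 : M + 1 ≤ k := (Nat.lt_two_pow_self (n := M)).trans_le hM1
  have hM3 : Real.log k ≤ M + 1 := by
    have h1 : (k : ℝ) ≤ 2 ^ (M + 1) := by
      exact_mod_cast (Nat.lt_pow_succ_log_self one_lt_two k).le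
    have h2 := Real.log_le_log hk0 h1
    rw [Real.log_pow] at h2
    push_cast at h2
    have h3 : Real.log 2 ≤ 1 := by linarith [Real.log_two_lt_d9]
    exact h2.trans (mul_le_of_le_one_right (by positivity) h3)
  have hc2 : (2 : ℝ) ≤ c := by exact_mod_cast hc
  have hck : c ≤ k := by
    have : (c : ℝ) ≤ k := by nlinarith [Real.log_le_self hk0.le]
    exact_mod_cast this
  obtain ⟨d, hNd, hd, A, hA, hcard, hkf⟩ := h M N
  obtain ⟨hs, hp⟩ := hkf k (by omega)
  have hcd : (0 : ℝ) < (c : ℝ) ^ d := by positivity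
  have hcard' : ((M : ℝ) + 1) ^ d ≤ (c : ℝ) ^ d * A.ncard := by exact_mod_cast hcard
  have hN : N ≤ A.ncard := by
    have h1 : (2 * c : ℝ) ^ d ≤ (c : ℝ) ^ d * A.ncard := by
      refine le_trans (pow_le_pow_left₀ (by positivity) ?_ d) hcard'
      nlinarith
    rw [mul_pow, mul_comm] at h1
    have h2 : (2 : ℝ) ^ d ≤ A.ncard := le_of_mul_le_mul_left h1 hcd
    have h3 : 2 ^ d ≤ A.ncard := by exact_mod_cast h2
    exact hNd.trans (Nat.lt_two_pow_self.le.trans h3)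
  have hapos : 0 < A.ncard := by
    refine Nat.pos_of_ne_zero fun h0 ↦ ?_
    rw [h0, mul_zero] at hcard
    exact absurd hcard (Nat.not_le.2 (by positivity))
  have ha : (0 : ℝ) < A.ncard := by exact_mod_cast hapos
  have hlog : d * Real.log (Real.log k) ≤ 2 * Real.log A.ncard := by
    have h1 : (Real.log k) ^ d ≤ (A.ncard : ℝ) ^ 2 := by
      refine le_of_mul_le_mul_left ?_ (pow_pos hcd 2)
      calc ((c : ℝ) ^ d) ^ 2 * Real.log k ^ d = ((c : ℝ) ^ 2 * Real.log k) ^ d := by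
            rw [mul_pow, ← pow_mul, ← pow_mul, mul_comm d]
        _ ≤ (((M : ℝ) + 1) ^ 2) ^ d := by
            refine pow_le_pow_left₀ (by positivity) ?_ d
            nlinarith
        _ = (((M : ℝ) + 1) ^ d) ^ 2 := by rw [← pow_mul, ← pow_mul, mul_comm]
        _ ≤ ((c : ℝ) ^ d * A.ncard) ^ 2 := pow_le_pow_left₀ (by positivity) hcard' 2
        _ = _ := mul_pow _ _ _
    have h2 := Real.log_le_log (by positivity) h1
    rwa [Real.log_pow, Real.log_pow, Nat.cast_ofNat] at h2
  have hmain : ((k : ℝ) ^ 3) ^ d ≤ (A.ncard : ℝ) ^ (C * Real.log k / Real.log (Real.log k)) := by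
    rw [← Real.log_le_log_iff (by positivity) (Real.rpow_pos_of_pos ha _), Real.log_rpow ha,
      Real.log_pow, Real.log_pow, div_mul_eq_mul_div, le_div_iff₀ hll]
    push_cast
    have h1 : (0 : ℝ) ≤ d * Real.log (Real.log k) := by positivity
    calc d * (3 * Real.log k) * Real.log (Real.log k)
        = 3 * Real.log k * (d * Real.log (Real.log k)) := by ring
      _ ≤ 3 * Real.log k * (2 * Real.log A.ncard) := by gcongr
      _ = 6 * Real.log k * Real.log A.ncard := by ring
      _ ≤ C * Real.log k * Real.log A.ncard := by
        have : 0 ≤ Real.log A.ncard := by linarith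
        gcongr
  refine ⟨A, hA, hN, max_le (le_trans ?_ hmain) (le_trans ?_ hmain)⟩
  · have : (c * k * 2 ^ M) ^ d ≤ (k ^ 3) ^ d := Nat.pow_le_pow_left (by
      calc c * k * 2 ^ M ≤ k * k * k := by gcongr
        _ = k ^ 3 := by ring) d
    exact_mod_cast hs.trans this
  · have : (c * k * (M + 1)) ^ d ≤ (k ^ 3) ^ d := Nat.pow_le_pow_left (by
      calc c * k * (M + 1) ≤ k * k * k := by gcongr
        _ = k ^ 3 := by ring) d
    exact_mod_cast hp.trans this

theorem exists_const_max_ncard_le :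
    ∃ C : ℝ, 0 < C ∧
      ∀ k : ℕ, 3 ≤ k →
        ∀ N : ℕ, ∃ A : Set ℝ, A.Finite ∧ N ≤ A.ncard ∧
          max ((kfoldSumSet k A).ncard : ℝ) ((kfoldProdSet k A).ncard : ℝ) ≤
            (A.ncard : ℝ) ^ (C * Real.log k / Real.log (Real.log k)) := by
  obtain ⟨c, hc, h⟩ := exists_finite_set_small_sum_prod
  refine ⟨Real.exp ((c : ℝ) ^ 2) + 6, by positivity, fun k hk N ↦ ?_⟩
  have hexp := Real.exp_pos ((c : ℝ) ^ 2)
  rcases le_total ((c : ℝ) ^ 2) (Real.log k) with hkc | hkc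
  · exact exists_finite_set_of_log_ge hc h (by linarith) hk hkc N
  · refine exists_finite_set_of_le hk ?_ N
    have := (Real.log_le_iff_le_exp (by positivity)).1 hkc
    linarith

end SumProd

/-- There exists an absolute constant `C > 0` such that for every fixed `k ≥ 3` there are
arbitrarily large finite `A ⊆ ℝ` with
`max(|kA|, |A^{(k)}|) ≤ |A| ^ (C * log k / log log k)`. -/
theorem statement3 :
    ∃ C : ℝ, 0 < C ∧
      ∀ k : ℕ, 3 ≤ k →
        ∀ N : ℕ, ∃ A : Set ℝ, A.Finite ∧ N ≤ A.ncard ∧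
          max ((kfoldSumSet k A).ncard : ℝ) ((kfoldProdSet k A).ncard : ℝ) ≤
            (A.ncard : ℝ) ^ (C * Real.log k / Real.log (Real.log k)) := by
  exact SumProd.exists_const_max_ncard_le
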